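/- Let 0 < d < 1/4 and let h ∈ ℤ[x] be an intersective polynomial of degree at least 2 with positive leading coefficient. Then there exist constants c₀ > 0 and X_min > 0, depending only on h and d, such that for every real X > X_min and every set A ⊆ {1, …, ⌊X⌋} satisfying (A − A) ∩ {h(n) : n ∈ ℤ} ⊆ {0}, one has |A| ≤ X · exp(−c₀ (log X)^d). -/

import Mathlib

set_option linter.unusedSectionVars false
set_option linter.style.longLine false
namespace FS
open Finset
open scoped BigOperators

section ops
variable {ι : Type} [Fintype ι] [DecidableEq ι] {Ω : ι → Type} [∀ i, Fintype (Ω i)] [∀ i, Nonempty (Ω i)]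

/-- averaging over the coordinates in `S` -/
noncomputable def EE (S : Finset ι) : ((∀ i, Ω i) → ℝ) →ₗ[ℝ] ((∀ i, Ω i) → ℝ) where
  toFun F x := 𝔼 y, F (S.piecewise y x)
  map_add' F G := by
    classical
    ext x; simp [Finset.expect_add_distrib]
  map_smul' c F := by
    classical
    ext x; simp [Finset.mul_expect]

lemma EE_apply (S : Finset ι) (F : (∀ i, Ω i) → ℝ) (x) : EE S F x = 𝔼 y, F (S.piecewise y x) := rfl

lemma EE_mul (S R : Finset ι) : (EE S * EE R : Module.End ℝ ((∀ i, Ω i) → ℝ)) = EE (S ∪ R) := by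
  classical
  refine LinearMap.ext fun F => funext fun x => ?_
  change EE S (EE R F) x = _
  simp only [EE_apply]
  rw [← Finset.expect_product' (univ) univ (fun y z => F (R.piecewise z (S.piecewise y x)))]
  have key : ∀ p : (∀ i, Ω i) × (∀ i, Ω i),
      R.piecewise p.2 (S.piecewise p.1 x) = (S ∪ R).piecewise (R.piecewise p.2 p.1) x := by
    intro p
    ext i
    by_cases h1 : i ∈ R <;> by_cases h2 : i ∈ S <;> simp [Finset.piecewise, h1, h2]
  simp only [key]
  let e : ((∀ i, Ω i) × (∀ i, Ω i)) ≃ ((∀ i, Ω i) × (∀ i, Ω i)) :=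
    { toFun := fun p => (R.piecewise p.2 p.1, R.piecewise p.1 p.2)
      invFun := fun p => (R.piecewise p.2 p.1, R.piecewise p.1 p.2)
      left_inv := fun p => by
        ext i <;> by_cases h1 : i ∈ R <;> simp [Finset.piecewise, h1]
      right_inv := fun p => by
        ext i <;> by_cases h1 : i ∈ R <;> simp [Finset.piecewise, h1] }
  have := Fintype.expect_equiv e (fun p => F ((S ∪ R).piecewise (R.piecewise p.2 p.1) x))
    (fun p => F ((S ∪ R).piecewise p.1 x)) (fun p => rfl)
  rw [Finset.univ_product_univ, this, ← Finset.univ_product_univ,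
    Finset.expect_product' univ univ (fun y z => F ((S ∪ R).piecewise y x))]
  simp [Finset.expect_const]

lemma EE_EE (S R : Finset ι) (F : (∀ i, Ω i) → ℝ) : EE S (EE R F) = EE (S ∪ R) F := by
  rw [← EE_mul]; rfl

lemma EE_empty : (EE (∅ : Finset ι) : Module.End ℝ ((∀ i, Ω i) → ℝ)) = 1 := by
  classical
  refine LinearMap.ext fun F => funext fun x => ?_
  simp [EE_apply]

lemma EE_mono (S : Finset ι) {F G : (∀ i, Ω i) → ℝ} (h : F ≤ G) : EE S F ≤ EE S G := by
  classical
  intro x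
  simp only [EE_apply]
  exact Finset.expect_le_expect fun y _ => h _

lemma EE_nonneg (S : Finset ι) {F : (∀ i, Ω i) → ℝ} (h : 0 ≤ F) : 0 ≤ EE S F := by
  have := EE_mono S h
  simpa using this

lemma EE_const (S : Finset ι) (c : ℝ) (x : ∀ i, Ω i) : EE S (fun _ => c) x = c := by
  classical
  simp [EE_apply]

/-- pulling out a factor not depending on `S` -/
lemma EE_pull (S : Finset ι) (F G : (∀ i, Ω i) → ℝ) : EE S (EE S F * G) = EE S F * EE S G := by
  classical
  ext x
  rw [Pi.mul_apply]
  conv_lhs => rw [EE_apply]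
  simp only [Pi.mul_apply]
  have : ∀ y, EE S F (S.piecewise y x) = EE S F x := by
    intro y
    simp only [EE_apply]
    refine Finset.expect_congr rfl fun z _ => ?_
    congr 1
    ext i
    by_cases h : i ∈ S <;> simp [Finset.piecewise, h]
  simp only [this]
  rw [← Finset.mul_expect]
  rfl

lemma EE_pull' (S : Finset ι) (F G : (∀ i, Ω i) → ℝ) (hF : EE S F = F) :
    EE S (F * G) = F * EE S G := by
  rw [← hF, EE_pull, hF]

lemma EE_cs (S : Finset ι) (F G : (∀ i, Ω i) → ℝ) (x) :
    (EE S (F * G) x) ^ 2 ≤ EE S (F ^ 2) x * EE S (G ^ 2) x := by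
  classical
  simp only [EE_apply, Finset.expect_eq_sum_div_card, Pi.mul_apply, Pi.pow_apply]
  rw [div_pow, div_mul_div_comm, ← pow_two]
  gcongr
  exact Finset.sum_mul_sq_le_sq_mul_sq _ _ _

lemma EE_sq_le (S : Finset ι) (F : (∀ i, Ω i) → ℝ) : (EE S F) ^ 2 ≤ EE S (F ^ 2) := by
  intro x
  have := EE_cs S F (fun _ => 1) x
  have h1 : (fun _ : (∀ i, Ω i) => (1:ℝ)) ^ 2 = fun _ => 1 := by ext; simp
  rw [h1, EE_const, mul_one] at this
  have h2 : F * (fun _ : (∀ i, Ω i) => (1:ℝ)) = F := by ext; simp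
  rw [h2] at this
  exact this

/-- the Efron-Stein projections -/
noncomputable def PP (T : Finset ι) : Module.End ℝ ((∀ i, Ω i) → ℝ) :=
  ∑ R ∈ T.powerset, (-1 : ℝ) ^ (T \ R).card • EE Rᶜ

lemma mobius_aux {M : Type} [AddCommGroup M] [Module ℝ M] (V : Finset ι) : ∀ a : Finset ι → M,
    ∑ T ∈ V.powerset, ∑ R ∈ T.powerset, (-1 : ℝ) ^ (T \ R).card • a R = a V := by
  induction V using Finset.induction_on with
  | empty => intro a; simp
  | insert i V hi ih =>
    intro a
    rw [Finset.sum_powerset_insert hi, ← Finset.sum_add_distrib, ← ih (fun T => a (insert i T))]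
    refine Finset.sum_congr rfl fun T hT => ?_
    have hiT : i ∉ T := fun h => hi (Finset.mem_powerset.1 hT h)
    rw [Finset.sum_powerset_insert hiT, ← Finset.sum_add_distrib, ← Finset.sum_add_distrib]
    refine Finset.sum_congr rfl fun R hR => ?_
    have hiR : i ∉ R := fun h => hiT (Finset.mem_powerset.1 hR h)
    have e1 : insert i T \ R = insert i (T \ R) := by
      rw [Finset.insert_sdiff_of_notMem _ hiR]
    have e2 : insert i T \ insert i R = T \ R := by
      ext j; by_cases hj : j = i <;> simp [hj, hiT]
    rw [e1, e2, Finset.card_insert_of_notMem (by simp [hiT])]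
    rw [pow_succ]
    module

lemma sum_PP (V : Finset ι) : ∑ T ∈ V.powerset, (PP T : Module.End ℝ ((∀ i, Ω i) → ℝ)) = EE Vᶜ := by
  unfold PP
  exact mobius_aux V (fun R => (EE Rᶜ : Module.End ℝ ((∀ i, Ω i) → ℝ)))

lemma EE_PP_zero (S T : Finset ι) (h : ¬ Disjoint S T) :
    EE S * (PP T : Module.End ℝ ((∀ i, Ω i) → ℝ)) = 0 := by
  rw [Finset.not_disjoint_iff] at h
  obtain ⟨i, hS, hT⟩ := h
  unfold PP
  obtain ⟨T', hT', rfl⟩ : ∃ T', i ∉ T' ∧ T = insert i T' :=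
    ⟨T.erase i, by simp, by simp [Finset.insert_erase hT]⟩
  rw [Finset.sum_powerset_insert hT', mul_add, Finset.mul_sum, Finset.mul_sum,
    ← Finset.sum_add_distrib]
  refine Finset.sum_eq_zero fun R hR => ?_
  have hiR : i ∉ R := fun h => hT' (Finset.mem_powerset.1 hR h)
  have e1 : insert i T' \ R = insert i (T' \ R) := by
    rw [Finset.insert_sdiff_of_notMem _ hiR]
  have e2 : insert i T' \ insert i R = T' \ R := by
    ext j; by_cases hj : j = i <;> simp [hj, hT']
  rw [e1, e2, Finset.card_insert_of_notMem (by simp [hT']), mul_smul_comm, mul_smul_comm,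
    EE_mul, EE_mul]
  have : S ∪ (insert i R)ᶜ = S ∪ Rᶜ := by
    ext j; by_cases hj : j = i <;> simp [hj, hS]
  rw [this, pow_succ]
  module

lemma EE_PP_self (S T : Finset ι) (h : Disjoint S T) :
    EE S * (PP T : Module.End ℝ ((∀ i, Ω i) → ℝ)) = PP T := by
  unfold PP
  rw [Finset.mul_sum]
  refine Finset.sum_congr rfl fun R hR => ?_
  rw [mul_smul_comm, EE_mul]
  congr 2
  apply Finset.union_eq_right.2
  intro j hj
  rw [Finset.mem_compl]
  intro hjR
  exact (Finset.disjoint_left.1 h hj) (Finset.mem_powerset.1 hR hjR)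

lemma PP_mul (T T' : Finset ι) : (PP T * PP T' : Module.End ℝ ((∀ i, Ω i) → ℝ)) =
    if T = T' then PP T else 0 := by
  have h1 : ∀ R : Finset ι, (EE Rᶜ * PP T' : Module.End ℝ ((∀ i, Ω i) → ℝ)) =
      if T' ⊆ R then PP T' else 0 := by
    intro R
    split_ifs with h
    · exact EE_PP_self _ _ (by
        rw [Finset.disjoint_left]; intro a ha hb; exact (Finset.mem_compl.1 ha) (h hb))
    · refine EE_PP_zero _ _ fun hd => h fun a ha => ?_
      by_contra hc
      exact Finset.disjoint_left.1 hd (Finset.mem_compl.2 hc) ha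
  -- use the mobius inversion uniqueness
  have h2 : PP T * PP T' = ∑ R ∈ T.powerset, (-1 : ℝ) ^ (T \ R).card •
      (if T' ⊆ R then (PP T' : Module.End ℝ ((∀ i, Ω i) → ℝ)) else 0) := by
    conv_lhs => rw [PP, Finset.sum_mul]
    refine Finset.sum_congr rfl fun R _ => ?_
    rw [smul_mul_assoc, h1]
  rw [h2]
  have h3 : ∀ R : Finset ι, (if T' ⊆ R then (PP T' : Module.End ℝ ((∀ i, Ω i) → ℝ)) else 0) =
      ∑ Q ∈ R.powerset, if Q = T' then PP T' else 0 := by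
    intro R
    rw [Finset.sum_ite_eq']
    simp [Finset.mem_powerset]
  simp only [h3]
  -- strong induction on T: g(T) = Σ ±Σ_{Q⊆R} b Q = b T
  have h4 : ∀ (b : Finset ι → Module.End ℝ ((∀ i, Ω i) → ℝ)) (T : Finset ι),
      ∑ R ∈ T.powerset, (-1 : ℝ) ^ (T \ R).card • ∑ Q ∈ R.powerset, b Q = b T := by
    intro b T
    induction T using Finset.induction_on generalizing b with
    | empty => simp
    | insert i T hi ih =>
      rw [Finset.sum_powerset_insert hi, ← Finset.sum_add_distrib, ← ih (fun R => b (insert i R))]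
      refine Finset.sum_congr rfl fun R hR => ?_
      have hiR : i ∉ R := fun h => hi (Finset.mem_powerset.1 hR h)
      have e1 : insert i T \ R = insert i (T \ R) := by
        rw [Finset.insert_sdiff_of_notMem _ hiR]
      have e2 : insert i T \ insert i R = T \ R := by
        ext j; by_cases hj : j = i <;> simp [hj, hi]
      rw [e1, e2, Finset.card_insert_of_notMem (by simp [hi]), Finset.sum_powerset_insert hiR, pow_succ]
      module
  rw [h4]
  split_ifs with h
  · rw [h]
  · rfl

/-- multiplier operators -/
noncomputable def MM (w : Finset ι → ℝ) : Module.End ℝ ((∀ i, Ω i) → ℝ) := ∑ T, w T • PP T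

lemma MM_mul (w w' : Finset ι → ℝ) : (MM w * MM w' : Module.End ℝ ((∀ i, Ω i) → ℝ)) = MM (w * w') := by
  unfold MM
  rw [Finset.sum_mul_sum]
  refine Finset.sum_congr rfl fun T _ => ?_
  rw [Finset.sum_eq_single T]
  · rw [smul_mul_smul_comm, PP_mul, if_pos rfl]; rfl
  · intro T' _ h
    rw [smul_mul_smul_comm, PP_mul, if_neg h.symm, smul_zero]
  · simp

lemma MM_MM (w w' : Finset ι → ℝ) (F : (∀ i, Ω i) → ℝ) : MM w (MM w' F) = MM (w * w') F := by
  rw [← MM_mul]; rfl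

lemma MM_add (w w' : Finset ι → ℝ) : (MM w + MM w' : Module.End ℝ ((∀ i, Ω i) → ℝ)) = MM (w + w') := by
  unfold MM
  rw [← Finset.sum_add_distrib]
  refine Finset.sum_congr rfl fun T _ => ?_
  rw [Pi.add_apply, add_smul]

lemma MM_smul (c : ℝ) (w : Finset ι → ℝ) : (c • MM w : Module.End ℝ ((∀ i, Ω i) → ℝ)) = MM (c • w) := by
  unfold MM
  rw [Finset.smul_sum]
  refine Finset.sum_congr rfl fun T _ => ?_
  rw [Pi.smul_apply, smul_smul, smul_eq_mul]

lemma EE_eq_MM (S : Finset ι) : (EE S : Module.End ℝ ((∀ i, Ω i) → ℝ)) =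
    MM (fun T => if Disjoint S T then 1 else 0) := by
  have := sum_PP (Ω := Ω) Sᶜ
  rw [compl_compl] at this
  rw [← this]
  unfold MM
  simp only [ite_smul, one_smul, zero_smul]
  rw [← Finset.sum_filter]
  refine Finset.sum_congr ?_ fun _ _ => rfl
  ext T
  simp only [Finset.mem_powerset, Finset.mem_filter, Finset.mem_univ, true_and]
  exact Finset.subset_compl_iff_disjoint_left

lemma MM_one : (MM (fun _ => 1) : Module.End ℝ ((∀ i, Ω i) → ℝ)) = 1 := by
  rw [← EE_empty, EE_eq_MM]
  simp

end ops
end FS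

namespace FS
open Finset
open scoped BigOperators

lemma one_var (m : ℕ) (hm : 1 ≤ m) (ρ A B C : ℝ) (hρ0 : 0 < ρ) (hρ : ρ ^ 2 * (16 * m) = 1)
    (hA : 0 ≤ A) (hC : 0 ≤ C)
    (hB : B ^ 2 ≤ A * C) :
    (A + 2 * ρ * B + ρ ^ 2 * C) ^ m ≤
      A ^ m + 2 * m * ρ * A ^ (m - 1) * B + m * A ^ (m - 1) * C + (16 * m) ^ m * C ^ m := by
  have hm' : (1:ℝ) ≤ m := by exact_mod_cast hm
  have hρ1 : ρ ^ 2 ≤ 1 / 16 := by nlinarith [sq_nonneg ρ]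
  have hAm : A ^ m = A ^ (m - 1) * A := by
    rw [← pow_succ]; congr 1; omega
  have habsB : (m * ρ * |B|) * 2 ≤ A + m * C := by
    have h1 : (m * ρ * |B| * 2) ^ 2 ≤ (A + m * C) ^ 2 := by
      have e : (m * ρ * |B| * 2) ^ 2 = m * (ρ ^ 2 * (16 * m)) * B ^ 2 / 4 := by
        rw [mul_pow, mul_pow, mul_pow, sq_abs]; ring
      rw [e, hρ]
      nlinarith [sq_nonneg (A - m * C), mul_le_mul_of_nonneg_left hB (by linarith : (0:ℝ) ≤ m),
        mul_nonneg hA hC, mul_nonneg (mul_nonneg hA hC) (by linarith : (0:ℝ) ≤ m)]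
    exact abs_le_of_sq_le_sq' h1 (by positivity) |>.2
  by_cases hcase : A ≤ 4 * m * C
  · have hnn : 0 ≤ A + 2 * ρ * B + ρ ^ 2 * C := by
      have : 0 ≤ A * (A + 2 * ρ * B + ρ ^ 2 * C) := by
        nlinarith [sq_nonneg (A + ρ * B), mul_le_mul_of_nonneg_left hB (sq_nonneg ρ)]
      rcases hA.eq_or_lt with h | h
      · have hB0 : B = 0 := by
          rw [← h, zero_mul] at hB
          nlinarith [sq_nonneg B]
        rw [← h, hB0]; simp; positivity
      · exact nonneg_of_mul_nonneg_right this h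
    have hle : A + 2 * ρ * B + ρ ^ 2 * C ≤ 16 * m * C := by
      have h1 : 2 * ρ * |B| ≤ A + m * C := by
        nlinarith [mul_nonneg hρ0.le (abs_nonneg B), mul_le_mul_of_nonneg_right hm' (mul_nonneg hρ0.le (abs_nonneg B))]
      have h2 : 2 * ρ * B ≤ 2 * ρ * |B| := by
        have := le_abs_self B
        nlinarith
      nlinarith [mul_nonneg hC (by linarith : (0:ℝ) ≤ m - 1)]
    have h3 : (A + 2 * ρ * B + ρ ^ 2 * C) ^ m ≤ (16 * m) ^ m * C ^ m := by
      rw [← mul_pow]; exact pow_le_pow_left₀ hnn hle m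
    have h4 : 0 ≤ A ^ m + 2 * m * ρ * A ^ (m - 1) * B + m * A ^ (m - 1) * C := by
      have e : A ^ m + 2 * m * ρ * A ^ (m - 1) * B + m * A ^ (m - 1) * C =
        A ^ (m - 1) * (A + m * ρ * B * 2 + m * C) := by rw [hAm]; ring
      rw [e]
      apply mul_nonneg (by positivity)
      have : -(m * ρ * |B|) ≤ m * ρ * B := by
        have := neg_abs_le B
        have h5 : 0 ≤ m * ρ := by positivity
        nlinarith
      linarith
    linarith
  · push Not at hcase
    have hApos : 0 < A := lt_of_le_of_lt (by positivity) hcase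
    set u := (2 * ρ * B + ρ ^ 2 * C) / A with hu
    have huA : u * A = 2 * ρ * B + ρ ^ 2 * C := by rw [hu]; field_simp
    have e1 : A + 2 * ρ * B + ρ ^ 2 * C = A * (1 + u) := by rw [mul_add, mul_comm A u, huA]; ring
    -- u^2 A ≤ 8 ρ^2 C + 2 ρ^4 C (C/A)
    have hu2 : u ^ 2 * A ≤ 8 * ρ ^ 2 * C + 2 * ρ ^ 4 * C / (4 * m) := by
      have h1 : u ^ 2 * A * A ≤ (8 * ρ ^ 2 * C) * A + 2 * ρ ^ 4 * C * C := by
        have : u ^ 2 * A * A = (2 * ρ * B + ρ ^ 2 * C) ^ 2 := by rw [← huA]; ring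
        rw [this]
        nlinarith [sq_nonneg (2 * ρ * B - ρ ^ 2 * C), mul_le_mul_of_nonneg_left hB (sq_nonneg ρ)]
      have h2 : C ≤ A / (4 * m) := by
        rw [le_div_iff₀ (by positivity)]; linarith
      have h3 : 2 * ρ ^ 4 * C * C ≤ 2 * ρ ^ 4 * C / (4 * m) * A := by
        calc 2 * ρ ^ 4 * C * C ≤ 2 * ρ ^ 4 * C * (A / (4 * m)) := by gcongr
          _ = _ := by ring
      have h4 : u ^ 2 * A * A ≤ (8 * ρ ^ 2 * C + 2 * ρ ^ 4 * C / (4 * m)) * A := by linarith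
      exact le_of_mul_le_mul_right h4 hApos
    have hmu2 : m * (u ^ 2 * A) ≤ (1 / 2 + 1 / 64) * C := by
      calc m * (u ^ 2 * A) ≤ m * (8 * ρ ^ 2 * C + 2 * ρ ^ 4 * C / (4 * m)) := by gcongr
        _ = (ρ ^ 2 * (16 * m)) * C / 2 + ρ ^ 4 * C / 2 := by field_simp; ring
        _ ≤ _ := by
          rw [hρ]
          have : ρ ^ 4 ≤ 1 / 256 := by nlinarith [sq_nonneg ρ]
          nlinarith [mul_le_mul_of_nonneg_right this hC]
    have hmu : |m * u| ≤ 1 := by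
      apply abs_le_of_sq_le_sq _ zero_le_one |> fun h => h
      have h1 : (m * u) ^ 2 * A ≤ 1 ^ 2 * A := by
        have : (m * u) ^ 2 * A = m * (m * (u ^ 2 * A)) := by ring
        rw [this]
        calc (m:ℝ) * (m * (u ^ 2 * A)) ≤ m * ((1 / 2 + 1 / 64) * C) := by gcongr
          _ ≤ 1 ^ 2 * A := by nlinarith
      exact le_of_mul_le_mul_right h1 hApos
    have h1u : 0 ≤ 1 + u := by
      have : |u| ≤ 1 := by
        rw [abs_mul, Nat.abs_cast] at hmu
        nlinarith [abs_nonneg u]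
      linarith [neg_abs_le u]
    have hexp : (1 + u) ^ m ≤ 1 + m * u + (m * u) ^ 2 := by
      have h1 : (1 + u) ^ m ≤ Real.exp (m * u) := by
        rw [Real.exp_nat_mul]
        exact pow_le_pow_left₀ h1u (by linarith [Real.add_one_le_exp u]) m
      have h2 := abs_le.1 (Real.abs_exp_sub_one_sub_id_le hmu)
      linarith [h2.2]
    rw [e1, mul_pow]
    have hfin : A ^ m * (1 + u) ^ m ≤ A ^ m * (1 + m * u + (m * u) ^ 2) := by gcongr
    have e2 : A ^ m * (1 + m * u + (m * u) ^ 2) =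
        A ^ m + A ^ (m - 1) * m * (u * A + m * (u ^ 2 * A)) := by
      rw [hAm]; ring
    rw [e2, huA] at hfin
    have h5 : A ^ (m - 1) * m * (2 * ρ * B + ρ ^ 2 * C + m * (u ^ 2 * A)) ≤
        A ^ (m - 1) * m * (2 * ρ * B + C) := by
      gcongr ?_ * ?_
      nlinarith [mul_le_mul_of_nonneg_right hρ1 hC]
    have h6 : 0 ≤ (16 * m : ℝ) ^ m * C ^ m := by positivity
    have e3 : A ^ (m - 1) * m * (2 * ρ * B + C) =
      2 * m * ρ * A ^ (m - 1) * B + m * A ^ (m - 1) * C := by ring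
    linarith

section ops
variable {ι : Type} [Fintype ι] [DecidableEq ι] {Ω : ι → Type} [∀ i, Fintype (Ω i)] [∀ i, Nonempty (Ω i)]

/-- `L_S` -/
noncomputable def LL (S : Finset ι) : Module.End ℝ ((∀ i, Ω i) → ℝ) := MM (fun T => if S ⊆ T then 1 else 0)

/-- noise on the coordinates in `V` -/
noncomputable def NN (ρ : ℝ) (V : Finset ι) : Module.End ℝ ((∀ i, Ω i) → ℝ) :=
  MM (fun T => ρ ^ (T ∩ V).card)

/-- `P^U_T` -/
noncomputable def QQ (U T : Finset ι) : Module.End ℝ ((∀ i, Ω i) → ℝ) :=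
  MM (fun T' => if T' ∩ U = T then 1 else 0)

lemma EE_MM_zero (S : Finset ι) (w : Finset ι → ℝ) (h : ∀ T, Disjoint S T → w T = 0)
    (F : (∀ i, Ω i) → ℝ) : EE S (MM w F) = 0 := by
  rw [EE_eq_MM, MM_MM]
  have : ((fun T => if Disjoint S T then 1 else 0) * w : Finset ι → ℝ) = fun _ => 0 := by
    ext T
    by_cases hT : Disjoint S T <;> simp [hT]
    exact h T hT
  rw [this]
  simp [MM]

lemma EE_MM_self (S : Finset ι) (w : Finset ι → ℝ) (h : ∀ T, ¬ Disjoint S T → w T = 0)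
    (F : (∀ i, Ω i) → ℝ) : EE S (MM w F) = MM w F := by
  rw [EE_eq_MM, MM_MM]
  congr 2
  ext T
  by_cases hT : Disjoint S T <;> simp [hT]
  exact (h T hT).symm

lemma QQ_orth (U T T' : Finset ι) (hT : T ⊆ U) (hT' : T' ⊆ U) (hne : T ≠ T')
    (F G : (∀ i, Ω i) → ℝ) : EE U (QQ U T F * QQ U T' G) = 0 := by
  have main : ∀ (T T' : Finset ι), T ⊆ U → ∀ i ∈ T, i ∉ T' → ∀ F G : (∀ i, Ω i) → ℝ,
      EE U (QQ U T F * QQ U T' G) = 0 := by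
    intro T T' hT i hi hi' F G
    have hiU : {i} ⊆ U := by simpa using hT hi
    have : EE U (QQ U T F * QQ U T' G) = EE U (EE {i} (QQ U T F * QQ U T' G)) := by
      rw [EE_EE, Finset.union_eq_left.2 hiU]
    have hz : EE {i} (QQ U T F) = 0 := by
      apply EE_MM_zero
      intro R hR
      rw [if_neg]
      intro h
      rw [← h] at hi
      exact (Finset.disjoint_singleton_left.1 hR) (Finset.mem_inter.1 hi).1
    rw [this, mul_comm, EE_pull', hz]
    · simp
    · apply EE_MM_self
      intro R hR
      rw [if_neg]
      intro h
      apply hi'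
      rw [← h, Finset.mem_inter]
      rw [Finset.disjoint_singleton_left, not_not] at hR
      exact ⟨hR, hT hi⟩
  by_cases h : T ⊆ T'
  · obtain ⟨i, hi, hi'⟩ := Finset.exists_of_ssubset (lt_of_le_of_ne h hne)
    rw [mul_comm]
    exact main T' T hT' i hi hi' G F
  · obtain ⟨i, hi, hi'⟩ := Finset.not_subset.1 h
    exact main T T' hT i hi hi' F G

lemma MM_eq_sum_QQ (U : Finset ι) (w : Finset ι → ℝ) (hw : ∀ T, w T = w (T ∩ U)) 
    (F : (∀ i, Ω i) → ℝ) : MM w F = ∑ T ∈ U.powerset, w T • QQ U T F := by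
  have : (MM w : Module.End ℝ ((∀ i, Ω i) → ℝ)) = ∑ T ∈ U.powerset, w T • QQ U T := by
    unfold QQ MM
    simp only [Finset.smul_sum]
    rw [Finset.sum_comm]
    refine Finset.sum_congr rfl fun T _ => ?_
    rw [Finset.sum_eq_single (T ∩ U)]
    · simp [← hw]
    · intro R _ hR
      simp [hR.symm]
    · intro h
      exact absurd (Finset.mem_powerset.2 Finset.inter_subset_right) h
  rw [this]
  simp

lemma parseval (U : Finset ι) (w w' : Finset ι → ℝ) (hw : ∀ T, w T = w (T ∩ U))
    (hw' : ∀ T, w' T = w' (T ∩ U)) (F : (∀ i, Ω i) → ℝ) (x) :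
    EE U (MM w F * MM w' F) x = ∑ T ∈ U.powerset, w T * w' T * EE U ((QQ U T F) ^ 2) x := by
  rw [MM_eq_sum_QQ U w hw, MM_eq_sum_QQ U w' hw', Finset.sum_mul_sum, map_sum, Finset.sum_apply]
  refine Finset.sum_congr rfl fun T hT => ?_
  rw [map_sum, Finset.sum_apply, Finset.sum_eq_single T]
  · rw [smul_mul_smul_comm, map_smul, Pi.smul_apply, smul_eq_mul, pow_two]
  · intro T' hT' hne
    rw [smul_mul_smul_comm, map_smul, QQ_orth U T T' (Finset.mem_powerset.1 hT)
      (Finset.mem_powerset.1 hT') hne.symm]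
    simp
  · exact fun h => absurd hT h

lemma EE_sq_nonneg (U : Finset ι) (F : (∀ i, Ω i) → ℝ) (x) : 0 ≤ EE U (F ^ 2) x :=
  EE_nonneg U (fun y => by simp only [Pi.zero_apply, Pi.pow_apply]; positivity) x

lemma EE_add_LL (i : ι) (f : (∀ i, Ω i) → ℝ) : EE {i} f + LL {i} f = f := by
  rw [EE_eq_MM, LL, ← LinearMap.add_apply, MM_add]
  have : ((fun T => if Disjoint {i} T then 1 else 0) + (fun T : Finset ι => if ({i} : Finset ι) ⊆ T then 1 else 0) : Finset ι → ℝ)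
      = fun _ => 1 := by
    ext T
    by_cases h : i ∈ T <;> simp [h]
  rw [this, MM_one]; rfl

lemma EE_LL_zero (i : ι) (f : (∀ i, Ω i) → ℝ) : EE {i} (LL {i} f) = 0 := by
  apply EE_MM_zero
  intro T hT
  rw [if_neg]
  simpa using hT

lemma EE_comm (S R : Finset ι) (f : (∀ i, Ω i) → ℝ) : EE S (EE R f) = EE R (EE S f) := by
  rw [EE_EE, EE_EE, Finset.union_comm]

lemma hc_step (m : ℕ) (hm : 1 ≤ m) (ρ : ℝ) (hρ0 : 0 < ρ) (hρ : ρ ^ 2 * (16 * m) = 1)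
    (i : ι) (Q : Finset ι) (f : (∀ i, Ω i) → ℝ) :
    EE {i} ((EE Q ((EE {i} f + ρ • LL {i} f) ^ 2)) ^ m) ≤
      EE {i} ((EE (insert i Q) (f ^ 2)) ^ m) +
        ((16 * m : ℝ) ^ m) • EE {i} ((EE Q ((LL {i} f) ^ 2)) ^ m) := by
  set A := EE Q ((EE {i} f) ^ 2) with hA
  set B := EE Q (EE {i} f * LL {i} f) with hB
  set C := EE Q ((LL {i} f) ^ 2) with hC
  have hAi : EE {i} A = A := by
    rw [hA, EE_comm]
    congr 1
    have h1 : EE {i} ((EE {i} f) ^ 2) = EE {i} (EE {i} f * EE {i} f) := by rw [pow_two]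
    rw [h1, EE_pull, EE_EE, Finset.union_self, pow_two]
  have hBi : EE {i} B = 0 := by
    rw [hB, EE_comm, EE_pull, EE_LL_zero]; simp
  have e1 : EE Q ((EE {i} f + ρ • LL {i} f) ^ 2) = A + (2 * ρ) • B + ρ ^ 2 • C := by
    rw [hA, hB, hC, ← map_smul (EE Q), ← map_smul (EE Q), ← map_add (EE Q), ← map_add (EE Q)]
    congr 1
    ext x
    simp only [Pi.pow_apply, Pi.add_apply, Pi.smul_apply, Pi.mul_apply, smul_eq_mul]
    ring
  have e2 : EE (insert i Q) (f ^ 2) = A + EE {i} C := by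
    rw [Finset.insert_eq, ← EE_EE, ← hAi, ← map_add]
    conv_lhs => rw [← EE_add_LL i f]
    have : (EE {i} f + LL {i} f) ^ 2 = (EE {i} f) ^ 2 + (2:ℝ) • (EE {i} f * LL {i} f) + (LL {i} f) ^ 2 := by
      ext x
      simp only [Pi.pow_apply, Pi.add_apply, Pi.smul_apply, Pi.mul_apply, smul_eq_mul]
      ring
    rw [this, map_add (EE Q), map_add (EE Q), map_smul (EE Q), ← hA, ← hB, ← hC, map_add, map_add, map_smul, hBi, map_add]
    simp
  rw [e1, e2]
  have hA0 : ∀ x, 0 ≤ A x := fun x => EE_sq_nonneg _ _ _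
  have hC0 : ∀ x, 0 ≤ C x := fun x => EE_sq_nonneg _ _ _
  have hB2 : ∀ x, (B x) ^ 2 ≤ A x * C x := fun x => EE_cs _ _ _ _
  have pt : (A + (2 * ρ) • B + ρ ^ 2 • C) ^ m ≤
      A ^ m + (2 * m * ρ) • (A ^ (m - 1) * B) + (m : ℝ) • (A ^ (m - 1) * C) + ((16 * m : ℝ) ^ m) • C ^ m := by
    intro x
    have := one_var m hm ρ (A x) (B x) (C x) hρ0 hρ (hA0 x) (hC0 x) (hB2 x)
    simp only [Pi.pow_apply, Pi.add_apply, Pi.smul_apply, Pi.mul_apply, smul_eq_mul]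
    linarith
  have hAn : ∀ n : ℕ, EE {i} (A ^ n) = A ^ n := by
    intro n
    induction n with
    | zero =>
      ext x; simp [EE_apply]
    | succ n ih => rw [pow_succ, ← ih, EE_pull, hAi]
  refine (EE_mono {i} pt).trans ?_
  rw [map_add, map_add, map_add, map_smul, map_smul, map_smul, hAn, EE_pull' _ _ _ (hAn _), EE_pull' _ _ _ (hAn _), hBi]
  have hCi : ∀ x, 0 ≤ EE {i} C x := fun x => EE_nonneg {i} (fun y => hC0 y) x
  have hpow : ∀ x, A x ^ m + m * (A x ^ (m-1) * EE {i} C x) ≤ (A x + EE {i} C x) ^ m := by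
    intro x
    have h0 := hCi x
    have hAx := hA0 x
    have h := one_add_mul_le_pow (a := EE {i} C x / A x) 
    rcases hAx.eq_or_lt with h1 | h1
    · rw [← h1, zero_add]
      rcases Nat.lt_or_ge 1 m with h2 | h2
      · rw [zero_pow (by omega), zero_pow (by omega)]; simp; positivity
      · have : m = 1 := by omega
        subst this; simp
    · have h3 := h (by have : 0 ≤ EE {i} C x / A x := by positivity
                       linarith) m
      have h4 := mul_le_mul_of_nonneg_left h3 (pow_nonneg hAx m)
      rw [← mul_pow] at h4
      have e5 : A x * (1 + EE {i} C x / A x) = A x + EE {i} C x := by field_simp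
      have e6 : A x ^ m * (1 + m * (EE {i} C x / A x)) = A x ^ m + m * (A x ^ (m-1) * EE {i} C x) := by
        have : A x ^ m = A x ^ (m-1) * A x := by rw [← pow_succ]; congr 1; omega
        rw [this]; field_simp
      rw [e5, e6] at h4
      exact h4
  have hinv : EE {i} ((A + EE {i} C) ^ m) = (A + EE {i} C) ^ m := by
    have hD : EE {i} (A + EE {i} C) = A + EE {i} C := by
      rw [map_add, hAi, EE_EE, Finset.union_self]
    have : ∀ n : ℕ, EE {i} ((A + EE {i} C) ^ n) = (A + EE {i} C) ^ n := by
      intro n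
      induction n with
      | zero => ext x; simp [EE_apply]
      | succ n ih => rw [pow_succ, EE_pull' _ _ _ ih, hD]
    exact this m
  rw [hinv]
  intro x
  have := hpow x
  simp only [Pi.pow_apply, Pi.add_apply, Pi.smul_apply, Pi.mul_apply, smul_eq_mul, Pi.zero_apply, mul_zero]
  linarith

lemma LL_insert (i : ι) (S : Finset ι) (f : (∀ i, Ω i) → ℝ) : LL (insert i S) f = LL {i} (LL S f) := by
  unfold LL
  rw [MM_MM]
  congr 2
  ext T
  by_cases h1 : i ∈ T <;> by_cases h2 : S ⊆ T <;> simp [Finset.insert_subset_iff, h1, h2]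

lemma NN_insert (ρ : ℝ) (i : ι) (V : Finset ι) (hi : i ∉ V) (f : (∀ i, Ω i) → ℝ) :
    NN ρ (insert i V) f = EE {i} (NN ρ V f) + ρ • LL {i} (NN ρ V f) := by
  unfold NN LL
  rw [EE_eq_MM, MM_MM, MM_MM, ← LinearMap.smul_apply, MM_smul, ← LinearMap.add_apply, MM_add]
  congr 2
  ext T
  by_cases h1 : i ∈ T
  · have : (T ∩ insert i V).card = (T ∩ V).card + 1 := by
      rw [Finset.inter_insert_of_mem h1, Finset.card_insert_of_notMem (by simp [hi])]
    simp only [this, Pi.add_apply, Pi.mul_apply, Pi.smul_apply]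
    simp [h1, pow_succ, mul_comm]
  · have : T ∩ insert i V = T ∩ V := by
      rw [Finset.inter_insert_of_notMem h1]
    simp [h1, this]

lemma LL_NN_comm (ρ : ℝ) (S V : Finset ι) (f : (∀ i, Ω i) → ℝ) : LL S (NN ρ V f) = NN ρ V (LL S f) := by
  unfold NN LL
  rw [MM_MM, MM_MM, mul_comm]

theorem hyper (m : ℕ) (hm : 1 ≤ m) (ρ : ℝ) (hρ0 : 0 < ρ) (hρ : ρ ^ 2 * (16 * m) = 1)
    (U : Finset ι) (H : (∀ i, Ω i) → ℝ) :
    EE U ((NN ρ U H) ^ (2 * m)) ≤ ∑ S ∈ U.powerset, (((16 * m : ℝ) ^ m) ^ S.card) •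
      EE U ((EE (U \ S) ((LL S H) ^ 2)) ^ m) := by
  have main : ∀ P : Finset ι, P ⊆ U → EE U ((NN ρ U H) ^ (2 * m)) ≤
      ∑ S ∈ P.powerset, (((16 * m : ℝ) ^ m) ^ S.card) •
        EE U ((EE (P \ S) ((NN ρ (U \ P) (LL S H)) ^ 2)) ^ m) := by
    intro P
    induction P using Finset.induction_on with
    | empty =>
      intro _
      simp only [Finset.powerset_empty, Finset.sum_singleton, Finset.card_empty, pow_zero, one_smul,
        Finset.sdiff_empty, EE_empty, Module.End.one_apply]
      have : (LL ∅ H) = H := by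
        unfold LL; simp [MM_one]
      rw [this, pow_mul]
    | insert i P hi ih =>
      intro hP
      have hiU : i ∈ U := hP (Finset.mem_insert_self _ _)
      refine (ih (fun a ha => hP (Finset.mem_insert_of_mem ha))).trans ?_
      rw [Finset.sum_powerset_insert hi, ← Finset.sum_add_distrib]
      refine Finset.sum_le_sum fun S hS => ?_
      have hiS : i ∉ S := fun h => hi (Finset.mem_powerset.1 hS h)
      set f := NN ρ (U \ insert i P) (LL S H) with hf
      have e1 : NN ρ (U \ P) (LL S H) = EE {i} f + ρ • LL {i} f := by
        rw [hf, ← NN_insert _ _ _ (by simp)]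
        congr 2
        ext j
        by_cases hj : j = i
        · subst hj; simp [hiU, hi]
        · simp [hj]
      have e2 : insert i P \ S = insert i (P \ S) := Finset.insert_sdiff_of_notMem _ hiS
      have e3 : insert i P \ insert i S = P \ S := by
        ext j; by_cases hj : j = i <;> simp [hj, hi]
      have e4 : NN ρ (U \ insert i P) (LL (insert i S) H) = LL {i} f := by
        rw [LL_insert, hf, LL_NN_comm]
      rw [e1, e2, e3, e4, Finset.card_insert_of_notMem hiS, pow_succ _ S.card, mul_smul, ← smul_add]
      have h1 := EE_mono U (hc_step m hm ρ hρ0 hρ i (P \ S) f)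
      rw [map_add, map_smul, EE_EE, EE_EE, EE_EE, Finset.union_eq_left.2 (by simpa using hiU)] at h1
      exact smul_le_smul_of_nonneg_left h1 (by positivity)
  refine (main U le_rfl).trans (le_of_eq ?_)
  refine Finset.sum_congr rfl fun S _ => ?_
  have : NN ρ (U \ U) (LL S H) = LL S H := by
    unfold NN; simp [MM_one]
  rw [this]

end ops
end FS

namespace FS
open Finset
open scoped BigOperators

section ops
variable {ι : Type} [Fintype ι] [DecidableEq ι] {Ω : ι → Type} [∀ i, Fintype (Ω i)] [∀ i, Nonempty (Ω i)]

lemma LL_single_bound (U : Finset ι) (i : ι) (f : (∀ i, Ω i) → ℝ) (K : ℝ)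
    (h : ∀ y, EE U (f ^ 2) y ≤ K) (y) : EE U ((LL {i} f) ^ 2) y ≤ 4 * K := by
  have e : LL {i} f = f - EE {i} f := by
    rw [eq_sub_iff_add_eq, add_comm]; exact EE_add_LL i f
  have h1 : (LL {i} f) ^ 2 ≤ (2:ℝ) • f ^ 2 + (2:ℝ) • EE {i} (f ^ 2) := by
    intro x
    have := EE_sq_le {i} f x
    rw [e]
    simp only [Pi.pow_apply, Pi.add_apply, Pi.smul_apply, Pi.sub_apply, smul_eq_mul] at this ⊢
    nlinarith [sq_nonneg (f x + EE {i} f x)]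
  have h2 := EE_mono U h1 y
  rw [map_add, map_smul, map_smul, EE_comm] at h2
  have h3 : EE {i} (EE U (f ^ 2)) y ≤ K := by
    have := EE_mono {i} (F := EE U (f ^ 2)) (G := fun _ => K) h y
    rwa [EE_const] at this
  have h4 := h y
  simp only [Pi.add_apply, Pi.smul_apply, smul_eq_mul] at h2
  linarith

lemma LL_bound (U S : Finset ι) (f : (∀ i, Ω i) → ℝ) (K : ℝ)
    (h : ∀ y, EE U (f ^ 2) y ≤ K) (y) : EE U ((LL S f) ^ 2) y ≤ 4 ^ S.card * K := by
  induction S using Finset.induction_on generalizing y with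
  | empty =>
    have : (LL ∅ f) = f := by unfold LL; simp [MM_one]
    rw [this]; simpa using h y
  | insert i S hi ih =>
    rw [LL_insert, Finset.card_insert_of_notMem hi, pow_succ _ S.card]
    have := LL_single_bound U i (LL S f) _ ih y
    linarith

set_option maxHeartbeats 1000000 in
theorem level_ineq (m d : ℕ) (hm : 4 ≤ m) (B : ℝ) (hB : 0 ≤ B) (F : (∀ i, Ω i) → ℝ)
    (hyp : ∀ S : Finset ι, S.card ≤ d → ∀ x, ∀ w : Finset ι → ℝ, (∀ T, w T = w (T ∩ Sᶜ)) →
      (∀ T, d < (T ∩ Sᶜ).card + S.card → w T = 0) →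
      (EE Sᶜ (F * MM w F) x) ^ (2 * m) ≤ B ^ (2 * m) * EE Sᶜ ((MM w F) ^ (2 * m)) x) (x0) :
    ∑ T with T.card ≤ d, (1 / (256 * m) : ℝ) ^ T.card * EE univ ((PP T F) ^ 2) x0 ≤ B ^ 2 := by
  classical
  have hm0 : (0:ℝ) < m := by have : 0 < m := by omega
                             exact_mod_cast this
  obtain ⟨κ, hκ0, hκ⟩ : ∃ κ : ℝ, 0 < κ ∧ κ ^ 2 * (256 * m) = 1 :=
    ⟨Real.sqrt (1 / (256 * m)), by positivity, by
      rw [Real.sq_sqrt (by positivity)]; field_simp⟩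
  let wΦ : Finset ι → Finset ι → ℝ := fun S T => if (T ∩ Sᶜ).card + S.card ≤ d then κ ^ (T ∩ Sᶜ).card else 0
  let wH : Finset ι → Finset ι → ℝ := fun S T => if (T ∩ Sᶜ).card + S.card ≤ d then (κ / 4) ^ (T ∩ Sᶜ).card else 0
  let wg : Finset ι → Finset ι → ℝ := fun S T => if (T ∩ Sᶜ).card + S.card ≤ d then (κ ^ 2) ^ (T ∩ Sᶜ).card else 0
  let N : Finset ι → (∀ i, Ω i) → ℝ := fun S => EE Sᶜ ((MM (wΦ S) F) ^ 2)
  have hN0 : ∀ S x, 0 ≤ N S x := fun S x => EE_sq_nonneg _ _ _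
  have hinter : ∀ S T : Finset ι, T ∩ Sᶜ ∩ Sᶜ = T ∩ Sᶜ := by
    intro S T; rw [Finset.inter_assoc, Finset.inter_self]
  have hwΦ : ∀ S T, wΦ S T = wΦ S (T ∩ Sᶜ) := by intro S T; simp only [wΦ, hinter]
  have hwH : ∀ S T, wH S T = wH S (T ∩ Sᶜ) := by intro S T; simp only [wH, hinter]
  have hwg : ∀ S T, wg S T = wg S (T ∩ Sᶜ) := by intro S T; simp only [wg, hinter]
  have hNp : ∀ S x, N S x = ∑ T ∈ Sᶜ.powerset, wΦ S T * wΦ S T * EE Sᶜ ((QQ Sᶜ T F) ^ 2) x := by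
    intro S x
    rw [← parseval _ _ _ (hwΦ S) (hwΦ S), ← pow_two]
  have hNF : ∀ S x, N S x = EE Sᶜ (F * MM (wg S) F) x := by
    intro S x
    have h1 := parseval Sᶜ (fun _ => 1) (wg S) (fun _ => rfl) (hwg S) F x
    rw [MM_one, Module.End.one_apply] at h1
    rw [h1, hNp]
    refine Finset.sum_congr rfl fun T _ => ?_
    congr 1
    simp only [wΦ, wg]
    split_ifs
    · rw [one_mul, ← pow_mul, mul_comm 2, pow_mul, pow_two]
    · simp
  obtain ⟨⟨S0, y0⟩, hmem, hmax⟩ := Finset.exists_max_image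
    ((univ.filter (fun S : Finset ι => S.card ≤ d)) ×ˢ (univ : Finset (∀ i, Ω i)))
    (fun p => (1 / 16 : ℝ) ^ p.1.card * N p.1 p.2) ⟨(∅, x0), by simp⟩
  set M := (1 / 16 : ℝ) ^ S0.card * N S0 y0 with hM
  have hM0 : 0 ≤ M := mul_nonneg (by positivity) (hN0 _ _)
  have hNM : ∀ S : Finset ι, S.card ≤ d → ∀ x, N S x ≤ 16 ^ S.card * M := by
    intro S hS x
    have := hmax (S, x) (by simp [hS])
    simp only at this
    have h16 : (16:ℝ) ^ S.card * ((1 / 16 : ℝ) ^ S.card * N S x) = N S x := by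
      rw [← mul_assoc, ← mul_pow]; norm_num
    rw [← h16]
    gcongr
  have h4m : (16 * m : ℝ) * (1 / 4) ^ (m - 1) ≤ 1 := by
    have : ∀ n : ℕ, (16 * ((n + 4 : ℕ) : ℝ)) * (1 / 4) ^ (n + 3) ≤ 1 := by
      intro n
      induction n with
      | zero => norm_num
      | succ n ih =>
        push_cast at ih ⊢
        rw [show n + 1 + 3 = (n + 3) + 1 by ring, pow_succ]
        have : (0:ℝ) ≤ (1 / 4) ^ (n + 3) := by positivity
        have hn : (0:ℝ) ≤ n := by positivity
        nlinarith [mul_nonneg this hn]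
    have h := this (m - 4)
    rwa [show m - 4 + 4 = m by omega, show m - 4 + 3 = m - 1 by omega] at h
  -- key inequality
  have key : ∀ S : Finset ι, S.card ≤ d → ∀ x,
      N S x ^ (2 * m) ≤ B ^ (2 * m) * ((16 ^ S.card * M) ^ (m - 1) * N S x) := by
    intro S hS x
    rw [hNF]
    refine (hyp S hS x (wg S) (hwg S) (fun T hT => if_neg (by omega))).trans ?_
    refine mul_le_mul_of_nonneg_left ?_ (by positivity)
    rw [← hNF]
    set U := Sᶜ with hU
    set H := MM (wH S) F with hH
    have hgH : MM (wg S) F = NN (4 * κ) U H := by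
      rw [hH, NN, MM_MM]
      congr 2
      ext T
      simp only [wg, wH, Pi.mul_apply]
      split_ifs
      · rw [← mul_pow]; congr 1; ring
      · simp
    rw [hgH]
    have hhc := hyper m (by omega) (4 * κ) (by positivity) (by nlinarith) U H x
    refine hhc.trans ?_
    have hLH : ∀ S' ⊆ U, LL S' H = MM (fun T => (if S' ⊆ T then 1 else 0) * wH S T) F := by
      intro S' hS'
      rw [hH, LL, MM_MM]
      rfl
    -- pointwise bound
    have hX : ∀ S' ∈ U.powerset, ∀ y, EE (U \ S') ((LL S' H) ^ 2) y ≤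
        (4 * κ ^ 2) ^ S'.card * (16 ^ S.card * M) := by
      intro S' hS' y
      rw [Finset.mem_powerset] at hS'
      have hdis : Disjoint S S' := by
        rw [Finset.disjoint_right]
        intro a ha
        exact Finset.mem_compl.1 (hS' ha)
      have hcU : (S ∪ S').card = S.card + S'.card := Finset.card_union_of_disjoint hdis
      have hU' : U \ S' = (S ∪ S')ᶜ := by
        ext a; simp [hU]
      by_cases hd : (S ∪ S').card ≤ d
      · have e1 : LL S' H = (κ / 4) ^ S'.card • LL S' (MM (wH (S ∪ S')) F) := by
          rw [hLH S' hS', LL, MM_MM, ← LinearMap.smul_apply, MM_smul]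
          congr 2
          ext T
          simp only [Pi.smul_apply, Pi.mul_apply, smul_eq_mul]
          by_cases hT : S' ⊆ T
          · have hc : (T ∩ Sᶜ).card = (T ∩ (S ∪ S')ᶜ).card + S'.card := by
              rw [← hU', ← hU]
              have : T ∩ U = (T ∩ (U \ S')) ∪ S' := by
                ext a
                simp only [Finset.mem_inter, Finset.mem_union, Finset.mem_sdiff]
                constructor
                · rintro ⟨h1, h2⟩
                  by_cases h3 : a ∈ S'
                  · exact Or.inr h3
                  · exact Or.inl ⟨h1, h2, h3⟩
                · rintro (⟨h1, h2, _⟩ | h)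
                  · exact ⟨h1, h2⟩
                  · exact ⟨hT h, hS' h⟩
              rw [this, Finset.card_union_of_disjoint]
              rw [Finset.disjoint_left]
              intro a ha hb
              simp only [Finset.mem_inter, Finset.mem_sdiff] at ha
              exact ha.2.2 hb
            have hiff : ((T ∩ Sᶜ).card + S.card ≤ d) ↔ ((T ∩ (S ∪ S')ᶜ).card + (S ∪ S').card ≤ d) := by
              rw [hc, hcU]; omega
            simp only [wH, hT, if_true, one_mul, hiff]
            split_ifs
            · rw [hc, pow_add]; ring
            · simp
          · simp [hT]
        have hΨ : ∀ y, EE (U \ S') ((MM (wH (S ∪ S')) F) ^ 2) y ≤ 16 ^ (S ∪ S').card * M := by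
          intro y
          refine le_trans ?_ (hNM _ hd y)
          rw [hNp, hU', pow_two, parseval _ _ _ (hwH _) (hwH _)]
          refine Finset.sum_le_sum fun T _ => ?_
          refine mul_le_mul_of_nonneg_right ?_ (EE_sq_nonneg _ _ _)
          simp only [wH, wΦ]
          split_ifs
          · have : κ / 4 ≤ κ := by linarith
            gcongr
          · simp
        have hb := LL_bound (U \ S') S' _ _ hΨ y
        rw [e1]
        have e2 : ((κ / 4) ^ S'.card • LL S' (MM (wH (S ∪ S')) F)) ^ 2 =
            ((κ / 4) ^ S'.card) ^ 2 • (LL S' (MM (wH (S ∪ S')) F)) ^ 2 := by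
          rw [smul_pow]
        rw [e2, map_smul, Pi.smul_apply, smul_eq_mul]
        refine (mul_le_mul_of_nonneg_left hb (by positivity)).trans (le_of_eq ?_)
        rw [hcU, pow_add, ← pow_mul, mul_comm S'.card 2, pow_mul]
        have : (4 * κ ^ 2) ^ S'.card = ((κ / 4) ^ 2) ^ S'.card * 4 ^ S'.card * 16 ^ S'.card := by
          rw [← mul_pow, ← mul_pow]; congr 1; ring
        rw [this]; ring
      · have e1 : LL S' H = 0 := by
          rw [hLH S' hS']
          have : (fun T => (if S' ⊆ T then 1 else 0) * wH S T) = fun _ => (0:ℝ) := by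
            ext T
            by_cases hT : S' ⊆ T
            · have : S'.card ≤ (T ∩ Sᶜ).card := Finset.card_le_card (Finset.subset_inter hT hS')
              have h2 : ¬ ((T ∩ Sᶜ).card + S.card ≤ d) := by omega
              simp only [wH, if_neg h2, mul_zero]
            · simp [hT]
          rw [this]; simp [MM]
        rw [e1]
        have : ((0 : (∀ i, Ω i) → ℝ)) ^ 2 = 0 := by ext; simp
        rw [this, map_zero]
        simp only [Pi.zero_apply]
        positivity
    have hX0 : ∀ S' y, 0 ≤ EE (U \ S') ((LL S' H) ^ 2) y := fun S' y => EE_sq_nonneg _ _ _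
    -- sum of second moments
    have hsum : ∑ S' ∈ U.powerset, EE U ((LL S' H) ^ 2) x ≤ N S x := by
      have e3 : ∀ S' ∈ U.powerset, EE U ((LL S' H) ^ 2) x =
          ∑ T ∈ U.powerset, (if S' ⊆ T then 1 else 0) * (wH S T * wH S T * EE U ((QQ U T F) ^ 2) x) := by
        intro S' hS'
        have hs := Finset.mem_powerset.1 hS'
        have hw : ∀ T, (if S' ⊆ T then (1:ℝ) else 0) * wH S T =
            (if S' ⊆ T ∩ U then (1:ℝ) else 0) * wH S (T ∩ U) := by
          intro T
          rw [← hwH S T]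
          have : S' ⊆ T ∩ U ↔ S' ⊆ T := ⟨fun h => h.trans Finset.inter_subset_left, fun h => Finset.subset_inter h hs⟩
          simp only [this]
        rw [hLH S' hs, pow_two, parseval _ _ _ hw hw]
        refine Finset.sum_congr rfl fun T _ => ?_
        by_cases hT : S' ⊆ T <;> simp [hT]
      rw [Finset.sum_congr rfl e3, Finset.sum_comm, hNp]
      refine Finset.sum_le_sum fun T hT => ?_
      rw [← Finset.sum_mul, ← mul_assoc]
      refine mul_le_mul_of_nonneg_right ?_ (EE_sq_nonneg _ _ _)
      have e4 : ∑ S' ∈ U.powerset, (if S' ⊆ T then (1:ℝ) else 0) = 2 ^ T.card := by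
        rw [← Finset.sum_filter]
        have : U.powerset.filter (fun S' => S' ⊆ T) = T.powerset := by
          ext a
          simp only [Finset.mem_filter, Finset.mem_powerset]
          exact ⟨fun h => h.2, fun h => ⟨h.trans (Finset.mem_powerset.1 hT), h⟩⟩
        rw [this]; simp
      rw [e4]
      have e5 : T ∩ Sᶜ = T := Finset.inter_eq_left.2 (Finset.mem_powerset.1 hT)
      simp only [wH, wΦ, e5]
      split_ifs
      · rw [← mul_pow, ← mul_pow, ← mul_pow]
        exact pow_le_pow_left₀ (by positivity) (by nlinarith) _
      · simp
    have hK0 : 0 ≤ (16:ℝ) ^ S.card * M := by positivity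
    rw [Finset.sum_apply]
    calc ∑ S' ∈ U.powerset, (((16 * m : ℝ) ^ m) ^ S'.card • EE U ((EE (U \ S') ((LL S' H) ^ 2)) ^ m)) x
        ≤ ∑ S' ∈ U.powerset, (16 ^ S.card * M) ^ (m - 1) * EE U ((LL S' H) ^ 2) x := by
          refine Finset.sum_le_sum fun S' hS' => ?_
          rw [Pi.smul_apply, smul_eq_mul]
          have h1 : (EE (U \ S') ((LL S' H) ^ 2)) ^ m ≤
              ((4 * κ ^ 2) ^ S'.card * (16 ^ S.card * M)) ^ (m - 1) • EE (U \ S') ((LL S' H) ^ 2) := by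
            intro y
            rw [Pi.pow_apply, Pi.smul_apply, smul_eq_mul]
            have : ∀ a : ℝ, a ^ m = a ^ (m - 1) * a := by
              intro a; rw [← pow_succ]; congr 1; omega
            rw [this]
            gcongr
            · exact hX0 S' y
            · exact hX0 S' y
            · exact hX S' hS' y
          have h2 := EE_mono U h1 x
          rw [map_smul, EE_EE, Pi.smul_apply, smul_eq_mul,
            Finset.union_eq_left.2 Finset.sdiff_subset] at h2
          refine (mul_le_mul_of_nonneg_left h2 (by positivity)).trans ?_
          rw [← mul_assoc]
          refine mul_le_mul_of_nonneg_right ?_ (EE_sq_nonneg _ _ _)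
          rw [mul_pow ((4 * κ ^ 2) ^ S'.card), ← mul_assoc]
          have e6 : ((16 * m : ℝ) ^ m) ^ S'.card * ((4 * κ ^ 2) ^ S'.card) ^ (m - 1) =
              ((16 * m : ℝ) * (1 / 4) ^ (m - 1)) ^ S'.card := by
            rw [← pow_mul (4 * κ ^ 2), mul_comm S'.card, pow_mul (4 * κ ^ 2), ← mul_pow]
            congr 1
            have : (16 * m : ℝ) ^ m = (16 * m) * (16 * m) ^ (m - 1) := by
              rw [← pow_succ']; congr 1; omega
            rw [this, mul_assoc, ← mul_pow]
            congr 2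
            linarith
          rw [e6]
          refine mul_le_of_le_one_left (by positivity) (pow_le_one₀ (by positivity) h4m)
      _ = (16 ^ S.card * M) ^ (m - 1) * ∑ S' ∈ U.powerset, EE U ((LL S' H) ^ 2) x := by
          rw [Finset.mul_sum]
      _ ≤ _ := by gcongr
  -- conclude
  have hS0 : S0.card ≤ d := by
    simp only [Finset.mem_product, Finset.mem_filter, Finset.mem_univ, true_and, and_true] at hmem
    exact hmem
  have hNS0 : N S0 y0 = 16 ^ S0.card * M := by
    rw [hM, ← mul_assoc, ← mul_pow]; norm_num
  have hfin := key S0 hS0 y0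
  rw [hNS0] at hfin
  set Z := (16:ℝ) ^ S0.card * M with hZ
  have hZ0 : 0 ≤ Z := by positivity
  have hMZ : M ≤ Z := by
    rw [hZ]
    exact le_mul_of_one_le_left hM0 (one_le_pow₀ (by norm_num))
  have hZB : Z ≤ B ^ 2 := by
    rcases hZ0.eq_or_lt with h | h
    · rw [← h]; positivity
    · have e7 : Z ^ (m - 1) * Z = Z ^ m := by rw [← pow_succ]; congr 1; omega
      rw [e7, two_mul, pow_add, ← two_mul] at hfin
      have := le_of_mul_le_mul_right hfin (pow_pos h m)
      rw [pow_mul] at this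
      exact le_of_pow_le_pow_left₀ (by omega) (by positivity) this
  have hlast := hNM ∅ (by simp) x0
  rw [hNp] at hlast
  simp only [Finset.card_empty, pow_zero, one_mul] at hlast
  refine le_trans (le_of_eq ?_) (hlast.trans (hMZ.trans hZB))
  rw [Finset.compl_empty, Finset.powerset_univ, Finset.sum_filter]
  refine Finset.sum_congr rfl fun T _ => ?_
  have e8 : (QQ univ T : Module.End ℝ ((∀ i, Ω i) → ℝ)) = PP T := by
    unfold QQ MM
    simp
  simp only [wΦ, Finset.compl_empty, Finset.inter_univ, Finset.card_empty, add_zero, e8]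
  split_ifs
  · congr 1
    rw [← mul_pow]; congr 1
    rw [div_eq_iff (by positivity)]; linarith
  · simp

end ops
end FS

namespace FS
open Finset

section ld
variable {K : Type} [Field K]

/-- X times the logarithmic derivative of u -/
noncomputable def ld (u : PowerSeries K) : PowerSeries K :=
  PowerSeries.X * PowerSeries.derivative K u * u⁻¹

lemma ld_mul_self (u : PowerSeries K) (hu : PowerSeries.constantCoeff u ≠ 0) :
    ld u * u = PowerSeries.X * PowerSeries.derivative K u := by
  unfold ld
  rw [mul_assoc, PowerSeries.inv_mul_cancel _ hu, mul_one]

lemma ld_unique (u v : PowerSeries K) (hu : PowerSeries.constantCoeff u ≠ 0)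
    (h : v * u = PowerSeries.X * PowerSeries.derivative K u) : v = ld u := by
  have hu0 : u ≠ 0 := by rintro rfl; simp at hu
  exact mul_right_cancel₀ hu0 (h.trans (ld_mul_self u hu).symm)

lemma ld_mul (u v : PowerSeries K) (hu : PowerSeries.constantCoeff u ≠ 0)
    (hv : PowerSeries.constantCoeff v ≠ 0) : ld (u * v) = ld u + ld v := by
  symm
  apply ld_unique
  · rw [map_mul]; exact mul_ne_zero hu hv
  · have h1 := ld_mul_self u hu
    have h2 := ld_mul_self v hv
    rw [Derivation.leibniz, smul_eq_mul, smul_eq_mul]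
    calc (ld u + ld v) * (u * v) = (ld u * u) * v + (ld v * v) * u := by ring
      _ = _ := by rw [h1, h2]; ring

lemma ld_one : ld (1 : PowerSeries K) = 0 := by
  unfold ld
  rw [Derivation.map_one_eq_zero]; simp

lemma ld_coeff_zero (u : PowerSeries K) : PowerSeries.coeff 0 (ld u) = 0 := by
  unfold ld
  rw [mul_assoc, PowerSeries.coeff_zero_X_mul]

lemma ld_shift (u : PowerSeries K) (hu : PowerSeries.constantCoeff u = 1) (c : K) (d : ℕ) (hd : 0 < d) :
    ∃ w : PowerSeries K, ld (u + PowerSeries.C c * PowerSeries.X ^ d) = ld u + PowerSeries.X ^ d * w ∧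
      PowerSeries.constantCoeff w = d * c := by
  set v := u + PowerSeries.C c * PowerSeries.X ^ d with hv
  have hvc : PowerSeries.constantCoeff v = 1 := by
    rw [hv, map_add, hu]; simp [hd.ne']
  have hv0 : PowerSeries.constantCoeff v ≠ 0 := by rw [hvc]; exact one_ne_zero
  refine ⟨(PowerSeries.C c * ((d : PowerSeries K) - ld u)) * v⁻¹, ?_, ?_⟩
  · symm
    apply ld_unique _ _ hv0
    have h1 := ld_mul_self u (by rw [hu]; exact one_ne_zero)
    have h2 : PowerSeries.derivative K v = PowerSeries.derivative K u +
        PowerSeries.C c * (((d : ℕ) : PowerSeries K) * PowerSeries.X ^ (d - 1)) := by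
      rw [hv, map_add, Derivation.leibniz]
      simp [PowerSeries.derivative_pow]
    have h3 : (PowerSeries.X : PowerSeries K) * PowerSeries.X ^ (d - 1) = PowerSeries.X ^ d := by
      rw [← pow_succ']; congr 1; omega
    have h4 : v⁻¹ * v = 1 := PowerSeries.inv_mul_cancel _ hv0
    rw [h2]
    calc (ld u + PowerSeries.X ^ d * ((PowerSeries.C c * ((d : PowerSeries K) - ld u)) * v⁻¹)) * v
        = ld u * v + PowerSeries.X ^ d * (PowerSeries.C c * ((d : PowerSeries K) - ld u)) * (v⁻¹ * v) := by ring
      _ = ld u * u + (PowerSeries.X ^ d) * PowerSeries.C c * ((d : ℕ) : PowerSeries K) := by rw [h4, hv]; ring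
      _ = _ := by rw [h1, ← h3]; ring
  · rw [map_mul, map_mul, map_sub, PowerSeries.constantCoeff_inv, hvc]
    have := ld_coeff_zero u
    rw [PowerSeries.coeff_zero_eq_constantCoeff_apply] at this
    rw [this]
    simp [mul_comm]
end ld

section weil
variable {p : ℕ} [Fact p.Prime]
open Polynomial

/-- power sum of the roots: minus the coefficient of the logarithmic derivative of the reverse -/
noncomputable def psm {K : Type} [Field K] (m : ℕ) (F : K[X]) : K :=
  - PowerSeries.coeff m (ld ((F.reverse : K[X]) : PowerSeries K))

lemma rev_const {K : Type} [Field K] {F : K[X]} (hF : F.Monic) :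
    PowerSeries.constantCoeff ((F.reverse : K[X]) : PowerSeries K) = 1 := by
  rw [← PowerSeries.coeff_zero_eq_constantCoeff_apply, Polynomial.coeff_coe, Polynomial.coeff_zero_reverse]
  exact hF

lemma psm_mul {K : Type} [Field K] (m : ℕ) {F G : K[X]} (hF : F.Monic) (hG : G.Monic) :
    psm m (F * G) = psm m F + psm m G := by
  unfold psm
  rw [Polynomial.reverse_mul_of_domain, Polynomial.coe_mul, ld_mul, map_add, neg_add]
  · rw [rev_const hF]; exact one_ne_zero
  · rw [rev_const hG]; exact one_ne_zero

lemma psm_one {K : Type} [Field K] (m : ℕ) : psm m (1 : K[X]) = 0 := by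
  unfold psm
  have : (1 : K[X]).reverse = 1 := by
    rw [← Polynomial.C_1, Polynomial.reverse_C]
  rw [this, Polynomial.coe_one, ld_one]; simp

/-- sum of `f` over the roots of `F` -/
noncomputable def ssm {K : Type} [Field K] (f F : K[X]) : K := ∑ m ∈ Finset.Icc 1 f.natDegree, f.coeff m * psm m F

lemma ssm_mul {K : Type} [Field K] (f : K[X]) {F G : K[X]} (hF : F.Monic) (hG : G.Monic) :
    ssm f (F * G) = ssm f F + ssm f G := by
  unfold ssm
  simp only [psm_mul _ hF hG, mul_add, Finset.sum_add_distrib]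

lemma ssm_shift {K : Type} [Field K] (f : K[X]) (hf : 1 ≤ f.natDegree) {F : K[X]} (hF : F.Monic) (c : K)
    (hn : f.natDegree ≤ F.natDegree) :
    ssm f (F + C c * X ^ (F.natDegree - f.natDegree)) =
      ssm f F - f.leadingCoeff * (f.natDegree * c) := by
  set d := f.natDegree with hd
  set n := F.natDegree with hn'
  have hlt : (C c * X ^ (n - d) : K[X]).degree < F.degree := by
    refine (degree_C_mul_X_pow_le _ _).trans_lt ?_
    rw [degree_eq_natDegree hF.ne_zero]
    exact_mod_cast (by omega : n - d < n)
  have hdeg : (F + C c * X ^ (n - d)).natDegree = n := natDegree_add_eq_left_of_degree_lt hlt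
  have hrev : (F + C c * X ^ (n - d)).reverse = F.reverse + C c * X ^ d := by
    ext i
    rw [coeff_reverse, hdeg, coeff_add, coeff_add, coeff_reverse, ← hn', coeff_C_mul_X_pow, coeff_C_mul_X_pow]
    congr 1
    have : revAt n i = n - d ↔ i = d := by
      constructor
      · intro h
        have := congrArg (revAt n) h
        rw [revAt_invol, revAt_le (by omega)] at this
        omega
      · rintro rfl; rw [revAt_le hn]
    simp only [this]
  obtain ⟨w, hw, hw0⟩ := ld_shift ((F.reverse : K[X]) : PowerSeries K) (rev_const hF) c d (by omega)
  have hp : ∀ m, psm m (F + C c * X ^ (n - d)) = psm m F - PowerSeries.coeff m (PowerSeries.X ^ d * w) := by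
    intro m
    unfold psm
    rw [hrev]
    have : ((F.reverse + C c * X ^ d : K[X]) : PowerSeries K) =
        ((F.reverse : K[X]) : PowerSeries K) + PowerSeries.C c * PowerSeries.X ^ d := by
      simp
    rw [this, hw, map_add]; ring
  unfold ssm
  simp only [hp, mul_sub, Finset.sum_sub_distrib]
  congr 1
  rw [← hd, Finset.sum_eq_single d]
  · rw [PowerSeries.coeff_X_pow_mul', if_pos le_rfl, Nat.sub_self, PowerSeries.coeff_zero_eq_constantCoeff_apply, hw0]
    rfl
  · intro m hm hne
    have : m < d := lt_of_le_of_ne (Finset.mem_Icc.1 hm).2 hne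
    rw [PowerSeries.coeff_X_pow_mul', if_neg (by omega), mul_zero]
  · intro h
    exact absurd (Finset.mem_Icc.2 ⟨hf, le_rfl⟩) h

/-- monic polynomials of degree `n` -/
noncomputable def mon (p : ℕ) [Fact p.Prime] (n : ℕ) : Finset (ZMod p)[X] :=
  univ.image (fun c : Fin n → ZMod p => X ^ n + ∑ i : Fin n, C (c i) * X ^ (i : ℕ))

lemma mem_mon {n : ℕ} {F : (ZMod p)[X]} : F ∈ mon p n ↔ F.Monic ∧ F.natDegree = n := by
  unfold mon
  rw [Finset.mem_image]
  constructor
  · rintro ⟨c, -, rfl⟩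
    have hlt : (∑ i : Fin n, C (c i) * X ^ (i : ℕ)).degree < (n : WithBot ℕ) := degree_sum_fin_lt c
    refine ⟨monic_X_pow_add hlt, ?_⟩
    rw [natDegree_add_eq_left_of_degree_lt (by rw [degree_X_pow]; exact hlt), natDegree_X_pow]
  · rintro ⟨h1, h2⟩
    refine ⟨fun i => F.coeff i, mem_univ _, ?_⟩
    conv_rhs => rw [h1.as_sum, h2]
    rw [Fin.sum_univ_eq_sum_range (fun i => C (F.coeff i) * X ^ i) n]

noncomputable def lam (ψ : AddChar (ZMod p) ℂ) (f F : (ZMod p)[X]) : ℂ := ψ (ssm f F)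

lemma lam_mul (ψ : AddChar (ZMod p) ℂ) (f : (ZMod p)[X]) {F G : (ZMod p)[X]} (hF : F.Monic) (hG : G.Monic) :
    lam ψ f (F * G) = lam ψ f F * lam ψ f G := by
  unfold lam
  rw [ssm_mul f hF hG, AddChar.map_add_eq_mul]

lemma lam_one (ψ : AddChar (ZMod p) ℂ) (f : (ZMod p)[X]) : lam ψ f 1 = 1 := by
  unfold lam ssm
  simp [psm_one]

lemma lam_pow (ψ : AddChar (ZMod p) ℂ) (f : (ZMod p)[X]) {F : (ZMod p)[X]} (hF : F.Monic) (i : ℕ) :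
    lam ψ f (F ^ i) = lam ψ f F ^ i := by
  induction i with
  | zero => simp [lam_one]
  | succ i ih => rw [pow_succ, lam_mul ψ f (hF.pow i) hF, ih, pow_succ]

noncomputable def Lc (ψ : AddChar (ZMod p) ℂ) (f : (ZMod p)[X]) (n : ℕ) : ℂ := ∑ F ∈ mon p n, lam ψ f F

lemma Lc_zero (ψ : AddChar (ZMod p) ℂ) (f : (ZMod p)[X]) : Lc ψ f 0 = 1 := by
  have : mon p 0 = {1} := by
    ext F
    rw [mem_mon, Finset.mem_singleton]
    constructor
    · rintro ⟨h1, h2⟩; exact h1.natDegree_eq_zero.1 h2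
    · rintro rfl; exact ⟨monic_one, natDegree_one⟩
  rw [Lc, this, Finset.sum_singleton, lam_one]

lemma Lc_vanish (ψ : AddChar (ZMod p) ℂ) (hψ : ψ ≠ 1) (f : (ZMod p)[X]) (hf : 1 ≤ f.natDegree)
    (hfp : f.natDegree < p) (n : ℕ) (hn : f.natDegree ≤ n) : Lc ψ f n = 0 := by
  obtain ⟨a, ha⟩ : ∃ a, ψ a ≠ 1 := by
    by_contra hcon
    push Not at hcon
    apply hψ
    ext x; simp [hcon x]
  have hd0 : ((f.natDegree : ℕ) : ZMod p) ≠ 0 := by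
    rw [Ne, ZMod.natCast_eq_zero_iff]
    intro h
    exact absurd (Nat.le_of_dvd hf h) (by omega)
  have hl0 : f.leadingCoeff ≠ 0 := by
    rw [Ne, leadingCoeff_eq_zero]; rintro rfl; simp at hf
  set c := -a / (f.leadingCoeff * f.natDegree) with hc
  have hca : f.leadingCoeff * (f.natDegree * c) = -a := by
    rw [hc]; field_simp
  have hmem : ∀ (c : ZMod p), ∀ F ∈ mon p n, F + C c * X ^ (n - f.natDegree) ∈ mon p n := by
    intro c F hF
    rw [mem_mon] at hF ⊢
    have hlt : (C c * X ^ (n - f.natDegree) : (ZMod p)[X]).degree < F.degree := by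
      refine (degree_C_mul_X_pow_le _ _).trans_lt ?_
      rw [degree_eq_natDegree hF.1.ne_zero, hF.2]
      exact_mod_cast (by omega : n - f.natDegree < n)
    exact ⟨hF.1.add_of_left hlt, (natDegree_add_eq_left_of_degree_lt hlt).trans hF.2⟩
  have h1 : Lc ψ f n = ∑ F ∈ mon p n, lam ψ f (F + C c * X ^ (n - f.natDegree)) := by
    unfold Lc
    symm
    refine Finset.sum_bij' (fun F _ => F + C c * X ^ (n - f.natDegree)) (fun F _ => F + C (-c) * X ^ (n - f.natDegree))
      (hmem c) (hmem (-c)) ?_ ?_ ?_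
    · intro F _; simp
    · intro F _; simp
    · intro F _; rfl
  have h2 : Lc ψ f n = ψ a * Lc ψ f n := by
    conv_lhs => rw [h1]
    unfold Lc
    rw [Finset.mul_sum]
    refine Finset.sum_congr rfl fun F hF => ?_
    rw [mem_mon] at hF
    unfold lam
    have := ssm_shift f hf hF.1 c (by omega)
    rw [hF.2] at this
    rw [this, hca, sub_neg_eq_add, add_comm, AddChar.map_add_eq_mul]
  have h3 : (1 - ψ a) * Lc ψ f n = 0 := by linear_combination h2
  rcases mul_eq_zero.1 h3 with h | h
  · exact absurd (sub_eq_zero.1 h).symm ha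
  · exact h

end weil
end FS

namespace FS
open Finset
section weil
variable {p : ℕ} [Fact p.Prime]
open Polynomial

open Classical in
/-- monic irreducible polynomials of degree `j` -/
noncomputable def irr (p : ℕ) [Fact p.Prime] (j : ℕ) : Finset (ZMod p)[X] := (mon p j).filter Irreducible

lemma mem_irr {j : ℕ} {P : (ZMod p)[X]} : P ∈ irr p j ↔ P.Monic ∧ P.natDegree = j ∧ Irreducible P := by
  classical
  unfold irr
  rw [Finset.mem_filter, mem_mon, and_assoc]

open Classical in
lemma deg_sum {n : ℕ} {F : (ZMod p)[X]} (hF : F ∈ mon p n) :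
    (n : ℕ) = ∑ j ∈ Icc 1 n, ∑ P ∈ irr p j, ∑ i ∈ Icc 1 n, if P ^ i ∣ F then j else 0 := by
  obtain ⟨hm, hn⟩ := mem_mon.1 hF
  have hF0 := hm.ne_zero
  set N := UniqueFactorizationMonoid.normalizedFactors F with hN
  have hmemN : ∀ P, P ∈ N → P.Monic ∧ Irreducible P ∧ P ∣ F := by
    intro P hP
    refine ⟨?_, UniqueFactorizationMonoid.irreducible_of_normalized_factor P hP,
      UniqueFactorizationMonoid.dvd_of_mem_normalizedFactors hP⟩
    have h1 := UniqueFactorizationMonoid.normalize_normalized_factor P hP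
    have h2 := UniqueFactorizationMonoid.irreducible_of_normalized_factor P hP
    rw [← h1]
    exact Polynomial.monic_normalize h2.ne_zero
  have hprod : N.prod = F := by
    have h1 := UniqueFactorizationMonoid.prod_normalizedFactors hF0
    have h2 : N.prod.Monic := by
      apply Polynomial.monic_multiset_prod_of_monic N id |> fun h => by
        simpa using h (fun P hP => (hmemN P hP).1)
    exact Polynomial.eq_of_monic_of_associated h2 hm h1
  have hcount : ∀ (P : (ZMod p)[X]), P.Monic → Irreducible P → ∀ i, P ^ i ∣ F ↔ i ≤ N.count P := by
    intro P hP hirr i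
    rw [pow_dvd_iff_le_emultiplicity,
      UniqueFactorizationMonoid.emultiplicity_eq_count_normalizedFactors hirr hF0, hP.normalize_eq_self]
    exact_mod_cast Iff.rfl
  have hdeg : F.natDegree = (N.map natDegree).sum := by
    rw [← hprod, Polynomial.natDegree_multiset_prod_of_monic]
    exact fun P hP => (hmemN P hP).1
  have hdeg2 : n = ∑ P ∈ N.toFinset, N.count P * P.natDegree := by
    rw [← hn, hdeg, Finset.sum_multiset_map_count]
    simp
  have hcle : ∀ P, P.Monic → Irreducible P → N.count P ≤ n := by
    intro P hP hi
    have h1 := (hcount P hP hi (N.count P)).2 le_rfl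
    have h2 := Polynomial.natDegree_le_of_dvd h1 hF0
    rw [hP.natDegree_pow, hn] at h2
    have := hi.natDegree_pos
    nlinarith
  have hinner : ∀ j, ∀ P ∈ irr p j, (∑ i ∈ Icc 1 n, if P ^ i ∣ F then j else 0) = N.count P * P.natDegree := by
    intro j P hP
    obtain ⟨h1, h2, h3⟩ := mem_irr.1 hP
    rw [← Finset.sum_filter, Finset.sum_const, h2, smul_eq_mul]
    congr 1
    have : (Icc 1 n).filter (fun i => P ^ i ∣ F) = Icc 1 (N.count P) := by
      ext i
      rw [Finset.mem_filter, hcount P h1 h3, Finset.mem_Icc, Finset.mem_Icc]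
      have := hcle P h1 h3
      omega
    rw [this]; simp
  have hdisj : ((Icc 1 n : Finset ℕ) : Set ℕ).PairwiseDisjoint (fun j => irr p j) := by
    intro a _ b _ hab
    rw [Function.onFun, Finset.disjoint_left]
    intro P h1 h2
    exact hab ((mem_irr.1 h1).2.1.symm.trans (mem_irr.1 h2).2.1)
  rw [Finset.sum_congr rfl fun j _ => Finset.sum_congr rfl (hinner j), ← Finset.sum_biUnion hdisj]
  conv_lhs => rw [hdeg2]
  apply Finset.sum_subset
  · intro P hP
    rw [Multiset.mem_toFinset] at hP
    obtain ⟨h1, h2, h3⟩ := hmemN P hP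
    rw [Finset.mem_biUnion]
    refine ⟨P.natDegree, ?_, mem_irr.2 ⟨h1, rfl, h2⟩⟩
    rw [Finset.mem_Icc, ← hn]
    exact ⟨h2.natDegree_pos, Polynomial.natDegree_le_of_dvd h3 hF0⟩
  · intro P _ hP
    rw [Multiset.mem_toFinset] at hP
    rw [Multiset.count_eq_zero_of_notMem hP, zero_mul]

open Classical in
lemma sum_dvd (ψ : AddChar (ZMod p) ℂ) (f : (ZMod p)[X]) (n : ℕ) {Q : (ZMod p)[X]} (hQ : Q.Monic) :
    ∑ F ∈ mon p n, (if Q ∣ F then lam ψ f F else 0) =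
      if Q.natDegree ≤ n then lam ψ f Q * Lc ψ f (n - Q.natDegree) else 0 := by
  split_ifs with h
  · rw [← Finset.sum_filter, Lc, Finset.mul_sum]
    symm
    refine Finset.sum_bij (fun F _ => Q * F) ?_ ?_ ?_ ?_
    · intro F hF
      obtain ⟨h1, h2⟩ := mem_mon.1 hF
      rw [Finset.mem_filter, mem_mon]
      refine ⟨⟨hQ.mul h1, ?_⟩, dvd_mul_right _ _⟩
      rw [hQ.natDegree_mul h1, h2]; omega
    · intro F _ G _ hFG
      exact mul_left_cancel₀ hQ.ne_zero hFG
    · intro F hF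
      rw [Finset.mem_filter, mem_mon] at hF
      obtain ⟨⟨h1, h2⟩, G, rfl⟩ := hF
      have h3 : G.Monic := hQ.of_mul_monic_left h1
      refine ⟨G, ?_, rfl⟩
      rw [mem_mon]
      rw [hQ.natDegree_mul h3] at h2
      exact ⟨h3, by omega⟩
    · intro F hF
      rw [lam_mul ψ f hQ (mem_mon.1 hF).1]
  · apply Finset.sum_eq_zero
    intro F hF
    obtain ⟨h1, h2⟩ := mem_mon.1 hF
    rw [if_neg]
    intro hd
    have := Polynomial.natDegree_le_of_dvd hd h1.ne_zero
    omega

/-- prime-power sums -/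
noncomputable def Sp (ψ : AddChar (ZMod p) ℂ) (f : (ZMod p)[X]) (m : ℕ) : ℂ :=
  ∑ j ∈ m.divisors, ∑ P ∈ irr p j, (j : ℂ) * lam ψ f P ^ (m / j)

lemma euler (ψ : AddChar (ZMod p) ℂ) (f : (ZMod p)[X]) (n : ℕ) :
    (n : ℂ) * Lc ψ f n = ∑ m ∈ Icc 1 n, Sp ψ f m * Lc ψ f (n - m) := by
  classical
  have h1 : (n : ℂ) * Lc ψ f n = ∑ j ∈ Icc 1 n, ∑ P ∈ irr p j, ∑ i ∈ Icc 1 n, (j : ℂ) *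
      ∑ F ∈ mon p n, (if P ^ i ∣ F then lam ψ f F else 0) := by
    calc (n : ℂ) * Lc ψ f n = ∑ F ∈ mon p n, (n : ℂ) * lam ψ f F := by rw [Lc, Finset.mul_sum]
      _ = ∑ F ∈ mon p n, ∑ j ∈ Icc 1 n, ∑ P ∈ irr p j, ∑ i ∈ Icc 1 n, (j : ℂ) * (if P ^ i ∣ F then lam ψ f F else 0) := by
          refine Finset.sum_congr rfl fun F hF => ?_
          conv_lhs => rw [deg_sum hF]
          push_cast
          rw [Finset.sum_mul]
          refine Finset.sum_congr rfl fun j _ => ?_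
          rw [Finset.sum_mul]
          refine Finset.sum_congr rfl fun P _ => ?_
          rw [Finset.sum_mul]
          refine Finset.sum_congr rfl fun i _ => ?_
          split_ifs <;> simp
      _ = _ := by
          rw [Finset.sum_comm]
          refine Finset.sum_congr rfl fun j _ => ?_
          rw [Finset.sum_comm]
          refine Finset.sum_congr rfl fun P _ => ?_
          rw [Finset.sum_comm]
          refine Finset.sum_congr rfl fun i _ => ?_
          rw [Finset.mul_sum]
  rw [h1]
  have h2 : ∀ j ∈ Icc 1 n, ∀ P ∈ irr p j, (∑ i ∈ Icc 1 n, (j : ℂ) *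
      ∑ F ∈ mon p n, (if P ^ i ∣ F then lam ψ f F else 0)) =
      ∑ m ∈ Icc 1 n, if j ∣ m then (j : ℂ) * lam ψ f P ^ (m / j) * Lc ψ f (n - m) else 0 := by
    intro j hj P hP
    obtain ⟨hP1, hP2, hP3⟩ := mem_irr.1 hP
    have hj0 : 1 ≤ j := (Finset.mem_Icc.1 hj).1
    have h3 : ∀ i ∈ Icc 1 n, (j : ℂ) * ∑ F ∈ mon p n, (if P ^ i ∣ F then lam ψ f F else 0) =
        if i * j ≤ n then (j : ℂ) * lam ψ f P ^ i * Lc ψ f (n - i * j) else 0 := by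
      intro i _
      rw [sum_dvd ψ f n (hP1.pow i), hP1.natDegree_pow, hP2, lam_pow ψ f hP1]
      split_ifs <;> ring
    rw [Finset.sum_congr rfl h3, ← Finset.sum_filter, ← Finset.sum_filter]
    refine Finset.sum_bij (fun i _ => i * j) ?_ ?_ ?_ ?_
    · intro i hi
      rw [Finset.mem_filter, Finset.mem_Icc] at hi ⊢
      exact ⟨⟨Nat.mul_pos (by omega) (by omega), hi.2⟩, dvd_mul_left _ _⟩
    · intro a _ b _ hab
      exact Nat.eq_of_mul_eq_mul_right (by omega) hab
    · intro m hm
      rw [Finset.mem_filter, Finset.mem_Icc] at hm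
      obtain ⟨⟨hm1, hm2⟩, c, rfl⟩ := hm
      refine ⟨c, ?_, mul_comm _ _⟩
      rw [Finset.mem_filter, Finset.mem_Icc]
      refine ⟨⟨?_, ?_⟩, by rw [mul_comm]; exact hm2⟩
      · exact Nat.pos_of_ne_zero (by rintro rfl; simp at hm1)
      · nlinarith
    · intro i _
      rw [Nat.mul_div_cancel _ (by omega)]
  rw [Finset.sum_congr rfl fun j hj => Finset.sum_congr rfl (h2 j hj)]
  rw [Finset.sum_congr rfl fun j hj => Finset.sum_comm, Finset.sum_comm]
  refine Finset.sum_congr rfl fun m hm => ?_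
  rw [Finset.mem_Icc] at hm
  have hdiv : m.divisors = (Icc 1 n).filter (fun j => j ∣ m) := by
    ext j
    rw [Nat.mem_divisors, Finset.mem_filter, Finset.mem_Icc]
    constructor
    · rintro ⟨h3, _⟩
      have := Nat.le_of_dvd (by omega) h3
      exact ⟨⟨Nat.pos_of_dvd_of_pos h3 (by omega), by omega⟩, h3⟩
    · rintro ⟨_, h3⟩
      exact ⟨h3, by omega⟩
  rw [Sp, hdiv, Finset.sum_mul, Finset.sum_filter]
  refine Finset.sum_congr rfl fun j _ => ?_
  split_ifs with h3
  · rw [Finset.sum_mul]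
  · simp

end weil
end FS

namespace FS
open Finset
section ps
open Polynomial

lemma psm_X_sub_C {K : Type} [Field K] (a : K) (m : ℕ) (hm : 1 ≤ m) : psm m (X - C a) = a ^ m := by
  have hrev : (X - C a : K[X]).reverse = 1 - C a * X := by
    ext i
    rw [coeff_reverse, natDegree_X_sub_C]
    rcases i with _ | _ | i
    · simp [revAt_le]
    · simp [revAt_le, coeff_one]
    · rw [revAt_eq_self_of_lt (by omega)]
      simp [coeff_X, coeff_one, coeff_C]
  have h : ld (((1 - C a * X : K[X])) : PowerSeries K) = PowerSeries.mk (fun m => if m = 0 then 0 else - a ^ m) := by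
    symm
    apply ld_unique
    · simp
    · have h2 : (((1 - C a * X : K[X])) : PowerSeries K) = 1 - PowerSeries.C a * PowerSeries.X := by simp
      rw [h2]
      ext n
      rw [mul_sub, mul_one, mul_left_comm, map_sub, PowerSeries.coeff_C_mul, map_sub, Derivation.map_one_eq_zero,
        zero_sub, Derivation.leibniz]
      rcases n with _ | n
      · simp
      · rw [PowerSeries.coeff_succ_mul_X, PowerSeries.coeff_succ_X_mul, PowerSeries.coeff_mk, PowerSeries.coeff_mk]
        rcases n with _ | n
        · simp
        · simp [PowerSeries.coeff_C, pow_succ']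
  rw [psm, hrev, h, PowerSeries.coeff_mk, if_neg (by omega), neg_neg]

lemma psm_prod {K : Type} [Field K] (s : Multiset K) (m : ℕ) (hm : 1 ≤ m) :
    psm m (s.map fun a => X - C a).prod = (s.map fun a => a ^ m).sum := by
  induction s using Multiset.induction_on with
  | empty => simp [psm_one]
  | cons a s ih =>
    rw [Multiset.map_cons, Multiset.prod_cons, psm_mul _ (monic_X_sub_C a), psm_X_sub_C a m hm, ih, Multiset.map_cons,
      Multiset.sum_cons]
    exact monic_multiset_prod_of_monic _ _ fun b _ => monic_X_sub_C b

lemma psm_map {K E : Type} [Field K] [Field E] (φ : K →+* E) (F : K[X]) (hF : F.Monic) (m : ℕ) :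
    psm m (F.map φ) = φ (psm m F) := by
  have hrev : (F.map φ).reverse = F.reverse.map φ := by
    ext i
    rw [coeff_reverse, coeff_map, coeff_map, coeff_reverse, natDegree_map]
  unfold psm
  rw [hrev, map_neg, Polynomial.polynomial_map_coe]
  congr 1
  have h1 := ld_mul_self ((F.reverse : K[X]) : PowerSeries K) (by rw [rev_const hF]; exact one_ne_zero)
  have h2 : PowerSeries.map φ (ld ((F.reverse : K[X]) : PowerSeries K)) =
      ld (PowerSeries.map φ ((F.reverse : K[X]) : PowerSeries K)) := by
    apply ld_unique
    · rw [← PowerSeries.coeff_zero_eq_constantCoeff_apply, PowerSeries.coeff_map,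
        PowerSeries.coeff_zero_eq_constantCoeff_apply, rev_const hF, map_one]; exact one_ne_zero
    · rw [← map_mul, h1, map_mul, PowerSeries.map_X]
      congr 1
      ext n
      simp [PowerSeries.coeff_derivative]
  rw [← h2, PowerSeries.coeff_map]

lemma psm_roots {K E : Type} [Field K] [Field E] [Algebra K E] (F : K[X]) (hF : F.Monic)
    (hs : (F.map (algebraMap K E)).Splits) (m : ℕ) (hm : 1 ≤ m) :
    algebraMap K E (psm m F) = ((F.aroots E).map fun a => a ^ m).sum := by
  rw [← psm_map _ _ hF, hs.eq_prod_roots_of_monic (hF.map _), psm_prod _ _ hm]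

lemma trace_pb {K L : Type} [Field K] [Field L] [Algebra K L] [FiniteDimensional K L] [PerfectField K]
    (pb : PowerBasis K L) (m : ℕ) (hm : 1 ≤ m) :
    Algebra.trace K L (pb.gen ^ m) = psm m (minpoly K pb.gen) := by
  classical
  apply (algebraMap K (AlgebraicClosure K)).injective
  rw [psm_roots _ (minpoly.monic (Algebra.IsIntegral.isIntegral _)) (IsAlgClosed.splits _) m hm,
    trace_eq_sum_embeddings (AlgebraicClosure K)]
  rw [Fintype.sum_equiv pb.liftEquiv' (fun σ : L →ₐ[K] AlgebraicClosure K => σ (pb.gen ^ m))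
    (fun y => (y : AlgebraicClosure K) ^ m),
    Finset.sum_mem_multiset _ (fun y => (y : AlgebraicClosure K) ^ m) (fun y => y ^ m) (fun _ => rfl),
    Finset.sum_eq_multiset_sum, Multiset.toFinset_val, Multiset.dedup_eq_self.mpr _]
  · exact nodup_roots ((separable_map _).mpr (Algebra.IsSeparable.isSeparable K _))
  · intro σ
    rw [PowerBasis.liftEquiv'_apply_coe, map_pow]

lemma trace_elt {K L : Type} [Field K] [Field L] [Algebra K L] [FiniteDimensional K L] [PerfectField K]
    (x : L) (m : ℕ) (hm : 1 ≤ m) :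
    Algebra.trace K L (x ^ m) = (Module.finrank K L / (minpoly K x).natDegree) • psm m (minpoly K x) := by
  have hx : IsIntegral K x := Algebra.IsIntegral.isIntegral x
  have h1 := trace_pb (IntermediateField.adjoin.powerBasis hx) m hm
  rw [IntermediateField.adjoin.powerBasis_gen, IntermediateField.minpoly_gen] at h1
  rw [← h1, ← Algebra.trace_trace (S := IntermediateField.adjoin K {x})]
  conv in x ^ m => rw [← IntermediateField.AdjoinSimple.algebraMap_gen K x]
  rw [← map_pow, Algebra.trace_algebraMap, LinearMap.map_smul_of_tower]
  congr 1
  rw [← IntermediateField.adjoin.finrank hx]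
  have := Module.finrank_mul_finrank K (IntermediateField.adjoin K {x}) L
  rw [← this, Nat.mul_div_cancel_left _ Module.finrank_pos]

end ps

section weil
variable {p : ℕ} [Fact p.Prime]
open Polynomial

open Classical in
lemma card_minpoly (K : Type) [Field K] [Fintype K] [Algebra (ZMod p) K] (j : ℕ) (hj : 0 < j)
    (hK : Fintype.card K = p ^ j) (e : ℕ) (he : e ∣ j) (P : (ZMod p)[X]) (hP : P ∈ irr p e) :
    (univ.filter fun x : K => minpoly (ZMod p) x = P).card = e := by
  obtain ⟨h1, h2, h3⟩ := mem_irr.1 hP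
  have hdvd : P ∣ X ^ (Nat.card (ZMod p)) ^ j - X := by
    rw [← h3.natDegree_dvd_iff_dvd_X_pow_card_pow_sub_X, h2]; exact he
  rw [Nat.card_zmod, ← hK] at hdvd
  have hsplit : (P.map (algebraMap (ZMod p) K)).Splits := by
    have h4 := FiniteField.splits_X_pow_card_sub_X (K := K) p
    rw [Polynomial.map_sub, Polynomial.map_pow, map_X] at h4
    have h5 := Polynomial.map_dvd (algebraMap (ZMod p) K) hdvd
    rw [Polynomial.map_sub, Polynomial.map_pow, map_X] at h5
    exact h4.of_dvd (FiniteField.X_pow_card_sub_X_ne_zero K Fintype.one_lt_card) h5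
  have hsep : P.Separable := PerfectField.separable_of_irreducible h3
  have hc := Polynomial.card_rootSet_eq_natDegree hsep hsplit
  rw [← h2, ← hc, ← Set.toFinset_card]
  congr 1
  ext x
  rw [Finset.mem_filter, Set.mem_toFinset, mem_rootSet]
  constructor
  · rintro ⟨-, rfl⟩
    exact ⟨h1.ne_zero, minpoly.aeval _ _⟩
  · rintro ⟨-, h⟩
    exact ⟨mem_univ _, (minpoly.eq_of_irreducible_of_monic h3 h h1).symm⟩

lemma trace_f (K : Type) [Field K] [Fintype K] [Algebra (ZMod p) K] (f : (ZMod p)[X]) (hf0 : f.coeff 0 = 0) (x : K) :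
    Algebra.trace (ZMod p) K (aeval x f) =
      (Module.finrank (ZMod p) K / (minpoly (ZMod p) x).natDegree) • ssm f (minpoly (ZMod p) x) := by
  rw [aeval_eq_sum_range, Finset.sum_range_succ', hf0, zero_smul, add_zero, map_sum, ssm, Finset.smul_sum]
  have : Icc 1 f.natDegree = (range f.natDegree).image Nat.succ := by
    ext i; simp only [mem_Icc, mem_image, mem_range]
    constructor
    · rintro ⟨h1, h2⟩; exact ⟨i - 1, by omega, by omega⟩
    · rintro ⟨a, h1, rfl⟩; omega
  rw [this, Finset.sum_image (fun a _ b _ h => Nat.succ_injective h)]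
  refine Finset.sum_congr rfl fun i _ => ?_
  rw [LinearMap.map_smul, trace_elt x (i + 1) (by omega), smul_eq_mul, mul_smul_comm]

lemma Sp_eq (ψ : AddChar (ZMod p) ℂ) (K : Type) [Field K] [Fintype K] [Algebra (ZMod p) K] (j : ℕ) (hj : 0 < j)
    (hK : Fintype.card K = p ^ j) (f : (ZMod p)[X]) (hf0 : f.coeff 0 = 0) :
    Sp ψ f j = ∑ x : K, ψ (Algebra.trace (ZMod p) K (aeval x f)) := by
  classical
  have hfr : Module.finrank (ZMod p) K = j := by
    have := Module.card_eq_pow_finrank (K := ZMod p) (V := K)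
    rw [hK, ZMod.card] at this
    exact (Nat.pow_right_injective (Fact.out : p.Prime).two_le this).symm
  have hdisj : ((j.divisors : Finset ℕ) : Set ℕ).PairwiseDisjoint (fun j => irr p j) := by
    intro a _ b _ hab
    rw [Function.onFun, Finset.disjoint_left]
    intro P h1 h2
    exact hab ((mem_irr.1 h1).2.1.symm.trans (mem_irr.1 h2).2.1)
  have hmaps : ∀ x ∈ (univ : Finset K), minpoly (ZMod p) x ∈ j.divisors.biUnion (fun j => irr p j) := by
    intro x _
    have hx : IsIntegral (ZMod p) x := Algebra.IsIntegral.isIntegral x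
    rw [Finset.mem_biUnion]
    refine ⟨(minpoly (ZMod p) x).natDegree, ?_, mem_irr.2 ⟨minpoly.monic hx, rfl, minpoly.irreducible hx⟩⟩
    rw [Nat.mem_divisors]
    refine ⟨?_, hj.ne'⟩
    rw [← hfr, ← IntermediateField.adjoin.finrank hx]
    exact Dvd.intro _ (Module.finrank_mul_finrank _ _ _)
  rw [← Finset.sum_fiberwise_of_maps_to hmaps, Finset.sum_biUnion hdisj, Sp]
  refine Finset.sum_congr rfl fun e he => Finset.sum_congr rfl fun P hP => ?_
  have h1 : ∀ x ∈ univ.filter (fun x : K => minpoly (ZMod p) x = P),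
      ψ (Algebra.trace (ZMod p) K (aeval x f)) = lam ψ f P ^ (j / e) := by
    intro x hx
    rw [Finset.mem_filter] at hx
    rw [trace_f K f hf0 x, hx.2, hfr, (mem_irr.1 hP).2.1, AddChar.map_nsmul_eq_pow]
    rfl
  rw [Finset.sum_congr rfl h1, Finset.sum_const, card_minpoly K j hj hK e (Nat.dvd_of_mem_divisors he) P hP,
    nsmul_eq_mul]

end weil
end FS

namespace FS
open Finset
section rad
open Polynomial

lemma power_sum_radius (s : Multiset ℂ) (B C : ℝ) (hB : 0 < B) (n0 : ℕ)
    (h : ∀ n ≥ n0, ‖(s.map fun v => v ^ n).sum‖ ≤ C * B ^ n) : ∀ v ∈ s, ‖v‖ ≤ B := by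
  classical
  intro v hv
  by_contra hcon
  push Not at hcon
  set Q : ℂ[X] := ∏ l ∈ s.toFinset.erase v, (X - Polynomial.C l) with hQ
  have hQl : ∀ l ∈ s.toFinset, l ≠ v → Q.eval l = 0 := by
    intro l hl hne
    rw [hQ, eval_prod]
    exact Finset.prod_eq_zero (Finset.mem_erase.2 ⟨hne, hl⟩) (by simp)
  have hQv : Q.eval v ≠ 0 := by
    rw [hQ, eval_prod, Finset.prod_ne_zero_iff]
    intro l hl
    have := (Finset.mem_erase.1 hl).1
    simp only [eval_sub, eval_X, eval_C]
    exact sub_ne_zero.2 this.symm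
  have hid : ∀ n, ∑ t ∈ range (Q.natDegree + 1), Q.coeff t * (s.map fun v => v ^ (n + t)).sum =
      (s.count v : ℂ) * v ^ n * Q.eval v := by
    intro n
    have h1 : ∀ t, (s.map fun v => v ^ (n + t)).sum = ∑ l ∈ s.toFinset, (s.count l : ℂ) * l ^ (n + t) := by
      intro t
      rw [Finset.sum_multiset_map_count]
      simp
    simp_rw [h1, Finset.mul_sum]
    rw [Finset.sum_comm, Finset.sum_eq_single v]
    · rw [eval_eq_sum_range, Finset.mul_sum]
      refine Finset.sum_congr rfl fun t _ => ?_
      rw [pow_add]; ring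
    · intro l hl hne
      have := hQl l hl hne
      rw [eval_eq_sum_range] at this
      calc _ = (s.count l : ℂ) * l ^ n * ∑ i ∈ range (Q.natDegree + 1), Q.coeff i * l ^ i := by
            rw [Finset.mul_sum]
            refine Finset.sum_congr rfl fun t _ => ?_
            rw [pow_add]; ring
        _ = 0 := by rw [this, mul_zero]
    · intro hv'
      exact absurd (Multiset.mem_toFinset.2 hv) hv'
  set C' : ℝ := ∑ t ∈ range (Q.natDegree + 1), ‖Q.coeff t‖ * (C * B ^ t) with hC'
  have hbound : ∀ n ≥ n0, ‖v‖ ^ n * ‖Q.eval v‖ ≤ C' * B ^ n := by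
    intro n hn
    have h1 : ‖(s.count v : ℂ) * v ^ n * Q.eval v‖ ≤ C' * B ^ n := by
      rw [← hid n, hC', Finset.sum_mul]
      refine (norm_sum_le _ _).trans (Finset.sum_le_sum fun t _ => ?_)
      rw [norm_mul, mul_assoc]
      refine mul_le_mul_of_nonneg_left ?_ (norm_nonneg _)
      refine (h (n + t) (by omega)).trans (le_of_eq ?_)
      rw [pow_add]; ring
    rw [norm_mul, norm_mul, norm_pow] at h1
    have h2 : (1 : ℝ) ≤ ‖(s.count v : ℂ)‖ := by
      rw [Complex.norm_natCast]
      exact_mod_cast Multiset.one_le_count_iff_mem.2 hv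
    refine le_trans ?_ h1
    have : 0 ≤ ‖v‖ ^ n * ‖Q.eval v‖ := by positivity
    nlinarith
  have hr : 1 < ‖v‖ / B := by rw [lt_div_iff₀ hB]; linarith
  have hq : 0 < ‖Q.eval v‖ := norm_pos_iff.2 hQv
  obtain ⟨n1, hn1⟩ := pow_unbounded_of_one_lt (C' / ‖Q.eval v‖) hr
  have h3 : (‖v‖ / B) ^ n1 ≤ (‖v‖ / B) ^ (max n0 n1) := pow_le_pow_right₀ hr.le (le_max_right _ _)
  have h4 := hbound (max n0 n1) (le_max_left _ _)
  have h5 : (‖v‖ / B) ^ (max n0 n1) ≤ C' / ‖Q.eval v‖ := by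
    rw [div_pow, div_le_div_iff₀ (by positivity) hq]
    exact h4
  linarith
end rad

section weil
variable {p : ℕ} [Fact p.Prime]
open Polynomial

lemma Sp_roots (ψ : AddChar (ZMod p) ℂ) (hψ : ψ ≠ 1) (f : (ZMod p)[X]) (hf : 1 ≤ f.natDegree)
    (hfp : f.natDegree < p) : ∃ s : Multiset ℂ, s.card ≤ f.natDegree ∧
      ∀ m, 1 ≤ m → Sp ψ f m = - (s.map fun v => v ^ m).sum := by
  set d := f.natDegree with hd
  set L : ℂ[X] := ∑ n ∈ range d, Polynomial.C (Lc ψ f n) * X ^ n with hL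
  have hLc : ∀ n, L.coeff n = Lc ψ f n := by
    intro n
    rw [hL, finset_sum_coeff]
    simp only [coeff_C_mul_X_pow]
    rw [Finset.sum_ite_eq]
    split_ifs with h
    · rfl
    · rw [Lc_vanish ψ hψ f hf hfp n (by simpa using h)]
  have hL0 : L.coeff 0 = 1 := by rw [hLc, Lc_zero]
  have hLne : L.coeff 0 ≠ 0 := by rw [hL0]; exact one_ne_zero
  have hrev : L.reverse.reverse = L := by
    ext i
    rw [coeff_reverse, coeff_reverse, reverse_natDegree, natTrailingDegree_eq_zero_of_constantCoeff_ne_zero, Nat.sub_zero, revAt_invol]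
    exact hLne
  have hmonic : L.reverse.Monic := by
    rw [Monic, reverse_leadingCoeff, trailingCoeff, natTrailingDegree_eq_zero_of_constantCoeff_ne_zero, hL0]
    exact hLne
  have hS : PowerSeries.mk (fun m => if m = 0 then 0 else Sp ψ f m) = ld ((L : ℂ[X]) : PowerSeries ℂ) := by
    apply ld_unique
    · rw [← PowerSeries.coeff_zero_eq_constantCoeff_apply, Polynomial.coeff_coe, hL0]; exact one_ne_zero
    · ext n
      rw [PowerSeries.coeff_mul, Finset.Nat.sum_antidiagonal_eq_sum_range_succ_mk, Finset.sum_range_succ']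
      simp only [PowerSeries.coeff_mk, Polynomial.coeff_coe, hLc]
      simp only [if_pos, zero_mul, add_zero, Nat.add_eq_zero_iff, one_ne_zero, and_false, if_false]
      have he := euler ψ f n
      have : Icc 1 n = (range n).image Nat.succ := by
        ext i; simp only [mem_Icc, mem_image, mem_range]
        constructor
        · rintro ⟨h1, h2⟩; exact ⟨i - 1, by omega, by omega⟩
        · rintro ⟨a, h1, rfl⟩; omega
      rw [this, Finset.sum_image (fun a _ b _ h => Nat.succ_injective h)] at he
      simp only [Nat.succ_eq_add_one] at he
      rw [← he]
      rcases n with _ | n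
      · simp
      · rw [PowerSeries.coeff_succ_X_mul, PowerSeries.coeff_derivative, Polynomial.coeff_coe, hLc]
        push_cast; ring
  refine ⟨L.reverse.roots, ?_, ?_⟩
  · refine (card_roots' _).trans ((reverse_natDegree_le _).trans ?_)
    rw [hL]
    refine natDegree_sum_le_of_forall_le _ _ fun i hi => ?_
    exact (natDegree_C_mul_X_pow_le _ _).trans (Finset.mem_range.1 hi).le
  · intro m hm
    have h1 := psm_roots (E := ℂ) L.reverse hmonic (IsAlgClosed.splits _) m hm
    rw [Algebra.algebraMap_self, RingHom.id_apply, aroots, Algebra.algebraMap_self, Polynomial.map_id] at h1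
    rw [← h1, psm, hrev, ← hS, PowerSeries.coeff_mk, if_neg (by omega), neg_neg]

lemma weil_of_even (ψ : AddChar (ZMod p) ℂ) (hψ : ψ ≠ 1) (f : (ZMod p)[X]) (hf : 1 ≤ f.natDegree)
    (hfp : f.natDegree < p) (C : ℝ) (n0 : ℕ) (h : ∀ n ≥ n0, ‖Sp ψ f (2 * n)‖ ≤ C * (p : ℝ) ^ n) :
    ‖Sp ψ f 1‖ ≤ f.natDegree * Real.sqrt p := by
  obtain ⟨s, hs, hsp⟩ := Sp_roots ψ hψ f hf hfp
  have hp : (0 : ℝ) < p := by exact_mod_cast (Fact.out : p.Prime).pos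
  have h1 := power_sum_radius (s.map fun v => v ^ 2) p C hp (max n0 1) (by
    intro n hn
    rw [Multiset.map_map]
    have := h n ((le_max_left _ _).trans hn)
    rw [hsp (2 * n) (by have := (le_max_right n0 1).trans hn; omega), norm_neg] at this
    simpa [pow_mul] using this)
  have h2 : ∀ v ∈ s, ‖v‖ ≤ Real.sqrt p := by
    intro v hv
    have := h1 (v ^ 2) (Multiset.mem_map_of_mem _ hv)
    rw [norm_pow] at this
    exact Real.le_sqrt_of_sq_le this
  rw [hsp 1 le_rfl, norm_neg]
  simp only [pow_one, Multiset.map_id']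
  have h3 : ‖s.sum‖ ≤ s.card * Real.sqrt p := by
    clear hs hsp h1
    induction s using Multiset.induction_on with
    | empty => simp
    | cons a s ih =>
      rw [Multiset.sum_cons, Multiset.card_cons]
      have := ih (fun v hv => h2 v (Multiset.mem_cons_of_mem hv))
      have h4 := h2 a (Multiset.mem_cons_self a s)
      have h5 := norm_add_le a s.sum
      push_cast; linarith
  refine h3.trans (mul_le_mul_of_nonneg_right (by exact_mod_cast hs) (Real.sqrt_nonneg _))

end weil
end FS

namespace FS
open Finset
section stepanov
open Polynomial

lemma exists_combo {K : Type} [Field K] (ι : Type) [Fintype ι] (N : ℕ) (w : ι → K[X])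
    (hw : ∀ i, w i ∈ degreeLT K N) (hN : N < Fintype.card ι) :
    ∃ r : ι → K, r ≠ 0 ∧ ∑ i, C (r i) * w i = 0 := by
  let φ : (ι → K) →ₗ[K] degreeLT K N := 
    Fintype.linearCombination K (fun i => (⟨w i, hw i⟩ : degreeLT K N))
  have hfr : Module.finrank K (degreeLT K N) < Module.finrank K (ι → K) := by
    rw [LinearEquiv.finrank_eq (degreeLTEquiv K N)]
    simpa using hN
  have : Module.Finite K (degreeLT K N) := Module.Finite.equiv (degreeLTEquiv K N).symm
  have hker := LinearMap.ker_ne_bot_of_finrank_lt (f := φ) hfr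
  obtain ⟨r, hr, hr0⟩ := (Submodule.ne_bot_iff _).1 hker
  refine ⟨r, hr0, ?_⟩
  rw [LinearMap.mem_ker] at hr
  have h2 := congrArg (Subtype.val) hr
  simpa [φ, Fintype.linearCombination_apply, Polynomial.smul_eq_C_mul] using h2

lemma combo_ne_zero {K : Type} [Field K] (ι : Type) [Fintype ι] (v : ι → K[X]) (hv0 : ∀ i, v i ≠ 0)
    (hv : Function.Injective fun i => (v i).natDegree) (r : ι → K) (hr : r ≠ 0) :
    ∑ i, C (r i) * v i ≠ 0 := by
  classical
  intro h
  obtain ⟨i0, hi0⟩ := Function.ne_iff.1 hr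
  obtain ⟨i, hi, hmax⟩ := Finset.exists_max_image (univ.filter fun i => r i ≠ 0) (fun i => (v i).natDegree)
    ⟨i0, by simpa using hi0⟩
  rw [Finset.mem_filter] at hi
  have h1 : (∑ j, C (r j) * v j).coeff (v i).natDegree = r i * (v i).leadingCoeff := by
    rw [finsetSum_coeff, Finset.sum_eq_single i]
    · rw [coeff_C_mul]; rfl
    · intro j _ hj
      rw [coeff_C_mul]
      by_cases hrj : r j = 0
      · rw [hrj, zero_mul]
      · have h2 := hmax j (by simpa using hrj)
        have h3 : (v j).natDegree ≠ (v i).natDegree := fun h => hj (hv h)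
        rw [coeff_eq_zero_of_natDegree_lt (lt_of_le_of_ne h2 h3), mul_zero]
    · intro h; exact absurd (mem_univ _) h
  rw [h, coeff_zero] at h1
  exact mul_ne_zero hi.2 (leadingCoeff_ne_zero.2 (hv0 i)) h1.symm

variable {p : ℕ} [Fact p.Prime]

lemma stepanov (K : Type) [Field K] [Fintype K] [DecidableEq K] [CharP K p] (n : ℕ) (hK : Fintype.card K = p ^ (2 * (n + 1)))
    (F : K[X]) (hF : 1 ≤ F.natDegree) (hFp : F.natDegree < p) :
    (univ.filter fun x : K => ∑ i ∈ range (2 * (n + 1)), (F.eval x) ^ p ^ i = 0).card ≤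
      p ^ (n + 1) * p ^ n + p ^ (n + 1) * (2 * F.natDegree + 4) := by
  set d := F.natDegree with hd
  set P := p ^ (n + 1) with hP
  have hp := (Fact.out : p.Prime)
  have hp2 := hp.two_le
  have hPp : P = p * p ^ n := by rw [hP, pow_succ']
  have hpn : 0 < p ^ n := pow_pos hp.pos n
  set T : K[X] := ∑ i ∈ range (n + 1), F ^ p ^ i with hT
  have hTdeg : T.natDegree = d * p ^ n := by
    rw [hT, Finset.sum_range_succ, natDegree_add_eq_right_of_natDegree_lt, natDegree_pow, mul_comm]
    rw [natDegree_pow]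
    refine lt_of_le_of_lt (natDegree_sum_le_of_forall_le (n := p ^ n * d - 1) _ _ ?_) ?_
    · intro i hi
      rw [natDegree_pow]
      have : p ^ i < p ^ n := Nat.pow_lt_pow_right hp.one_lt (Finset.mem_range.1 hi)
      have : p ^ i * d < p ^ n * d := Nat.mul_lt_mul_of_pos_right this hF
      show p ^ i * d ≤ _
      omega
    · have : 0 < p ^ n * d := Nat.mul_pos hpn hF
      show p ^ n * d - 1 < p ^ n * d
      omega
  have hT0 : T ≠ 0 := by
    intro h
    rw [h, natDegree_zero] at hTdeg
    have : 0 < d * p ^ n := Nat.mul_pos hF hpn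
    omega
  have hfrob : ∀ x y : K, (x + y) ^ P = x ^ P + y ^ P := fun x y => by
    rw [hP]; exact add_pow_char_pow x y p (n + 1)
  have hqP : ∀ x : K, (x ^ P) ^ P = x := by
    intro x
    rw [← pow_mul, hP, ← pow_add, ← two_mul, ← hK, FiniteField.pow_card]
  -- index set
  let ι := Fin (p ^ n) × Fin (p ^ n + d + 3) × Fin p
  let w : ι → K[X] := fun i => X ^ (P * i.1.val + i.2.1.val) * (-T) ^ (i.2.2.val)
  have hwdeg : ∀ i, (w i).natDegree = P * i.1.val + i.2.1.val + i.2.2.val * (d * p ^ n) := by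
    intro i
    simp only [w]
    rw [natDegree_mul (pow_ne_zero _ X_ne_zero) (pow_ne_zero _ (neg_ne_zero.2 hT0)), natDegree_X_pow, natDegree_pow,
      natDegree_neg, hTdeg]
  have hw0 : ∀ i, w i ≠ 0 := fun i => mul_ne_zero (pow_ne_zero _ X_ne_zero) (pow_ne_zero _ (neg_ne_zero.2 hT0))
  obtain ⟨r', hr'0, hr'⟩ := exists_combo ι (P * p ^ n + (p ^ n + d + 3) + d * P) w (by
    intro i
    rw [mem_degreeLT, degree_eq_natDegree (hw0 i), hwdeg]
    have h1 : i.1.val < p ^ n := i.1.2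
    have h2 := i.2.1.2
    have h3 := i.2.2.2
    have h4 : P * i.1.val ≤ P * p ^ n := Nat.mul_le_mul_left _ h1.le
    have h5 : i.2.2.val * (d * p ^ n) ≤ d * P := by
      rw [hPp]
      calc i.2.2.val * (d * p ^ n) ≤ p * (d * p ^ n) := Nat.mul_le_mul_right _ h3.le
        _ = _ := by ring
    exact_mod_cast (by omega)) (by
    simp only [ι, Fintype.card_prod, Fintype.card_fin]
    have h1 : d + 1 ≤ p := hFp
    have : P * 1 ≤ P * p ^ n := Nat.mul_le_mul_left _ hpn
    have e1 : p ^ n * ((p ^ n + d + 3) * p) = P * p ^ n + P * (d + 3) := by rw [hPp]; ring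
    rw [e1]
    have e2 : p ^ n + d + 3 < 3 * P := by
      rw [hPp]; nlinarith
    nlinarith)
  let r : ι → K := fun i => r' i ^ P
  have hPpos : P ≠ 0 := by rw [hP]; exact (pow_pos hp.pos _).ne'
  have hr0 : r ≠ 0 := by
    obtain ⟨i, hi⟩ := Function.ne_iff.1 hr'0
    exact Function.ne_iff.2 ⟨i, pow_ne_zero _ hi⟩
  let v : ι → K[X] := fun i => X ^ (i.1.val + P * i.2.1.val) * T ^ (i.2.2.val)
  have hv0 : ∀ i, v i ≠ 0 := fun i => mul_ne_zero (pow_ne_zero _ X_ne_zero) (pow_ne_zero _ hT0)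
  have hvdeg : ∀ i, (v i).natDegree = i.1.val + P * i.2.1.val + i.2.2.val * (d * p ^ n) := by
    intro i
    simp only [v]
    rw [natDegree_mul (pow_ne_zero _ X_ne_zero) (pow_ne_zero _ hT0), natDegree_X_pow, natDegree_pow, hTdeg]
  have hinj : Function.Injective fun i => (v i).natDegree := by
    rintro ⟨a, b, c⟩ ⟨a', b', c'⟩ h
    simp only [hvdeg] at h
    rw [hPp] at h
    have e : ∀ a b c : ℕ, a + p * p ^ n * b + c * (d * p ^ n) = a + p ^ n * (p * b + c * d) := by intros; ring
    rw [e, e] at h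
    have h1 : a.val = a'.val := by
      have := congrArg (· % p ^ n) h
      simpa [Nat.add_mul_mod_self_left, Nat.mod_eq_of_lt a.2, Nat.mod_eq_of_lt a'.2] using this
    have h2 : p * b.val + c.val * d = p * b'.val + c'.val * d := by
      rw [h1] at h
      exact Nat.eq_of_mul_eq_mul_left hpn (by omega)
    have hcop : Nat.Coprime p d := by
      rw [hp.coprime_iff_not_dvd]
      intro hdv
      exact absurd (Nat.le_of_dvd hF hdv) (by omega)
    have h3 : c.val * d ≡ c'.val * d [MOD p] := by
      have := congrArg (· % p) h2
      simp only [Nat.mul_add_mod] at this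
      exact this
    have h4 := Nat.ModEq.cancel_right_of_coprime hcop h3
    have h5 : c.val = c'.val := Nat.ModEq.eq_of_lt_of_lt h4 c.2 c'.2
    have h6 : b.val = b'.val := by
      rw [h5] at h2
      exact Nat.eq_of_mul_eq_mul_left hp.pos (by omega)
    ext <;> simp [h1, h5, h6]
  have hG := combo_ne_zero ι v hv0 hinj r hr0
  set G := ∑ i, C (r i) * v i with hGdef
  have hGdeg : G.natDegree ≤ P * p ^ n + P * (2 * d + 4) := by
    rw [hGdef]
    refine natDegree_sum_le_of_forall_le _ _ fun i _ => ?_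
    refine (natDegree_C_mul_le _ _).trans ?_
    rw [hvdeg]
    have h1 : i.1.val < p ^ n := i.1.2
    have h2 := i.2.1.2
    have h3 := i.2.2.2
    have h4 : P * i.2.1.val ≤ P * (p ^ n + d + 3) := Nat.mul_le_mul_left _ h2.le
    have h5 : i.2.2.val * (d * p ^ n) ≤ d * P := by
      rw [hPp]
      calc i.2.2.val * (d * p ^ n) ≤ p * (d * p ^ n) := Nat.mul_le_mul_right _ h3.le
        _ = _ := by ring
    have h6 : p ^ n ≤ P := by rw [hPp]; nlinarith
    nlinarith
  have hroot : ∀ x ∈ (univ.filter fun x : K => ∑ i ∈ range (2 * (n + 1)), (F.eval x) ^ p ^ i = 0), x ∈ G.roots.toFinset := by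
    intro x hx
    rw [Finset.mem_filter] at hx
    rw [Multiset.mem_toFinset, mem_roots hG, IsRoot.def]
    have hTx : (T.eval x) ^ P = - T.eval x := by
      have h1 : T.eval x = ∑ i ∈ range (n + 1), (F.eval x) ^ p ^ i := by
        rw [hT, eval_finsetSum]; simp
      have h2 : (T.eval x) ^ P = ∑ i ∈ range (n + 1), (F.eval x) ^ p ^ (n + 1 + i) := by
        rw [h1, hP, sum_pow_char_pow]
        refine Finset.sum_congr rfl fun i _ => ?_
        rw [← pow_mul, ← pow_add, add_comm]
      have h3 := hx.2
      rw [two_mul, Finset.sum_range_add] at h3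
      rw [h2, h1]
      exact eq_neg_of_add_eq_zero_right h3
    have hsum : ∀ (s : Finset ι) (g : ι → K), (∑ i ∈ s, g i) ^ P = ∑ i ∈ s, g i ^ P := by
      intro s g
      rw [hP]; exact sum_pow_char_pow p (n + 1) s g
    have h0 : (G.eval x) ^ P = 0 := by
      rw [hGdef, eval_finsetSum, hsum]
      have := congrArg (eval x) hr'
      rw [eval_finsetSum, eval_zero] at this
      rw [← this]
      refine Finset.sum_congr rfl fun i _ => ?_
      simp only [v, w, r, eval_mul, eval_C, eval_pow, eval_X, eval_neg]
      rw [mul_pow, hqP, mul_pow, ← hTx]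
      congr 1
      rw [pow_add, mul_pow, pow_add, ← pow_mul, pow_mul x P, ← pow_mul, ← pow_mul]
      have : x ^ (P * i.2.1.val * P) = x ^ i.2.1.val := by
        rw [mul_right_comm, pow_mul, pow_mul, hqP]
      rw [← mul_assoc, this, mul_comm i.1.val P]
      congr 1
      rw [← pow_mul, ← pow_mul, mul_comm]
    exact pow_eq_zero_iff hPpos |>.1 h0
  calc _ ≤ G.roots.toFinset.card := Finset.card_le_card hroot
    _ ≤ G.roots.card := Multiset.toFinset_card_le _
    _ ≤ G.natDegree := card_roots' _
    _ ≤ _ := hGdeg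

lemma Sp_even (ψ : AddChar (ZMod p) ℂ) (hψ : ψ ≠ 1) (f : (ZMod p)[X]) (hf : 1 ≤ f.natDegree)
    (hfp : f.natDegree < p) (hf0 : f.coeff 0 = 0) (n : ℕ) :
    ‖Sp ψ f (2 * (n + 1))‖ ≤ (p * (2 * f.natDegree + 4) : ℝ) * (p : ℝ) ^ (n + 1) := by
  classical
  have hp := (Fact.out : p.Prime)
  let K := GaloisField p (2 * (n + 1))
  letI : Fintype K := Fintype.ofFinite K
  have hK : Fintype.card K = p ^ (2 * (n + 1)) := by
    rw [← Nat.card_eq_fintype_card]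
    exact GaloisField.card p (2 * (n + 1)) (by omega)
  rw [Sp_eq ψ K (2 * (n + 1)) (by omega) hK f hf0]
  let tr : K → ZMod p := fun x => Algebra.trace (ZMod p) K (aeval x f)
  let N : ZMod p → ℕ := fun a => (univ.filter fun x : K => tr x = a).card
  set B : ℕ := p ^ (n + 1) * p ^ n + p ^ (n + 1) * (2 * f.natDegree + 4) with hB
  have hN : ∀ a, N a ≤ B := by
    intro a
    obtain ⟨z, hz⟩ := Algebra.trace_surjective (ZMod p) K a
    have hdeg : (f.map (algebraMap (ZMod p) K) - C z).natDegree = f.natDegree := by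
      rw [natDegree_sub_C, natDegree_map]
    have h1 := stepanov K n hK (f.map (algebraMap (ZMod p) K) - C z) (by rw [hdeg]; exact hf) (by rw [hdeg]; exact hfp)
    rw [hdeg] at h1
    refine le_trans (Finset.card_le_card ?_) h1
    intro x hx
    rw [Finset.mem_filter] at hx ⊢
    refine ⟨mem_univ _, ?_⟩
    have h2 : eval x (f.map (algebraMap (ZMod p) K) - C z) = aeval x f - z := by
      rw [eval_sub, eval_C, eval_map_algebraMap]
    have h3 := FiniteField.algebraMap_trace_eq_sum_pow (ZMod p) K (aeval x f - z)
    have hfr : Module.finrank (ZMod p) K = 2 * (n + 1) := GaloisField.finrank p (by omega)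
    rw [Nat.card_zmod, hfr, map_sub, hz] at h3
    rw [h2, ← h3]
    have h4 : Algebra.trace (ZMod p) K (aeval x f) = a := hx.2
    rw [h4, sub_self, map_zero]
  have hsum : ∑ a, N a = p ^ (2 * (n + 1)) := by
    rw [← hK, ← Finset.card_univ]
    exact (Finset.card_eq_sum_card_fiberwise (fun x _ => mem_univ (tr x))).symm
  have h1 : ∑ x : K, ψ (Algebra.trace (ZMod p) K (aeval x f)) = ∑ a, (N a : ℂ) * ψ a := by
    rw [← Finset.sum_fiberwise_of_maps_to (g := tr) (t := univ) (fun x _ => mem_univ _)]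
    refine Finset.sum_congr rfl fun a _ => ?_
    rw [Finset.sum_congr rfl (g := fun _ => ψ a), Finset.sum_const, nsmul_eq_mul]
    intro x hx
    have : tr x = a := (Finset.mem_filter.1 hx).2
    show ψ (tr x) = ψ a
    rw [this]
  have h2 : ∑ a, (N a : ℂ) * ψ a = - ∑ a, ((B - N a : ℝ) : ℂ) * ψ a := by
    have h3 : ∑ a, ψ a = 0 := AddChar.sum_eq_zero_of_ne_one hψ
    push_cast
    simp only [sub_mul, Finset.sum_sub_distrib]
    rw [← Finset.mul_sum, h3]; ring
  rw [h1, h2, norm_neg]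
  calc ‖∑ a, ((B - N a : ℝ) : ℂ) * ψ a‖ ≤ ∑ a, (B - N a : ℝ) := by
        refine (norm_sum_le _ _).trans (Finset.sum_le_sum fun a _ => ?_)
        rw [norm_mul, AddChar.norm_apply, mul_one, Complex.norm_real, Real.norm_of_nonneg]
        have : (N a : ℝ) ≤ B := by exact_mod_cast hN a
        linarith
    _ = p * B - (p : ℝ) ^ (2 * (n + 1)) := by
        rw [Finset.sum_sub_distrib, Finset.sum_const, Finset.card_univ, ZMod.card, nsmul_eq_mul]
        congr 1
        exact_mod_cast hsum
    _ = _ := by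
        rw [hB]; push_cast
        have : (p : ℝ) ^ (2 * (n + 1)) = p ^ (n + 1) * (p * p ^ n) := by ring
        rw [this]; ring

/-- Weil bound for polynomial exponential sums over the prime field. -/
theorem weil (ψ : AddChar (ZMod p) ℂ) (hψ : ψ ≠ 1) (f : (ZMod p)[X]) (hf : 1 ≤ f.natDegree)
    (hfp : f.natDegree < p) : ‖∑ x : ZMod p, ψ (f.eval x)‖ ≤ f.natDegree * Real.sqrt p := by
  set f' := f - C (f.coeff 0) with hf'
  have hdeg : f'.natDegree = f.natDegree := natDegree_sub_C
  have h1 := weil_of_even ψ hψ f' (by rw [hdeg]; exact hf) (by rw [hdeg]; exact hfp)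
    (p * (2 * f'.natDegree + 4)) 1 (by
      intro n hn
      obtain ⟨m, rfl⟩ : ∃ m, n = m + 1 := ⟨n - 1, by omega⟩
      exact Sp_even ψ hψ f' (by rw [hdeg]; exact hf) (by rw [hdeg]; exact hfp) (by simp [hf']) m)
  rw [Sp_eq ψ (ZMod p) 1 one_pos (by simp [ZMod.card]) f' (by simp [hf']), hdeg] at h1
  refine le_trans (le_of_eq ?_) h1
  have h2 : ∀ x : ZMod p, ψ (f.eval x) = ψ (f.coeff 0) * ψ (Algebra.trace (ZMod p) (ZMod p) (aeval x f')) := by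
    intro x
    rw [Algebra.trace_self_apply, ← AddChar.map_add_eq_mul]
    congr 1
    simp [hf', aeval_def, eval₂_eq_eval_map]
  rw [Finset.sum_congr rfl fun x _ => h2 x, ← Finset.mul_sum, norm_mul, AddChar.norm_apply, one_mul]

end stepanov
end FS

namespace FS
open Finset

/-- finite set of integers inside an interval of length `l` -/
lemma card_int_interval (s : Finset ℤ) (a l : ℝ) (hl : 0 ≤ l) (h : ∀ x ∈ s, a ≤ (x : ℝ) ∧ (x : ℝ) ≤ a + l) :
    (s.card : ℝ) ≤ l + 1 := by
  have hsub : s ⊆ Finset.Icc ⌈a⌉ ⌊a + l⌋ := by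
    intro x hx
    rw [Finset.mem_Icc]
    exact ⟨Int.ceil_le.2 (h x hx).1, Int.le_floor.2 (h x hx).2⟩
  have h1 := Finset.card_le_card hsub
  rw [Int.card_Icc] at h1
  have h2 : (((⌊a + l⌋ + 1 - ⌈a⌉).toNat : ℕ) : ℝ) ≤ l + 1 := by
    rcases le_or_gt 0 (⌊a + l⌋ + 1 - ⌈a⌉) with h0 | h0
    · have h3 : (((⌊a + l⌋ + 1 - ⌈a⌉).toNat : ℕ) : ℝ) = ((⌊a + l⌋ + 1 - ⌈a⌉ : ℤ) : ℝ) := by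
        exact_mod_cast congrArg (Int.cast (R := ℝ)) (Int.toNat_of_nonneg h0)
      rw [h3]; push_cast
      have := Int.floor_le (a + l)
      have := Int.le_ceil a
      linarith
    · rw [Int.toNat_of_nonpos h0.le]; simp; linarith
  exact le_trans (by exact_mod_cast h1) h2

lemma card_nat_interval (s : Finset ℕ) (a l : ℝ) (hl : 0 ≤ l) (h : ∀ x ∈ s, a ≤ (x : ℝ) ∧ (x : ℝ) ≤ a + l) :
    (s.card : ℝ) ≤ l + 1 := by
  have := card_int_interval (s.map Nat.castEmbedding) a l hl (by
    intro x hx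
    rw [Finset.mem_map] at hx
    obtain ⟨n, hn, rfl⟩ := hx
    simpa using h n hn)
  simpa using this

set_option maxHeartbeats 2000000 in
lemma near_multiples (N : ℕ) (c η δ : ℝ) (hδ : 0 < δ) (hδ1 : δ ≤ 1) (hη : 0 < η) (hηδ : η ≤ δ / 32)
    (H : Finset ℕ) (hH : H ⊆ range N) (hHN : δ * N ≤ H.card) (hN : 32 ≤ δ ^ 2 * N)
    (hb : ∀ h ∈ H, ∃ b : ℤ, |h * c - b| ≤ η) :
    ∃ t : ℕ, 1 ≤ t ∧ (t : ℝ) ≤ 2 / δ ∧ ∃ b : ℤ, |t * c - b| ≤ 8 * η * t / (δ * N) := by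
  classical
  choose! b hb using hb
  have hNpos : (0 : ℝ) < N := by
    by_contra h0
    have : (N : ℝ) ≤ 0 := not_lt.1 h0
    nlinarith [sq_nonneg δ]
  have hδN : 32 ≤ δ * N := by nlinarith
  -- gap
  obtain ⟨t, ht1, ht2, bt, hbt⟩ : ∃ t : ℕ, 1 ≤ t ∧ (t : ℝ) ≤ 2 / δ ∧ ∃ b : ℤ, |t * c - b| ≤ 2 * η := by
    set g := ⌈2 / δ⌉₊ with hg
    have hg0 : 0 < g := Nat.ceil_pos.2 (by positivity)
    have hg1 : 2 / δ ≤ g := Nat.le_ceil _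
    have hmap : ∀ h ∈ H, h / g ∈ range (N / g + 1) := by
      intro h hh
      rw [Finset.mem_range]
      have := Finset.mem_range.1 (hH hh)
      have := Nat.div_le_div_right (c := g) this.le
      omega
    have hcard : (range (N / g + 1)).card < H.card := by
      rw [Finset.card_range]
      have h1 : ((N / g : ℕ) : ℝ) ≤ (N : ℝ) / g := Nat.cast_div_le
      have h2 : (N : ℝ) / g ≤ δ * N / 2 := by
        rw [div_le_iff₀ (by exact_mod_cast hg0)]
        rw [div_le_iff₀ hδ] at hg1
        nlinarith
      have : ((N / g + 1 : ℕ) : ℝ) < H.card := by push_cast; linarith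
      exact_mod_cast this
    obtain ⟨x, hx, y, hy, hxy, hdiv⟩ := Finset.exists_ne_map_eq_of_card_lt_of_maps_to hcard hmap
    have key : ∀ x ∈ H, ∀ y ∈ H, x < y → x / g = y / g → ∃ t : ℕ, 1 ≤ t ∧ (t : ℝ) ≤ 2 / δ ∧ ∃ b : ℤ, |t * c - b| ≤ 2 * η := by
      intro x hx y hy hlt he
      have h1 : y - x < g := by
        have e1 := Nat.div_add_mod x g
        have e2 := Nat.div_add_mod y g
        have e3 := Nat.mod_lt y hg0
        rw [he] at e1
        omega
      refine ⟨y - x, by omega, (Nat.lt_ceil.1 h1).le, b y - b x, ?_⟩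
      have h2 := hb x hx
      have h3 := hb y hy
      rw [Nat.cast_sub hlt.le]
      push_cast
      rw [abs_le] at h2 h3 ⊢
      constructor <;> nlinarith [h2.1, h2.2, h3.1, h3.2]
    rcases lt_or_gt_of_ne hxy with h | h
    · exact key x hx y hy h hdiv
    · exact key y hy x hx h hdiv.symm
  refine ⟨t, ht1, ht2, bt, ?_⟩
  by_contra hcon
  push Not at hcon
  have ht0 : (0 : ℝ) < t := by exact_mod_cast ht1
  set κ := t * c - bt with hκ
  have hκ0 : 0 < |κ| := lt_trans (by positivity) hcon
  -- injection data: h ↦ (h % t, b h - bt * (h / t))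
  let φ : ℕ → ℕ × ℤ := fun h => (h % t, b h - bt * (h / t : ℕ))
  have hx : ∀ h ∈ H, |((h % t : ℕ) : ℝ) * c + ((h / t : ℕ) : ℝ) * κ - ((b h - bt * (h / t : ℕ) : ℤ) : ℝ)| ≤ η := by
    intro h hh
    have h1 := hb h hh
    have h2 : (h : ℝ) = t * ((h / t : ℕ) : ℝ) + ((h % t : ℕ) : ℝ) := by exact_mod_cast (Nat.div_add_mod h t).symm
    have : ((h % t : ℕ) : ℝ) * c + ((h / t : ℕ) : ℝ) * κ - ((b h - bt * (h / t : ℕ) : ℤ) : ℝ) = h * c - b h := by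
      generalize h / t = i at *
      simp only [Int.cast_sub, Int.cast_mul, Int.cast_natCast]
      rw [hκ]; linear_combination (-c) * h2
    rw [this]; exact h1
  have hfib : ∀ v ∈ H.image φ, (((H.filter fun h => φ h = v).card : ℕ) : ℝ) ≤ 2 * η / |κ| + 1 := by
    rintro ⟨r, e⟩ -
    -- map to h / t
    have hinj : Set.InjOn (fun h => h / t) ((H.filter fun h => φ h = (r, e) : Finset ℕ) : Set ℕ) := by
      intro x hx y hy hxy
      have hx' := (Finset.mem_filter.1 (Finset.mem_coe.1 hx)).2
      have hy' := (Finset.mem_filter.1 (Finset.mem_coe.1 hy)).2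
      simp only [φ, Prod.mk.injEq] at hx' hy'
      have e1 := Nat.div_add_mod x t
      have e2 := Nat.div_add_mod y t
      simp only at hxy
      rw [hx'.1, hxy] at e1
      rw [hy'.1] at e2
      omega
    rw [← Finset.card_image_of_injOn hinj]
    refine card_nat_interval _ ((e - r * c) / κ - η / |κ|) (2 * η / |κ|) (by positivity) ?_
    intro i hi
    obtain ⟨h, hh, rfl⟩ := Finset.mem_image.1 hi
    obtain ⟨hh1, hh2⟩ := Finset.mem_filter.1 hh
    have h1 := hx h hh1
    simp only [φ, Prod.mk.injEq] at hh2
    rw [hh2.1, hh2.2] at h1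
    have hκne : κ ≠ 0 := abs_pos.1 hκ0
    have h2 : |((h / t : ℕ) : ℝ) - (e - r * c) / κ| ≤ η / |κ| := by
      rw [le_div_iff₀ hκ0, ← abs_mul, sub_mul, div_mul_cancel₀ _ hκne]
      have e : ((h / t : ℕ) : ℝ) * κ - (e - r * c) = r * c + ((h / t : ℕ) : ℝ) * κ - e := by ring
      rw [e]; exact h1
    rw [abs_le] at h2
    constructor
    · linarith [h2.1]
    · have : 2 * η / |κ| = η / |κ| + η / |κ| := by ring
      linarith [h2.2]
  have himg : ((H.image φ).card : ℝ) ≤ t * (|κ| * N / t + 2) := by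
    -- the image lies in a sigma over residues
    have h1 : (H.image φ).card ≤ ∑ r ∈ range t, ((H.image φ).filter fun v => v.1 = r).card := by
      rw [Finset.card_eq_sum_card_fiberwise (f := Prod.fst) (t := range t)]
      intro v hv
      obtain ⟨h, hh, rfl⟩ := Finset.mem_image.1 (Finset.mem_coe.1 hv)
      simp only [φ, Finset.coe_range, Set.mem_Iio]
      exact Nat.mod_lt _ ht1
    have h2 : ∀ r ∈ range t, ((((H.image φ).filter fun v => v.1 = r).card : ℕ) : ℝ) ≤ |κ| * N / t + 2 := by
      intro r _
      have hinj : Set.InjOn Prod.snd (((H.image φ).filter fun v => v.1 = r : Finset (ℕ × ℤ)) : Set (ℕ × ℤ)) := by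
        intro x hx y hy hxy
        have hx' := (Finset.mem_filter.1 (Finset.mem_coe.1 hx)).2
        have hy' := (Finset.mem_filter.1 (Finset.mem_coe.1 hy)).2
        exact Prod.ext (hx'.trans hy'.symm) hxy
      rw [← Finset.card_image_of_injOn hinj]
      have hη1 : η ≤ 1 / 32 := by linarith
      have := card_int_interval ((((H.image φ).filter fun v => v.1 = r)).image Prod.snd)
        (min (r * c) (r * c + (N / t) * κ) - η) (|κ| * N / t + 2 * η) (by positivity) (by
          intro e he
          obtain ⟨v, hv, rfl⟩ := Finset.mem_image.1 he
          obtain ⟨hv1, hv2⟩ := Finset.mem_filter.1 hv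
          obtain ⟨h, hh, rfl⟩ := Finset.mem_image.1 hv1
          have h3 := hx h hh
          simp only [φ] at hv2 ⊢
          rw [hv2] at h3
          have h4 : ((h / t : ℕ) : ℝ) ≤ N / t := by
            refine Nat.cast_div_le.trans ?_
            have : (h : ℝ) ≤ N := by exact_mod_cast (Finset.mem_range.1 (hH hh)).le
            gcongr
          have h5 : (0 : ℝ) ≤ ((h / t : ℕ) : ℝ) := by positivity
          rw [abs_le] at h3
          have e1 : |κ| * N / t = N / t * |κ| := by ring
          rw [e1]
          rcases le_or_gt 0 κ with hk | hk
          · rw [abs_of_nonneg hk, min_eq_left (by nlinarith)]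
            constructor <;> nlinarith [h3.1, h3.2]
          · rw [abs_of_neg hk, min_eq_right (by nlinarith)]
            constructor <;> nlinarith [h3.1, h3.2])
      linarith
    calc ((H.image φ).card : ℝ) ≤ ((∑ r ∈ range t, ((H.image φ).filter fun v => v.1 = r).card : ℕ) : ℝ) := by exact_mod_cast h1
      _ = ∑ r ∈ range t, ((((H.image φ).filter fun v => v.1 = r).card : ℕ) : ℝ) := by push_cast; rfl
      _ ≤ ∑ r ∈ range t, (|κ| * N / t + 2) := Finset.sum_le_sum h2
      _ = _ := by rw [Finset.sum_const, Finset.card_range, nsmul_eq_mul]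
  have hcount : (H.card : ℝ) ≤ t * (|κ| * N / t + 2) * (2 * η / |κ| + 1) := by
    rw [Finset.card_eq_sum_card_image φ H]
    push_cast
    calc _ ≤ ∑ v ∈ H.image φ, (2 * η / |κ| + 1) := Finset.sum_le_sum hfib
      _ = (H.image φ).card * (2 * η / |κ| + 1) := by rw [Finset.sum_const, nsmul_eq_mul]
      _ ≤ _ := by gcongr
  have e2 : t * (|κ| * N / t + 2) * (2 * η / |κ| + 1) = 2 * η * N + |κ| * N + 4 * η * t / |κ| + 2 * t := by
    field_simp
    ring
  rw [e2] at hcount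
  have h6 : 4 * η * t / |κ| ≤ δ * N / 2 := by
    rw [div_le_iff₀ hκ0]
    rw [div_lt_iff₀ (by positivity)] at hcon
    nlinarith
  have h7 : 2 * (t : ℝ) ≤ δ * N / 8 := by
    have : 2 * (t : ℝ) ≤ 4 / δ := by
      have : 2 * (2 / δ) = 4 / δ := by ring
      linarith
    refine this.trans ?_
    rw [div_le_iff₀ hδ]; nlinarith
  have h8 : |κ| * N ≤ 2 * η * N := by gcongr
  have h9 : η * N ≤ δ * N / 32 := by nlinarith
  linarith
end FS

namespace FS
open Finset

/-- additive character of the reals -/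
noncomputable def ee (x : ℝ) : ℂ := Complex.exp ((2 * Real.pi * x : ℝ) * Complex.I)

lemma ee_add (x y : ℝ) : ee (x + y) = ee x * ee y := by
  unfold ee; rw [← Complex.exp_add]; congr 1; push_cast; ring

lemma ee_zero : ee 0 = 1 := by simp [ee]

lemma norm_ee (x : ℝ) : ‖ee x‖ = 1 := by
  unfold ee; exact Complex.norm_exp_ofReal_mul_I _

lemma ee_neg (x : ℝ) : ee (-x) = (starRingEnd ℂ) (ee x) := by
  unfold ee; rw [← Complex.exp_conj]; congr 1
  rw [map_mul, Complex.conj_I, Complex.conj_ofReal]; push_cast; ring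

lemma ee_sub (x y : ℝ) : ee (x - y) = ee x * (starRingEnd ℂ) (ee y) := by
  rw [sub_eq_add_neg, ee_add, ee_neg]

lemma ee_int (n : ℤ) : ee n = 1 := by
  unfold ee; rw [Complex.exp_eq_one_iff]; exact ⟨n, by push_cast; ring⟩

lemma ee_nat (n : ℕ) : ee n = 1 := by exact_mod_cast ee_int n

lemma ee_add_int (x : ℝ) (n : ℤ) : ee (x + n) = ee x := by rw [ee_add, ee_int, mul_one]

lemma ee_mul_nat (x : ℝ) (n : ℕ) : ee (n * x) = ee x ^ n := by
  unfold ee; rw [← Complex.exp_nat_mul]; congr 1; push_cast; ring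

lemma norm_ee_sub_one_sq (x : ℝ) : ‖ee x - 1‖ ^ 2 = 4 * Real.sin (Real.pi * x) ^ 2 := by
  unfold ee
  rw [Complex.exp_mul_I, ← Complex.normSq_eq_norm_sq, Complex.normSq_apply]
  simp only [Complex.sub_re, Complex.sub_im, Complex.add_re, Complex.add_im, Complex.mul_re, Complex.mul_im,
    Complex.one_re, Complex.one_im, Complex.I_re, Complex.I_im, ← Complex.ofReal_cos, ← Complex.ofReal_sin, Complex.ofReal_re, Complex.ofReal_im]
  have e1 : Real.cos (2 * Real.pi * x) = 1 - 2 * Real.sin (Real.pi * x) ^ 2 := by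
    rw [mul_assoc, Real.cos_two_mul, Real.cos_sq']; ring
  have e2 := Real.sin_sq_add_cos_sq (2 * Real.pi * x)
  rw [e1] at e2
  simp only [e1]
  nlinarith [e2]

lemma norm_ee_sub_one (x : ℝ) : ‖ee x - 1‖ = 2 * |Real.sin (Real.pi * x)| := by
  have h := norm_ee_sub_one_sq x
  have : (2 * |Real.sin (Real.pi * x)|) ^ 2 = 4 * Real.sin (Real.pi * x) ^ 2 := by
    rw [mul_pow, sq_abs]; norm_num
  rw [← this] at h
  exact (sq_eq_sq₀ (norm_nonneg _) (by positivity)).1 h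

lemma norm_ee_sub_one_le (x : ℝ) : ‖ee x - 1‖ ≤ 2 * Real.pi * |x| := by
  rw [norm_ee_sub_one]
  have h : |Real.sin (Real.pi * x)| ≤ |Real.pi * x| := Real.abs_sin_le_abs
  rw [abs_mul, abs_of_pos Real.pi_pos] at h
  linarith

lemma norm_ee_sub_le (x y : ℝ) : ‖ee x - ee y‖ ≤ 2 * Real.pi * |x - y| := by
  have : ee x - ee y = ee y * (ee (x - y) - 1) := by
    rw [mul_sub, ← ee_add]; simp
  rw [this, norm_mul, norm_ee, one_mul]; exact norm_ee_sub_one_le _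

lemma le_norm_ee_sub_one (x : ℝ) (hx : |x| ≤ 1 / 2) : 4 * |x| ≤ ‖ee x - 1‖ := by
  rw [norm_ee_sub_one]
  have h := Real.mul_abs_le_abs_sin (x := Real.pi * x) (by
    rw [abs_mul, abs_of_pos Real.pi_pos]; nlinarith [Real.pi_pos])
  rw [abs_mul, abs_of_pos Real.pi_pos, ← mul_assoc, div_mul_cancel₀ _ Real.pi_pos.ne'] at h
  linarith

lemma le_norm_ee_sub_one_round (x : ℝ) : 4 * |x - round x| ≤ ‖ee x - 1‖ := by
  have h := le_norm_ee_sub_one (x - round x) (abs_sub_round x)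
  have : ee x = ee (x - round x) := by
    rw [← ee_add_int (x - round x) (round x)]; simp
  rw [this]; exact h

/-- geometric sum bound -/
lemma norm_geom (x : ℝ) (l : ℕ) : 2 * |x - round x| * ‖∑ n ∈ range l, ee (n * x)‖ ≤ 1 := by
  have h1 : (∑ n ∈ range l, ee (n * x)) * (ee x - 1) = ee x ^ l - 1 := by
    simp only [ee_mul_nat]
    exact geom_sum_mul _ _
  have h2 : ‖ee x ^ l - 1‖ ≤ 2 := by
    refine (norm_sub_le _ _).trans ?_
    rw [norm_pow, norm_ee]; norm_num
  rw [← h1, norm_mul] at h2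
  have h3 := le_norm_ee_sub_one_round x
  have h4 := mul_le_mul_of_nonneg_left h3 (norm_nonneg (∑ n ∈ range l, ee (n * x)))
  linarith

/-- van der Corput identity -/
lemma vdc (f : ℕ → ℂ) (l : ℕ) :
    ‖∑ n ∈ range l, f n‖ ^ 2 = ∑ n ∈ range l, ‖f n‖ ^ 2 +
      2 * (∑ h ∈ range l, ∑ n ∈ range (l - 1 - h), f (n + (h + 1)) * (starRingEnd ℂ) (f n)).re := by
  induction l with
  | zero => simp
  | succ l ih =>
    have h1 : ∑ h ∈ range (l + 1), ∑ n ∈ range (l + 1 - 1 - h), f (n + (h + 1)) * (starRingEnd ℂ) (f n)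
        = ∑ h ∈ range l, ∑ n ∈ range (l - 1 - h), f (n + (h + 1)) * (starRingEnd ℂ) (f n)
          + f l * (starRingEnd ℂ) (∑ n ∈ range l, f n) := by
      rw [sum_range_succ, map_sum, Finset.mul_sum, ← Finset.sum_range_reflect (fun n => f l * (starRingEnd ℂ) (f n)), ]
      have : l + 1 - 1 - l = 0 := by omega
      rw [this, range_zero, sum_empty, add_zero, ← Finset.sum_add_distrib]
      refine Finset.sum_congr rfl fun h hh => ?_
      have hh := Finset.mem_range.1 hh
      have e : l + 1 - 1 - h = (l - 1 - h) + 1 := by omega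
      rw [e, sum_range_succ]
      congr 3
      omega
    rw [h1, sum_range_succ, sum_range_succ, Complex.add_re, mul_add]
    have h2 : ‖∑ n ∈ range l, f n + f l‖ ^ 2 = ‖∑ n ∈ range l, f n‖ ^ 2 + ‖f l‖ ^ 2
        + 2 * (f l * (starRingEnd ℂ) (∑ n ∈ range l, f n)).re := by
      rw [← Complex.normSq_eq_norm_sq, ← Complex.normSq_eq_norm_sq, ← Complex.normSq_eq_norm_sq, Complex.normSq_add]
      rw [← Complex.conj_re, map_mul, Complex.conj_conj]; ring_nf
    rw [h2, ih]; ring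

open Polynomial in
lemma taylor_diff (P : ℝ[X]) (k : ℕ) (hP : P.natDegree ≤ k + 1) (r : ℝ) :
    (taylor r P - P).natDegree ≤ k ∧ (taylor r P - P).coeff k = (k + 1) * r * P.coeff (k + 1) := by
  have hz : ∀ n, k + 1 < n → P.coeff n = 0 := fun n hn => coeff_eq_zero_of_natDegree_lt (by omega)
  constructor
  · rw [natDegree_le_iff_coeff_eq_zero]
    intro n hn
    rw [coeff_sub, taylor_coeff]
    have h1 : hasseDeriv n P = C (P.coeff n) := by
      ext j
      rw [hasseDeriv_coeff, coeff_C]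
      split_ifs with hj
      · subst hj; simp
      · rw [hz _ (by omega)]; simp
    rw [h1]; simp
  · rw [coeff_sub, taylor_coeff]
    have h1 : hasseDeriv k P = C (P.coeff k) + C ((k + 1) * P.coeff (k + 1)) * X := by
      ext j
      rw [hasseDeriv_coeff, coeff_add, coeff_C, coeff_C_mul, coeff_X]
      rcases j with _ | _ | j
      · simp
      · simp [add_comm 1 k]
      · rw [hz _ (by omega)]; simp
    rw [h1]; simp; ring

lemma weyl_count (l N : ℕ) (hl : l ≤ N) (hN : 0 < N) (δ : ℝ) (hδ : 0 < δ) (hN2 : 2 ≤ δ ^ 2 * N) (P : Polynomial ℝ)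
    (hs : δ * N ≤ ‖∑ n ∈ range l, ee (P.eval (n : ℝ))‖) :
    ∃ H : Finset ℕ, H ⊆ range N ∧ δ ^ 2 / 8 * N ≤ H.card ∧ ∀ h ∈ H, ∃ l' ≤ N, δ ^ 2 / 8 * N ≤ 
      ‖∑ n ∈ range l', ee ((Polynomial.taylor (h : ℝ) P - P).eval (n : ℝ))‖ := by
  set f : ℕ → ℂ := fun n => ee (P.eval (n : ℝ)) with hf
  set S : ℕ → ℂ := fun h => ∑ n ∈ range (l - 1 - h), f (n + (h + 1)) * (starRingEnd ℂ) (f n) with hS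
  have hNr : (0 : ℝ) < N := by exact_mod_cast hN
  have hv := vdc f l
  have h1 : ∑ n ∈ range l, ‖f n‖ ^ 2 = l := by simp [hf, norm_ee]
  rw [h1] at hv
  have h2 : (∑ h ∈ range l, S h).re ≤ ∑ h ∈ range l, ‖S h‖ :=
    (Complex.re_le_norm _).trans (norm_sum_le _ _)
  have hSe : ∀ h, S h = ∑ n ∈ range (l - 1 - h), ee ((Polynomial.taylor ((h + 1 : ℕ) : ℝ) P - P).eval (n : ℝ)) := by
    intro h
    refine Finset.sum_congr rfl fun n _ => ?_
    simp only [hf]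
    rw [← ee_sub, Polynomial.eval_sub, Polynomial.taylor_eval]
    push_cast; rfl
  have hlN : (l : ℝ) ≤ N := by exact_mod_cast hl
  have h3 : (δ * N) ^ 2 ≤ N + 2 * ∑ h ∈ range l, ‖S h‖ := by
    have : (δ * N) ^ 2 ≤ ‖∑ n ∈ range l, f n‖ ^ 2 := by gcongr
    linarith
  have hb : ∀ h, ‖S h‖ ≤ N := by
    intro h
    rw [hSe]
    refine (norm_sum_le _ _).trans ?_
    simp only [norm_ee, sum_const, card_range, nsmul_eq_mul, mul_one]
    refine le_trans ?_ hlN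
    exact_mod_cast (by omega)
  set T := (range l).filter fun h => δ ^ 2 / 8 * N ≤ ‖S h‖ with hT
  have h4 : ∑ h ∈ range l, ‖S h‖ ≤ T.card * N + N * (δ ^ 2 / 8 * N) := by
    rw [← Finset.sum_filter_add_sum_filter_not (range l) (fun h => δ ^ 2 / 8 * N ≤ ‖S h‖)]
    have i1 : ∑ h ∈ T, ‖S h‖ ≤ T.card * N := by
      refine (Finset.sum_le_card_nsmul _ _ _ fun h _ => hb h).trans ?_
      rw [nsmul_eq_mul]
    have i2 : ∑ h ∈ (range l).filter (fun h => ¬ (δ ^ 2 / 8 * N ≤ ‖S h‖)), ‖S h‖ ≤ N * (δ ^ 2 / 8 * N) := by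
      refine (Finset.sum_le_card_nsmul _ _ (δ ^ 2 / 8 * N) fun h hh => (not_le.1 (Finset.mem_filter.1 hh).2).le).trans ?_
      rw [nsmul_eq_mul]
      gcongr
      have := Finset.card_filter_le (range l) (fun h => ¬ (δ ^ 2 / 8 * N ≤ ‖S h‖))
      rw [card_range] at this
      exact this.trans hl
    exact add_le_add i1 i2
  refine ⟨T.map ⟨fun h => h + 1, add_left_injective 1⟩, ?_, ?_, ?_⟩
  · intro x hx
    obtain ⟨h, hh, rfl⟩ := Finset.mem_map.1 hx
    obtain ⟨hh1, hh2⟩ := Finset.mem_filter.1 hh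
    have := Finset.mem_range.1 hh1
    simp only [Function.Embedding.coeFn_mk, Finset.mem_range]
    by_contra hc
    have e : l - 1 - h = 0 := by omega
    have : S h = 0 := by simp [hS, e]
    rw [this, norm_zero] at hh2
    have : 0 < δ ^ 2 / 8 * N := by positivity
    linarith
  · rw [Finset.card_map]
    by_contra hc
    push Not at hc
    nlinarith
  · intro x hx
    obtain ⟨h, hh, rfl⟩ := Finset.mem_map.1 hx
    obtain ⟨hh1, hh2⟩ := Finset.mem_filter.1 hh
    refine ⟨l - 1 - h, by omega, ?_⟩
    rw [hSe] at hh2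
    exact hh2

end FS

namespace FS
open Finset

lemma weyl_base (N : ℕ) (hN : 1 ≤ N) (δ : ℝ) (hδ : 0 < δ) (P : Polynomial ℝ) (hP : P.natDegree ≤ 1)
    (l : ℕ) (hs : δ * N ≤ ‖∑ n ∈ range l, ee (P.eval (n : ℝ))‖) :
    ∃ b : ℤ, |P.coeff 1 - b| ≤ (2 / δ) / N := by
  refine ⟨round (P.coeff 1), ?_⟩
  have h1 : ∑ n ∈ range l, ee (P.eval (n : ℝ)) = ee (P.coeff 0) * ∑ n ∈ range l, ee (n * P.coeff 1) := by
    rw [Finset.mul_sum]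
    refine Finset.sum_congr rfl fun n _ => ?_
    rw [← ee_add]
    congr 1
    rw [Polynomial.eval_eq_sum_range' (n := 2) (by omega)]
    simp [Finset.sum_range_succ]; ring
  rw [h1, norm_mul, norm_ee, one_mul] at hs
  have h2 := norm_geom (P.coeff 1) l
  have hNr : (0 : ℝ) < N := by exact_mod_cast hN
  rw [div_div, le_div_iff₀ (by positivity)]
  have h3 := mul_le_mul_of_nonneg_left hs (by positivity : 0 ≤ 2 * |P.coeff 1 - round (P.coeff 1)|)
  nlinarith

/-- Pigeonhole step of the Weyl induction. -/
lemma weyl_step_aux (k C : ℕ) (hk : 1 ≤ k) (x : ℝ) (hx : 2 ≤ x) (N : ℕ) (hN : x ^ (12 + 8 * C) ≤ N) (a : ℝ) (H : Finset ℕ)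
    (hH : H ⊆ range N) (hHN : 1 / x ^ 3 * N ≤ H.card)
    (hq : ∀ h ∈ H, ∃ q : ℕ, 1 ≤ q ∧ (q : ℝ) ≤ x ^ (4 * C) ∧ ∃ b : ℤ, |q * ((k + 1) * h * a) - b| ≤ x ^ (4 * C) / N ^ k) :
    ∃ q : ℕ, 1 ≤ q ∧ (q : ℝ) ≤ x ^ (4 + 8 * C + (k + 1)) ∧ ∃ b : ℤ, |q * a - b| ≤ x ^ (10 + 12 * C) / N ^ (k + 1) := by
  classical
  have hx0 : 0 < x := by linarith
  have hx1 : 1 ≤ x := by linarith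
  have hN0 : (0 : ℝ) < N := lt_of_lt_of_le (by positivity) hN
  choose! q hq1 hq2 b hb using hq
  set B := x ^ (4 * C) with hB
  have hB0 : 0 < B := by positivity
  have hB1 : 1 ≤ B := one_le_pow₀ hx1
  have hmap : ∀ h ∈ H, q h ∈ Finset.Icc 1 ⌊B⌋₊ := fun h hh =>
    Finset.mem_Icc.2 ⟨hq1 h hh, Nat.le_floor (hq2 h hh)⟩
  have hBf : 0 < ⌊B⌋₊ := Nat.floor_pos.2 hB1
  obtain ⟨y, hy, hyc⟩ := Finset.exists_le_card_fiber_of_nsmul_le_card_of_maps_to (b := (H.card : ℝ) / ⌊B⌋₊) hmap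
    (Finset.nonempty_Icc.2 hBf) (by
      rw [Nat.card_Icc, nsmul_eq_mul, Nat.add_sub_cancel]
      rw [mul_div_cancel₀]
      exact_mod_cast hBf.ne')
  obtain ⟨hy1, hy2⟩ := Finset.mem_Icc.1 hy
  have hyB : (y : ℝ) ≤ B := (Nat.cast_le.2 hy2).trans (Nat.floor_le hB0.le)
  set H' := H.filter fun h => q h = y with hH'
  have hN1 : (N : ℝ) ≤ N ^ k := by
    have : (1 : ℝ) ≤ N := le_trans (one_le_pow₀ hx1) hN
    exact le_self_pow₀ this (by omega)
  have hx5 : 32 ≤ x ^ 5 := by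
    calc (32 : ℝ) = 2 ^ 5 := by norm_num
      _ ≤ x ^ 5 := by gcongr
  obtain ⟨t, ht1, ht2, bt, hbt⟩ := near_multiples N (y * (k + 1) * a) (B / N ^ k) (1 / x ^ (3 + 4 * C)) (by positivity)
    (by rw [div_le_one (by positivity)]; exact one_le_pow₀ hx1) (by positivity) (by
      rw [div_div, div_le_div_iff₀ (by positivity) (by positivity)]
      refine le_trans ?_ (le_trans hN (by linarith))
      calc B * (x ^ (3 + 4 * C) * 32) ≤ B * (x ^ (3 + 4 * C) * x ^ 5) := by gcongr
        _ = x ^ (8 + 8 * C) := by rw [hB]; ring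
        _ ≤ x ^ (12 + 8 * C) := pow_le_pow_right₀ hx1 (by omega)) H' ((Finset.filter_subset _ _).trans hH) (by
      refine le_trans ?_ hyc
      rw [le_div_iff₀ (by exact_mod_cast hBf)]
      refine le_trans ?_ hHN
      have hf : (⌊B⌋₊ : ℝ) ≤ B := Nat.floor_le hB0.le
      calc 1 / x ^ (3 + 4 * C) * N * ⌊B⌋₊ ≤ 1 / x ^ (3 + 4 * C) * N * B := by gcongr
        _ = 1 / x ^ 3 * N := by rw [hB, pow_add]; field_simp) (by
      have e : (1 / x ^ (3 + 4 * C)) ^ 2 * x ^ (12 + 8 * C) = x ^ 6 := by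
        rw [one_div, inv_pow, ← pow_mul, inv_mul_eq_iff_eq_mul₀ (by positivity), ← pow_add]; congr 1; ring
      calc (32 : ℝ) ≤ x ^ 6 := hx5.trans (pow_le_pow_right₀ hx1 (by omega))
        _ = (1 / x ^ (3 + 4 * C)) ^ 2 * x ^ (12 + 8 * C) := e.symm
        _ ≤ _ := by gcongr) (by
      intro h hh
      obtain ⟨hh1, hh2⟩ := Finset.mem_filter.1 hh
      refine ⟨b h, ?_⟩
      have := hb h hh1
      rw [hh2] at this
      convert this using 3; ring)
  rw [div_div_eq_mul_div, div_one] at ht2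
  have ht3 : (t : ℝ) ≤ x ^ (4 + 4 * C) := by
    refine ht2.trans ?_
    calc 2 * x ^ (3 + 4 * C) ≤ x * x ^ (3 + 4 * C) := by gcongr
      _ = _ := by ring
  refine ⟨t * y * (k + 1), ?_, ?_, bt, ?_⟩
  · exact Nat.mul_pos (Nat.mul_pos ht1 hy1) (by omega)
  · push_cast
    have hk2 : ((k : ℝ) + 1) ≤ x ^ (k + 1) := by
      have : ((k + 1 : ℕ) : ℝ) ≤ 2 ^ (k + 1) := by exact_mod_cast (Nat.lt_two_pow_self (n := k + 1)).le
      push_cast at this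
      exact this.trans (by gcongr)
    calc (t : ℝ) * y * (k + 1) ≤ x ^ (4 + 4 * C) * B * x ^ (k + 1) := by gcongr
      _ = _ := by rw [hB]; ring
  · have e : ((t * y * (k + 1) : ℕ) : ℝ) * a = t * (y * (k + 1) * a) := by push_cast; ring
    rw [e]
    refine hbt.trans ?_
    have e2 : 8 * (B / (N : ℝ) ^ k) * t / (1 / x ^ (3 + 4 * C) * N) = 8 * B * x ^ (3 + 4 * C) * t / N ^ (k + 1) := by
      field_simp
      ring
    rw [e2]
    gcongr
    calc 8 * B * x ^ (3 + 4 * C) * t ≤ x ^ 3 * B * x ^ (3 + 4 * C) * x ^ (4 + 4 * C) := by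
          gcongr
          calc (8 : ℝ) = 2 ^ 3 := by norm_num
            _ ≤ x ^ 3 := by gcongr
      _ = x ^ (10 + 12 * C) := by rw [hB]; ring

lemma weyl_top (k : ℕ) (hk : 1 ≤ k) : ∃ C : ℕ, ∀ N : ℕ, 1 ≤ N → ∀ δ : ℝ, 0 < δ → δ ≤ 1 → ∀ P : Polynomial ℝ, P.natDegree ≤ k →
    ∀ l ≤ N, δ * N ≤ ‖∑ n ∈ range l, ee (P.eval (n : ℝ))‖ →
    ∃ q : ℕ, 1 ≤ q ∧ (q : ℝ) ≤ (2 / δ) ^ C ∧ ∃ b : ℤ, |q * P.coeff k - b| ≤ (2 / δ) ^ C / N ^ k := by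
  induction k, hk using Nat.le_induction with
  | base =>
    refine ⟨1, fun N hN δ hδ hδ1 P hP l hl hs => ⟨1, le_rfl, ?_, ?_⟩⟩
    · rw [pow_one, le_div_iff₀ hδ]; push_cast; linarith
    · obtain ⟨b, hb⟩ := weyl_base N hN δ hδ P hP l hs
      exact ⟨b, by simpa using hb⟩
  | succ k hk ih =>
    obtain ⟨C, hC⟩ := ih
    refine ⟨(12 + 12 * C) * (k + 1), fun N hN δ hδ hδ1 P hP l hl hs => ?_⟩
    set x := 2 / δ with hxdef
    have hx : 2 ≤ x := by rw [hxdef, le_div_iff₀ hδ]; linarith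
    have hx1 : 1 ≤ x := by linarith
    have hNr : (0 : ℝ) < N := by exact_mod_cast hN
    rcases lt_or_ge (N : ℝ) (x ^ (12 + 8 * C)) with hsmall | hbig
    · refine ⟨1, le_rfl, by push_cast; exact one_le_pow₀ hx1, round (P.coeff (k + 1)), ?_⟩
      rw [Nat.cast_one, one_mul]
      refine (abs_sub_round _).trans ?_
      rw [le_div_iff₀ (by positivity)]
      calc 1 / 2 * (N : ℝ) ^ (k + 1) ≤ 1 * (x ^ (12 + 8 * C)) ^ (k + 1) := by gcongr; norm_num
        _ = x ^ ((12 + 8 * C) * (k + 1)) := by rw [one_mul, ← pow_mul]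
        _ ≤ _ := pow_le_pow_right₀ hx1 (by gcongr; omega)
    · have hδx : δ = 2 / x := by rw [hxdef]; field_simp
      have hx0 : 0 < x := by linarith
      have hd8 : 1 / x ^ 3 ≤ δ ^ 2 / 8 := by
        clear_value x
        rw [hδx, div_pow, div_div, div_le_div_iff₀ (by positivity) (by positivity)]
        nlinarith [sq_nonneg x]
      obtain ⟨H, hH1, hH2, hH3⟩ := weyl_count l N hl hN δ hδ (by
        have : x ^ 3 ≤ N := (pow_le_pow_right₀ hx1 (by omega)).trans hbig
        rw [hδx, div_pow, div_mul_eq_mul_div, le_div_iff₀ (by positivity)]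
        nlinarith [sq_nonneg x]) P hs
      obtain ⟨q, hq1, hq2, b, hb⟩ := weyl_step_aux k C hk x hx N hbig (P.coeff (k + 1)) H hH1 (le_trans (by gcongr) hH2) (by
        intro h hh
        obtain ⟨l', hl', hs'⟩ := hH3 h hh
        obtain ⟨hd1, hd2⟩ := taylor_diff P k hP h
        obtain ⟨q, hq1, hq2, b, hb⟩ := hC N hN (1 / x ^ 3) (by positivity) (by rw [div_le_one (by positivity)]; exact one_le_pow₀ hx1)
          (Polynomial.taylor (h : ℝ) P - P) hd1 l' hl' (le_trans (by gcongr) hs')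
        have hle : (2 / (1 / x ^ 3)) ^ C ≤ x ^ (4 * C) := by
          rw [div_div_eq_mul_div, div_one, pow_mul]
          gcongr
          calc 2 * x ^ 3 ≤ x * x ^ 3 := by gcongr
            _ = x ^ 4 := by ring
        refine ⟨q, hq1, hq2.trans hle, b, ?_⟩
        rw [hd2] at hb
        exact hb.trans (by gcongr))
      refine ⟨q, hq1, hq2.trans (pow_le_pow_right₀ hx1 ?_), b, hb.trans ?_⟩
      · nlinarith
      · gcongr
        nlinarith
end FS

namespace FS
open Finset Polynomial

lemma ee_div_congr (Q : ℕ) (hQ : 0 < Q) (a b : ℤ) (h : (Q : ℤ) ∣ a - b) : ee ((a : ℝ) / Q) = ee ((b : ℝ) / Q) := by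
  obtain ⟨c, hc⟩ := h
  have : (a : ℝ) / Q = (b : ℝ) / Q + (c : ℤ) := by
    have h2 : (a : ℝ) = b + Q * c := by
      have : a = b + Q * c := by linarith
      exact_mod_cast this
    have : (Q : ℝ) ≠ 0 := by exact_mod_cast hQ.ne'
    field_simp; linarith
  rw [this, ee_add_int]

lemma sum_period (Q M : ℕ) (f : ℕ → ℂ) (hf : ∀ n, f (n + Q) = f n) :
    ∑ n ∈ range (Q * M), f n = M * ∑ n ∈ range Q, f n := by
  induction M with
  | zero => simp
  | succ M ih =>
    rw [mul_add, mul_one, Finset.sum_range_add, ih]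
    have : ∀ M n, f (Q * M + n) = f n := by
      intro M n
      induction M with
      | zero => simp
      | succ M ih =>
        rw [← ih, ← hf (Q * M + n)]; congr 1; ring
    simp only [this]
    push_cast; ring

lemma sum_classes (q M : ℕ) (f : ℕ → ℂ) :
    ∑ n ∈ range (M * q), f n = ∑ r ∈ range q, ∑ m ∈ range M, f (r + q * m) := by
  rw [Finset.sum_comm]
  induction M with
  | zero => simp
  | succ M ih =>
    rw [Finset.sum_range_succ, ← ih, add_mul, one_mul, Finset.sum_range_add]
    congr 1
    refine Finset.sum_congr rfl fun r _ => ?_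
    congr 1; ring

lemma dvd_taylor_coeff (d c r : ℤ) (f : ℤ[X]) (n : ℕ) (h : ∀ i, n ≤ i → d ∣ c * f.coeff i) :
    d ∣ c * (taylor r f).coeff n := by
  rw [taylor_coeff, Polynomial.eval_eq_sum_range, Finset.mul_sum]
  refine Finset.dvd_sum fun i _ => ?_
  rw [hasseDeriv_coeff]
  have := h (i + n) (by omega)
  have e : c * (((i + n).choose n : ℤ) * f.coeff (i + n) * r ^ i) = (c * f.coeff (i + n)) * (((i + n).choose n : ℤ) * r ^ i) := by ring
  rw [e]
  exact this.mul_right _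

lemma comp_coeff (P : ℤ[X]) (r q : ℤ) (j : ℕ) :
    (P.comp (C q * X + C r)).coeff j = q ^ j * (taylor r P).coeff j := by
  have : P.comp (C q * X + C r) = (taylor r P).comp (C q * X) := by
    rw [taylor_apply, comp_assoc]; simp
  rw [this, comp_C_mul_X_coeff]
  ring

/-- top coefficient of complete sums -/
lemma complete_top (k : ℕ) (hk : 1 ≤ k) : ∃ C : ℕ, ∀ Q : ℕ, 1 ≤ Q → ∀ δ : ℝ, 0 < δ → δ ≤ 1 → ∀ P : ℤ[X], P.natDegree ≤ k →
    δ * Q ≤ ‖∑ n ∈ range Q, ee (((P.eval (n : ℤ) : ℤ) : ℝ) / Q)‖ →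
    ∃ q : ℕ, 1 ≤ q ∧ (q : ℝ) ≤ (2 / δ) ^ C ∧ (Q : ℤ) ∣ q * P.coeff k := by
  obtain ⟨C₀, hC⟩ := weyl_top k hk
  refine ⟨C₀, fun Q hQ δ hδ hδ1 P hP hs => ?_⟩
  have hQ0 : (0 : ℝ) < Q := by exact_mod_cast hQ
  set M := ⌊(2 / δ) ^ C₀⌋₊ + 1 with hM
  have hM1 : (2 / δ) ^ C₀ < M := by rw [hM]; push_cast; exact Nat.lt_floor_add_one _
  set R : ℝ[X] := C (1 / (Q : ℝ)) * P.map (Int.castRingHom ℝ) with hR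
  have hRe : ∀ n : ℕ, R.eval (n : ℝ) = ((P.eval (n : ℤ) : ℤ) : ℝ) / Q := by
    intro n
    rw [hR, eval_mul, eval_C]
    have : (P.map (Int.castRingHom ℝ)).eval (n : ℝ) = ((P.eval (n : ℤ) : ℤ) : ℝ) := by
      have := Polynomial.eval_intCast_map (Int.castRingHom ℝ) P (n : ℤ)
      simpa using this
    rw [this]; ring
  have hRc : R.coeff k = (P.coeff k : ℝ) / Q := by
    rw [hR, coeff_C_mul, coeff_map]; simp; ring
  obtain ⟨q, hq1, hq2, b, hb⟩ := hC (Q * M) (Nat.mul_pos hQ (by omega)) δ hδ hδ1 R (by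
    refine (natDegree_C_mul_le _ _).trans ((natDegree_map_le).trans hP)) (Q * M) le_rfl (by
      have : ∑ n ∈ range (Q * M), ee (R.eval (n : ℝ)) = M * ∑ n ∈ range Q, ee (R.eval (n : ℝ)) := by
        refine sum_period Q M _ fun n => ?_
        rw [hRe, hRe]
        refine ee_div_congr Q hQ _ _ ?_
        have := Polynomial.sub_dvd_eval_sub ((n + Q : ℕ) : ℤ) (n : ℤ) P
        simpa using this
      rw [this, norm_mul]
      simp only [hRe]
      rw [Complex.norm_natCast]
      push_cast
      calc δ * ((Q : ℝ) * M) = M * (δ * Q) := by ring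
        _ ≤ _ := by gcongr)
  refine ⟨q, hq1, hq2, ?_⟩
  have h1 : |(q : ℝ) * R.coeff k - b| < 1 / Q := by
    refine lt_of_le_of_lt hb ?_
    have hM0 : (0 : ℝ) < M := by rw [hM]; positivity
    have : ((Q * M : ℕ) : ℝ) ^ k ≥ Q * M := by
      have : (1 : ℝ) ≤ ((Q * M : ℕ) : ℝ) := by exact_mod_cast Nat.mul_pos hQ (by omega)
      have := le_self_pow₀ this (by omega : k ≠ 0)
      push_cast at this ⊢
      exact this
    rw [div_lt_div_iff₀ (by positivity) hQ0]
    nlinarith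
  rw [hRc] at h1
  have h2 : |((q * P.coeff k - b * Q : ℤ) : ℝ)| < 1 := by
    have e : ((q * P.coeff k - b * Q : ℤ) : ℝ) = ((q : ℝ) * ((P.coeff k : ℝ) / Q) - b) * Q := by
      push_cast; field_simp
    rw [e, abs_mul, abs_of_pos hQ0]
    rwa [lt_div_iff₀ hQ0] at h1
  have h3 : |q * P.coeff k - b * Q| < 1 := by exact_mod_cast h2
  have h4 : q * P.coeff k - b * Q = 0 := Int.abs_lt_one_iff.1 h3
  exact ⟨b, by linarith⟩

lemma complete_all (k : ℕ) : ∃ C : ℕ, ∀ Q : ℕ, 1 ≤ Q → ∀ δ : ℝ, 0 < δ → δ ≤ 1 → ∀ P : ℤ[X], P.natDegree ≤ k →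
    δ * Q ≤ ‖∑ n ∈ range Q, ee (((P.eval (n : ℤ) : ℤ) : ℝ) / Q)‖ →
    ∃ q : ℕ, 1 ≤ q ∧ (q : ℝ) ≤ (2 / δ) ^ C ∧ ∀ j, 1 ≤ j → (Q : ℤ) ∣ q * P.coeff j := by
  induction k with
  | zero =>
    refine ⟨0, fun Q hQ δ hδ hδ1 P hP hs => ⟨1, le_rfl, by simp, fun j hj => ?_⟩⟩
    rw [coeff_eq_zero_of_natDegree_lt (by omega)]; simp
  | succ k ih =>
    obtain ⟨C₁, h₁⟩ := complete_top (k + 1) (by omega)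
    obtain ⟨C₂, h₂⟩ := ih
    refine ⟨C₂ + C₁ * (k + 1), fun Q hQ δ hδ hδ1 P hP hs => ?_⟩
    have hQ0 : (0 : ℝ) < Q := by exact_mod_cast hQ
    obtain ⟨q₁, hq1, hq1', hq1''⟩ := h₁ Q hQ δ hδ hδ1 P hP hs
    have hf : ∀ n : ℕ, ee (((P.eval ((n + Q : ℕ) : ℤ) : ℤ) : ℝ) / Q) = ee (((P.eval (n : ℤ) : ℤ) : ℝ) / Q) := by
      intro n
      refine ee_div_congr Q hQ _ _ ?_
      have := Polynomial.sub_dvd_eval_sub ((n + Q : ℕ) : ℤ) (n : ℤ) P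
      simpa using this
    have hsum := sum_period Q q₁ (fun n => ee (((P.eval (n : ℤ) : ℤ) : ℝ) / Q)) hf
    rw [sum_classes q₁ Q] at hsum
    obtain ⟨r, hr, hrs⟩ : ∃ r ∈ range q₁, δ * Q ≤ ‖∑ m ∈ range Q, ee (((P.eval ((r + q₁ * m : ℕ) : ℤ) : ℤ) : ℝ) / Q)‖ := by
      by_contra hcon
      push Not at hcon
      have h3 : ‖∑ r ∈ range q₁, ∑ m ∈ range Q, ee (((P.eval ((r + q₁ * m : ℕ) : ℤ) : ℤ) : ℝ) / Q)‖ < q₁ * (δ * Q) := by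
        refine lt_of_le_of_lt (norm_sum_le _ _) ?_
        refine lt_of_lt_of_eq (Finset.sum_lt_sum_of_nonempty (Finset.nonempty_range_iff.2 (by omega)) hcon) ?_
        simp
      rw [hsum, norm_mul, Complex.norm_natCast] at h3
      have : (0 : ℝ) < q₁ := by exact_mod_cast hq1
      have := lt_of_mul_lt_mul_left h3 this.le
      linarith
    set P₁ := P.comp (C (q₁ : ℤ) * X + C (r : ℤ)) with hP₁
    set P₂ := P₁ - C (P₁.coeff (k + 1)) * X ^ (k + 1) with hP₂
    have hP₁d : P₁.natDegree ≤ k + 1 := by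
      refine natDegree_comp_le.trans ?_
      have : (C (q₁ : ℤ) * X + C (r : ℤ)).natDegree ≤ 1 := natDegree_linear_le
      nlinarith
    have hP₂d : P₂.natDegree ≤ k := by
      rw [natDegree_le_iff_coeff_eq_zero]
      intro n hn
      rw [hP₂, coeff_sub, coeff_C_mul_X_pow]
      split_ifs with h
      · rw [h]; simp
      · rw [coeff_eq_zero_of_natDegree_lt (by omega)]; simp
    have htop : (Q : ℤ) ∣ P₁.coeff (k + 1) := by
      rw [hP₁, comp_coeff]
      have : (Q : ℤ) ∣ q₁ * (taylor (r : ℤ) P).coeff (k + 1) := by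
        refine dvd_taylor_coeff _ _ _ _ _ fun i hi => ?_
        rcases hi.eq_or_lt with h | h
        · rw [← h]; exact hq1''
        · rw [coeff_eq_zero_of_natDegree_lt (by omega)]; simp
      rw [pow_succ, mul_assoc]
      exact this.mul_left _
    obtain ⟨q₂, hq2, hq2', hq2''⟩ := h₂ Q hQ δ hδ hδ1 P₂ hP₂d (by
      refine hrs.trans (le_of_eq ?_)
      congr 1
      refine Finset.sum_congr rfl fun m _ => ?_
      refine ee_div_congr Q hQ _ _ ?_
      have : P.eval ((r + q₁ * m : ℕ) : ℤ) = P₁.eval (m : ℤ) := by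
        rw [hP₁, eval_comp]; congr 1; simp; ring
      rw [this, hP₂, eval_sub]
      simp only [eval_mul, eval_C, eval_pow, eval_X]
      rw [sub_sub_cancel]
      exact htop.mul_right _)
    refine ⟨q₂ * q₁ ^ (k + 1), Nat.mul_pos hq2 (pow_pos hq1 _), ?_, ?_⟩
    · push_cast
      rw [pow_add (2 / δ), pow_mul (2 / δ)]
      gcongr
    · intro j hj
      have hall : ∀ i, 1 ≤ i → (Q : ℤ) ∣ ((q₂ * q₁ ^ (k + 1) : ℕ) : ℤ) * (taylor (r : ℤ) P).coeff i := by
        intro i hi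
        rcases lt_or_ge (k + 1) i with h | h
        · rw [coeff_eq_zero_of_natDegree_lt (by rw [natDegree_taylor]; omega)]; simp
        have h4 : (Q : ℤ) ∣ q₂ * P₁.coeff i := by
          have e : P₁.coeff i = P₂.coeff i + (if i = k + 1 then P₁.coeff (k + 1) else 0) := by
            rw [hP₂, coeff_sub, coeff_C_mul_X_pow]; ring
          rw [e, mul_add]
          refine dvd_add (hq2'' i hi) ?_
          split_ifs
          · exact htop.mul_left _
          · simp
        rw [hP₁, comp_coeff] at h4
        have e : ((q₂ * q₁ ^ (k + 1) : ℕ) : ℤ) * (taylor (r : ℤ) P).coeff i = (q₂ * ((q₁ : ℤ) ^ i * (taylor (r : ℤ) P).coeff i)) * (q₁ : ℤ) ^ (k + 1 - i) := by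
          have : (q₁ : ℤ) ^ (k + 1) = (q₁ : ℤ) ^ i * (q₁ : ℤ) ^ (k + 1 - i) := by rw [← pow_add]; congr 1; omega
          push_cast; rw [this]; ring
        rw [e]; exact h4.mul_right _
      have := dvd_taylor_coeff (Q : ℤ) ((q₂ * q₁ ^ (k + 1) : ℕ) : ℤ) (-(r : ℤ)) (taylor (r : ℤ) P) j (fun i hi => hall i (by omega))
      rw [taylor_taylor] at this
      simpa using this
end FS

namespace FS
open Finset Polynomial

lemma eval_diff_bound (G : ℤ[X]) (k : ℕ) (hk : 1 ≤ k) (hG : G.natDegree ≤ k) (Ch : ℝ) (hCh : 0 ≤ Ch)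
    (hc : ∀ j, |(G.coeff j : ℝ)| ≤ Ch * G.coeff k) (hk0 : 0 ≤ G.coeff k) (N q x y : ℕ) (hN : 1 ≤ N) (hx : x ≤ N) (hy : y ≤ N) (hyx : y ≤ x) (hxy : x ≤ y + q) :
    |((G.eval (x : ℤ) : ℤ) : ℝ) - ((G.eval (y : ℤ) : ℤ) : ℝ)| ≤ (k + 1) * k * Ch * G.coeff k * N ^ (k - 1) * q := by
  have hN1 : (1 : ℝ) ≤ N := by exact_mod_cast hN
  rw [Polynomial.eval_eq_sum_range' (n := k + 1) (by omega), Polynomial.eval_eq_sum_range' (n := k + 1) (by omega)]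
  push_cast
  rw [← Finset.sum_sub_distrib]
  refine (Finset.abs_sum_le_sum_abs _ _).trans ?_
  have : ∀ j ∈ range (k + 1), |(G.coeff j : ℝ) * (x : ℝ) ^ j - (G.coeff j : ℝ) * (y : ℝ) ^ j| ≤ k * Ch * G.coeff k * N ^ (k - 1) * q := by
    intro j hj
    have hj := Finset.mem_range.1 hj
    rw [← mul_sub, abs_mul]
    have hk0' : (0 : ℝ) ≤ G.coeff k := by exact_mod_cast hk0
    have h1 := abs_pow_sub_pow_le (x : ℝ) (y : ℝ) j
    have h2 : |(x : ℝ) - y| ≤ q := by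
      have a1 : (y : ℝ) ≤ x := by exact_mod_cast hyx
      have a2 : (x : ℝ) ≤ y + q := by exact_mod_cast hxy
      rw [abs_of_nonneg (by linarith)]; linarith
    have h3 : max |(x : ℝ)| |(y : ℝ)| ≤ N := by
      rw [Nat.abs_cast, Nat.abs_cast]
      exact max_le (by exact_mod_cast hx) (by exact_mod_cast hy)
    have h4 : |(x : ℝ) ^ j - (y : ℝ) ^ j| ≤ q * k * N ^ (k - 1) := by
      refine h1.trans ?_
      have : max |(x : ℝ)| |(y : ℝ)| ^ (j - 1) ≤ (N : ℝ) ^ (k - 1) :=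
        (pow_le_pow_left₀ (by positivity) h3 _).trans (pow_le_pow_right₀ hN1 (by omega))
      have hjk : (j : ℝ) ≤ k := by exact_mod_cast (by omega : j ≤ k)
      gcongr
    calc _ ≤ (Ch * G.coeff k) * (q * k * (N : ℝ) ^ (k - 1)) := by gcongr; exact hc j
      _ = _ := by ring
  refine (Finset.sum_le_card_nsmul _ _ _ this).trans (le_of_eq ?_)
  rw [card_range, nsmul_eq_mul]; push_cast; ring

/-- block decomposition -/
lemma block_bound (G : ℤ[X]) (N q : ℕ) (hq : 1 ≤ q) (a : ℤ) (φ E : ℝ) (hE0 : 0 ≤ E)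
    (hE : ∀ x y : ℕ, x ≤ N → y ≤ N → y ≤ x → x ≤ y + q → 2 * Real.pi * |φ - a / q| * |((G.eval (x : ℤ) : ℤ) : ℝ) - ((G.eval (y : ℤ) : ℤ) : ℝ)| ≤ E) :
    ‖∑ m ∈ range N, ee (φ * ((G.eval (m : ℤ) : ℤ) : ℝ))‖ ≤ N / q * ‖∑ n ∈ range q, ee (((((C a * G).eval (n : ℤ) : ℤ) : ℤ) : ℝ) / q)‖ + N * E + q := by
  set M := N / q with hM
  have hdm := Nat.div_add_mod N q
  have hq0 : (0 : ℝ) < q := by exact_mod_cast hq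
  set f : ℕ → ℂ := fun m => ee (φ * ((G.eval (m : ℤ) : ℤ) : ℝ)) with hf
  have hsplit : ∑ m ∈ range N, f m = ∑ m ∈ range (q * M), f m + ∑ m ∈ range (N % q), f (q * M + m) := by
    conv_lhs => rw [← hdm]
    rw [Finset.sum_range_add]
  have htail : ‖∑ m ∈ range (N % q), f (q * M + m)‖ ≤ q := by
    refine (norm_sum_le _ _).trans ?_
    simp only [hf, norm_ee, sum_const, card_range, nsmul_eq_mul, mul_one]
    exact_mod_cast (Nat.mod_lt _ hq).le
  set β := φ - a / q with hβ
  have hterm : ∀ i n : ℕ, f (q * i + n) = ee (((((C a * G).eval (n : ℤ) : ℤ) : ℤ) : ℝ) / q) * ee (β * ((G.eval ((q * i + n : ℕ) : ℤ) : ℤ) : ℝ)) := by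
    intro i n
    have e1 : ee (((((C a * G).eval (n : ℤ) : ℤ) : ℤ) : ℝ) / q) = ee (((((C a * G).eval ((q * i + n : ℕ) : ℤ) : ℤ) : ℤ) : ℝ) / q) := by
      refine ee_div_congr q hq _ _ ?_
      have h1 := Polynomial.sub_dvd_eval_sub (n : ℤ) ((q * i + n : ℕ) : ℤ) (C a * G)
      refine dvd_trans ?_ h1
      push_cast
      exact ⟨-i, by ring⟩
    rw [e1, ← ee_add]
    simp only [hf]
    congr 1
    rw [hβ]; simp only [eval_mul, eval_C]; push_cast; field_simp; ring
  have hblock : ∀ i ∈ range M, ‖∑ n ∈ range q, f (q * i + n)‖ ≤ ‖∑ n ∈ range q, ee (((((C a * G).eval (n : ℤ) : ℤ) : ℤ) : ℝ) / q)‖ + q * E := by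
    intro i hi
    have hi := Finset.mem_range.1 hi
    have hle : q * (i + 1) ≤ N := by
      calc q * (i + 1) ≤ q * M := Nat.mul_le_mul_left _ hi
        _ ≤ N := Nat.mul_div_le N q
    have e : ∑ n ∈ range q, f (q * i + n) = ee (β * ((G.eval ((q * i : ℕ) : ℤ) : ℤ) : ℝ)) * ∑ n ∈ range q, ee (((((C a * G).eval (n : ℤ) : ℤ) : ℤ) : ℝ) / q)
        + ∑ n ∈ range q, ee (((((C a * G).eval (n : ℤ) : ℤ) : ℤ) : ℝ) / q) * (ee (β * ((G.eval ((q * i + n : ℕ) : ℤ) : ℤ) : ℝ)) - ee (β * ((G.eval ((q * i : ℕ) : ℤ) : ℤ) : ℝ))) := by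
      rw [Finset.mul_sum, ← Finset.sum_add_distrib]
      refine Finset.sum_congr rfl fun n _ => ?_
      rw [hterm]; ring
    rw [e]
    refine (norm_add_le _ _).trans ?_
    rw [norm_mul, norm_ee, one_mul]
    gcongr
    refine (norm_sum_le _ _).trans ?_
    have : ∀ n ∈ range q, ‖ee (((((C a * G).eval (n : ℤ) : ℤ) : ℤ) : ℝ) / q) * (ee (β * ((G.eval ((q * i + n : ℕ) : ℤ) : ℤ) : ℝ)) - ee (β * ((G.eval ((q * i : ℕ) : ℤ) : ℤ) : ℝ)))‖ ≤ E := by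
      intro n hn
      have hn := Finset.mem_range.1 hn
      rw [norm_mul, norm_ee, one_mul]
      refine (norm_ee_sub_le _ _).trans ?_
      rw [← mul_sub, abs_mul, ← mul_assoc]
      have hle' : q * i + q ≤ N := by linarith [hle, mul_add q i 1]
      exact hE (q * i + n) (q * i) (by omega) (by omega) (by omega) (by omega)
    refine (Finset.sum_le_card_nsmul _ _ _ this).trans (le_of_eq ?_)
    rw [card_range, nsmul_eq_mul]
  have hmain : ∑ m ∈ range (q * M), f m = ∑ i ∈ range M, ∑ n ∈ range q, f (q * i + n) := by
    rw [mul_comm q M, sum_classes q M f, Finset.sum_comm]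
    refine Finset.sum_congr rfl fun i _ => Finset.sum_congr rfl fun n _ => by rw [add_comm]
  rw [hsplit, hmain]
  refine (norm_add_le _ _).trans ?_
  have h1 : ‖∑ i ∈ range M, ∑ n ∈ range q, f (q * i + n)‖ ≤ M * (‖∑ n ∈ range q, ee (((((C a * G).eval (n : ℤ) : ℤ) : ℤ) : ℝ) / q)‖ + q * E) := by
    refine (norm_sum_le _ _).trans ((Finset.sum_le_card_nsmul _ _ _ hblock).trans (le_of_eq ?_))
    rw [card_range, nsmul_eq_mul]
  have hMq : (M : ℝ) ≤ N / q := Nat.cast_div_le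
  have h2 : (M : ℝ) * (q * E) ≤ N * E := by
    have : (M : ℝ) * q ≤ N := by rwa [le_div_iff₀ hq0] at hMq
    nlinarith
  have h3 : (M : ℝ) * ‖∑ n ∈ range q, ee (((((C a * G).eval (n : ℤ) : ℤ) : ℤ) : ℝ) / q)‖ ≤ N / q * ‖∑ n ∈ range q, ee (((((C a * G).eval (n : ℤ) : ℤ) : ℤ) : ℝ) / q)‖ := by gcongr
  linarith

lemma arc (k : ℕ) (hk : 1 ≤ k) (Ch : ℝ) (hCh : 0 ≤ Ch) : ∃ C₀ : ℕ, ∀ G : ℤ[X], G.natDegree ≤ k → G.coeff 0 = 0 → G.content = 1 → 0 < G.coeff k →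
    (∀ j, |(G.coeff j : ℝ)| ≤ Ch * G.coeff k) → ∀ δ : ℝ, 0 < δ → δ ≤ 1 → ∀ N : ℕ, G.coeff k * (2 / δ) ^ C₀ ≤ N → ∀ φ : ℝ,
    δ * N ≤ ‖∑ m ∈ range N, ee (φ * ((G.eval (m : ℤ) : ℤ) : ℝ))‖ →
    ∃ q : ℕ, ∃ a : ℤ, 1 ≤ q ∧ (q : ℝ) ≤ (2 / δ) ^ C₀ ∧ IsCoprime a (q : ℤ) ∧ |φ - a / q| ≤ (2 / δ) ^ C₀ / (G.coeff k * N ^ k) ∧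
      ‖∑ m ∈ range N, ee (φ * ((G.eval (m : ℤ) : ℤ) : ℝ))‖ ≤ N / q * ‖∑ n ∈ range q, ee (((((C a * G).eval (n : ℤ) : ℤ) : ℤ) : ℝ) / q)‖ + δ / 2 * N := by
  obtain ⟨C₁, h₁⟩ := weyl_top k hk
  obtain ⟨C₂, h₂⟩ := complete_all k
  obtain ⟨C₃, hC₃⟩ : ∃ C₃ : ℕ, 8 * ((k + 1) * k * Ch) + 1 ≤ (2 : ℝ) ^ C₃ :=
    pow_unbounded_of_one_lt _ (by norm_num : (1 : ℝ) < 2) |>.imp fun _ h => h.le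
  refine ⟨C₃ + 2 * C₁ + 2 * C₂ + 1, fun G hGd hG0 hGc hGk hGj δ hδ hδ1 N hN φ hs => ?_⟩
  set x := 2 / δ with hx
  have hx2 : 2 ≤ x := by rw [hx, le_div_iff₀ hδ]; linarith
  have hx1 : 1 ≤ x := by linarith
  have hgk : (0 : ℝ) < G.coeff k := by exact_mod_cast hGk
  have hgk1 : (1 : ℝ) ≤ G.coeff k := by exact_mod_cast hGk
  have hN0 : (0 : ℝ) < N := lt_of_lt_of_le (by positivity) hN
  have hN1 : 1 ≤ N := by exact_mod_cast hN0
  set R : ℝ[X] := C φ * G.map (Int.castRingHom ℝ) with hR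
  have hRe : ∀ n : ℕ, R.eval (n : ℝ) = φ * ((G.eval (n : ℤ) : ℤ) : ℝ) := by
    intro n
    rw [hR, eval_mul, eval_C]
    have : (G.map (Int.castRingHom ℝ)).eval (n : ℝ) = ((G.eval (n : ℤ) : ℤ) : ℝ) := by
      have := Polynomial.eval_intCast_map (Int.castRingHom ℝ) G (n : ℤ)
      simpa using this
    rw [this]
  obtain ⟨q₁, hq1, hq1', b, hb⟩ := h₁ N hN1 δ hδ hδ1 R (by
    refine (natDegree_C_mul_le _ _).trans ((natDegree_map_le).trans hGd)) N le_rfl (by simpa only [hRe] using hs)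
  have hRc : R.coeff k = φ * G.coeff k := by rw [hR, coeff_C_mul, coeff_map]; simp
  rw [hRc] at hb
  -- reduce the fraction
  set r : ℚ := (b : ℚ) / ((q₁ : ℤ) * G.coeff k : ℤ) with hr
  have hq1r : (1 : ℝ) ≤ q₁ := by exact_mod_cast hq1
  have hrR : (r : ℝ) = (b : ℝ) / (q₁ * G.coeff k) := by rw [hr]; push_cast; rfl
  have hden : (r.den : ℝ) ≤ q₁ * G.coeff k := by
    have h1 : (r.den : ℤ) ∣ (q₁ : ℤ) * G.coeff k := by
      rw [hr, ← Rat.divInt_eq_div]; exact Rat.den_dvd _ _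
    have h2 : (r.den : ℤ) ≤ (q₁ : ℤ) * G.coeff k := Int.le_of_dvd (by positivity) h1
    exact_mod_cast h2
  have hrnd : (r : ℝ) = (r.num : ℝ) / (r.den : ℝ) := by exact_mod_cast (Rat.num_div_den r).symm
  have hβ : |φ - (r.num : ℝ) / r.den| ≤ x ^ C₁ / (G.coeff k * N ^ k) := by
    rw [← hrnd, hrR]
    have e : φ - (b : ℝ) / (q₁ * G.coeff k) = (q₁ * (φ * G.coeff k) - b) / (q₁ * G.coeff k) := by
      field_simp
    rw [e, abs_div, abs_of_pos (by positivity : (0 : ℝ) < q₁ * G.coeff k), div_le_div_iff₀ (by positivity) (by positivity)]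
    rw [le_div_iff₀ (by positivity)] at hb
    calc _ = (|q₁ * (φ * G.coeff k) - b| * N ^ k) * G.coeff k := by ring
      _ ≤ x ^ C₁ * (1 * G.coeff k) := by rw [one_mul]; gcongr
      _ ≤ x ^ C₁ * (q₁ * G.coeff k) := by gcongr
  have hqb : (r.den : ℝ) ≤ x ^ C₁ * G.coeff k := hden.trans (by gcongr)
  set E := 2 * Real.pi * (x ^ C₁ / (G.coeff k * N ^ k)) * ((k + 1) * k * Ch * G.coeff k * N ^ (k - 1) * r.den) with hE
  have hE0 : 0 ≤ E := by positivity
  have hblock := block_bound G N r.den r.den_pos r.num φ E hE0 (by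
    intro x y hx hy hyx hxy
    rw [hE]
    gcongr
    exact eval_diff_bound G k hk hGd Ch hCh hGj hGk.le N r.den x y hN1 hx hy hyx hxy)
  have hNE : N * E ≤ 8 * ((k + 1) * k * Ch) * (x ^ C₁ * (x ^ C₁ * G.coeff k)) := by
    have hpow : (N : ℝ) ^ k = N * N ^ (k - 1) := by rw [← pow_succ', Nat.sub_add_cancel hk]
    have e : N * E = 2 * Real.pi * ((k + 1) * k * Ch) * (x ^ C₁ * r.den) := by
      rw [hE, hpow]; field_simp
    rw [e]
    have : 2 * Real.pi ≤ 8 := by linarith [Real.pi_le_four]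
    gcongr
  have herr : N * E + r.den ≤ δ / 2 * N := by
    have e : δ / 2 = 1 / x := by rw [hx]; field_simp
    rw [e, div_mul_eq_mul_div, one_mul, le_div_iff₀ (by linarith)]
    have h5 : x ^ C₁ * G.coeff k ≤ x ^ C₁ * (x ^ C₁ * G.coeff k) := by
      have : 1 ≤ x ^ C₁ := one_le_pow₀ hx1
      have h0 : 0 ≤ x ^ C₁ * G.coeff k := by positivity
      nlinarith
    calc (N * E + r.den) * x ≤ (8 * ((k + 1) * k * Ch) * (x ^ C₁ * (x ^ C₁ * G.coeff k)) + x ^ C₁ * (x ^ C₁ * G.coeff k)) * x := by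
          gcongr; linarith
      _ = (8 * ((k + 1) * k * Ch) + 1) * (x ^ C₁ * (x ^ C₁ * G.coeff k)) * x := by ring
      _ ≤ x ^ C₃ * (x ^ C₁ * (x ^ C₁ * G.coeff k)) * x := by
          have : (2 : ℝ) ^ C₃ ≤ x ^ C₃ := by gcongr
          have := hC₃.trans this
          gcongr
      _ = G.coeff k * x ^ (C₃ + 2 * C₁ + 1) := by ring
      _ ≤ G.coeff k * x ^ (C₃ + 2 * C₁ + 2 * C₂ + 1) := mul_le_mul_of_nonneg_left (pow_le_pow_right₀ hx1 (by omega)) hgk.le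
      _ ≤ N := hN
  have hfin : ‖∑ m ∈ range N, ee (φ * ((G.eval (m : ℤ) : ℤ) : ℝ))‖ ≤ N / r.den * ‖∑ n ∈ range r.den, ee (((((C r.num * G).eval (n : ℤ) : ℤ) : ℤ) : ℝ) / r.den)‖ + δ / 2 * N := by
    linarith
  have hcop : IsCoprime r.num (r.den : ℤ) := by
    rw [Int.isCoprime_iff_gcd_eq_one]
    exact r.reduced
  refine ⟨r.den, r.num, r.den_pos, ?_, hcop, hβ.trans ?_, hfin⟩
  · -- exact version
    have hden0 : (0 : ℝ) < r.den := by exact_mod_cast r.den_pos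
    obtain ⟨q', hq', hq'', hq3⟩ := h₂ r.den r.den_pos (δ / 2) (by positivity) (by linarith) (C r.num * G) ((natDegree_C_mul_le _ _).trans hGd) (by
      have h6 := hs.trans hfin
      have h7 : δ / 2 * N ≤ N / r.den * ‖∑ n ∈ range r.den, ee (((((C r.num * G).eval (n : ℤ) : ℤ) : ℤ) : ℝ) / r.den)‖ := by linarith
      rw [div_mul_eq_mul_div (N : ℝ), le_div_iff₀ hden0] at h7
      have h8 : (N : ℝ) * (δ / 2 * r.den) ≤ N * ‖∑ n ∈ range r.den, ee (((((C r.num * G).eval (n : ℤ) : ℤ) : ℤ) : ℝ) / r.den)‖ := by linarith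
      exact le_of_mul_le_mul_left h8 hN0)
    have hdvd : (r.den : ℤ) ∣ q' := by
      have h9 : ∀ j, (r.den : ℤ) ∣ (C (q' : ℤ) * G).coeff j := by
        intro j
        rw [coeff_C_mul]
        rcases Nat.eq_zero_or_pos j with h0 | h0
        · rw [h0, hG0]; simp
        · have := hq3 j h0
          rw [coeff_C_mul, mul_left_comm] at this
          exact hcop.symm.dvd_of_dvd_mul_left this
      have h10 : (r.den : ℤ) ∣ (C (q' : ℤ) * G).content := dvd_content_iff_C_dvd.2 ((C_dvd_iff_dvd_coeff _ _).2 h9)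
      rw [content_C_mul, hGc, mul_one] at h10
      simpa using h10
    have h11 : (r.den : ℝ) ≤ q' := by
      have : (r.den : ℤ) ≤ q' := Int.le_of_dvd (by exact_mod_cast hq') hdvd
      exact_mod_cast this
    refine h11.trans (hq''.trans ?_)
    have e : 2 / (δ / 2) = 2 * x := by rw [hx]; field_simp
    rw [e]
    calc (2 * x) ^ C₂ ≤ (x * x) ^ C₂ := by gcongr
      _ = x ^ (2 * C₂) := by rw [← pow_two, ← pow_mul]
      _ ≤ _ := pow_le_pow_right₀ hx1 (by omega)
  · exact div_le_div_of_nonneg_right (pow_le_pow_right₀ hx1 (by omega)) (by positivity)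
end FS

namespace FS
open Finset Polynomial

lemma ee_eq_one (x : ℝ) (h : ee x = 1) : x = round x := by
  have := le_norm_ee_sub_one_round x
  rw [h, sub_self, norm_zero] at this
  have h2 : |x - round x| = 0 := le_antisymm (by linarith) (abs_nonneg _)
  linarith [abs_eq_zero.1 h2]

lemma ee_div_ne_one (q : ℕ) (hq : 0 < q) (c : ℤ) (h : ¬ (q : ℤ) ∣ c) : ee ((c : ℝ) / q) ≠ 1 := by
  intro h1
  have h2 := ee_eq_one _ h1
  refine h ⟨round ((c : ℝ) / q), ?_⟩
  have : (q : ℝ) ≠ 0 := by exact_mod_cast hq.ne'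
  rw [div_eq_iff this] at h2
  have h3 : (c : ℝ) = ((round ((c : ℝ) / q) * q : ℤ) : ℝ) := by push_cast; exact h2
  have h4 := Int.cast_injective h3
  linarith

lemma sum_shift (Q c : ℕ) (f : ℕ → ℂ) (hf : ∀ n, f (n + Q) = f n) :
    ∑ n ∈ range Q, f (n + c) = ∑ n ∈ range Q, f n := by
  induction c with
  | zero => simp
  | succ c ih =>
    rw [← ih]
    have h1 := Finset.sum_range_succ (fun n => f (n + c)) Q
    have h2 := Finset.sum_range_succ' (fun n => f (n + c)) Q
    have h3 : f (Q + c) = f (0 + c) := by rw [zero_add, add_comm, hf]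
    rw [h1, h3] at h2
    have := add_right_cancel h2
    rw [this]
    refine Finset.sum_congr rfl fun n _ => ?_
    congr 1; ring

/-- the complete exponential sum -/
noncomputable def cs (G : ℤ[X]) (q : ℕ) (a : ℤ) : ℂ := ∑ n ∈ range q, ee (((a * G.eval (n : ℤ) : ℤ) : ℝ) / q)

lemma cs_period (G : ℤ[X]) (q : ℕ) (hq : 0 < q) (a : ℤ) (n m : ℕ) (h : (q : ℤ) ∣ (n : ℤ) - m) :
    ee (((a * G.eval (n : ℤ) : ℤ) : ℝ) / q) = ee (((a * G.eval (m : ℤ) : ℤ) : ℝ) / q) := by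
  refine ee_div_congr q hq _ _ ?_
  rw [← mul_sub]
  exact ((h.trans (Polynomial.sub_dvd_eval_sub (n : ℤ) (m : ℤ) G))).mul_left _

lemma cs_linear (G : ℤ[X]) (p j : ℕ) (hp : p.Prime) (hj : 1 ≤ j) (a : ℤ) (ha : IsCoprime a (p : ℤ))
    (h1 : ¬ (p : ℤ) ∣ G.coeff 1) (h2 : ∀ i, 2 ≤ i → (p : ℤ) ∣ G.coeff i) : cs G (p ^ j) a = 0 := by
  have hp0 : 0 < p := hp.pos
  have hq : 0 < p ^ j := pow_pos hp0 _
  have hpj : p ^ j = p ^ (j - 1) * p := by rw [← pow_succ, Nat.sub_add_cancel hj]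
  have hG : ∀ n : ℤ, ((p ^ j : ℕ) : ℤ) ∣ G.eval (n + (p : ℤ) ^ (j - 1)) - (G.eval n + (p : ℤ) ^ (j - 1) * G.coeff 1) := by
    intro n
    rw [Polynomial.eval_eq_sum_range' (n := G.natDegree + 2) (by omega), Polynomial.eval_eq_sum_range' (n := G.natDegree + 2) (by omega)]
    rw [sub_add_eq_sub_sub, ← Finset.sum_sub_distrib]
    have e : (p : ℤ) ^ (j - 1) * G.coeff 1 = ∑ i ∈ range (G.natDegree + 2), if i = 1 then (p : ℤ) ^ (j - 1) * G.coeff 1 else 0 := by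
      rw [Finset.sum_ite_eq' (range (G.natDegree + 2)) 1]
      simp
    rw [e, ← Finset.sum_sub_distrib]
    refine Finset.dvd_sum fun i _ => ?_
    rcases i with _ | _ | i
    · simp
    · simp; ring_nf; simp
    · rw [if_neg (by omega), sub_zero, ← mul_sub, hpj]
      push_cast
      rw [mul_comm]
      refine mul_dvd_mul (h2 _ (by omega)) ?_
      have := sub_dvd_pow_sub_pow (n + (p : ℤ) ^ (j - 1)) n (i + 1 + 1)
      simpa using this
  have hne : ee (((a * G.coeff 1 : ℤ) : ℝ) / p) ≠ 1 := by
    refine ee_div_ne_one p hp0 _ ?_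
    intro h
    exact h1 (ha.symm.dvd_of_dvd_mul_left h)
  have hsh := sum_shift (p ^ j) (p ^ (j - 1)) (fun n => ee (((a * G.eval (n : ℤ) : ℤ) : ℝ) / (p ^ j : ℕ))) (by
    intro n
    exact cs_period G _ hq a _ _ (by simp))
  have h3 : ∑ n ∈ range (p ^ j), ee (((a * G.eval ((n + p ^ (j - 1) : ℕ) : ℤ) : ℤ) : ℝ) / (p ^ j : ℕ)) = ee (((a * G.coeff 1 : ℤ) : ℝ) / p) * cs G (p ^ j) a := by
    rw [cs, Finset.mul_sum]
    refine Finset.sum_congr rfl fun n _ => ?_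
    have hpR : (p : ℝ) ≠ 0 := by exact_mod_cast hp0.ne'
    have e1 : ((a * G.coeff 1 : ℤ) : ℝ) / p = (((p : ℤ) ^ (j - 1) * (a * G.coeff 1) : ℤ) : ℝ) / (p ^ j : ℕ) := by
      rw [hpj]; push_cast; field_simp
    rw [e1, ← ee_add, ← add_div, ← Int.cast_add]
    refine ee_div_congr _ hq _ _ ?_
    have := (hG n).mul_left a
    have e3 : ∀ z : ℤ, a * z - ((p : ℤ) ^ (j - 1) * (a * G.coeff 1) + a * eval (n : ℤ) G) = a * (z - (eval (n : ℤ) G + (p : ℤ) ^ (j - 1) * G.coeff 1)) := fun z => by ring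
    rw [e3]
    simpa using this
  rw [h3] at hsh
  have h4 : (ee (((a * G.coeff 1 : ℤ) : ℝ) / p) - 1) * cs G (p ^ j) a = 0 := by
    rw [sub_mul, one_mul, hsh]; simp [cs]
  exact (mul_eq_zero.1 h4).resolve_left (sub_ne_zero.2 hne)

lemma sum_zmod (p : ℕ) [NeZero p] (F : ZMod p → ℂ) : ∑ x : ZMod p, F x = ∑ n ∈ range p, F (n : ZMod p) := by
  refine Finset.sum_bij' (fun x _ => x.val) (fun n _ => (n : ZMod p)) ?_ ?_ ?_ ?_ ?_
  · intro x _; exact Finset.mem_range.2 (ZMod.val_lt x)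
  · intro n _; exact Finset.mem_univ _
  · intro x _; simp
  · intro n hn; exact ZMod.val_cast_of_lt (Finset.mem_range.1 hn)
  · intro x _; simp

lemma stdAddChar_ee (p : ℕ) [NeZero p] (c : ℤ) : ZMod.stdAddChar (c : ZMod p) = ee ((c : ℝ) / p) := by
  rw [ZMod.stdAddChar_coe, ee]; congr 1; push_cast; ring

lemma cs_prime (G : ℤ[X]) (p k : ℕ) (hp : p.Prime) (hG : G.natDegree ≤ k) (hkp : k < p) (a : ℤ) (ha : IsCoprime a (p : ℤ))
    (h1 : ∃ i, 1 ≤ i ∧ ¬ (p : ℤ) ∣ G.coeff i) : ‖cs G p a‖ ≤ k * Real.sqrt p := by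
  have : Fact p.Prime := ⟨hp⟩
  set f : (ZMod p)[X] := (C a * G).map (Int.castRingHom (ZMod p)) with hf
  have h2 : cs G p a = ∑ x : ZMod p, ZMod.stdAddChar (f.eval x) := by
    rw [sum_zmod, cs]
    refine Finset.sum_congr rfl fun n _ => ?_
    have : f.eval ((n : ℕ) : ZMod p) = ((a * G.eval (n : ℤ) : ℤ) : ZMod p) := by
      have := Polynomial.eval_intCast_map (Int.castRingHom (ZMod p)) (C a * G) (n : ℤ)
      rw [eval_mul, eval_C, Int.cast_natCast] at this
      rw [hf, this]; rfl
    rw [this, stdAddChar_ee]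
  have hfd : f.natDegree ≤ k := natDegree_map_le.trans ((natDegree_C_mul_le _ _).trans hG)
  have hfd1 : 1 ≤ f.natDegree := by
    obtain ⟨i, hi, hi2⟩ := h1
    refine hi.trans (le_natDegree_of_ne_zero ?_)
    rw [hf, coeff_map, coeff_C_mul]
    intro h0
    have : ((a * G.coeff i : ℤ) : ZMod p) = 0 := by simpa using h0
    rw [ZMod.intCast_zmod_eq_zero_iff_dvd] at this
    exact hi2 (ha.symm.dvd_of_dvd_mul_left this)
  rw [h2]
  refine (weil (ZMod.stdAddChar (N := p)) ?_ f hfd1 (by omega)).trans ?_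
  · intro h
    have h3 := ee_div_ne_one p hp.pos 1 (by
      intro h
      have := Int.natCast_dvd_natCast.1 (by simpa using h : ((p : ℕ) : ℤ) ∣ ((1 : ℕ) : ℤ))
      exact hp.one_lt.ne' (Nat.dvd_one.1 this))
    rw [← stdAddChar_ee, h] at h3
    simp at h3
  · gcongr

lemma card_roots_mod (G : ℤ[X]) (p k : ℕ) (hp : p.Prime) (hG : G.natDegree ≤ k) (h1 : ∃ i, ¬ (p : ℤ) ∣ G.coeff i) :
    ((range p).filter fun u : ℕ => (p : ℤ) ∣ G.eval (u : ℤ)).card ≤ k := by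
  classical
  have : Fact p.Prime := ⟨hp⟩
  set f : (ZMod p)[X] := G.map (Int.castRingHom (ZMod p)) with hf
  have hf0 : f ≠ 0 := by
    obtain ⟨i, hi⟩ := h1
    intro h0
    have : f.coeff i = 0 := by rw [h0]; simp
    rw [hf, coeff_map] at this
    have : ((G.coeff i : ℤ) : ZMod p) = 0 := by simpa using this
    rw [ZMod.intCast_zmod_eq_zero_iff_dvd] at this
    exact hi this
  have h2 : ((range p).filter fun u : ℕ => (p : ℤ) ∣ G.eval (u : ℤ)).card ≤ f.roots.toFinset.card := by
    refine Finset.card_le_card_of_injOn (fun u : ℕ => (u : ZMod p)) ?_ ?_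
    · intro u hu
      obtain ⟨hu1, hu2⟩ := Finset.mem_filter.1 (Finset.mem_coe.1 hu)
      rw [Finset.mem_coe, Multiset.mem_toFinset, mem_roots hf0, IsRoot.def]
      have := Polynomial.eval_intCast_map (Int.castRingHom (ZMod p)) G (u : ℤ)
      have h3 : ((G.eval (u : ℤ) : ℤ) : ZMod p) = 0 := (ZMod.intCast_zmod_eq_zero_iff_dvd _ _).2 hu2
      simp only [Int.cast_natCast] at this
      rw [hf, this]; simpa using h3
    · intro u hu v hv huv
      have hu1 := Finset.mem_range.1 (Finset.mem_filter.1 (Finset.mem_coe.1 hu)).1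
      have hv1 := Finset.mem_range.1 (Finset.mem_filter.1 (Finset.mem_coe.1 hv)).1
      have := (ZMod.natCast_eq_natCast_iff' u v p).1 huv
      rwa [Nat.mod_eq_of_lt hu1, Nat.mod_eq_of_lt hv1] at this
  refine h2.trans ((Multiset.toFinset_card_le _).trans ((card_roots' f).trans (natDegree_map_le.trans hG)))

lemma cs_pp (G : ℤ[X]) (p j k : ℕ) (hp : p.Prime) (hj : 2 ≤ j) (hG : G.natDegree ≤ k) (hkp : k < p) (a : ℤ) (ha : IsCoprime a (p : ℤ))
    (h1 : ∃ i, 1 ≤ i ∧ ¬ (p : ℤ) ∣ G.coeff i) : ‖cs G (p ^ j) a‖ ≤ p ^ (j - 1) * k := by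
  classical
  have hp0 : 0 < p := hp.pos
  have hq : 0 < p ^ j := pow_pos hp0 _
  have hpR : (p : ℝ) ≠ 0 := by exact_mod_cast hp0.ne'
  have hpj : p ^ j = p * p ^ (j - 1) := by rw [← pow_succ', Nat.sub_add_cancel (by omega)]
  have hpj2 : p ^ (j - 1) = p * p ^ (j - 2) := by rw [← pow_succ']; congr 1; omega
  have hinner : ∀ u : ℕ, ∑ v ∈ range p, ee (((a * G.eval ((u + p ^ (j - 1) * v : ℕ) : ℤ) : ℤ) : ℝ) / (p ^ j : ℕ))
      = ee (((a * G.eval (u : ℤ) : ℤ) : ℝ) / (p ^ j : ℕ)) * (if (p : ℤ) ∣ G.derivative.eval (u : ℤ) then (p : ℂ) else 0) := by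
    intro u
    have e1 : ∀ v : ℕ, ee (((a * G.eval ((u + p ^ (j - 1) * v : ℕ) : ℤ) : ℤ) : ℝ) / (p ^ j : ℕ))
        = ee (((a * G.eval (u : ℤ) : ℤ) : ℝ) / (p ^ j : ℕ)) * ee (((a * G.derivative.eval (u : ℤ) : ℤ) : ℝ) / p) ^ v := by
      intro v
      rw [← ee_mul_nat, ← ee_add]
      have e2 : ((a * G.eval (u : ℤ) : ℤ) : ℝ) / (p ^ j : ℕ) + v * (((a * G.derivative.eval (u : ℤ) : ℤ) : ℝ) / p)
          = ((a * G.eval (u : ℤ) + v * (a * G.derivative.eval (u : ℤ)) * (p : ℤ) ^ (j - 1) : ℤ) : ℝ) / (p ^ j : ℕ) := by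
        rw [hpj]; push_cast; field_simp
      rw [e2]
      refine ee_div_congr _ hq _ _ ?_
      obtain ⟨c, hc⟩ := G.binomExpansion (u : ℤ) ((p : ℤ) ^ (j - 1) * v)
      push_cast
      rw [hc]
      have h5 : (p : ℤ) ^ j ∣ ((p : ℤ) ^ (j - 1)) ^ 2 := by rw [← pow_mul]; exact pow_dvd_pow _ (by omega)
      have h6 : a * (eval (u : ℤ) G + eval (u : ℤ) (derivative G) * ((p : ℤ) ^ (j - 1) * v) + c * ((p : ℤ) ^ (j - 1) * v) ^ 2) - (a * eval (u : ℤ) G + v * (a * eval (u : ℤ) (derivative G)) * (p : ℤ) ^ (j - 1))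
        = ((p : ℤ) ^ (j - 1)) ^ 2 * (a * c * v ^ 2) := by ring
      rw [h6]
      exact h5.mul_right _
    simp only [e1]
    rw [← Finset.mul_sum]
    congr 1
    split_ifs with h
    · have : ee (((a * G.derivative.eval (u : ℤ) : ℤ) : ℝ) / p) = 1 := by
        obtain ⟨c, hc⟩ := h
        rw [hc]
        have : ((a * (p * c) : ℤ) : ℝ) / p = ((a * c : ℤ) : ℝ) := by push_cast; field_simp
        rw [this, ee_int]
      rw [this]; simp
    · have hne := ee_div_ne_one p hp0 (a * G.derivative.eval (u : ℤ)) (fun h' => h (ha.symm.dvd_of_dvd_mul_left h'))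
      have h7 := geom_sum_mul (ee (((a * G.derivative.eval (u : ℤ) : ℤ) : ℝ) / p)) p
      rw [← ee_mul_nat, mul_div_cancel₀ _ hpR, ee_int, sub_self] at h7
      exact (mul_eq_zero.1 h7).resolve_right (sub_ne_zero.2 hne)
  have h2 : cs G (p ^ j) a = ∑ u ∈ range (p ^ (j - 1)), ee (((a * G.eval (u : ℤ) : ℤ) : ℝ) / (p ^ j : ℕ)) * (if (p : ℤ) ∣ G.derivative.eval (u : ℤ) then (p : ℂ) else 0) := by
    rw [cs]
    have := sum_classes (p ^ (j - 1)) p (fun n => ee (((a * G.eval (n : ℤ) : ℤ) : ℝ) / (p ^ j : ℕ)))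
    rw [← hpj] at this
    rw [this]
    exact Finset.sum_congr rfl fun u _ => hinner u
  have h3 : ‖cs G (p ^ j) a‖ ≤ p * ((range (p ^ (j - 1))).filter fun u : ℕ => (p : ℤ) ∣ G.derivative.eval (u : ℤ)).card := by
    rw [h2]
    refine (norm_sum_le _ _).trans ?_
    simp only [norm_mul, norm_ee, one_mul]
    have : ∀ u : ℕ, ‖(if (p : ℤ) ∣ G.derivative.eval (u : ℤ) then (p : ℂ) else 0)‖ = if (p : ℤ) ∣ G.derivative.eval (u : ℤ) then (p : ℝ) else 0 := by
      intro u; split_ifs <;> simp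
    simp only [this]
    rw [← Finset.sum_filter, Finset.sum_const, nsmul_eq_mul, mul_comm]
  have h4 : ((((range (p ^ (j - 1))).filter fun u : ℕ => (p : ℤ) ∣ G.derivative.eval (u : ℤ)).card : ℕ) : ℂ)
      = (p ^ (j - 2) : ℕ) * ((((range p).filter fun u : ℕ => (p : ℤ) ∣ G.derivative.eval (u : ℤ)).card : ℕ) : ℂ) := by
    rw [Finset.card_filter, Finset.card_filter]
    have := sum_period p (p ^ (j - 2)) (fun u : ℕ => if (p : ℤ) ∣ G.derivative.eval (u : ℤ) then (1 : ℂ) else 0) (by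
      intro n
      have h5 : (p : ℤ) ∣ G.derivative.eval ((n + p : ℕ) : ℤ) - G.derivative.eval (n : ℤ) := by
        refine dvd_trans ?_ (Polynomial.sub_dvd_eval_sub ((n + p : ℕ) : ℤ) (n : ℤ) G.derivative)
        simp
      have h6 : (p : ℤ) ∣ G.derivative.eval ((n + p : ℕ) : ℤ) ↔ (p : ℤ) ∣ G.derivative.eval (n : ℤ) := (dvd_iff_dvd_of_dvd_sub h5)
      simp only [h6])
    rw [← hpj2] at this
    rw [Nat.cast_sum, Nat.cast_sum]
    simp only [Nat.cast_ite, Nat.cast_one, Nat.cast_zero]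
    exact this
  have h5 : ((range (p ^ (j - 1))).filter fun u : ℕ => (p : ℤ) ∣ G.derivative.eval (u : ℤ)).card ≤ p ^ (j - 2) * k := by
    have h6 : ((range (p ^ (j - 1))).filter fun u : ℕ => (p : ℤ) ∣ G.derivative.eval (u : ℤ)).card = p ^ (j - 2) * ((range p).filter fun u : ℕ => (p : ℤ) ∣ G.derivative.eval (u : ℤ)).card := by
      exact_mod_cast h4
    rw [h6]
    refine Nat.mul_le_mul_left _ (card_roots_mod G.derivative p k hp ((natDegree_derivative_le G).trans (by omega)) ?_)
    obtain ⟨i, hi, hi2⟩ := h1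
    refine ⟨i - 1, ?_⟩
    rw [coeff_derivative, Nat.sub_add_cancel hi]
    intro h
    rcases (Nat.prime_iff_prime_int.1 hp).dvd_or_dvd h with h | h
    · exact hi2 h
    · have hik : i ≤ k := by
        by_contra hc
        rw [coeff_eq_zero_of_natDegree_lt (by omega)] at hi2
        simp at hi2
      have h' : (p : ℤ) ∣ ((i : ℕ) : ℤ) := by
        have e : (((i - 1 : ℕ) : ℤ) + 1) = (i : ℤ) := by omega
        rwa [e] at h
      have := Nat.le_of_dvd hi (Int.natCast_dvd_natCast.1 h')
      omega
  refine h3.trans ?_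
  have h8 : (p : ℝ) ^ (j - 1) = p * p ^ (j - 2) := by exact_mod_cast hpj2
  rw [h8, mul_assoc]
  gcongr
  exact_mod_cast h5

lemma sum_crt (q₁ q₂ : ℕ) (hq₁ : 0 < q₁) (hq₂ : 0 < q₂) (hc : Nat.Coprime q₁ q₂) (F H : ℕ → ℂ) (hF : ∀ n m, n ≡ m [MOD q₁] → F n = F m) (hH : ∀ n m, n ≡ m [MOD q₂] → H n = H m) :
    ∑ n ∈ range (q₁ * q₂), F n * H n = (∑ u ∈ range q₁, F u) * ∑ v ∈ range q₂, H v := by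
  rw [Finset.sum_mul_sum, ← Finset.sum_product']
  refine Finset.sum_bij (fun n _ => (n % q₁, n % q₂)) ?_ ?_ ?_ ?_
  · intro n _
    exact Finset.mem_product.2 ⟨Finset.mem_range.2 (Nat.mod_lt _ hq₁), Finset.mem_range.2 (Nat.mod_lt _ hq₂)⟩
  · intro n hn m hm h
    have h1 : n ≡ m [MOD q₁] := (Prod.mk.inj h).1
    have h2 : n ≡ m [MOD q₂] := (Prod.mk.inj h).2
    have h3 := (Nat.modEq_and_modEq_iff_modEq_mul hc).1 ⟨h1, h2⟩
    exact Nat.ModEq.eq_of_lt_of_lt h3 (Finset.mem_range.1 hn) (Finset.mem_range.1 hm)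
  · rintro ⟨u, v⟩ huv
    obtain ⟨hu, hv⟩ := Finset.mem_product.1 huv
    have hu := Finset.mem_range.1 hu
    have hv := Finset.mem_range.1 hv
    refine ⟨Nat.chineseRemainder hc u v, Finset.mem_range.2 (Nat.chineseRemainder_lt_mul hc u v hq₁.ne' hq₂.ne'), ?_⟩
    have := (Nat.chineseRemainder hc u v).2
    simp only at hu hv
    refine Prod.ext ?_ ?_
    · exact (show _ % q₁ = u % q₁ from this.1).trans (Nat.mod_eq_of_lt hu)
    · exact (show _ % q₂ = v % q₂ from this.2).trans (Nat.mod_eq_of_lt hv)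
  · intro n _
    simp only
    rw [hF n (n % q₁) (Nat.mod_modEq n q₁).symm, hH n (n % q₂) (Nat.mod_modEq n q₂).symm]

lemma cs_mul (G : ℤ[X]) (q₁ q₂ : ℕ) (hq₁ : 0 < q₁) (hq₂ : 0 < q₂) (hc : Nat.Coprime q₁ q₂) (a : ℤ) (ha : IsCoprime a ((q₁ * q₂ : ℕ) : ℤ)) :
    ∃ a₁ a₂ : ℤ, IsCoprime a₁ (q₁ : ℤ) ∧ IsCoprime a₂ (q₂ : ℤ) ∧ cs G (q₁ * q₂) a = cs G q₁ a₁ * cs G q₂ a₂ := by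
  obtain ⟨s, t, hst⟩ := Nat.isCoprime_iff_coprime.2 hc
  push_cast at ha
  have ha1 : IsCoprime a (q₁ : ℤ) := (IsCoprime.mul_right_iff.1 ha).1
  have ha2 : IsCoprime a (q₂ : ℤ) := (IsCoprime.mul_right_iff.1 ha).2
  have ht : IsCoprime t (q₁ : ℤ) := ⟨q₂, s, by linarith⟩
  have hs : IsCoprime s (q₂ : ℤ) := ⟨q₁, t, by linarith⟩
  refine ⟨a * t, a * s, ha1.mul_left ht, ha2.mul_left hs, ?_⟩
  have hmod : ∀ (q n m : ℕ), n ≡ m [MOD q] → (q : ℤ) ∣ (n : ℤ) - m := fun q n m h => (Nat.modEq_iff_dvd.1 h.symm)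
  have := sum_crt q₁ q₂ hq₁ hq₂ hc (fun n => ee (((a * t * G.eval (n : ℤ) : ℤ) : ℝ) / q₁)) (fun n => ee (((a * s * G.eval (n : ℤ) : ℤ) : ℝ) / q₂))
    (fun n m h => cs_period G q₁ hq₁ _ n m (hmod _ _ _ h)) (fun n m h => cs_period G q₂ hq₂ _ n m (hmod _ _ _ h))
  rw [cs, cs, cs, ← this]
  refine Finset.sum_congr rfl fun n _ => ?_
  rw [← ee_add]
  congr 1
  have r1 : (q₁ : ℝ) ≠ 0 := by exact_mod_cast hq₁.ne'
  have r2 : (q₂ : ℝ) ≠ 0 := by exact_mod_cast hq₂.ne'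
  have hst' : (s : ℝ) * q₁ + t * q₂ = 1 := by exact_mod_cast hst
  push_cast
  field_simp
  linear_combination (-(a : ℝ) * (eval (n : ℤ) G : ℤ)) * hst'

/-- bound for complete sums -/
lemma cs_bound (G : ℤ[X]) (k y : ℕ) (ε : ℝ) (hε : k ≤ ε * Real.sqrt y) (hky : k ≤ y) (hy : 1 ≤ y) (hG : G.natDegree ≤ k)
    (hsmall : ∀ p : ℕ, p.Prime → p ≤ y → ¬ (p : ℤ) ∣ G.coeff 1 ∧ ∀ i, 2 ≤ i → (p : ℤ) ∣ G.coeff i)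
    (hlarge : ∀ p : ℕ, p.Prime → y < p → ∃ i, 1 ≤ i ∧ ¬ (p : ℤ) ∣ G.coeff i) (q : ℕ) :
    1 ≤ q → ∀ a : ℤ, IsCoprime a (q : ℤ) → ‖cs G q a‖ ≤ q * ∏ p ∈ q.primeFactors, (if p ≤ y then 0 else ε) := by
  induction q using Nat.recOnPosPrimePosCoprime with
  | zero => intro h; omega
  | one => intro _ a _; simp [cs, norm_ee]
  | prime_pow p n hp hn =>
    intro _ a ha
    have hap : IsCoprime a (p : ℤ) := by
      push_cast at ha
      exact ha.of_isCoprime_of_dvd_right (dvd_pow_self _ hn.ne')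
    rw [Nat.primeFactors_prime_pow hn.ne' hp, Finset.prod_singleton]
    have hp0 : (0 : ℝ) < p := by exact_mod_cast hp.pos
    split_ifs with h
    · rw [cs_linear G p n hp hn a hap (hsmall p hp h).1 (hsmall p hp h).2]; simp
    · push Not at h
      have hyp : (y : ℝ) ≤ p := by exact_mod_cast h.le
      have hε0 : 0 ≤ ε := by
        by_contra hc
        have h1 : 0 < Real.sqrt y := Real.sqrt_pos.2 (by exact_mod_cast hy)
        have : (0 : ℝ) ≤ k := by positivity
        nlinarith
      have hkp : (k : ℝ) ≤ ε * Real.sqrt p := hε.trans (by gcongr)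
      rcases Nat.lt_or_ge 1 n with hn1 | hn1
      · refine (cs_pp G p n k hp hn1 hG (by omega) a hap (hlarge p hp h)).trans ?_
        have e : ((p ^ n : ℕ) : ℝ) = p ^ (n - 1) * p := by
          push_cast; rw [← pow_succ]; congr 1; omega
        rw [e, mul_assoc]
        gcongr
        refine hkp.trans ?_
        rw [mul_comm]
        gcongr
        rw [Real.sqrt_le_left (by positivity)]
        have : (1 : ℝ) ≤ p := by exact_mod_cast hp.one_lt.le
        nlinarith
      · have : n = 1 := by omega
        subst this
        rw [pow_one]
        refine (cs_prime G p k hp hG (by omega) a hap (hlarge p hp h)).trans ?_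
        calc k * Real.sqrt p ≤ ε * Real.sqrt p * Real.sqrt p := by gcongr
          _ = p * ε := by rw [mul_assoc, Real.mul_self_sqrt hp0.le, mul_comm]
  | coprime q₁ q₂ h₁ h₂ hc ih₁ ih₂ =>
    intro _ a ha
    obtain ⟨a₁, a₂, ha₁, ha₂, he⟩ := cs_mul G q₁ q₂ (by omega) (by omega) hc a ha
    rw [he, norm_mul, hc.primeFactors_mul, Finset.prod_union hc.disjoint_primeFactors]
    have i1 := ih₁ (by omega) a₁ ha₁
    have i2 := ih₂ (by omega) a₂ ha₂
    calc _ ≤ (q₁ * ∏ p ∈ q₁.primeFactors, (if p ≤ y then 0 else ε)) * (q₂ * ∏ p ∈ q₂.primeFactors, (if p ≤ y then 0 else ε)) :=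
          mul_le_mul i1 i2 (norm_nonneg _) ((norm_nonneg _).trans i1)
      _ = _ := by push_cast; ring
end FS

namespace FS
open Finset
open scoped BigOperators

section T1
variable {ι : Type} [Fintype ι] [DecidableEq ι] {Ω : ι → Type} [∀ i, Fintype (Ω i)] [∀ i, Nonempty (Ω i)]

open Classical in
lemma EE_sum (S : Finset ι) (h : (∀ i, Ω i) → ℝ) (x : ∀ i, Ω i) :
    EE Sᶜ h x = (∏ i ∈ S, (Fintype.card (Ω i) : ℝ)) / (∏ i, (Fintype.card (Ω i) : ℝ)) *
      ∑ z with (∀ i ∈ S, z i = x i), h z := by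
  rw [EE_apply, Fintype.expect_eq_sum_div_card]
  have h1 : ∑ y, h (Sᶜ.piecewise y x) = ∑ z ∈ ({z | ∀ i ∈ S, z i = x i} : Finset (∀ i, Ω i)),
      ∑ y with Sᶜ.piecewise y x = z, h (Sᶜ.piecewise y x) := by
    rw [Finset.sum_fiberwise_of_maps_to]
    intro y _
    simp only [mem_filter, mem_univ, true_and]
    intro i hi
    simp [Finset.piecewise, hi]
  have h2 : ∀ z ∈ ({z | ∀ i ∈ S, z i = x i} : Finset (∀ i, Ω i)),
      ∑ y with Sᶜ.piecewise y x = z, h (Sᶜ.piecewise y x) = (∏ i ∈ S, (Fintype.card (Ω i) : ℝ)) * h z := by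
    intro z hz
    simp only [mem_filter, mem_univ, true_and] at hz
    have : ∑ y with Sᶜ.piecewise y x = z, h (Sᶜ.piecewise y x) = ∑ y with Sᶜ.piecewise y x = z, h z := by
      refine Finset.sum_congr rfl fun y hy => ?_
      rw [(mem_filter.1 hy).2]
    rw [this, Finset.sum_const, nsmul_eq_mul]
    congr 1
    have e : ({y | Sᶜ.piecewise y x = z} : Finset (∀ i, Ω i)) =
        Fintype.piFinset (fun i => if i ∈ S then univ else {z i}) := by
      ext y
      simp only [mem_filter, mem_univ, true_and, Fintype.mem_piFinset]
      constructor
      · rintro rfl i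
        by_cases hi : i ∈ S <;> simp [hi, Finset.piecewise]
      · intro hy
        funext i
        have := hy i
        by_cases hi : i ∈ S
        · simp [Finset.piecewise, hi, hz i hi]
        · simp only [hi, if_false, mem_singleton] at this
          simp [Finset.piecewise, hi, this]
    rw [e, Fintype.card_piFinset]
    have : ∀ i, (if i ∈ S then (univ : Finset (Ω i)) else {z i}).card = if i ∈ S then Fintype.card (Ω i) else 1 := by
      intro i; split_ifs <;> simp
    simp only [this]
    rw [Finset.prod_ite_mem]; simp
  rw [h1, Finset.sum_congr rfl h2, ← Finset.mul_sum, Fintype.card_pi]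
  push_cast
  ring

lemma EE_le_mul (S R : Finset ι) (hd : Disjoint S R) (h : (∀ i, Ω i) → ℝ) (h0 : 0 ≤ h) (z : ∀ i, Ω i) :
    EE (Sᶜ \ R) h z ≤ (∏ i ∈ R, (Fintype.card (Ω i) : ℝ)) * EE Sᶜ h z := by
  classical
  have e : Sᶜ \ R = (S ∪ R)ᶜ := by ext i; simp
  rw [e, EE_sum, EE_sum, Finset.prod_union hd]
  have h1 : ∑ z' with (∀ i ∈ S ∪ R, z' i = z i), h z' ≤ ∑ z' with (∀ i ∈ S, z' i = z i), h z' := by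
    refine Finset.sum_le_sum_of_subset_of_nonneg ?_ fun _ _ _ => h0 _
    intro z' hz
    simp only [mem_filter, mem_univ, true_and] at hz ⊢
    exact fun i hi => hz i (mem_union_left _ hi)
  calc _ ≤ (∏ i ∈ S, (Fintype.card (Ω i) : ℝ)) * (∏ i ∈ R, (Fintype.card (Ω i) : ℝ)) / (∏ i, (Fintype.card (Ω i) : ℝ)) *
      ∑ z' with (∀ i ∈ S, z' i = z i), h z' := by gcongr
    _ = _ := by ring

lemma EE_pow_mean (S : Finset ι) (h : (∀ i, Ω i) → ℝ) (h0 : 0 ≤ h) (m : ℕ) (x) :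
    (EE S h x) ^ m ≤ EE S (h ^ m) x := by
  rcases Nat.eq_zero_or_pos m with rfl | hm
  · rw [pow_zero, pow_zero]; exact (EE_const S 1 x).ge
  simp only [EE_apply, Fintype.expect_eq_sum_div_card]
  obtain ⟨m, rfl⟩ : ∃ m', m = m' + 1 := ⟨m - 1, by omega⟩
  have := pow_sum_div_card_le_sum_pow (s := (univ : Finset (∀ i, Ω i))) (f := fun y => h (S.piecewise y x)) (n := m)
    (fun y _ => h0 _)
  rw [div_pow, pow_succ (Fintype.card _ : ℝ), ← div_div]
  simp only [Pi.pow_apply]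
  rw [Finset.card_univ] at this
  gcongr

/-- decomposition of `MM w F` into pieces depending on few coordinates -/
lemma MM_decomp (d : ℕ) (S : Finset ι) (w : Finset ι → ℝ) (hw : ∀ T, w T = w (T ∩ Sᶜ))
    (hw0 : ∀ T, d < (T ∩ Sᶜ).card + S.card → w T = 0) (F : (∀ i, Ω i) → ℝ) :
    MM w F = ∑ T ∈ Sᶜ.powerset with T.card + S.card ≤ d, ∑ R ∈ T.powerset,
      (-1 : ℝ) ^ (T \ R).card • EE (Sᶜ \ R) (MM w F) := by
  have h1 : ∀ T ∈ Sᶜ.powerset, ∑ R ∈ T.powerset, (-1 : ℝ) ^ (T \ R).card • EE (Sᶜ \ R) (MM w F) =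
      MM (fun T' => if T' ∩ Sᶜ = T then w T' else 0) F := by
    intro T hT
    simp_rw [EE_eq_MM, MM_MM]
    have : ∀ R, (-1 : ℝ) ^ (T \ R).card • MM ((fun T' => if Disjoint (Sᶜ \ R) T' then 1 else 0) * w) F =
      MM ((-1 : ℝ) ^ (T \ R).card • ((fun T' => if Disjoint (Sᶜ \ R) T' then 1 else 0) * w)) F := by
      intro R; rw [← MM_smul]; rfl
    simp_rw [this]
    have hs : ∀ (s : Finset (Finset ι)) (f : Finset ι → Finset ι → ℝ), ∑ R ∈ s, MM (f R) F = MM (∑ R ∈ s, f R) F := by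
      intro s f
      induction s using Finset.induction_on with
      | empty =>
        simp only [Finset.sum_empty]
        unfold MM; simp
      | insert a s ha ih =>
        rw [Finset.sum_insert ha, Finset.sum_insert ha, ih, ← MM_add]; rfl
    rw [hs]
    congr 2
    funext T'
    simp only [Finset.sum_apply, Pi.smul_apply, Pi.mul_apply, smul_eq_mul]
    have hT' : T ⊆ Sᶜ := Finset.mem_powerset.1 hT
    have hm : ∑ R ∈ T.powerset, (-1 : ℝ) ^ (T \ R).card * (if T' ∩ Sᶜ ⊆ R then 1 else 0 : ℝ) = if T' ∩ Sᶜ = T then 1 else 0 := by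
      set a := T' ∩ Sᶜ
      by_cases hsub : a ⊆ T
      · have hb : ∑ R ∈ T.powerset, (-1 : ℝ) ^ (T \ R).card * (if a ⊆ R then 1 else 0 : ℝ) =
            ∑ R ∈ (T \ a).powerset, (-1 : ℝ) ^ R.card := by
          simp only [mul_ite, mul_one, mul_zero]
          rw [← Finset.sum_filter]
          refine Finset.sum_bij' (fun R _ => T \ R) (fun R _ => T \ R) ?_ ?_ ?_ ?_ ?_
          · intro R hR
            simp only [mem_filter, mem_powerset] at hR ⊢
            exact Finset.sdiff_subset_sdiff (Finset.Subset.refl _) hR.2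
          · intro R hR
            simp only [mem_filter, mem_powerset] at hR ⊢
            refine ⟨Finset.sdiff_subset, fun i hi => ?_⟩
            simp only [mem_sdiff]
            refine ⟨hsub hi, fun h => ?_⟩
            exact (Finset.mem_sdiff.1 (hR h)).2 hi
          · intro R hR
            simp only [mem_filter, mem_powerset] at hR
            exact Finset.sdiff_sdiff_eq_self hR.1
          · intro R hR
            simp only [mem_powerset] at hR
            exact Finset.sdiff_sdiff_eq_self (hR.trans Finset.sdiff_subset)
          · intro R hR; rfl
        rw [hb]
        have := Finset.sum_powerset_neg_one_pow_card (x := T \ a)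
        have h2 : (∑ R ∈ (T \ a).powerset, (-1 : ℝ) ^ R.card) = ((∑ R ∈ (T \ a).powerset, (-1 : ℤ) ^ R.card : ℤ) : ℝ) := by push_cast; rfl
        rw [h2, this]
        by_cases he : a = T
        · simp [he]
        · have : ¬ T \ a = ∅ := by
            rw [Finset.sdiff_eq_empty_iff_subset]; exact fun h => he (Finset.Subset.antisymm hsub h)
          simp [he, this]
      · rw [if_neg (fun h : a = T => hsub h.subset)]
        refine Finset.sum_eq_zero fun R hR => ?_
        rw [if_neg (fun h => hsub (h.trans (Finset.mem_powerset.1 hR)))]; ring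
    have h3 : ∀ R, (if Disjoint (Sᶜ \ R) T' then 1 else 0 : ℝ) = if T' ∩ Sᶜ ⊆ R then 1 else 0 := by
      intro R
      congr 1
      rw [eq_iff_iff, Finset.disjoint_left]
      constructor
      · intro h i hi
        by_contra hR
        rw [mem_inter] at hi
        exact h (Finset.mem_sdiff.2 ⟨hi.2, hR⟩) hi.1
      · intro h i hi hT
        rw [mem_sdiff] at hi
        exact hi.2 (h (mem_inter.2 ⟨hT, hi.1⟩))
    simp_rw [h3, ← mul_assoc]
    rw [← Finset.sum_mul, hm]
    split_ifs <;> simp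
  rw [Finset.sum_congr rfl fun T hT => h1 T (Finset.mem_filter.1 hT).1]
  have h2 : ∀ T, MM (fun T' => if T' ∩ Sᶜ = T then w T' else 0) F = w T • QQ Sᶜ T F ∨ ¬ T ⊆ Sᶜ := by
    intro T
    by_cases hT : T ⊆ Sᶜ
    · left
      unfold QQ
      change _ = (w T • MM _) F
      rw [MM_smul]
      congr 2
      funext T'
      simp only [Pi.smul_apply, smul_eq_mul]
      split_ifs with h
      · rw [hw T', h]; simp
      · simp
    · right; exact hT
  rw [MM_eq_sum_QQ Sᶜ w hw F, Finset.sum_filter]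
  refine Finset.sum_congr rfl fun T hT => ?_
  have hT' := Finset.mem_powerset.1 hT
  split_ifs with h
  · rcases h2 T with h | h
    · exact h.symm
    · exact absurd hT' h
  · rw [hw0 T, zero_smul]
    rw [Finset.inter_eq_left.2 hT']; omega

lemma card_small (d : ℕ) (V : Finset ι) : (({T ∈ V.powerset | T.card ≤ d} : Finset (Finset ι)).card) ≤ (V.card + 1) ^ d := by
  have h1 : ({T ∈ V.powerset | T.card ≤ d} : Finset (Finset ι)) ⊆ (range (d + 1)).biUnion fun j => V.powersetCard j := by
    intro T hT
    simp only [mem_filter, mem_powerset] at hT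
    simp only [mem_biUnion, mem_range, mem_powersetCard]
    exact ⟨T.card, by omega, hT.1, rfl⟩
  refine (Finset.card_le_card h1).trans (Finset.card_biUnion_le.trans ?_)
  rw [add_pow]
  refine Finset.sum_le_sum fun j hj => ?_
  rw [Finset.card_powersetCard, one_pow, mul_one]
  have : 1 ≤ d.choose j := Nat.choose_pos (by simp at hj; omega)
  calc _ ≤ V.card ^ j := Nat.choose_le_pow _ _
    _ ≤ _ := Nat.le_mul_of_pos_right _ this

end T1
end FS

namespace FS
open Finset
open scoped BigOperators

section T2
variable {ι : Type} [Fintype ι] [DecidableEq ι]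

/-- sums of functions depending on at most `u` coordinates, with total sup norm at most `b` -/
inductive Rep {Ω : ι → Type} (u : ℕ) : ℝ → ((∀ i, Ω i) → ℝ) → Prop
  | base (b : ℝ) (h : (∀ i, Ω i) → ℝ) (U : Finset ι) (hU : U.card ≤ u)
      (hdep : ∀ z z', (∀ i ∈ U, z i = z' i) → h z = h z') (hb : ∀ z, |h z| ≤ b) : Rep u b h
  | add (b b' : ℝ) (h h' : (∀ i, Ω i) → ℝ) : Rep u b h → Rep u b' h' → Rep u (b + b') (h + h')

lemma Rep.mul {Ω : ι → Type} {u v : ℕ} {b c : ℝ} {f g : (∀ i, Ω i) → ℝ} (hf : Rep u b f) (hg : Rep v c g) :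
    Rep (u + v) (b * c) (f * g) := by
  induction hf with
  | base b f U hU hdep hb =>
    induction hg with
    | base c g V hV hdep' hc =>
      refine Rep.base _ _ (U ∪ V) ((Finset.card_union_le _ _).trans (by omega)) ?_ ?_
      · intro z z' h
        simp only [Pi.mul_apply]
        rw [hdep z z' fun i hi => h i (mem_union_left _ hi), hdep' z z' fun i hi => h i (mem_union_right _ hi)]
      · intro z
        simp only [Pi.mul_apply, abs_mul]
        exact mul_le_mul (hb z) (hc z) (abs_nonneg _) ((abs_nonneg _).trans (hb z))
    | add c c' g g' _ _ ih1 ih2 =>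
      rw [mul_add, mul_add]
      exact Rep.add _ _ _ _ ih1 ih2
  | add b b' f f' _ _ ih1 ih2 =>
    rw [add_mul, add_mul]
    exact Rep.add _ _ _ _ ih1 ih2

lemma Rep.pow {Ω : ι → Type} {u : ℕ} {b : ℝ} {f : (∀ i, Ω i) → ℝ} (hf : Rep u b f) (n : ℕ) :
    Rep (n * u) (b ^ n) (f ^ n) := by
  induction n with
  | zero =>
    refine Rep.base _ _ ∅ (by simp) ?_ ?_
    · intro z z' _; simp
    · intro z; simp
  | succ n ih =>
    rw [pow_succ, pow_succ, Nat.succ_mul]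
    exact ih.mul hf

lemma Rep.sum {Ω : ι → Type} {κ : Type} {u : ℕ} (s : Finset κ) (b : κ → ℝ) (f : κ → (∀ i, Ω i) → ℝ) 
    (hf : ∀ k ∈ s, Rep u (b k) (f k)) : Rep u (∑ k ∈ s, b k) (∑ k ∈ s, f k) := by
  classical
  induction s using Finset.induction_on with
  | empty =>
    refine Rep.base _ _ ∅ (by simp) ?_ ?_
    · intro z z' _; simp
    · intro z; simp
  | insert a s ha ih =>
    rw [Finset.sum_insert ha, Finset.sum_insert ha]
    exact Rep.add _ _ _ _ (hf a (mem_insert_self _ _)) (ih fun k hk => hf k (mem_insert_of_mem hk))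

lemma sum_period_real (Q M : ℕ) (f : ℕ → ℝ) (hf : ∀ n, f (n + Q) = f n) :
    ∑ n ∈ range (Q * M), f n = M * ∑ n ∈ range Q, f n := by
  have := sum_period Q M (fun n => (f n : ℂ)) (fun n => by rw [hf])
  exact_mod_cast this

lemma period_sum_err (q Y : ℕ) (hq : 0 < q) (f : ℕ → ℝ) (hf : ∀ n, f (n + q) = f n) (b : ℝ) (hb : ∀ n, |f n| ≤ b) :
    |∑ t ∈ range Y, f t - Y * ((∑ t ∈ range q, f t) / q)| ≤ 2 * q * b := by
  have hb0 : 0 ≤ b := (abs_nonneg _).trans (hb 0)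
  set M := Y / q
  set r := Y % q
  have hY : Y = q * M + r := (Nat.div_add_mod Y q).symm
  have hr : r < q := Nat.mod_lt _ hq
  have hq' : (0:ℝ) < q := by exact_mod_cast hq
  have hsum : ∀ (n : ℕ) (a : ℕ), |∑ t ∈ range n, f (a + t)| ≤ n * b := by
    intro n a
    refine (Finset.abs_sum_le_sum_abs _ _).trans ?_
    refine (Finset.sum_le_sum fun t _ => hb _).trans ?_
    simp
  have h1 : ∑ t ∈ range Y, f t - Y * ((∑ t ∈ range q, f t) / q) =
      ∑ t ∈ range r, f (q * M + t) - r * ((∑ t ∈ range q, f (0 + t)) / q) := by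
    rw [hY, Finset.sum_range_add, sum_period_real q M f hf]
    push_cast
    simp only [zero_add]
    field_simp
    ring
  rw [h1]
  have hr' : (r:ℝ) ≤ q := by exact_mod_cast hr.le
  have h2 : |(r:ℝ) * ((∑ t ∈ range q, f (0 + t)) / q)| ≤ r * b := by
    rw [abs_mul, abs_div, abs_of_nonneg (by positivity : (0:ℝ) ≤ r), abs_of_pos hq']
    have := hsum q 0
    gcongr
    rw [div_le_iff₀ hq']; linarith
  calc _ ≤ |∑ t ∈ range r, f (q * M + t)| + |(r:ℝ) * ((∑ t ∈ range q, f (0 + t)) / q)| := abs_sub _ _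
    _ ≤ r * b + r * b := add_le_add (hsum r _) h2
    _ ≤ q * b + q * b := by gcongr
    _ = _ := by ring

variable (n : ι → ℕ) [∀ i, NeZero (n i)] 

/-- reduction modulo all the `n i` -/
def red (t : ℕ) : ∀ i, ZMod (n i) := fun i => (t : ZMod (n i))

lemma red_bij (hco : Pairwise (Function.onFun Nat.Coprime n)) (h : (∀ i, ZMod (n i)) → ℝ) :
    ∑ t ∈ range (∏ i, n i), h (red n t) = ∑ z, h z := by
  have : NeZero (∏ i, n i) := ⟨Finset.prod_ne_zero_iff.2 fun i _ => NeZero.ne _⟩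
  have h1 := (ZMod.prodEquivPi n hco).toEquiv.sum_comp h
  rw [← h1]
  have h2 := sum_zmod (∏ i, n i) (fun x => ((h ((ZMod.prodEquivPi n hco).toEquiv x) : ℝ) : ℂ))
  have h3 : ∀ t : ℕ, (ZMod.prodEquivPi n hco).toEquiv (t : ZMod (∏ i, n i)) = red n t := by
    intro t
    change (ZMod.prodEquivPi n hco) (t : ZMod (∏ i, n i)) = red n t
    rw [map_natCast]; rfl
  simp only [h3] at h2
  exact_mod_cast h2.symm

lemma Rep.equi (hco : Pairwise (Function.onFun Nat.Coprime n)) (Q0 : ℕ) (hQ0 : 1 ≤ Q0) (hn : ∀ i, n i ≤ Q0) {u : ℕ} {b : ℝ}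
    {h : (∀ i, ZMod (n i)) → ℝ} (hr : Rep u b h) (Y : ℕ) :
    |∑ t ∈ range Y, h (red n t) - Y * ((∑ z, h z) / ∏ i, (n i : ℝ))| ≤ 2 * Q0 ^ u * b := by
  have hn1 : ∀ i, 1 ≤ n i := fun i => Nat.one_le_iff_ne_zero.2 (NeZero.ne _)
  induction hr with
  | base b h U hU hdep hb =>
    set q := ∏ i ∈ U, n i
    have hq : 0 < q := Finset.prod_pos fun i _ => hn1 i
    have hper : ∀ t, h (red n (t + q)) = h (red n t) := by
      intro t
      refine hdep _ _ fun i hi => ?_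
      simp only [red, Nat.cast_add]
      have : ((q:ℕ) : ZMod (n i)) = 0 := (ZMod.natCast_eq_zero_iff _ _).2 (Finset.dvd_prod_of_mem _ hi)
      rw [this, add_zero]
    have h1 := period_sum_err q Y hq (fun t => h (red n t)) hper b (fun t => hb _)
    have h2 : (∑ t ∈ range q, h (red n t)) / q = (∑ z, h z) / ∏ i, (n i : ℝ) := by
      rw [← red_bij n hco]
      have hs : ∏ i, n i = q * ∏ i ∈ Uᶜ, n i := (Finset.prod_mul_prod_compl U n).symm
      have hp : (0:ℝ) < ((∏ i ∈ Uᶜ, n i : ℕ) : ℝ) := by exact_mod_cast Finset.prod_pos fun i _ => hn1 i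
      have hq' : (0:ℝ) < q := by exact_mod_cast hq
      have hs' : ∏ i, (n i:ℝ) = (q:ℝ) * ((∏ i ∈ Uᶜ, n i : ℕ) : ℝ) := by exact_mod_cast hs
      rw [hs, sum_period_real q _ (fun t => h (red n t)) hper, hs']
      field_simp
    rw [← h2]
    refine h1.trans ?_
    have hb0 : 0 ≤ b := (abs_nonneg _).trans (hb (red n 0))
    have : (q:ℝ) ≤ Q0 ^ u := by
      have : q ≤ Q0 ^ u := by
        calc q ≤ ∏ i ∈ U, Q0 := Finset.prod_le_prod' fun i _ => hn i
          _ = Q0 ^ U.card := by simp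
          _ ≤ _ := Nat.pow_le_pow_right hQ0 hU
      exact_mod_cast this
    gcongr
  | add b b' h h' _ _ ih1 ih2 =>
    have : ∑ t ∈ range Y, (h + h') (red n t) - Y * ((∑ z, (h + h') z) / ∏ i, (n i : ℝ)) =
      (∑ t ∈ range Y, h (red n t) - Y * ((∑ z, h z) / ∏ i, (n i : ℝ))) +
      (∑ t ∈ range Y, h' (red n t) - Y * ((∑ z, h' z) / ∏ i, (n i : ℝ))) := by
      simp only [Pi.add_apply, Finset.sum_add_distrib]; ring
    rw [this]
    refine (abs_add_le _ _).trans ?_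
    linarith

end T2
end FS

namespace FS
open Finset
open scoped BigOperators

section T3
variable {ι : Type} [Fintype ι] [DecidableEq ι]
variable (n : ι → ℕ) [∀ i, NeZero (n i)] 

lemma prod_le_pow_card (S : Finset ι) (Q0 d : ℕ) (hQ0 : 1 ≤ Q0) (hn : ∀ i, n i ≤ Q0) (hS : S.card ≤ d) :
    (∏ i ∈ S, (n i : ℝ)) ≤ (Q0:ℝ) ^ d := by
  have : ∏ i ∈ S, n i ≤ Q0 ^ d := by
    calc _ ≤ ∏ i ∈ S, Q0 := Finset.prod_le_prod' fun i _ => hn i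
      _ = Q0 ^ S.card := by simp
      _ ≤ _ := Nat.pow_le_pow_right hQ0 hS
  exact_mod_cast this

lemma moment (hco : Pairwise (Function.onFun Nat.Coprime n)) (Q0 : ℕ) (hQ0 : 2 ≤ Q0) (hn : ∀ i, n i ≤ Q0)
    (hι : Fintype.card ι + 1 ≤ Q0) (m d : ℕ) (hm : 4 ≤ m) (hd : 1 ≤ d) (Y : ℕ) (hY : Q0 ^ (8 * m * d) ≤ Y)
    (F : (∀ i, ZMod (n i)) → ℝ) (S : Finset ι) (hS : S.card ≤ d) (x : ∀ i, ZMod (n i)) (w : Finset ι → ℝ) (hw : ∀ T, w T = w (T ∩ Sᶜ))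
    (hw0 : ∀ T, d < (T ∩ Sᶜ).card + S.card → w T = 0) :
    (∏ i ∈ S, (n i : ℝ)) * ∑ t ∈ range Y with (∀ i ∈ S, red n t i = x i), (MM w F (red n t)) ^ (2 * m) ≤
      2 * Y * EE Sᶜ ((MM w F) ^ (2 * m)) x := by
  classical
  set g := MM w F with hg
  set E := EE Sᶜ (g ^ 2) x with hE
  have hE0 : 0 ≤ E := EE_sq_nonneg _ _ _
  set b0 : ℝ := Real.sqrt ((Q0:ℝ) ^ d * E) with hb0
  have hb00 : 0 ≤ b0 := Real.sqrt_nonneg _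
  set 𝒯 : Finset (Finset ι) := {T ∈ Sᶜ.powerset | T.card + S.card ≤ d} with h𝒯
  -- the frozen function
  set gx : (∀ i, ZMod (n i)) → ℝ := fun z => g (S.piecewise x z) with hgx
  have hgxsum : gx = ∑ T ∈ 𝒯, ∑ R ∈ T.powerset, fun z => (-1 : ℝ) ^ (T \ R).card * EE (Sᶜ \ R) g (S.piecewise x z) := by
    funext z
    have h1 := congrFun (MM_decomp d S w hw hw0 F) (S.piecewise x z)
    simp only [Finset.sum_apply, Pi.smul_apply, smul_eq_mul] at h1 ⊢
    exact h1
  have hEfr : ∀ z, EE Sᶜ (g ^ 2) (S.piecewise x z) = E := by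
    intro z
    rw [hE, EE_apply, EE_apply]
    refine Finset.expect_congr rfl fun y _ => ?_
    refine congrArg (g ^ 2) (funext fun i => ?_)
    by_cases hi : i ∈ S <;> simp [Finset.piecewise, hi]
  have hpiece : ∀ T ∈ 𝒯, ∀ R ∈ T.powerset, Rep d b0 (fun z => (-1 : ℝ) ^ (T \ R).card * EE (Sᶜ \ R) g (S.piecewise x z)) := by
    intro T hT R hR
    rw [h𝒯, mem_filter, mem_powerset] at hT
    rw [mem_powerset] at hR
    have hRc : R.card ≤ d := (Finset.card_le_card hR).trans (by omega)
    have hdis : Disjoint S R := by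
      rw [Finset.disjoint_left]; intro i hi hiR
      exact (Finset.mem_compl.1 (hT.1 (hR hiR))) hi
    refine Rep.base _ _ R hRc ?_ ?_
    · intro z z' hz
      congr 1
      rw [EE_apply, EE_apply]
      refine Finset.expect_congr rfl fun y _ => ?_
      congr 1
      funext i
      by_cases hi : i ∈ S
      · simp [Finset.piecewise, hi]
      · by_cases hi2 : i ∈ R
        · simp [Finset.piecewise, hi, hi2, hz i hi2]
        · simp [Finset.piecewise, hi, hi2]
    · intro z
      rw [abs_mul, abs_pow, abs_neg, abs_one, one_pow, one_mul]
      refine Real.abs_le_sqrt ?_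
      have h1 := EE_sq_le (Sᶜ \ R) g (S.piecewise x z)
      simp only [Pi.pow_apply] at h1
      refine h1.trans ((EE_le_mul S R hdis (g ^ 2) (fun z => sq_nonneg _) _).trans ?_)
      rw [hEfr]
      simp only [ZMod.card]
      have := prod_le_pow_card n R Q0 d (by omega) hn hRc
      gcongr
  set b : ℝ := ∑ T ∈ 𝒯, ∑ R ∈ T.powerset, b0 with hb
  have hrep : Rep d b gx := by
    rw [hgxsum]
    exact Rep.sum _ _ _ fun T hT => Rep.sum _ _ _ fun R hR => hpiece T hT R hR
  have hQ1 : (2:ℝ) ≤ Q0 := by exact_mod_cast hQ0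
  have hb_nonneg : 0 ≤ b := Finset.sum_nonneg fun _ _ => Finset.sum_nonneg fun _ _ => hb00
  have hb_le : b ≤ (Q0:ℝ) ^ (2 * d) * b0 := by
    have h1 : b ≤ ∑ T ∈ 𝒯, (2:ℝ) ^ d * b0 := by
      refine Finset.sum_le_sum fun T hT => ?_
      rw [h𝒯, mem_filter, mem_powerset] at hT
      rw [Finset.sum_const, Finset.card_powerset, nsmul_eq_mul]
      push_cast
      gcongr
      · norm_num
      · omega
    refine h1.trans ?_
    rw [Finset.sum_const, nsmul_eq_mul]
    have h2 : (𝒯.card : ℝ) ≤ (Q0:ℝ) ^ d := by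
      have : 𝒯.card ≤ Q0 ^ d := by
        calc 𝒯.card ≤ ({T ∈ Sᶜ.powerset | T.card ≤ d} : Finset (Finset ι)).card := by
              refine Finset.card_le_card ?_
              intro T hT
              rw [h𝒯, mem_filter] at hT
              rw [mem_filter]; exact ⟨hT.1, by omega⟩
          _ ≤ (Sᶜ.card + 1) ^ d := card_small d Sᶜ
          _ ≤ Q0 ^ d := by
              refine Nat.pow_le_pow_left ?_ d
              have : Sᶜ.card ≤ Fintype.card ι := Finset.card_le_univ _
              omega
      exact_mod_cast this
    calc (𝒯.card : ℝ) * (2 ^ d * b0) ≤ (Q0:ℝ) ^ d * ((Q0:ℝ) ^ d * b0) := by gcongr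
      _ = _ := by rw [two_mul, pow_add]; ring
  set E' := EE Sᶜ (g ^ (2 * m)) x with hE'
  have hEE' : E ^ m ≤ E' := by
    have := EE_pow_mean Sᶜ (g ^ 2) (fun z => sq_nonneg _) m x
    rwa [← pow_mul] at this
  have hE'0 : 0 ≤ E' := (pow_nonneg hE0 m).trans hEE'
  have hbpow : b ^ (2 * m) ≤ (Q0:ℝ) ^ (5 * m * d) * E' := by
    calc b ^ (2 * m) ≤ ((Q0:ℝ) ^ (2 * d) * b0) ^ (2 * m) := by gcongr
      _ = ((Q0:ℝ) ^ (2 * d)) ^ (2 * m) * ((b0 ^ 2) ^ m) := by rw [mul_pow, pow_mul b0]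
      _ = (Q0:ℝ) ^ (5 * m * d) * E ^ m := by
          rw [hb0, Real.sq_sqrt (by positivity), mul_pow, ← pow_mul, ← pow_mul, ← mul_assoc, ← pow_add]
          congr 2; ring
      _ ≤ _ := by gcongr
  set ind : (∀ i, ZMod (n i)) → ℝ := fun z => if ∀ i ∈ S, z i = x i then 1 else 0 with hind
  have hindr : Rep d 1 ind := by
    refine Rep.base _ _ S hS ?_ ?_
    · intro z z' hz
      have : (∀ i ∈ S, z i = x i) ↔ (∀ i ∈ S, z' i = x i) :=
        forall₂_congr fun i hi => by rw [hz i hi]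
      simp only [hind, this]
    · intro z; simp only [hind]; split_ifs <;> simp
  have hequi := Rep.equi n hco Q0 (by omega) hn (hindr.mul (hrep.pow (2 * m))) Y
  have hcond : ∀ z, (∀ i ∈ S, z i = x i) → gx z = g z := by
    intro z hz
    simp only [hgx]
    congr 1
    funext i
    by_cases hi : i ∈ S
    · simp [Finset.piecewise, hi, hz i hi]
    · simp [Finset.piecewise, hi]
  have hprod : ∀ z, (ind * gx ^ (2 * m)) z = if ∀ i ∈ S, z i = x i then g z ^ (2 * m) else 0 := by
    intro z
    simp only [Pi.mul_apply, Pi.pow_apply, hind]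
    split_ifs with h
    · rw [hcond z h, one_mul]
    · simp
  have hs1 : ∑ t ∈ range Y, (ind * gx ^ (2 * m)) (red n t) =
      ∑ t ∈ range Y with (∀ i ∈ S, red n t i = x i), (g (red n t)) ^ (2 * m) := by
    rw [Finset.sum_filter]
    exact Finset.sum_congr rfl fun t _ => hprod _
  have hs2 : ∑ z, (ind * gx ^ (2 * m)) z = ∑ z with (∀ i ∈ S, z i = x i), (g ^ (2 * m)) z := by
    rw [Finset.sum_filter]
    exact Finset.sum_congr rfl fun t _ => hprod _
  have hs3 : E' = (∏ i ∈ S, (n i : ℝ)) / (∏ i, (n i : ℝ)) * ∑ z with (∀ i ∈ S, z i = x i), (g ^ (2 * m)) z := by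
    rw [hE', EE_sum]; simp only [ZMod.card]; congr!
  rw [hs1, hs2] at hequi
  set s1 := ∑ t ∈ range Y with (∀ i ∈ S, red n t i = x i), (g (red n t)) ^ (2 * m)
  set qS := ∏ i ∈ S, (n i : ℝ)
  have hq0 : 0 ≤ qS := Finset.prod_nonneg fun _ _ => by positivity
  have hqS : qS ≤ (Q0:ℝ) ^ d := prod_le_pow_card n S Q0 d (by omega) hn hS
  have h5 : s1 ≤ Y * ((∑ z with (∀ i ∈ S, z i = x i), (g ^ (2 * m)) z) / ∏ i, (n i : ℝ)) + 2 * Q0 ^ (d + 2 * m * d) * (1 * b ^ (2 * m)) := by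
    linarith [(abs_le.1 hequi).2]
  have h6 : 2 * (Q0:ℝ) ^ d * Q0 ^ (d + 2 * m * d) * (Q0:ℝ) ^ (5 * m * d) ≤ Y := by
    have : 2 * Q0 ^ d * Q0 ^ (d + 2 * m * d) * Q0 ^ (5 * m * d) ≤ Y := by
      refine le_trans ?_ hY
      calc 2 * Q0 ^ d * Q0 ^ (d + 2 * m * d) * Q0 ^ (5 * m * d) ≤ Q0 * Q0 ^ d * Q0 ^ (d + 2 * m * d) * Q0 ^ (5 * m * d) := by gcongr
        _ = Q0 ^ (1 + d + (d + 2 * m * d) + 5 * m * d) := by ring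
        _ ≤ _ := Nat.pow_le_pow_right (by omega) (by nlinarith)
    exact_mod_cast this
  calc qS * s1 ≤ qS * (Y * ((∑ z with (∀ i ∈ S, z i = x i), (g ^ (2 * m)) z) / ∏ i, (n i : ℝ)) + 2 * Q0 ^ (d + 2 * m * d) * (1 * b ^ (2 * m))) := by gcongr
    _ = Y * E' + qS * (2 * Q0 ^ (d + 2 * m * d) * b ^ (2 * m)) := by rw [hs3]; ring
    _ ≤ Y * E' + (Q0:ℝ) ^ d * (2 * Q0 ^ (d + 2 * m * d) * ((Q0:ℝ) ^ (5 * m * d) * E')) := by gcongr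
    _ = Y * E' + (2 * (Q0:ℝ) ^ d * Q0 ^ (d + 2 * m * d) * (Q0:ℝ) ^ (5 * m * d)) * E' := by ring
    _ ≤ Y * E' + Y * E' := by gcongr
    _ = _ := by ring

open Classical in
/-- the (normalised) push-forward of a set of integers -/
noncomputable def push (Y : ℕ) (B : Finset ℕ) : (∀ i, ZMod (n i)) → ℝ :=
  fun z => (∏ i, (n i : ℝ)) / Y * ({t ∈ B | red n t = z} : Finset ℕ).card

open Classical in
lemma EE_push (Y : ℕ) (B : Finset ℕ) (g : (∀ i, ZMod (n i)) → ℝ) (S : Finset ι) (x : ∀ i, ZMod (n i)) :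
    EE Sᶜ (push n Y B * g) x = (∏ i ∈ S, (n i : ℝ)) / Y * ∑ t ∈ B with (∀ i ∈ S, red n t i = x i), g (red n t) := by
  rw [EE_sum]
  simp only [ZMod.card, Pi.mul_apply, push]
  have h1 : ∀ z : ∀ i, ZMod (n i), (∏ i, (n i : ℝ)) / Y * (({t ∈ B | red n t = z} : Finset ℕ).card : ℝ) * g z =
      (∏ i, (n i : ℝ)) / Y * ∑ t ∈ B with red n t = z, g (red n t) := by
    intro z
    rw [Finset.sum_congr rfl (fun t ht => by rw [(mem_filter.1 ht).2] : ∀ t ∈ ({t ∈ B | red n t = z} : Finset ℕ), g (red n t) = g z)]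
    simp; ring
  simp only [h1]
  rw [← Finset.mul_sum]
  have h2 : ∑ z with (∀ i ∈ S, z i = x i), ∑ t ∈ B with red n t = z, g (red n t) =
      ∑ t ∈ B with (∀ i ∈ S, red n t i = x i), g (red n t) := by
    rw [← Finset.sum_fiberwise_of_maps_to (s := ({t ∈ B | ∀ i ∈ S, red n t i = x i} : Finset ℕ))
      (t := ({z | ∀ i ∈ S, z i = x i} : Finset (∀ i, ZMod (n i)))) (g := red n) (f := fun t => g (red n t))]
    · refine Finset.sum_congr rfl fun z hz => ?_
      rw [Finset.filter_filter]
      refine Finset.sum_congr ?_ fun _ _ => rfl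
      ext t
      simp only [mem_filter, mem_univ, true_and] at hz ⊢
      constructor
      · rintro ⟨h, rfl⟩; exact ⟨h, hz, rfl⟩
      · rintro ⟨h, _, h3⟩; exact ⟨h, h3⟩
    · intro t ht
      simp only [mem_filter, mem_univ, true_and] at ht ⊢
      exact ht.2
  refine Eq.trans (congrArg _ (congrArg _ (Eq.trans (by congr!) h2))) ?_
  have : (∏ i, (n i : ℝ)) ≠ 0 := Finset.prod_ne_zero_iff.2 fun i _ => by exact_mod_cast NeZero.ne (n i)
  field_simp

open Classical in
theorem push_level (hco : Pairwise (Function.onFun Nat.Coprime n)) (Q0 : ℕ) (hQ0 : 2 ≤ Q0) (hn : ∀ i, n i ≤ Q0)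
    (hι : Fintype.card ι + 1 ≤ Q0) (m d : ℕ) (hm : 4 ≤ m) (hd : 1 ≤ d) (Y : ℕ) (hY : Q0 ^ (8 * m * d) ≤ Y)
    (α : ℝ) (hα : 0 < α) (hαm : 1 ≤ 9 ^ m * α) (B : Finset ℕ) (hB : B ⊆ range Y)
    (NI : ∀ S : Finset ι, S.card ≤ d → ∀ x : ∀ i, ZMod (n i),
      (({t ∈ B | ∀ i ∈ S, red n t i = x i} : Finset ℕ).card : ℝ) * ∏ i ∈ S, (n i : ℝ) ≤ 2 * α * Y) (x0) :
    ∑ T with T.card ≤ d, (1 / (256 * m) : ℝ) ^ T.card * EE univ ((PP T (push n Y B)) ^ 2) x0 ≤ 36 * α ^ 2 := by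
  have hY0 : (0:ℝ) < Y := by
    have : 0 < Q0 ^ (8 * m * d) := Nat.pow_pos (by omega)
    exact_mod_cast lt_of_lt_of_le this hY
  have h36 : 36 * α ^ 2 = (6 * α) ^ 2 := by ring
  rw [h36]
  refine level_ineq m d hm (6 * α) (by positivity) _ ?_ x0
  intro S hS x w hw hw0
  have hmom := moment n hco Q0 hQ0 hn hι m d hm hd Y hY (push n Y B) S hS x w hw hw0
  rw [EE_push]
  set g := MM w (push n Y B)
  set E' := EE Sᶜ (g ^ (2 * m)) x with hE'
  set B' : Finset ℕ := {t ∈ B | ∀ i ∈ S, red n t i = x i} with hB'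
  have hN := NI S hS x
  rw [← hB'] at hN
  set qS := ∏ i ∈ S, (n i : ℝ)
  have hq0 : 0 < qS := Finset.prod_pos fun i _ => by exact_mod_cast Nat.pos_of_ne_zero (NeZero.ne (n i))
  have h1 : |∑ t ∈ B', g (red n t)| ^ (2 * m) ≤ (B'.card : ℝ) ^ (2 * m - 1) * ∑ t ∈ B', g (red n t) ^ (2 * m) := by
    obtain ⟨k, hk⟩ : ∃ k, 2 * m = k + 1 := ⟨2 * m - 1, by omega⟩
    have hev : ∀ r : ℝ, |r| ^ (2 * m) = r ^ (2 * m) := fun r => by rw [pow_mul, sq_abs, ← pow_mul]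
    have h2 := pow_sum_div_card_le_sum_pow (s := B') (f := fun t => |g (red n t)|) (n := k) (fun t _ => abs_nonneg _)
    rw [← hk] at h2
    simp only [hev] at h2
    have hk' : 2 * m - 1 = k := by omega
    rw [hk']
    rcases Finset.eq_empty_or_nonempty B' with he | hne
    · rw [he]; simp only [Finset.sum_empty, abs_zero, mul_zero]; rw [zero_pow (by omega)]
    · have hc : (0:ℝ) < B'.card := by exact_mod_cast hne.card_pos
      rw [div_le_iff₀ (pow_pos hc k)] at h2
      calc _ ≤ (∑ t ∈ B', |g (red n t)|) ^ (2 * m) := by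
            gcongr; exact Finset.abs_sum_le_sum_abs _ _
        _ ≤ _ := by linarith
  have h2 : ∑ t ∈ B', g (red n t) ^ (2 * m) ≤ ∑ t ∈ range Y with (∀ i ∈ S, red n t i = x i), g (red n t) ^ (2 * m) := by
    refine Finset.sum_le_sum_of_subset_of_nonneg ?_ fun t _ _ => by rw [pow_mul]; positivity
    exact Finset.filter_subset_filter _ hB
  have h3 : qS * ∑ t ∈ B', g (red n t) ^ (2 * m) ≤ 2 * Y * E' := le_trans (by gcongr) hmom
  have hE'0 : 0 ≤ E' := by
    have : (0:ℝ) ≤ qS * ∑ t ∈ B', g (red n t) ^ (2 * m) :=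
      mul_nonneg hq0.le (Finset.sum_nonneg fun t _ => by rw [pow_mul]; positivity)
    by_contra h
    push Not at h
    nlinarith
  obtain ⟨k, hk⟩ : ∃ k, 2 * m = k + 1 := ⟨2 * m - 1, by omega⟩
  have hk' : 2 * m - 1 = k := by omega
  rw [hk'] at h1
  have hev : ∀ r : ℝ, |r| ^ (2 * m) = r ^ (2 * m) := fun r => by rw [pow_mul, sq_abs, ← pow_mul]
  rw [hev] at h1
  have hfin : 2 * (2 * α) ^ k ≤ (6 * α) ^ (2 * m) := by
    have e1 : (6 * α) ^ (2 * m) = 9 ^ m * (2 * α) ^ (2 * m) := by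
      rw [show 6 * α = 3 * (2 * α) by ring, mul_pow, pow_mul (3:ℝ)]; norm_num
    rw [e1, hk, pow_succ]
    have : (0:ℝ) < (2 * α) ^ k := by positivity
    nlinarith
  have hc0 : (0:ℝ) ≤ (B'.card : ℝ) := Nat.cast_nonneg _
  have hs20 : 0 ≤ ∑ t ∈ B', g (red n t) ^ (2 * m) := Finset.sum_nonneg fun t _ => by rw [pow_mul]; positivity
  generalize (B'.card : ℝ) = c at hN h1 hc0
  generalize (∑ t ∈ B', g (red n t) ^ (2 * m)) = s2 at h1 h3 hs20
  generalize (∑ t ∈ B', g (red n t)) = s1 at h1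
  clear h2
  calc (qS / Y * s1) ^ (2 * m) = (qS / Y) ^ (2 * m) * s1 ^ (2 * m) := by rw [mul_pow]
    _ ≤ (qS / Y) ^ (2 * m) * (c ^ k * s2) := by gcongr
    _ = (c * qS / Y) ^ k * ((qS * s2) / Y) := by
        rw [hk, pow_succ, div_pow, div_pow, mul_pow]; field_simp
    _ ≤ (2 * α) ^ k * ((2 * Y * E') / Y) := by
        gcongr
        rw [div_le_iff₀ hY0]; exact hN
    _ = 2 * (2 * α) ^ k * E' := by field_simp
    _ ≤ _ := by gcongr

end T3
end FS

namespace FS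
open Finset
open scoped BigOperators ComplexConjugate

section T4
variable {ι : Type} [Fintype ι] [DecidableEq ι]
variable (n : ι → ℕ) [∀ i, NeZero (n i)] 

noncomputable def fc (f : (∀ i, ZMod (n i)) → ℝ) (χ : AddChar (∀ i, ZMod (n i)) ℂ) : ℂ :=
  (∑ z, (f z : ℂ) * χ (-z)) / (Fintype.card (∀ i, ZMod (n i)) : ℂ)

open Classical in
noncomputable def csupp (χ : AddChar (∀ i, ZMod (n i)) ℂ) : Finset ι := {i | ∃ y : ZMod (n i), χ (Pi.single i y) ≠ 1}

lemma addChar_map_sum {G κ : Type} [AddCommGroup G] (χ : AddChar G ℂ) (s : Finset κ) (f : κ → G) :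
    χ (∑ i ∈ s, f i) = ∏ i ∈ s, χ (f i) := by
  classical
  induction s using Finset.induction_on with
  | empty => simp
  | insert a s ha ih => rw [Finset.sum_insert ha, Finset.prod_insert ha, AddChar.map_add_eq_mul, ih]

lemma fc_EE (A : Finset ι) (f : (∀ i, ZMod (n i)) → ℝ) (χ : AddChar (∀ i, ZMod (n i)) ℂ) :
    fc n (EE A f) χ = if Disjoint A (csupp n χ) then fc n f χ else 0 := by
  classical
  set N : ℂ := (Fintype.card (∀ i, ZMod (n i)) : ℂ) with hN
  have hN0 : N ≠ 0 := by rw [hN]; exact_mod_cast Fintype.card_ne_zero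
  set P : (∀ i, ZMod (n i)) → (∀ i, ZMod (n i)) := fun y => A.piecewise y 0 with hP
  have h1 : ∀ z, ((EE A f z : ℝ) : ℂ) = (∑ y, (f (z + P y) : ℂ)) / N := by
    intro z
    rw [EE_apply, Fintype.expect_eq_sum_div_card]
    push_cast
    congr 1
    rw [← Equiv.sum_comp (Equiv.addLeft z)]
    refine Finset.sum_congr rfl fun y _ => ?_
    congr 2
    funext i
    by_cases hi : i ∈ A <;> simp [hP, Finset.piecewise, hi]
  have h2 : fc n (EE A f) χ = (∑ y, χ (P y)) / N * fc n f χ := by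
    unfold fc
    simp only [h1]
    rw [← hN, ← mul_div_assoc]
    congr 1
    have : ∀ z, (∑ y, (f (z + P y) : ℂ)) / N * χ (-z) = (∑ y, (f (z + P y) : ℂ) * χ (-z)) / N := by
      intro z; rw [← Finset.sum_mul]; ring
    simp only [this]
    rw [← Finset.sum_div, Finset.sum_comm]
    have h3 : ∀ y, ∑ z, (f (z + P y) : ℂ) * χ (-z) = χ (P y) * ∑ z, (f z : ℂ) * χ (-z) := by
      intro y
      rw [← Equiv.sum_comp (Equiv.addRight (P y)) (fun z => (f z : ℂ) * χ (-z)), Finset.mul_sum]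
      refine Finset.sum_congr rfl fun z _ => ?_
      simp only [Equiv.coe_addRight]
      rw [neg_add, AddChar.map_add_eq_mul]
      have : χ (P y) * χ (-P y) = 1 := by rw [← AddChar.map_add_eq_mul]; simp
      linear_combination (-(f (z + P y) : ℂ) * χ (-z)) * this
    simp only [h3]
    rw [← Finset.sum_mul]; ring
  rw [h2]
  split_ifs with hd
  · have : ∀ y, χ (P y) = 1 := by
      intro y
      rw [← Finset.univ_sum_single (P y), addChar_map_sum]
      refine Finset.prod_eq_one fun i _ => ?_
      by_cases hi : i ∈ A
      · have := Finset.disjoint_left.1 hd hi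
        simp only [csupp, mem_filter, mem_univ, true_and, not_exists, not_not] at this
        exact this _
      · simp [hP, Finset.piecewise, hi]
    simp only [this]
    rw [Finset.sum_const, Finset.card_univ, nsmul_eq_mul, mul_one, div_self hN0, one_mul]
  · rw [Finset.not_disjoint_iff] at hd
    obtain ⟨i, hiA, hi⟩ := hd
    simp only [csupp, mem_filter, mem_univ, true_and] at hi
    obtain ⟨y0, hy0⟩ := hi
    have : ∑ y, χ (P y) = χ (Pi.single i y0) * ∑ y, χ (P y) := by
      conv_lhs => rw [← Equiv.sum_comp (Equiv.addLeft (Pi.single i y0))]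
      rw [Finset.mul_sum]
      refine Finset.sum_congr rfl fun y _ => ?_
      rw [← AddChar.map_add_eq_mul]
      congr 1
      funext j
      by_cases hj : j ∈ A
      · simp [hP, Finset.piecewise, hj]
      · have : j ≠ i := fun h => hj (h ▸ hiA)
        simp [hP, Finset.piecewise, hj, this]
    have h0 : ∑ y, χ (P y) = 0 := by
      have h4 : (χ (Pi.single i y0) - 1) * ∑ y, χ (P y) = 0 := by linear_combination -this
      rcases mul_eq_zero.1 h4 with h | h
      · exact absurd (sub_eq_zero.1 h) hy0
      · exact h
    rw [h0]; simp

lemma fc_PP (f : (∀ i, ZMod (n i)) → ℝ) (χ : AddChar (∀ i, ZMod (n i)) ℂ) :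
    fc n (PP (csupp n χ) f) χ = fc n f χ := by
  set T := csupp n χ with hT
  have h1 : fc n (PP T f) χ = ∑ R ∈ T.powerset, ((-1 : ℝ) ^ (T \ R).card : ℝ) * fc n (EE Rᶜ f) χ := by
    unfold fc PP
    simp only [LinearMap.sum_apply, LinearMap.smul_apply, Finset.sum_apply, Pi.smul_apply, smul_eq_mul]
    push_cast
    simp only [Finset.sum_mul, mul_div_assoc', Finset.mul_sum]
    rw [Finset.sum_comm, Finset.sum_div]
    refine Finset.sum_congr rfl fun R _ => ?_
    congr 1
    refine Finset.sum_congr rfl fun z _ => by ring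
  rw [h1, Finset.sum_eq_single T]
  · rw [fc_EE, if_pos]
    · simp
    · rw [← hT]; exact disjoint_compl_left
  · intro R hR hne
    rw [fc_EE, if_neg, mul_zero]
    intro h
    apply hne
    refine Finset.Subset.antisymm (Finset.mem_powerset.1 hR) ?_
    intro i hi
    by_contra hiR
    exact Finset.disjoint_left.1 h (Finset.mem_compl.2 hiR) hi
  · intro h; simp at h

lemma fc_bessel (f : (∀ i, ZMod (n i)) → ℝ) (X : Finset (AddChar (∀ i, ZMod (n i)) ℂ)) (x0) :
    ∑ χ ∈ X, ‖fc n f χ‖ ^ 2 ≤ EE univ (f ^ 2) x0 := by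
  classical
  set N : ℝ := (Fintype.card (∀ i, ZMod (n i)) : ℝ) with hN
  have hN0 : 0 < N := by rw [hN]; exact_mod_cast Fintype.card_pos
  set g : (∀ i, ZMod (n i)) → ℂ := fun z => ∑ χ ∈ X, fc n f χ * χ z with hg
  have hEE : EE univ (f ^ 2) x0 = (∑ z, f z ^ 2) / N := by
    rw [EE_apply, Fintype.expect_eq_sum_div_card]; simp [hN]
  rw [hEE, le_div_iff₀ hN0]
  set s := ∑ χ ∈ X, ‖fc n f χ‖ ^ 2 with hs
  have hmul : ∀ c : ℂ, c * conj c = ((‖c‖ ^ 2 : ℝ) : ℂ) := by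
    intro c; rw [Complex.mul_conj, Complex.normSq_eq_norm_sq]
  have hfg : ∑ z, (f z : ℂ) * conj (g z) = ((N * s : ℝ) : ℂ) := by
    simp only [hg, map_sum, map_mul, Finset.mul_sum]
    rw [Finset.sum_comm]
    push_cast
    rw [hs]; push_cast
    rw [Finset.mul_sum]
    refine Finset.sum_congr rfl fun χ _ => ?_
    have h1 : ∑ z, (f z : ℂ) * χ (-z) = N * fc n f χ := by
      unfold fc
      rw [hN]; push_cast
      have : (Fintype.card (∀ i, ZMod (n i)) : ℂ) ≠ 0 := by exact_mod_cast Fintype.card_ne_zero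
      field_simp
    have h2 : ∑ z, (f z : ℂ) * (conj (fc n f χ) * conj (χ z)) = conj (fc n f χ) * ∑ z, (f z : ℂ) * χ (-z) := by
      rw [Finset.mul_sum]
      refine Finset.sum_congr rfl fun z _ => ?_
      rw [AddChar.map_neg_eq_conj]; ring
    rw [h2, h1]
    have := hmul (fc n f χ)
    push_cast at this
    rw [← this]; ring
  have hgg : ∑ z, g z * conj (g z) = ((N * s : ℝ) : ℂ) := by
    have horth : ∀ χ ψ : AddChar (∀ i, ZMod (n i)) ℂ, ∑ z, χ z * conj (ψ z) = if χ = ψ then (N : ℂ) else 0 := by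
      intro χ ψ
      have := AddChar.sum_eq_ite (χ - ψ)
      simp only [AddChar.sub_apply, AddChar.map_neg_eq_conj, sub_eq_zero] at this
      rw [this, hN]; push_cast; rfl
    calc ∑ z, g z * conj (g z) = ∑ χ ∈ X, ∑ ψ ∈ X, fc n f χ * conj (fc n f ψ) * ∑ z, χ z * conj (ψ z) := by
          simp only [hg, map_sum, map_mul, Finset.sum_mul_sum]
          rw [Finset.sum_comm]
          refine Finset.sum_congr rfl fun χ _ => ?_
          rw [Finset.sum_comm]
          refine Finset.sum_congr rfl fun ψ _ => ?_
          rw [Finset.mul_sum]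
          refine Finset.sum_congr rfl fun z _ => by ring
      _ = ∑ χ ∈ X, fc n f χ * conj (fc n f χ) * N := by
          refine Finset.sum_congr rfl fun χ hχ => ?_
          simp only [horth, mul_ite, mul_zero]
          rw [Finset.sum_ite_eq, if_pos hχ]
      _ = _ := by
          simp only [hmul]
          rw [hs]; push_cast
          rw [← Finset.sum_mul]; ring
  have hnn : 0 ≤ ∑ z, ‖(f z : ℂ) - g z‖ ^ 2 := Finset.sum_nonneg fun _ _ => by positivity
  have hexp : ((∑ z, ‖(f z : ℂ) - g z‖ ^ 2 : ℝ) : ℂ) = ((∑ z, f z ^ 2 - N * s : ℝ) : ℂ) := by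
    have hconj := congrArg conj hfg
    rw [map_sum, Complex.conj_ofReal] at hconj
    simp only [map_mul, Complex.conj_conj, Complex.conj_ofReal] at hconj
    rw [Complex.ofReal_sum]
    simp only [← hmul, map_sub, Complex.conj_ofReal]
    have : ∀ z, ((f z : ℂ) - g z) * ((f z : ℂ) - conj (g z)) = (f z : ℂ) ^ 2 - (f z : ℂ) * conj (g z) - (f z : ℂ) * g z + g z * conj (g z) := by
      intro z; ring
    simp only [this, Finset.sum_add_distrib, Finset.sum_sub_distrib]
    rw [hfg, hgg, hconj]
    push_cast; ring
  have h3 : ∑ z, ‖(f z : ℂ) - g z‖ ^ 2 = ∑ z, f z ^ 2 - N * s := by exact_mod_cast hexp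
  linarith

lemma fc_level (d : ℕ) (η : ℝ) (hη : 0 ≤ η) (f : (∀ i, ZMod (n i)) → ℝ) (X : Finset (AddChar (∀ i, ZMod (n i)) ℂ))
    (hX : ∀ χ ∈ X, (csupp n χ).card ≤ d) (x0) :
    ∑ χ ∈ X, η ^ (csupp n χ).card * ‖fc n f χ‖ ^ 2 ≤ ∑ T with T.card ≤ d, η ^ T.card * EE univ ((PP T f) ^ 2) x0 := by
  classical
  rw [← Finset.sum_fiberwise_of_maps_to (s := X) (t := ({T | T.card ≤ d} : Finset (Finset ι))) (g := csupp n)]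
  · refine Finset.sum_le_sum fun T _ => ?_
    have : ∑ χ ∈ X with csupp n χ = T, η ^ (csupp n χ).card * ‖fc n f χ‖ ^ 2 =
        η ^ T.card * ∑ χ ∈ X with csupp n χ = T, ‖fc n (PP T f) χ‖ ^ 2 := by
      rw [Finset.mul_sum]
      refine Finset.sum_congr rfl fun χ hχ => ?_
      have h := (mem_filter.1 hχ).2
      rw [h]
      congr 3
      rw [← h, fc_PP]
    rw [this]
    have := fc_bessel n (PP T f) {χ ∈ X | csupp n χ = T} x0
    gcongr
  · intro χ hχ
    simp only [mem_filter, mem_univ, true_and]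
    exact hX χ hχ

end T4
end FS

namespace FS
open Finset
open scoped BigOperators ComplexConjugate

section T5
variable {ι : Type} [Fintype ι] [DecidableEq ι]
variable (n : ι → ℕ) [∀ i, NeZero (n i)] 

lemma ratchar (hco : Pairwise (Function.onFun Nat.Coprime n)) (Q : ℕ) (hQ : Q = ∏ i, n i) [NeZero Q] :
    ∃ χ : ZMod Q → AddChar (∀ i, ZMod (n i)) ℂ, Function.Injective χ ∧
      ∀ (a : ℤ) (t : ℕ), χ (a : ZMod Q) (red n t) = ee ((a * t : ℤ) / (Q : ℝ)) := by
  subst hQ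
  set e := ZMod.prodEquivPi n hco with he
  refine ⟨fun a => ((ZMod.stdAddChar (N := ∏ i, n i)).mulShift a).compAddMonoidHom (e.symm : (∀ i, ZMod (n i)) →+ ZMod (∏ i, n i)), ?_, ?_⟩
  · intro a b hab
    apply AddChar.to_mulShift_inj_of_isPrimitive (ZMod.isPrimitive_stdAddChar _)
    ext x
    have := DFunLike.congr_fun hab (e x)
    simpa using this
  · intro a t
    have h1 : e.symm (red n t) = (t : ZMod (∏ i, n i)) := by
      rw [RingEquiv.symm_apply_eq, map_natCast]; rfl
    change (ZMod.stdAddChar (N := ∏ i, n i)).mulShift a (e.symm (red n t)) = _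
    rw [h1, AddChar.mulShift_apply]
    have : ((a : ZMod (∏ i, n i)) * (t : ZMod (∏ i, n i))) = ((a * t : ℤ) : ZMod (∏ i, n i)) := by push_cast; rfl
    rw [this, stdAddChar_ee]

open Classical in
theorem transfer0 (hco : Pairwise (Function.onFun Nat.Coprime n)) (Q0 : ℕ) (hQ0 : 2 ≤ Q0) (hn : ∀ i, n i ≤ Q0)
    (hι : Fintype.card ι + 1 ≤ Q0) (m d : ℕ) (hm : 4 ≤ m) (hd : 1 ≤ d) (Y : ℕ) (hY : Q0 ^ (8 * m * d) ≤ Y)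
    (α : ℝ) (hα : 0 < α) (hαm : 1 ≤ 9 ^ m * α) (B : Finset ℕ) (hB : B ⊆ range Y)
    (NI : ∀ S : Finset ι, S.card ≤ d → ∀ x : ∀ i, ZMod (n i),
      (({t ∈ B | ∀ i ∈ S, red n t i = x i} : Finset ℕ).card : ℝ) * ∏ i ∈ S, (n i : ℝ) ≤ 2 * α * Y)
    (X : Finset ℚ) (hX : ∀ ξ ∈ X, 0 ≤ ξ ∧ ξ < 1) (hden : ∀ ξ ∈ X, ξ.den ∣ ∏ i, n i)
    (w : ℚ → ℕ) (hw : ∀ ξ ∈ X, w ξ ≤ d ∧ ({i | ¬ Nat.Coprime (n i) ξ.den} : Finset ι).card ≤ w ξ) :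
    ∑ ξ ∈ X, (1 / (256 * m) : ℝ) ^ (w ξ) * ‖(∑ t ∈ B, ee (-((ξ:ℝ) * t))) / Y‖ ^ 2 ≤ 36 * α ^ 2 := by
  obtain ⟨Q, hQ⟩ : ∃ Q, Q = ∏ i, n i := ⟨_, rfl⟩
  have hQ1 : Q ≠ 0 := by rw [hQ]; exact Finset.prod_ne_zero_iff.2 fun i _ => NeZero.ne _
  have : NeZero Q := ⟨hQ1⟩
  have hQR : (Q:ℝ) ≠ 0 := by exact_mod_cast hQ1
  obtain ⟨χ, hinj, hχ⟩ := ratchar n hco Q hQ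
  set num : ℚ → ℤ := fun ξ => ξ.num * ((Q / ξ.den : ℕ) : ℤ) with hnum
  have hξQ : ∀ ξ ∈ X, (num ξ : ℝ) / Q = (ξ:ℝ) := by
    intro ξ hξ
    obtain ⟨c, hc⟩ := hden ξ hξ
    rw [← hQ] at hc
    have hd0 : 0 < ξ.den := ξ.den_pos
    have h1 : Q / ξ.den = c := by rw [hc]; exact Nat.mul_div_cancel_left c hd0
    have hc0 : (c:ℝ) ≠ 0 := by
      rintro h; apply hQ1; rw [hc]; have : c = 0 := by exact_mod_cast h
      simp [this]
    have hd0' : (ξ.den:ℝ) ≠ 0 := by exact_mod_cast hd0.ne'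
    rw [hnum]
    simp only [h1]
    rw [hc]; push_cast
    conv_rhs => rw [Rat.cast_def]
    field_simp
  set ch : ℚ → AddChar (∀ i, ZMod (n i)) ℂ := fun ξ => χ ((num ξ : ℤ) : ZMod Q) with hch
  have hch1 : ∀ ξ ∈ X, ∀ t : ℕ, ch ξ (red n t) = ee ((ξ:ℝ) * t) := by
    intro ξ hξ t
    rw [hch]; simp only [hχ]
    rw [← hξQ ξ hξ]; congr 1; push_cast; ring
  have hchinj : Set.InjOn ch X := by
    intro ξ hξ ξ' hξ' h
    have h1 : ((num ξ : ℤ) : ZMod Q) = ((num ξ' : ℤ) : ZMod Q) := hinj h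
    rw [ZMod.intCast_eq_intCast_iff_dvd_sub] at h1
    have hb : ∀ ξ ∈ X, 0 ≤ num ξ ∧ num ξ < Q := by
      intro ξ hξ
      have h2 := hξQ ξ hξ
      have h3 : (0:ℝ) ≤ ξ := by exact_mod_cast (hX ξ hξ).1
      have h4 : (ξ:ℝ) < 1 := by exact_mod_cast (hX ξ hξ).2
      have hQp : (0:ℝ) < Q := by positivity
      rw [← h2] at h3 h4
      rw [div_lt_one hQp] at h4
      have h5 : 0 ≤ (num ξ : ℝ) := by
        by_contra h; push Not at h; exact absurd (div_neg_of_neg_of_pos h hQp) (not_lt.2 h3)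
      exact ⟨by exact_mod_cast h5, by exact_mod_cast h4⟩
    have heq : num ξ' - num ξ = 0 := by
      refine Int.eq_zero_of_abs_lt_dvd h1 ?_
      have := hb ξ hξ; have := hb ξ' hξ'
      rw [abs_lt]; constructor <;> linarith
    have h6 : (ξ:ℝ) = ξ' := by rw [← hξQ ξ hξ, ← hξQ ξ' hξ', show num ξ' = num ξ by linarith]
    exact_mod_cast h6
  have hsupp : ∀ ξ ∈ X, csupp n (ch ξ) ⊆ ({i | ¬ Nat.Coprime (n i) ξ.den} : Finset ι) := by
    intro ξ hξ i hi
    simp only [csupp, mem_filter, mem_univ, true_and] at hi ⊢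
    obtain ⟨y, hy⟩ := hi
    intro hcop
    apply hy
    obtain ⟨t, ht⟩ : ∃ t : ℕ, red n t = Pi.single i y := by
      set s := (ZMod.prodEquivPi n hco).symm (Pi.single i y)
      have hQ' : NeZero (∏ i, n i) := ⟨by rw [← hQ]; exact hQ1⟩
      refine ⟨s.val, ?_⟩
      have h1 : (ZMod.prodEquivPi n hco) ((s.val : ℕ) : ZMod (∏ i, n i)) = Pi.single i y := by
        rw [ZMod.natCast_zmod_val]; simp [s]
      rw [map_natCast] at h1
      exact h1
    rw [← ht, hch1 ξ hξ]
    have hdvd : ∏ j ∈ univ.erase i, n j ∣ t := by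
      have h0 : ((∏ j ∈ univ.erase i, n j : ℕ) : ℤ) ∣ (t : ℤ) := by
        push_cast
        refine Finset.prod_dvd_of_coprime ?_ ?_
        · intro j _ k _ hjk
          exact Nat.isCoprime_iff_coprime.2 (hco hjk)
        · intro j hj
          have h2 := congrFun ht j
          rw [Pi.single_eq_of_ne (Finset.mem_erase.1 hj).1] at h2
          exact Int.natCast_dvd_natCast.2 ((ZMod.natCast_eq_zero_iff _ _).1 h2)
      exact_mod_cast h0
    have hd2 : ξ.den ∣ t := by
      refine dvd_trans ?_ hdvd
      have := hden ξ hξ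
      rw [← Finset.mul_prod_erase univ n (mem_univ i)] at this
      exact (Nat.Coprime.dvd_of_dvd_mul_left hcop.symm this)
    obtain ⟨c, hc⟩ := hd2
    have : (ξ:ℝ) * t = ((ξ.num * c : ℤ) : ℝ) := by
      rw [hc, Rat.cast_def]
      have : (ξ.den:ℝ) ≠ 0 := by exact_mod_cast ξ.den_pos.ne'
      push_cast; field_simp
    rw [this, ee_int]
  have hfc : ∀ ξ ∈ X, fc n (push n Y B) (ch ξ) = (∑ t ∈ B, ee (-((ξ:ℝ) * t))) / Y := by
    intro ξ hξ
    unfold fc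
    have hcard : (Fintype.card (∀ i, ZMod (n i)) : ℂ) = ((∏ i, (n i : ℝ) : ℝ) : ℂ) := by
      rw [Fintype.card_pi]; simp only [ZMod.card]; push_cast; rfl
    have hne : ((∏ i, (n i : ℝ) : ℝ) : ℂ) ≠ 0 := by
      rw [← hcard]; exact_mod_cast Fintype.card_ne_zero
    have h1 : ∀ z, ((push n Y B z : ℝ) : ℂ) * ch ξ (-z) = ((∏ i, (n i : ℝ) : ℝ) : ℂ) / Y * ∑ t ∈ B with red n t = z, ee (-((ξ:ℝ) * t)) := by
      intro z
      have h2 : ∀ t ∈ ({t ∈ B | red n t = z} : Finset ℕ), ee (-((ξ:ℝ) * t)) = ch ξ (-z) := by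
        intro t ht
        rw [← (mem_filter.1 ht).2, AddChar.map_neg_eq_conj, hch1 ξ hξ, ee_neg]
      rw [Finset.sum_congr rfl h2, Finset.sum_const, nsmul_eq_mul]
      simp only [push]
      push_cast
      ring_nf
    simp only [h1]
    rw [← Finset.mul_sum, Finset.sum_fiberwise, hcard]
    field_simp
  have hlev := push_level n hco Q0 hQ0 hn hι m d hm hd Y hY α hα hαm B hB (by intro S hS x; convert NI S hS x) (red n 0)
  refine le_trans ?_ hlev
  refine le_trans ?_ (fc_level n d (1 / (256 * m)) (by positivity) (push n Y B) (X.image ch) ?_ (red n 0))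
  · rw [Finset.sum_image hchinj]
    refine Finset.sum_le_sum fun ξ hξ => ?_
    rw [hfc ξ hξ]
    have hm0 : (1:ℝ) ≤ m := by exact_mod_cast (by omega : 1 ≤ m)
    have : (csupp n (ch ξ)).card ≤ w ξ := (Finset.card_le_card (hsupp ξ hξ)).trans (hw ξ hξ).2
    have h1 : (1 / (256 * m) : ℝ) ^ w ξ ≤ (1 / (256 * m) : ℝ) ^ (csupp n (ch ξ)).card := by
      refine pow_le_pow_of_le_one (by positivity) ?_ this
      rw [div_le_one (by positivity)]; linarith
    gcongr
  · intro c hc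
    obtain ⟨ξ, hξ, rfl⟩ := Finset.mem_image.1 hc
    exact ((Finset.card_le_card (hsupp ξ hξ)).trans (hw ξ hξ).2).trans (hw ξ hξ).1

end T5

section T6

/-- the modulus attached to a set of primes -/
def qmod (Q0 : ℕ) (S : Finset ℕ) : ℕ := ∏ p ∈ S, p ^ Nat.log p Q0

lemma two_pow_omega (q : ℕ) (hq : q ≠ 0) : 2 ^ q.primeFactors.card ≤ q := by
  calc 2 ^ q.primeFactors.card = ∏ p ∈ q.primeFactors, 2 := by simp
    _ ≤ ∏ p ∈ q.primeFactors, p := Finset.prod_le_prod' fun p hp => (Nat.prime_of_mem_primeFactors hp).two_le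
    _ ≤ q := Nat.le_of_dvd (Nat.pos_of_ne_zero hq) (Nat.prod_primeFactors_dvd q)

theorem transfer (Q0 : ℕ) (hQ0 : 2 ≤ Q0) (m d : ℕ) (hm : 4 ≤ m) (hd : 1 ≤ d) (hQd : Q0 < 2 ^ (d + 1))
    (P : Finset ℕ) (hP : ∀ p ∈ P, p.Prime ∧ p ≤ Q0) (Y : ℕ) (hY : Q0 ^ (8 * m * d) ≤ Y)
    (α : ℝ) (hα : 0 < α) (hαm : 1 ≤ 9 ^ m * α) (B : Finset ℕ) (hB : B ⊆ range Y)
    (NI : ∀ S : Finset ℕ, S ⊆ P → S.card ≤ d → ∀ r : ℕ,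
      (({t ∈ B | t % qmod Q0 S = r} : Finset ℕ).card : ℝ) * qmod Q0 S ≤ 2 * α * Y)
    (X : Finset ℚ) (hX : ∀ ξ ∈ X, 0 ≤ ξ ∧ ξ < 1) (hden : ∀ ξ ∈ X, ξ.den ≤ Q0 ∧ ξ.den.primeFactors ⊆ P) :
    ∑ ξ ∈ X, (1 / (256 * m) : ℝ) ^ (ξ.den.primeFactors.card) * ‖(∑ t ∈ B, ee (-((ξ:ℝ) * t))) / Y‖ ^ 2 ≤ 36 * α ^ 2 := by
  classical
  set n : {p // p ∈ P} → ℕ := fun p => p.1 ^ Nat.log p.1 Q0 with hn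
  have : ∀ i, NeZero (n i) := fun i => ⟨pow_ne_zero _ (hP i.1 i.2).1.ne_zero⟩
  have hco : Pairwise (Function.onFun Nat.Coprime n) := by
    intro i j hij
    exact Nat.coprime_pow_primes _ _ (hP i.1 i.2).1 (hP j.1 j.2).1 (fun h => hij (Subtype.ext h))
  have hle : ∀ i, n i ≤ Q0 := fun i => Nat.pow_log_le_self _ (by omega)
  have hprodQ : ∏ i, n i = qmod Q0 P := by
    rw [qmod, ← Finset.prod_coe_sort P (fun p => p ^ Nat.log p Q0)]
  have hden' : ∀ ξ ∈ X, ξ.den ∣ ∏ i, n i := by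
    intro ξ hξ
    rw [hprodQ, qmod]
    have hne : ξ.den ≠ 0 := ξ.den_ne_zero
    conv_lhs => rw [← Nat.prod_factorization_pow_eq_self hne]
    rw [Finsupp.prod, Nat.support_factorization]
    refine dvd_trans ?_ (Finset.prod_dvd_prod_of_subset _ _ _ (hden ξ hξ).2)
    refine Finset.prod_dvd_prod_of_dvd _ _ fun p hp => pow_dvd_pow _ ?_
    have hpp := Nat.prime_of_mem_primeFactors hp
    refine Nat.le_log_of_pow_le hpp.one_lt ?_
    exact (Nat.le_of_dvd (Nat.pos_of_ne_zero hne) (Nat.ordProj_dvd _ _)).trans (hden ξ hξ).1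
  refine transfer0 n hco Q0 hQ0 hle ?_ m d hm hd Y hY α hα hαm B hB ?_ X hX hden' (fun ξ => ξ.den.primeFactors.card) ?_
  · rw [Fintype.card_coe]
    have : P ⊆ Finset.Icc 2 Q0 := fun p hp => Finset.mem_Icc.2 ⟨(hP p hp).1.two_le, (hP p hp).2⟩
    have := Finset.card_le_card this
    rw [Nat.card_Icc] at this
    omega
  · intro S hS x
    set S' : Finset ℕ := S.image Subtype.val with hS'
    have hS'c : S'.card ≤ d := Finset.card_image_le.trans hS
    have hS'P : S' ⊆ P := by
      intro p hp
      obtain ⟨i, _, rfl⟩ := Finset.mem_image.1 hp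
      exact i.2
    have hq : qmod Q0 S' = ∏ i ∈ S, n i := by
      rw [qmod, hS', Finset.prod_image (fun a _ b _ h => Subtype.ext h)]
    have hq' : (∏ i ∈ S, (n i : ℝ)) = (qmod Q0 S' : ℝ) := by rw [hq]; push_cast; rfl
    rw [hq']
    rcases Finset.eq_empty_or_nonempty ({t ∈ B | ∀ i ∈ S, red n t i = x i} : Finset ℕ) with he | ⟨t0, ht0⟩
    · rw [he]; simp; positivity
    · refine le_trans ?_ (NI S' hS'P hS'c (t0 % qmod Q0 S'))
      refine mul_le_mul_of_nonneg_right ?_ (Nat.cast_nonneg _)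
      refine Nat.cast_le.2 (Finset.card_le_card ?_)
      intro t ht
      simp only [mem_filter] at ht ht0 ⊢
      refine ⟨ht.1, ?_⟩
      have h1 : ∀ i ∈ S, t ≡ t0 [MOD n i] := by
        intro i hi
        have := (ht.2 i hi).trans (ht0.2 i hi).symm
        exact (ZMod.natCast_eq_natCast_iff _ _ _).1 this
      change t ≡ t0 [MOD qmod Q0 S']
      rw [hq]
      rw [Nat.modEq_iff_dvd]
      push_cast
      refine Finset.prod_dvd_of_coprime ?_ ?_
      · intro i _ j _ hij
        exact Nat.isCoprime_iff_coprime.2 (hco hij)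
      · intro i hi
        exact Nat.modEq_iff_dvd.1 (h1 i hi)
  · intro ξ hξ
    refine ⟨?_, ?_⟩
    · have h1 := two_pow_omega ξ.den ξ.den_ne_zero
      have h2 : 2 ^ ξ.den.primeFactors.card < 2 ^ (d + 1) := lt_of_le_of_lt (h1.trans (hden ξ hξ).1) hQd
      have := (Nat.pow_lt_pow_iff_right (by norm_num : 1 < 2)).1 h2
      omega
    · rw [← Finset.card_map ⟨Subtype.val, Subtype.val_injective⟩]
      refine Finset.card_le_card ?_
      intro p hp
      rw [Finset.mem_map] at hp
      obtain ⟨i, hi, rfl⟩ := hp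
      simp only [mem_filter, mem_univ, true_and] at hi
      simp only [Function.Embedding.coeFn_mk]
      rw [Nat.mem_primeFactors]
      refine ⟨(hP i.1 i.2).1, ?_, ξ.den_ne_zero⟩
      by_contra h
      apply hi
      exact Nat.Coprime.pow_left _ (((hP i.1 i.2).1.coprime_iff_not_dvd).2 h)

end T6
end FS


namespace FS
open Finset

section M1

lemma orth (R : ℕ) (hR : 0 < R) (n : ℤ) (hn : |n| < R) :
    ∑ j ∈ range R, ee ((j:ℝ) / R * n) = if n = 0 then (R:ℂ) else 0 := by
  split_ifs with h0
  · subst h0; simp [ee_zero]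
  · have hR' : (R:ℝ) ≠ 0 := by exact_mod_cast hR.ne'
    have h1 : ee ((n:ℝ) / R) ≠ 1 := by
      refine ee_div_ne_one R hR n ?_
      intro hd
      exact h0 (Int.eq_zero_of_abs_lt_dvd hd hn)
    have h2 : ∀ j ∈ range R, ee ((j:ℝ) / R * n) = ee ((n:ℝ)/R) ^ j := by
      intro j _
      rw [← ee_mul_nat]; congr 1; ring
    rw [Finset.sum_congr rfl h2, geom_sum_eq h1, ← ee_mul_nat]
    rw [show (R:ℝ) * ((n:ℝ)/R) = ((n:ℤ):ℝ) by field_simp, ee_int]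
    simp

lemma planch (f : ℤ → ℂ) (Ω : Finset ℤ) (B R : ℕ) (hΩ : ∀ z ∈ Ω, |z| ≤ B) (hf : ∀ z, z ∉ Ω → f z = 0)
    (H : ℤ) (hH : |H| ≤ B) (hR : 3 * B < R) :
    ∑ j ∈ range R, (∑ z ∈ Ω, f z * ee ((j:ℝ) / R * z)) * (starRingEnd ℂ) (∑ z ∈ Ω, f z * ee ((j:ℝ) / R * z))
      * ee ((j:ℝ) / R * H) = R * ∑ z ∈ Ω, f z * (starRingEnd ℂ) (f (z + H)) := by
  have h1 : ∀ j ∈ range R, (∑ z ∈ Ω, f z * ee ((j:ℝ) / R * z)) * (starRingEnd ℂ) (∑ z ∈ Ω, f z * ee ((j:ℝ) / R * z))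
      * ee ((j:ℝ) / R * H) = ∑ z ∈ Ω, ∑ w ∈ Ω, f z * (starRingEnd ℂ) (f w) * ee ((j:ℝ) / R * ((z - w + H : ℤ) : ℝ)) := by
    intro j _
    rw [map_sum, Finset.sum_mul_sum, Finset.sum_mul]
    refine Finset.sum_congr rfl fun z _ => ?_
    rw [Finset.sum_mul]
    refine Finset.sum_congr rfl fun w _ => ?_
    rw [map_mul, ← ee_neg]
    have : ee ((j:ℝ) / R * ((z - w + H : ℤ) : ℝ)) = ee ((j:ℝ) / R * z) * ee (-((j:ℝ) / R * w)) * ee ((j:ℝ) / R * H) := by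
      rw [← ee_add, ← ee_add]; congr 1; push_cast; ring
    rw [this]; ring
  rw [Finset.sum_congr rfl h1, Finset.sum_comm, Finset.mul_sum]
  refine Finset.sum_congr rfl fun z hz => ?_
  rw [Finset.sum_comm]
  have h2 : ∀ w ∈ Ω, ∑ j ∈ range R, f z * (starRingEnd ℂ) (f w) * ee ((j:ℝ) / R * ((z - w + H : ℤ) : ℝ))
      = if w = z + H then R * (f z * (starRingEnd ℂ) (f w)) else 0 := by
    intro w hw
    rw [← Finset.mul_sum, orth R (by omega)]
    · by_cases h : w = z + H
      · rw [if_pos h, if_pos (by omega)]; ring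
      · rw [if_neg h, if_neg (by omega)]; ring
    · have h3 := abs_le.1 (hΩ z hz)
      have h4 := abs_le.1 (hΩ w hw)
      have h5 := abs_le.1 hH
      rw [abs_lt]; constructor <;> omega
  rw [Finset.sum_congr rfl h2, Finset.sum_ite_eq']
  split_ifs with h
  · rfl
  · rw [hf _ h]; simp

/-- weighted progression average -/
noncomputable def pav (A : Finset ℤ) (V Y : ℕ) (w : ℕ → ℂ) (z : ℤ) : ℂ :=
  ∑ t ∈ range Y, if z + V * t ∈ A then w t else 0

lemma pav_ft (A : Finset ℤ) (X V Y : ℕ) (hA : A ⊆ Finset.Ico 0 (X:ℤ)) (hVY : V * Y ≤ X) (w : ℕ → ℂ) (θ : ℝ) :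
    ∑ z ∈ Finset.Ico (-(X:ℤ)) X, pav A V Y w z * ee (θ * z) =
      (∑ x ∈ A, ee (θ * x)) * ∑ t ∈ range Y, w t * ee (-(θ * V * t)) := by
  unfold pav
  simp only [Finset.sum_mul]
  rw [Finset.sum_comm]
  simp only [Finset.mul_sum]
  rw [Finset.sum_comm (s := A)]
  refine Finset.sum_congr rfl fun t ht => ?_
  simp only [ite_mul, zero_mul]
  rw [← Finset.sum_filter]
  have hVt : (V:ℤ) * t ≤ X := by
    have := Finset.mem_range.1 ht
    have h1 : V * t ≤ V * Y := Nat.mul_le_mul_left _ this.le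
    exact_mod_cast h1.trans hVY
  have hVt0 : (0:ℤ) ≤ V * t := by positivity
  refine Finset.sum_bij' (fun z _ => z + V * t) (fun x _ => x - V * t) ?_ ?_ ?_ ?_ ?_
  · intro z hz; exact (Finset.mem_filter.1 hz).2
  · intro x hx
    have := Finset.mem_Ico.1 (hA hx)
    simp only [Finset.mem_filter, Finset.mem_Ico, sub_add_cancel]
    exact ⟨⟨by omega, by omega⟩, hx⟩
  · intro z _; ring
  · intro x _; ring
  · intro z _
    have : ee (θ * z) = ee (θ * ((z + V * t : ℤ):ℝ)) * ee (-(θ * V * t)) := by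
      rw [← ee_add]; congr 1; push_cast; ring
    rw [this]; ring

lemma pav_zero (A : Finset ℤ) (X V Y : ℕ) (hA : A ⊆ Finset.Ico 0 (X:ℤ)) (w : ℕ → ℂ) (z : ℤ)
    (hz : z ∉ Finset.Ico (-((V * Y : ℕ):ℤ)) X) : pav A V Y w z = 0 := by
  unfold pav
  refine Finset.sum_eq_zero fun t ht => ?_
  rw [if_neg]
  intro h
  have h1 := Finset.mem_Ico.1 (hA h)
  apply hz
  rw [Finset.mem_Ico]
  have := Finset.mem_range.1 ht
  have h2 : V * t ≤ V * Y := Nat.mul_le_mul_left _ this.le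
  have h3 : (V:ℤ) * t ≤ ((V * Y : ℕ) : ℤ) := by exact_mod_cast h2
  have hVt0 : (0:ℤ) ≤ V * t := by positivity
  constructor <;> omega

end M1
end FS


namespace FS
open Finset Polynomial

section M2

noncomputable def chi (Y : ℕ) (φ : ℝ) : ℂ := (∑ t ∈ range Y, ee (-(φ * t))) / Y

lemma chi_norm_le (Y : ℕ) (φ : ℝ) : ‖chi Y φ‖ ≤ 1 := by
  unfold chi
  rw [norm_div, Complex.norm_natCast]
  refine div_le_one_of_le₀ ?_ (Nat.cast_nonneg _)
  refine (norm_sum_le _ _).trans ?_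
  simp [norm_ee]

lemma chi_near (Y : ℕ) (hY : 1 ≤ Y) (φ η : ℝ) (c : ℤ) (h : |φ - c| ≤ η) :
    1 - ‖chi Y φ‖ ^ 2 ≤ 16 * Y * η := by
  have hη : 0 ≤ η := (abs_nonneg _).trans h
  have hY0 : (0:ℝ) < Y := by exact_mod_cast hY
  have h1 : ‖1 - chi Y φ‖ ≤ 8 * Y * η := by
    unfold chi
    have e : (1:ℂ) - (∑ t ∈ range Y, ee (-(φ * t))) / Y = (∑ t ∈ range Y, (1 - ee (-(φ * t)))) / Y := by
      have : (Y:ℂ) ≠ 0 := by exact_mod_cast hY0.ne'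
      rw [Finset.sum_sub_distrib]; simp; field_simp
    rw [e, norm_div, Complex.norm_natCast, div_le_iff₀ hY0]
    refine (norm_sum_le _ _).trans ?_
    have : ∀ t ∈ range Y, ‖1 - ee (-(φ * t))‖ ≤ 8 * Y * η := by
      intro t ht
      have e2 : ee (-(φ * t)) = ee (-((φ - c) * t)) := by
        rw [show -((φ - c) * t) = -(φ * t) + ((c * t : ℤ):ℝ) by push_cast; ring, ee_add_int]
      rw [e2, norm_sub_rev]
      refine (norm_ee_sub_one_le _).trans ?_
      rw [abs_neg, abs_mul, Nat.abs_cast]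
      have ht' : (t:ℝ) ≤ Y := by exact_mod_cast (Finset.mem_range.1 ht).le
      have hpi : Real.pi ≤ 4 := Real.pi_le_four
      have hpi0 := Real.pi_pos
      calc 2 * Real.pi * (|φ - c| * t) ≤ 2 * 4 * (η * Y) := by gcongr
        _ = _ := by ring
    refine (Finset.sum_le_sum this).trans ?_
    simp; linarith
  have h2 : 1 - ‖chi Y φ‖ ≤ 8 * Y * η := by
    have := norm_sub_norm_le (1:ℂ) (chi Y φ)
    rw [norm_one] at this
    linarith
  have h3 := chi_norm_le Y φ
  have h4 := norm_nonneg (chi Y φ)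
  nlinarith

noncomputable def Xi (y Q0 : ℕ) : Finset ℚ :=
  ((range (Q0 + 1) ×ˢ range (Q0 + 1)).image (fun p => (p.1:ℚ) / p.2)).filter
    (fun ξ => (0 < ξ ∧ ξ < 1) ∧ ξ.den ≤ Q0 ∧ ∀ p ∈ ξ.den.primeFactors, y < p)

theorem pw (k : ℕ) (hk : 1 ≤ k) (Ch : ℝ) (hCh : 0 ≤ Ch) : ∃ C₀ : ℕ, ∀ G : ℤ[X], G.natDegree ≤ k → G.coeff 0 = 0 →
    G.content = 1 → 0 < G.coeff k → (∀ j, |(G.coeff j : ℝ)| ≤ Ch * G.coeff k) →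
    ∀ (y : ℕ) (ε : ℝ), (k : ℝ) ≤ ε * √y → k ≤ y → 1 ≤ y →
    (∀ p : ℕ, p.Prime → p ≤ y → ¬ (p:ℤ) ∣ G.coeff 1 ∧ ∀ i, 2 ≤ i → (p:ℤ) ∣ G.coeff i) →
    (∀ p : ℕ, p.Prime → y < p → ∃ i, 1 ≤ i ∧ ¬ (p:ℤ) ∣ G.coeff i) →
    ∀ α : ℝ, 0 < α → α ≤ 1 → ∀ Q0 : ℕ, (8 / α) ^ C₀ ≤ (Q0:ℝ) → ∀ N Y : ℕ, 1 ≤ Y → 1 ≤ N →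
    (G.coeff k : ℝ) * Q0 ≤ N → 64 * Y * Q0 ≤ α * (G.coeff k * N ^ k) → ∀ φ : ℝ,
    (1 - ‖chi Y φ‖ ^ 2) * ‖(∑ m ∈ range N, ee (φ * ((G.eval (m:ℤ) : ℤ) : ℝ))) / N‖ ≤
      α / 4 + 2 * ∑ ξ ∈ Xi y Q0, ε ^ ξ.den.primeFactors.card * ‖chi Y (φ - ξ)‖ ^ 2 := by
  obtain ⟨C₀, hC⟩ := arc k hk Ch hCh
  refine ⟨C₀, ?_⟩
  intro G hG hG0 hG1 hGk hGj y ε hε hky hy hsm hla α hα hα1 Q0 hQ0 N Y hY hN hNQ hYQ φ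
  have hN0 : (0:ℝ) < N := by exact_mod_cast hN
  have hY0 : (0:ℝ) < Y := by exact_mod_cast hY
  have hGk' : (0:ℝ) < G.coeff k := by exact_mod_cast hGk
  have hε0 : 0 ≤ ε := by
    by_contra hlt
    push Not at hlt
    have : (1:ℝ) ≤ k := by exact_mod_cast hk
    nlinarith [Real.sqrt_nonneg (y:ℝ)]
  have hsum0 : 0 ≤ 2 * ∑ ξ ∈ Xi y Q0, ε ^ ξ.den.primeFactors.card * ‖chi Y (φ - ξ)‖ ^ 2 := by positivity
  have hx1 := chi_norm_le Y φ
  have hx0 := norm_nonneg (chi Y φ)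
  have hx2 : 1 - ‖chi Y φ‖ ^ 2 ≤ 1 := by nlinarith
  have hx3 : 0 ≤ 1 - ‖chi Y φ‖ ^ 2 := by nlinarith
  set g := ∑ m ∈ range N, ee (φ * ((G.eval (m:ℤ) : ℤ) : ℝ)) with hg
  have hgn : ‖g / N‖ = ‖g‖ / N := by rw [norm_div, Complex.norm_natCast]
  rw [hgn]
  have hred : ∀ c : ℝ, ‖g‖ / N ≤ c → (1 - ‖chi Y φ‖ ^ 2) * (‖g‖ / N) ≤ c := by
    intro c hc
    have : 0 ≤ ‖g‖ / N := by positivity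
    nlinarith
  by_cases hsmall : ‖g‖ ≤ α / 4 * N
  · refine (hred (α / 4) ?_).trans (by linarith)
    rw [div_le_iff₀ hN0]; exact hsmall
  push Not at hsmall
  have e8 : 2 / (α / 4) = 8 / α := by field_simp; norm_num
  obtain ⟨q, a, hq1, hq, hco, hφ, hgb⟩ := hC G hG hG0 hG1 hGk hGj (α / 4) (by positivity) (by linarith) N
    (by rw [e8]; refine le_trans ?_ hNQ; gcongr) φ hsmall.le
  rw [e8] at hq hφ
  have hqQ : q ≤ Q0 := by exact_mod_cast hq.trans hQ0
  have hq0 : (0:ℝ) < q := by exact_mod_cast hq1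
  have hη : 16 * Y * ((8 / α) ^ C₀ / (G.coeff k * N ^ k)) ≤ α / 4 := by
    have : (0:ℝ) < G.coeff k * N ^ k := by positivity
    calc 16 * Y * ((8 / α) ^ C₀ / (G.coeff k * N ^ k)) ≤ 16 * Y * (Q0 / (G.coeff k * N ^ k)) := by gcongr
      _ = (64 * Y * Q0) / (4 * (G.coeff k * N ^ k)) := by field_simp; ring
      _ ≤ (α * (G.coeff k * N ^ k)) / (4 * (G.coeff k * N ^ k)) := by gcongr
      _ = α / 4 := by field_simp
  rcases Nat.lt_or_ge 1 q with hq2 | hq2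
  swap
  · have hq1' : q = 1 := by omega
    subst hq1'
    have h1 := chi_near Y hY φ _ a (by simpa using hφ)
    have h2 : ‖g‖ / N ≤ 1 := by
      rw [div_le_one hN0]
      refine (norm_sum_le _ _).trans ?_
      simp [norm_ee]
    have h3 : 0 ≤ ‖g‖ / N := by positivity
    nlinarith
  have hcs := cs_bound G k y ε hε hky hy hG hsm hla q hq1 a hco
  have hgb2 : ‖g‖ / N ≤ (∏ p ∈ q.primeFactors, (if p ≤ y then 0 else ε)) + α / 8 := by
    rw [div_le_iff₀ hN0]
    refine hgb.trans ?_
    have : ‖∑ n ∈ range q, ee ((((C a * G).eval (n:ℤ) : ℤ) : ℝ) / q)‖ = ‖cs G q a‖ := by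
      unfold cs; simp
    rw [this]
    calc N / q * ‖cs G q a‖ + α / 4 / 2 * N ≤ N / q * (q * ∏ p ∈ q.primeFactors, (if p ≤ y then 0 else ε)) + α / 4 / 2 * N := by
          gcongr
      _ = _ := by field_simp; ring
  refine hred _ ?_
  by_cases hall : ∀ p ∈ q.primeFactors, y < p
  swap
  · push Not at hall
    obtain ⟨p, hp, hpy⟩ := hall
    have hz : (∏ p ∈ q.primeFactors, (if p ≤ y then (0:ℝ) else ε)) = 0 := Finset.prod_eq_zero hp (if_pos hpy)
    rw [hz] at hgb2
    linarith
  have hprod : (∏ p ∈ q.primeFactors, (if p ≤ y then 0 else ε)) = ε ^ q.primeFactors.card := by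
    rw [Finset.prod_congr rfl (fun p hp => if_neg (by have := hall p hp; omega)), Finset.prod_const]
  rw [hprod] at hgb2
  set b := a % q with hb
  have hqz : (0:ℤ) < q := by exact_mod_cast hq1
  have hb0 : 0 ≤ b := Int.emod_nonneg _ hqz.ne'
  have hbq : b < q := Int.emod_lt_of_pos _ hqz
  have hab : a = b + q * (a / q) := (Int.emod_add_mul_ediv a q).symm
  have hbco : IsCoprime b (q:ℤ) := by
    rw [hab] at hco
    exact IsCoprime.of_add_mul_left_left hco
  set ξ : ℚ := (b:ℚ) / ((q:ℤ):ℚ) with hξ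
  have hden : ξ.den = q := by
    have := Rat.den_div_eq_of_coprime (a := b) (b := (q:ℤ)) hqz (Int.isCoprime_iff_gcd_eq_one.1 hbco)
    exact Nat.cast_injective (R := ℤ) this
  have hbne : b ≠ 0 := by
    intro h0
    rw [h0, isCoprime_zero_left, Int.isUnit_iff] at hbco
    omega
  have hqq : (0:ℚ) < ((q:ℤ):ℚ) := by exact_mod_cast hqz
  have hmem : ξ ∈ Xi y Q0 := by
    unfold Xi
    rw [Finset.mem_filter, Finset.mem_image]
    refine ⟨⟨(b.toNat, q), ?_, ?_⟩, ⟨?_, ?_⟩, ?_, ?_⟩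
    · rw [Finset.mem_product, Finset.mem_range, Finset.mem_range]
      constructor <;> simp <;> omega
    · simp only [hξ]
      have : ((b.toNat : ℕ) : ℚ) = (b:ℚ) := by
        have h : ((b.toNat : ℕ) : ℤ) = b := Int.toNat_of_nonneg hb0
        exact_mod_cast congrArg (fun z : ℤ => (z:ℚ)) h
      rw [this]; simp
    · have : (0:ℚ) < b := by exact_mod_cast (by omega : 0 < b)
      positivity
    · rw [hξ, div_lt_one hqq]; exact_mod_cast hbq
    · rw [hden]; exact hqQ
    · rw [hden]; exact hall
  have hnear : |φ - ξ - ((a / q : ℤ) : ℝ)| ≤ (8 / α) ^ C₀ / (G.coeff k * N ^ k) := by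
    have : φ - ξ - ((a / q : ℤ) : ℝ) = φ - a / q := by
      have e1 : (a:ℝ) = b + q * ((a / q : ℤ):ℝ) := by exact_mod_cast congrArg (fun z : ℤ => (z:ℝ)) hab
      have e2 : (ξ:ℝ) = b / q := by rw [hξ]; push_cast; rfl
      rw [e1, e2]; field_simp; ring
    rw [this]; exact hφ
  have h1 := chi_near Y hY _ _ _ hnear
  have h2 : (1:ℝ)/2 ≤ ‖chi Y (φ - ξ)‖ ^ 2 := by linarith
  have h3 : ε ^ q.primeFactors.card * ‖chi Y (φ - ξ)‖ ^ 2 ≤ ∑ ξ ∈ Xi y Q0, ε ^ ξ.den.primeFactors.card * ‖chi Y (φ - ξ)‖ ^ 2 := by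
    have := Finset.single_le_sum (f := fun ξ : ℚ => ε ^ ξ.den.primeFactors.card * ‖chi Y (φ - ξ)‖ ^ 2) (fun i _ => by positivity) hmem
    simp only [hden] at this
    exact this
  have h4 : 0 ≤ ε ^ q.primeFactors.card := by positivity
  nlinarith

end M2
end FS


namespace FS
open Finset Polynomial

section M3

/-- real progression average -/
noncomputable def arr (A : Finset ℤ) (V Y : ℕ) (z : ℤ) : ℝ :=
  (({t ∈ range Y | z + V * t ∈ A} : Finset ℕ).card : ℝ) / Y

lemma pav_arr (A : Finset ℤ) (V Y : ℕ) (z : ℤ) : pav A V Y (fun _ => 1 / (Y:ℂ)) z = (arr A V Y z : ℂ) := by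
  unfold pav arr
  rw [← Finset.sum_filter, Finset.sum_const, nsmul_eq_mul]
  push_cast; ring

lemma arr_nonneg (A : Finset ℤ) (V Y : ℕ) (z : ℤ) : 0 ≤ arr A V Y z := by
  unfold arr; positivity

lemma arr_zero (A : Finset ℤ) (X V Y : ℕ) (hA : A ⊆ Finset.Ico 0 (X:ℤ)) (z : ℤ)
    (hz : z ∉ Finset.Ico (-((V * Y : ℕ):ℤ)) X) : arr A V Y z = 0 := by
  have := pav_zero A X V Y hA (fun _ => 1 / (Y:ℂ)) z hz
  rw [pav_arr] at this
  exact_mod_cast this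

lemma arr_sum (A : Finset ℤ) (X V Y : ℕ) (hY : 1 ≤ Y) (hA : A ⊆ Finset.Ico 0 (X:ℤ)) (hVY : V * Y ≤ X)
    (I : Finset ℤ) (hI : Finset.Ico (-((V * Y : ℕ):ℤ)) X ⊆ I) : ∑ z ∈ I, arr A V Y z = A.card := by
  have hY0 : (Y:ℂ) ≠ 0 := by exact_mod_cast (by omega : Y ≠ 0)
  have h1 : ∑ z ∈ Finset.Ico (-(X:ℤ)) X, arr A V Y z = A.card := by
    have := pav_ft A X V Y hA hVY (fun _ => 1 / (Y:ℂ)) 0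
    simp only [pav_arr, zero_mul, neg_zero, ee_zero, mul_one, Finset.sum_const, nsmul_eq_mul, card_range] at this
    rw [mul_one_div_cancel hY0, mul_one] at this
    exact_mod_cast this
  have h2 : ∀ J : Finset ℤ, Finset.Ico (-((V * Y : ℕ):ℤ)) X ⊆ J →
      ∑ z ∈ Finset.Ico (-((V * Y : ℕ):ℤ)) X, arr A V Y z = ∑ z ∈ J, arr A V Y z := fun J hJ =>
    Finset.sum_subset hJ fun z _ hz => arr_zero A X V Y hA z hz
  rw [← h2 I hI, h2 _ (?_ : _ ⊆ Finset.Ico (-(X:ℤ)) X), h1]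
  refine Finset.Ico_subset_Ico ?_ le_rfl
  have : ((V * Y : ℕ):ℤ) ≤ X := by exact_mod_cast hVY
  omega

lemma corr_lower (A : Finset ℤ) (X V Y : ℕ) (hY : 1 ≤ Y) (hA : A ⊆ Finset.Ico 0 (X:ℤ)) (hVY : 100 * (V * Y) ≤ X)
    (H : ℤ) (hH0 : 0 ≤ H) (hH : 100 * H ≤ X) (α : ℝ) (hα : 0 < α) (hcard : (A.card : ℝ) = α * X)
    (hni : ∀ z, arr A V Y z ≤ 1.1 * α) :
    0.96 * α ^ 2 * X ≤ ∑ z ∈ Finset.Ico (-(X:ℤ)) X, arr A V Y z * arr A V Y (z + H) := by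
  have hVYz : 100 * ((V * Y : ℕ):ℤ) ≤ X := by exact_mod_cast hVY
  have hsub : Finset.Ico (-((V * Y : ℕ):ℤ) - H) (X:ℤ) ⊆ Finset.Ico (-(X:ℤ)) X := by
    refine Finset.Ico_subset_Ico ?_ le_rfl
    omega
  refine le_trans ?_ (Finset.sum_le_sum_of_subset_of_nonneg hsub fun z _ _ => mul_nonneg (arr_nonneg _ _ _ _) (arr_nonneg _ _ _ _))
  have h1 : ∑ z ∈ Finset.Ico (-((V * Y : ℕ):ℤ) - H) (X:ℤ), arr A V Y z = α * X := by
    rw [arr_sum A X V Y hY hA (by omega) _ (Finset.Ico_subset_Ico (by omega) le_rfl), hcard]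
  have h2 : ∑ z ∈ Finset.Ico (-((V * Y : ℕ):ℤ) - H) (X:ℤ), arr A V Y (z + H) = α * X := by
    have : ∑ z ∈ Finset.Ico (-((V * Y : ℕ):ℤ)) ((X:ℤ) + H), arr A V Y z = α * X := by
      rw [arr_sum A X V Y hY hA (by omega) _ (Finset.Ico_subset_Ico le_rfl (by omega)), hcard]
    rw [← this]
    refine Finset.sum_bij' (fun z _ => z + H) (fun z _ => z - H) ?_ ?_ ?_ ?_ ?_
    · intro z hz; simp only [Finset.mem_Ico] at hz ⊢; omega
    · intro z hz; simp only [Finset.mem_Ico] at hz ⊢; omega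
    · intro z _; ring
    · intro z _; ring
    · intro z _; rfl
  have h3 : ∀ z ∈ Finset.Ico (-((V * Y : ℕ):ℤ) - H) (X:ℤ), 1.1 * α * arr A V Y z + 1.1 * α * arr A V Y (z + H) - (1.1 * α) ^ 2
      ≤ arr A V Y z * arr A V Y (z + H) := by
    intro z _
    nlinarith [mul_nonneg (sub_nonneg.2 (hni z)) (sub_nonneg.2 (hni (z + H)))]
  refine le_trans ?_ (Finset.sum_le_sum h3)
  rw [Finset.sum_sub_distrib, Finset.sum_add_distrib, ← Finset.mul_sum, ← Finset.mul_sum, h1, h2, Finset.sum_const, Int.card_Ico, nsmul_eq_mul]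
  have h4 : ((((X:ℤ) - (-((V * Y : ℕ):ℤ) - H)).toNat : ℕ) : ℝ) ≤ 1.02 * X := by
    have : ((((X:ℤ) - (-((V * Y : ℕ):ℤ) - H)).toNat : ℕ) : ℤ) = (X:ℤ) - (-((V * Y : ℕ):ℤ) - H) := Int.toNat_of_nonneg (by omega)
    have h5 : 100 * ((((X:ℤ) - (-((V * Y : ℕ):ℤ) - H)).toNat : ℕ) : ℤ) ≤ 102 * X := by rw [this]; linarith
    have h6 : 100 * ((((X:ℤ) - (-((V * Y : ℕ):ℤ) - H)).toNat : ℕ) : ℝ) ≤ 102 * X := by exact_mod_cast h5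
    linarith
  have h7 : 0 ≤ α ^ 2 * X := by positivity
  nlinarith [mul_le_mul_of_nonneg_right h4 (sq_nonneg (1.1 * α))]

theorem fstep (k : ℕ) (hk : 1 ≤ k) (Ch : ℝ) (hCh : 0 ≤ Ch) : ∃ C₀ : ℕ, ∀ G : ℤ[X], G.natDegree ≤ k → G.coeff 0 = 0 →
    G.content = 1 → 0 < G.coeff k → (∀ j, |(G.coeff j : ℝ)| ≤ Ch * G.coeff k) →
    ∀ (y m d Q0 : ℕ), 4 ≤ m → 1 ≤ d → 2 ≤ Q0 → Q0 < 2 ^ (d + 1) → (38400 * m * k) ^ 2 ≤ y →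
    (∀ p : ℕ, p.Prime → p ≤ y → ¬ (p:ℤ) ∣ G.coeff 1 ∧ ∀ i, 2 ≤ i → (p:ℤ) ∣ G.coeff i) →
    (∀ p : ℕ, p.Prime → y < p → ∃ i, 1 ≤ i ∧ ¬ (p:ℤ) ∣ G.coeff i) →
    ∀ (X V Y N : ℕ) (A : Finset ℤ), A ⊆ Finset.Ico 0 (X:ℤ) → 1 ≤ X →
    ∀ α : ℝ, 0 < α → α ≤ 1 → (A.card : ℝ) = α * X → (8 / α) ^ C₀ ≤ (Q0:ℝ) → 1 ≤ 9 ^ m * α →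
    Q0 ^ (8 * m * d) ≤ Y → 1 ≤ N → (G.coeff k : ℝ) * Q0 ≤ N → 64 * Y * Q0 ≤ α * (G.coeff k * N ^ k) →
    100 * (V * Y) ≤ X → ∀ H0 : ℤ, (∀ n : ℕ, n < N → 0 ≤ H0 + V * G.eval (n:ℤ) ∧ 100 * (H0 + V * G.eval (n:ℤ)) ≤ X) →
    (∀ n : ℕ, n < N → ∀ a ∈ A, ∀ b ∈ A, b - a ≠ H0 + V * G.eval (n:ℤ)) →
    (∀ z : ℤ, (({t ∈ range Y | z + V * t ∈ A} : Finset ℕ).card : ℝ) ≤ 1.1 * α * Y) →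
    (∀ S : Finset ℕ, (∀ p ∈ S, p.Prime ∧ p ≤ Q0) → S.card ≤ d → ∀ (z : ℤ) (r : ℕ),
      (({t ∈ range Y | z + V * t ∈ A ∧ t % qmod Q0 S = r} : Finset ℕ).card : ℝ) * qmod Q0 S ≤ 2 * α * Y) →
    False := by
  obtain ⟨C₀, hC⟩ := pw k hk Ch hCh
  refine ⟨C₀, ?_⟩
  intro G hG hG0 hG1 hGk hGj y m d Q0 hm hd hQ2 hQd hy hsm hla X V Y N A hA hX α hα hα1 hcard hQ0 hαm hYQ hN hNQ hYN hVY H0 hH hdiff NI1 NI2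
  have hm0 : (4:ℝ) ≤ m := by exact_mod_cast hm
  have hk0 : (1:ℝ) ≤ k := by exact_mod_cast hk
  have hY : 1 ≤ Y := le_trans (Nat.one_le_pow _ _ (by omega)) hYQ
  have hY0 : (0:ℝ) < Y := by exact_mod_cast hY
  have hN0 : (0:ℝ) < N := by exact_mod_cast hN
  have hX0 : (0:ℝ) < X := by exact_mod_cast hX
  set ε : ℝ := 1 / (38400 * m) with hε
  have hε0 : 0 < ε := by positivity
  have hmk : 1 ≤ 38400 * m * k := Nat.mul_pos (by omega) hk
  have hky : k ≤ y := by
    refine le_trans ?_ hy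
    calc k ≤ 38400 * m * k := Nat.le_mul_of_pos_left _ (by omega)
      _ ≤ _ := Nat.le_self_pow (by norm_num) _
  have hεk : (k:ℝ) ≤ ε * √y := by
    have h1 : ((38400 * m * k : ℕ) : ℝ) ≤ √y := by
      apply Real.le_sqrt_of_sq_le
      exact_mod_cast hy
    rw [hε, one_div, ← div_eq_inv_mul, le_div_iff₀ (by positivity)]
    refine le_trans (le_of_eq ?_) h1
    push_cast; ring
  have hpw := hC G hG hG0 hG1 hGk hGj y ε hεk hky (hk.trans hky) hsm hla α hα hα1 Q0 hQ0 N Y hY hN hNQ hYN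
  set R : ℕ := 3 * X + 1 with hR
  have hR0 : (0:ℝ) < R := by positivity
  set θ : ℕ → ℝ := fun j => (j:ℝ) / R with hθ
  set Ah : ℕ → ℂ := fun j => ∑ x ∈ A, ee (θ j * x) with hAh
  set Hn : ℕ → ℤ := fun n => H0 + V * G.eval (n:ℤ) with hHn
  have hHabs : ∀ n, n < N → |Hn n| ≤ X := by
    intro n hn
    have := hH n hn
    have e : Hn n = H0 + V * G.eval (n:ℤ) := rfl
    rw [abs_le]; omega
  have hAabs : ∀ z ∈ A, |z| ≤ (X:ℕ) := by
    intro z hz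
    have := Finset.mem_Ico.1 (hA hz)
    rw [abs_of_nonneg this.1]; exact this.2.le
  have hΩabs : ∀ z ∈ Finset.Ico (-(X:ℤ)) X, |z| ≤ (X:ℕ) := by
    intro z hz
    have := Finset.mem_Ico.1 hz
    rw [abs_le]; omega
  have hmulconj : ∀ w : ℂ, w * (starRingEnd ℂ) w = ((‖w‖ ^ 2 : ℝ) : ℂ) := fun w => by
    rw [Complex.mul_conj, Complex.normSq_eq_norm_sq]
  -- indicator transform
  have hind : ∀ H : ℤ, |H| ≤ (X:ℕ) → ∑ j ∈ range R, ((‖Ah j‖ ^ 2 : ℝ) : ℂ) * ee (θ j * H) =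
      R * ∑ z ∈ A, (if z + H ∈ A then (1:ℂ) else 0) := by
    intro H hHX
    have := planch (fun z => if z ∈ A then (1:ℂ) else 0) A X R hAabs (fun z hz => if_neg hz) H hHX (by omega)
    have e : ∀ j : ℕ, ∑ z ∈ A, (if z ∈ A then (1:ℂ) else 0) * ee ((j:ℝ) / R * z) = Ah j := by
      intro j
      refine Finset.sum_congr rfl fun z hz => ?_
      rw [if_pos hz, one_mul]
    simp only [e, hmulconj] at this
    rw [this]
    congr 1
    refine Finset.sum_congr rfl fun z hz => ?_
    rw [if_pos hz, one_mul]
    split_ifs <;> simp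
  have hE0 : ∀ n ∈ range N, ∑ j ∈ range R, ((‖Ah j‖ ^ 2 : ℝ) : ℂ) * ee (θ j * (Hn n)) = 0 := by
    intro n hn
    have hn' := Finset.mem_range.1 hn
    rw [hind _ (hHabs n hn'), Finset.sum_eq_zero, mul_zero]
    intro z hz
    rw [if_neg]
    intro h
    exact hdiff n hn' z hz _ h (by simp only [hHn]; ring)
  have hP : ∑ j ∈ range R, ‖Ah j‖ ^ 2 = R * (α * X) := by
    have := hind 0 (by simp)
    simp only [Int.cast_zero, mul_zero, ee_zero, mul_one, add_zero] at this
    rw [Finset.sum_congr rfl (fun z hz => if_pos hz), Finset.sum_const, nsmul_eq_mul, mul_one] at this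
    rw [← hcard]
    exact_mod_cast this
  -- weighted transform
  have hpl : ∀ (w : ℕ → ℂ) (H : ℤ), |H| ≤ (X:ℕ) →
      ∑ j ∈ range R, ((‖Ah j‖ ^ 2 * ‖∑ t ∈ range Y, w t * ee (-(θ j * V * t))‖ ^ 2 : ℝ) : ℂ) * ee (θ j * H) =
      R * ∑ z ∈ Finset.Ico (-(X:ℤ)) X, pav A V Y w z * (starRingEnd ℂ) (pav A V Y w (z + H)) := by
    intro w H hHX
    have := planch (pav A V Y w) (Finset.Ico (-(X:ℤ)) X) X R hΩabs ?_ H hHX (by omega)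
    · rw [← this]
      refine Finset.sum_congr rfl fun j _ => ?_
      rw [hmulconj, pav_ft A X V Y hA (by omega), norm_mul, mul_pow]
    · intro z hz
      refine pav_zero A X V Y hA w z ?_
      intro h
      apply hz
      rw [Finset.mem_Ico] at h ⊢
      have : 100 * ((V * Y : ℕ):ℤ) ≤ X := by exact_mod_cast hVY
      omega
  have hni : ∀ z, arr A V Y z ≤ 1.1 * α := by
    intro z
    unfold arr
    rw [div_le_iff₀ hY0]; exact NI1 z
  set Sn : ℕ → ℝ := fun n => ∑ z ∈ Finset.Ico (-(X:ℤ)) X, arr A V Y z * arr A V Y (z + Hn n) with hSn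
  have hSnlow : ∀ n ∈ range N, 0.96 * α ^ 2 * X ≤ Sn n := by
    intro n hn
    have hn' := hH n (Finset.mem_range.1 hn)
    exact corr_lower A X V Y hY hA hVY (Hn n) hn'.1 hn'.2 α hα hcard hni
  have hchi : ∀ φ : ℝ, ∑ t ∈ range Y, 1 / (Y:ℂ) * ee (-(φ * t)) = chi Y φ := by
    intro φ
    rw [← Finset.mul_sum]; unfold chi; ring
  have hE1 : ∀ n ∈ range N, ∑ j ∈ range R, ((‖Ah j‖ ^ 2 * ‖chi Y (θ j * V)‖ ^ 2 : ℝ) : ℂ) * ee (θ j * (Hn n)) = ((R * Sn n : ℝ) : ℂ) := by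
    intro n hn
    have := hpl (fun _ => 1 / (Y:ℂ)) (Hn n) (hHabs n (Finset.mem_range.1 hn))
    simp only [hchi, pav_arr, Complex.conj_ofReal] at this
    rw [this]; simp only [hSn]; push_cast; rfl
  have hmain : (R:ℝ) * (N * (0.96 * α ^ 2 * X)) ≤ ∑ j ∈ range R, ‖Ah j‖ ^ 2 * ((1 - ‖chi Y (θ j * V)‖ ^ 2) *
      ‖∑ n ∈ range N, ee (θ j * V * ((G.eval (n:ℤ) : ℤ) : ℝ))‖) := by
    have h1 : ∑ j ∈ range R, ((‖Ah j‖ ^ 2 * (1 - ‖chi Y (θ j * V)‖ ^ 2) : ℝ) : ℂ) * ∑ n ∈ range N, ee (θ j * (Hn n))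
        = - ((R * ∑ n ∈ range N, Sn n : ℝ) : ℂ) := by
      simp only [Finset.mul_sum]
      rw [Finset.sum_comm]
      push_cast
      rw [← Finset.sum_neg_distrib]
      refine Finset.sum_congr rfl fun n hn => ?_
      have e0 := hE0 n hn
      have e1 := hE1 n hn
      push_cast at e0 e1
      rw [← e1, ← sub_eq_zero, sub_neg_eq_add, ← Finset.sum_add_distrib]
      rw [← e0]
      refine Finset.sum_congr rfl fun j _ => ?_
      ring
    have h2 : (R:ℝ) * ∑ n ∈ range N, Sn n ≤ ‖∑ j ∈ range R, ((‖Ah j‖ ^ 2 * (1 - ‖chi Y (θ j * V)‖ ^ 2) : ℝ) : ℂ) * ∑ n ∈ range N, ee (θ j * (Hn n))‖ := by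
      rw [h1, norm_neg, Complex.norm_real]; exact le_abs_self _
    have h3 : (N:ℝ) * (0.96 * α ^ 2 * X) ≤ ∑ n ∈ range N, Sn n := by
      have := Finset.card_nsmul_le_sum _ _ _ hSnlow
      rwa [nsmul_eq_mul, card_range] at this
    refine (mul_le_mul_of_nonneg_left h3 hR0.le).trans (h2.trans ((norm_sum_le _ _).trans ?_))
    refine Finset.sum_le_sum fun j _ => ?_
    have hx1 := chi_norm_le Y (θ j * V)
    have hx0 := norm_nonneg (chi Y (θ j * V))
    have hx3 : 0 ≤ 1 - ‖chi Y (θ j * V)‖ ^ 2 := by nlinarith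
    have e2 : ∑ n ∈ range N, ee (θ j * (Hn n)) = ee (θ j * H0) * ∑ n ∈ range N, ee (θ j * V * ((G.eval (n:ℤ) : ℤ) : ℝ)) := by
      rw [Finset.mul_sum]
      refine Finset.sum_congr rfl fun n _ => ?_
      rw [← ee_add]; congr 1; simp only [hHn]; push_cast; ring
    rw [norm_mul, Complex.norm_real, Real.norm_of_nonneg (by positivity), e2, norm_mul, norm_ee, one_mul, mul_assoc]
  -- major arc sums
  have hξsum : ∀ ξ : ℚ, ∑ j ∈ range R, ‖Ah j‖ ^ 2 * ‖chi Y (θ j * V - ξ)‖ ^ 2 =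
      R * ∑ z ∈ Finset.Ico (-(X:ℤ)) X, ‖pav A V Y (fun t => ee ((ξ:ℝ) * t) / Y) z‖ ^ 2 := by
    intro ξ
    have := hpl (fun t => ee ((ξ:ℝ) * t) / Y) 0 (by simp)
    simp only [Int.cast_zero, mul_zero, ee_zero, mul_one, add_zero, hmulconj] at this
    have e : ∀ j : ℕ, ∑ t ∈ range Y, ee ((ξ:ℝ) * t) / Y * ee (-(θ j * V * t)) = chi Y (θ j * V - ξ) := by
      intro j
      unfold chi
      rw [Finset.sum_div]
      refine Finset.sum_congr rfl fun t _ => ?_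
      rw [div_mul_eq_mul_div, ← ee_add]; congr 2; ring
    simp only [e] at this
    exact_mod_cast this
  have hz : ∀ z : ℤ, ∑ ξ ∈ Xi y Q0, ε ^ ξ.den.primeFactors.card * ‖pav A V Y (fun t => ee ((ξ:ℝ) * t) / Y) z‖ ^ 2 ≤ 0.24 * α ^ 2 := by
    intro z
    set B : Finset ℕ := {t ∈ range Y | z + V * t ∈ A} with hB
    set P : Finset ℕ := {p ∈ range (Q0 + 1) | p.Prime} with hPdef
    have htr := transfer Q0 hQ2 m d hm hd hQd P ?_ Y hYQ α hα hαm B (Finset.filter_subset _ _) ?_ (Xi y Q0) ?_ ?_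
    · have h1 : ∀ ξ ∈ Xi y Q0, ε ^ ξ.den.primeFactors.card * ‖pav A V Y (fun t => ee ((ξ:ℝ) * t) / Y) z‖ ^ 2 ≤
          1 / 150 * ((1 / (256 * m) : ℝ) ^ (ξ.den.primeFactors.card) * ‖(∑ t ∈ B, ee (-((ξ:ℝ) * t))) / Y‖ ^ 2) := by
        intro ξ hξ
        have e1 : ‖pav A V Y (fun t => ee ((ξ:ℝ) * t) / Y) z‖ = ‖(∑ t ∈ B, ee (-((ξ:ℝ) * t))) / Y‖ := by
          unfold pav
          rw [← Finset.sum_filter, ← hB, ← Finset.sum_div, norm_div, norm_div]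
          congr 1
          rw [← Complex.norm_conj, map_sum]
          congr 1
          refine Finset.sum_congr rfl fun t _ => ?_
          rw [ee_neg]
        rw [e1, ← mul_assoc]
        refine mul_le_mul_of_nonneg_right ?_ (by positivity)
        have e2 : ε = 1 / 150 * (1 / (256 * m)) := by rw [hε]; field_simp; norm_num
        rw [e2, mul_pow]
        refine mul_le_mul_of_nonneg_right ?_ (by positivity)
        have hω : 1 ≤ ξ.den.primeFactors.card := by
          rw [Finset.one_le_card, Nat.nonempty_primeFactors]
          have hξ' := (Finset.mem_filter.1 hξ).2.1
          by_contra hle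
          have h1 : ξ.den = 1 := by have := ξ.den_pos; omega
          have h2 : ((ξ.num:ℤ):ℚ) = ξ := Rat.den_eq_one_iff ξ |>.1 h1
          rw [← h2] at hξ'
          have a1 : 0 < ξ.num := by exact_mod_cast hξ'.1
          have a2 : ξ.num < 1 := by exact_mod_cast hξ'.2
          omega
        calc ((1:ℝ)/150) ^ ξ.den.primeFactors.card ≤ (1/150) ^ 1 := pow_le_pow_of_le_one (by norm_num) (by norm_num) hω
          _ = _ := pow_one _
      refine (Finset.sum_le_sum h1).trans ?_
      rw [← Finset.mul_sum]
      linarith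
    · intro p hp
      have := Finset.mem_filter.1 hp
      exact ⟨this.2, by have := Finset.mem_range.1 this.1; omega⟩
    · intro S hS hSd r
      have := NI2 S (fun p hp => by
        have := Finset.mem_filter.1 (hS hp)
        exact ⟨this.2, by have := Finset.mem_range.1 this.1; omega⟩) hSd z r
      rw [hB, Finset.filter_filter]
      exact this
    · intro ξ hξ
      have := (Finset.mem_filter.1 hξ).2.1
      exact ⟨this.1.le, this.2⟩
    · intro ξ hξ
      have := (Finset.mem_filter.1 hξ).2.2
      refine ⟨this.1, fun p hp => ?_⟩
      rw [hPdef, Finset.mem_filter, Finset.mem_range]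
      have h2 := Nat.le_of_mem_primeFactors hp
      exact ⟨by omega, Nat.prime_of_mem_primeFactors hp⟩
  have hξtot : ∑ ξ ∈ Xi y Q0, ε ^ ξ.den.primeFactors.card * ∑ j ∈ range R, ‖Ah j‖ ^ 2 * ‖chi Y (θ j * V - ξ)‖ ^ 2 ≤
      R * (1.01 * X * (0.24 * α ^ 2)) := by
    have e : ∑ ξ ∈ Xi y Q0, ε ^ ξ.den.primeFactors.card * ∑ j ∈ range R, ‖Ah j‖ ^ 2 * ‖chi Y (θ j * V - ξ)‖ ^ 2 =
        R * ∑ z ∈ Finset.Ico (-(X:ℤ)) X, ∑ ξ ∈ Xi y Q0, ε ^ ξ.den.primeFactors.card * ‖pav A V Y (fun t => ee ((ξ:ℝ) * t) / Y) z‖ ^ 2 := by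
      rw [Finset.sum_comm, Finset.mul_sum]
      refine Finset.sum_congr rfl fun ξ _ => ?_
      rw [hξsum, Finset.mul_sum, Finset.mul_sum, Finset.mul_sum]
      refine Finset.sum_congr rfl fun z _ => ?_
      ring
    rw [e]
    refine mul_le_mul_of_nonneg_left ?_ hR0.le
    have hVYz : 100 * ((V * Y : ℕ):ℤ) ≤ X := by exact_mod_cast hVY
    have hsub : Finset.Ico (-((V * Y : ℕ):ℤ)) (X:ℤ) ⊆ Finset.Ico (-(X:ℤ)) X := Finset.Ico_subset_Ico (by omega) le_rfl
    rw [← Finset.sum_subset hsub ?_]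
    · refine (Finset.sum_le_card_nsmul _ _ _ (fun z _ => hz z)).trans ?_
      rw [nsmul_eq_mul, Int.card_Ico]
      refine mul_le_mul_of_nonneg_right ?_ (by positivity)
      have : ((((X:ℤ) - (-((V * Y : ℕ):ℤ))).toNat : ℕ) : ℤ) = (X:ℤ) - (-((V * Y : ℕ):ℤ)) := Int.toNat_of_nonneg (by omega)
      have h5 : 100 * ((((X:ℤ) - (-((V * Y : ℕ):ℤ))).toNat : ℕ) : ℤ) ≤ 101 * X := by rw [this]; linarith
      have h6 : 100 * ((((X:ℤ) - (-((V * Y : ℕ):ℤ))).toNat : ℕ) : ℝ) ≤ 101 * X := by exact_mod_cast h5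
      linarith
    · intro z _ hz'
      refine Finset.sum_eq_zero fun ξ _ => ?_
      rw [pav_zero A X V Y hA _ z hz']; simp
  have hup : ∑ j ∈ range R, ‖Ah j‖ ^ 2 * ((1 - ‖chi Y (θ j * V)‖ ^ 2) *
      ‖∑ n ∈ range N, ee (θ j * V * ((G.eval (n:ℤ) : ℤ) : ℝ))‖) ≤
      N * (α / 4 * (R * (α * X)) + 2 * (R * (1.01 * X * (0.24 * α ^ 2)))) := by
    have h1 : ∀ j ∈ range R, ‖Ah j‖ ^ 2 * ((1 - ‖chi Y (θ j * V)‖ ^ 2) *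
      ‖∑ n ∈ range N, ee (θ j * V * ((G.eval (n:ℤ) : ℤ) : ℝ))‖) ≤ N * (α / 4 * ‖Ah j‖ ^ 2 + 2 * ∑ ξ ∈ Xi y Q0, ε ^ ξ.den.primeFactors.card * (‖Ah j‖ ^ 2 * ‖chi Y (θ j * V - ξ)‖ ^ 2)) := by
      intro j _
      have := hpw (θ j * V)
      rw [norm_div, Complex.norm_natCast, ← mul_div_assoc, div_le_iff₀ hN0] at this
      refine (mul_le_mul_of_nonneg_left this (sq_nonneg ‖Ah j‖)).trans (le_of_eq ?_)
      have e : ∑ ξ ∈ Xi y Q0, ε ^ ξ.den.primeFactors.card * (‖Ah j‖ ^ 2 * ‖chi Y (θ j * V - ξ)‖ ^ 2) = ‖Ah j‖ ^ 2 * ∑ ξ ∈ Xi y Q0, ε ^ ξ.den.primeFactors.card * ‖chi Y (θ j * V - ξ)‖ ^ 2 := by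
        rw [Finset.mul_sum]
        refine Finset.sum_congr rfl fun ξ _ => ?_
        ring
      rw [e]; ring
    refine (Finset.sum_le_sum h1).trans ?_
    rw [← Finset.mul_sum, Finset.sum_add_distrib, ← Finset.mul_sum, hP, ← Finset.mul_sum, Finset.sum_comm]
    refine mul_le_mul_of_nonneg_left ?_ hN0.le
    have : ∑ ξ ∈ Xi y Q0, ∑ j ∈ range R, ε ^ ξ.den.primeFactors.card * (‖Ah j‖ ^ 2 * ‖chi Y (θ j * V - ξ)‖ ^ 2) ≤ R * (1.01 * X * (0.24 * α ^ 2)) := by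
      refine le_trans (le_of_eq ?_) hξtot
      refine Finset.sum_congr rfl fun ξ _ => ?_
      rw [Finset.mul_sum]
    linarith
  have hfin := hmain.trans hup
  have hpos : 0 < (R:ℝ) * N * (α ^ 2 * X) := by positivity
  nlinarith

end M3
end FS


namespace FS
open Finset Polynomial

section A1

/-- the rescaled polynomial -/
noncomputable def hc (h : ℤ[X]) (r0 : ℤ) (D : ℕ) : ℤ[X] := h.comp (C (D:ℤ) * X + C r0)

/-- the content of the rescaled polynomial -/
noncomputable def Mc (h : ℤ[X]) (r0 : ℤ) (D : ℕ) : ℤ := (hc h r0 D).content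

lemma hc_coeff (h : ℤ[X]) (r0 : ℤ) (D j : ℕ) : (hc h r0 D).coeff j = (D:ℤ) ^ j * (taylor r0 h).coeff j := comp_coeff _ _ _ _

lemma hc_eval (h : ℤ[X]) (r0 : ℤ) (D : ℕ) (n : ℤ) : (hc h r0 D).eval n = h.eval (r0 + D * n) := by
  unfold hc; simp [eval_comp]; ring_nf

lemma hc_top (h : ℤ[X]) (r0 : ℤ) (D : ℕ) : (hc h r0 D).coeff h.natDegree = (D:ℤ) ^ h.natDegree * h.leadingCoeff := by
  rw [hc_coeff, ← natDegree_taylor h r0]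
  rw [coeff_natDegree, leadingCoeff_taylor]

lemma hc_zero (h : ℤ[X]) (r0 : ℤ) (D : ℕ) : (hc h r0 D).coeff 0 = h.eval r0 := by
  rw [hc_coeff]; simp [taylor_coeff_zero]

lemma hc_natDegree_le (h : ℤ[X]) (r0 : ℤ) (D : ℕ) : (hc h r0 D).natDegree ≤ h.natDegree := by
  refine natDegree_le_iff_coeff_eq_zero.2 fun j hj => ?_
  rw [hc_coeff, coeff_eq_zero_of_natDegree_lt (by rwa [natDegree_taylor]), mul_zero]


lemma hc_ne_zero (h : ℤ[X]) (hl : 0 < h.leadingCoeff) (r0 : ℤ) (D : ℕ) (hD : 1 ≤ D) : hc h r0 D ≠ 0 := by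
  intro h0
  have := hc_top h r0 D
  rw [h0, coeff_zero] at this
  have : (0:ℤ) < (D:ℤ) ^ h.natDegree * h.leadingCoeff := by positivity
  omega

lemma Mc_pos (h : ℤ[X]) (hl : 0 < h.leadingCoeff) (r0 : ℤ) (D : ℕ) (hD : 1 ≤ D) : 0 < Mc h r0 D := by
  have h1 : Mc h r0 D ≠ 0 := fun h0 => hc_ne_zero h hl r0 D hD (content_eq_zero_iff.1 h0)
  have h2 : 0 ≤ Mc h r0 D := by
    have : normalize (Mc h r0 D) = Mc h r0 D := normalize_content
    rw [← this, ← Int.abs_eq_normalize]; exact abs_nonneg _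
  omega

lemma Mc_dvd_coeff (h : ℤ[X]) (r0 : ℤ) (D j : ℕ) : Mc h r0 D ∣ (D:ℤ) ^ j * (taylor r0 h).coeff j := by
  rw [← hc_coeff]; exact content_dvd_coeff j

lemma Mc_dvd_top (h : ℤ[X]) (r0 : ℤ) (D : ℕ) : Mc h r0 D ∣ (D:ℤ) ^ h.natDegree * h.leadingCoeff := by
  rw [← hc_top h r0 D]; exact content_dvd_coeff _

lemma dvd_Mc (h : ℤ[X]) (r0 : ℤ) (D : ℕ) (c : ℤ) (hc0 : ∀ j, c ∣ (D:ℤ) ^ j * (taylor r0 h).coeff j) : c ∣ Mc h r0 D := by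
  unfold Mc
  rw [dvd_content_iff_C_dvd, C_dvd_iff_dvd_coeff]
  intro j; rw [hc_coeff]; exact hc0 j


lemma key_dvd (h : ℤ[X]) (r0 : ℤ) (DD : ℕ) (hr0 : h.leadingCoeff * ((DD.factorial : ℕ) : ℤ) ^ (h.natDegree + 1) ∣ h.eval r0) (D q : ℕ) (hD : 1 ≤ D) (hDD : D ≤ DD) (hq : 1 ≤ q) (hqD : q ≤ DD) :
    (q:ℤ) * ((D:ℤ) ^ h.natDegree * h.leadingCoeff) ∣ h.eval r0 := by
  refine dvd_trans ?_ hr0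
  have h1 : (D:ℤ) ∣ ((DD.factorial : ℕ) : ℤ) := Int.natCast_dvd_natCast.2 (Nat.dvd_factorial hD hDD)
  have h2 : (q:ℤ) ∣ ((DD.factorial : ℕ) : ℤ) := Int.natCast_dvd_natCast.2 (Nat.dvd_factorial hq hqD)
  rw [pow_succ, show (q:ℤ) * ((D:ℤ) ^ h.natDegree * h.leadingCoeff) = h.leadingCoeff * ((D:ℤ) ^ h.natDegree * q) by ring]
  exact mul_dvd_mul_left _ (mul_dvd_mul (pow_dvd_pow_of_dvd h1 _) h2)

lemma cont_step (h : ℤ[X]) (r0 : ℤ) (DD : ℕ) (hr0 : h.leadingCoeff * ((DD.factorial : ℕ) : ℤ) ^ (h.natDegree + 1) ∣ h.eval r0) (D q : ℕ) (hD : 1 ≤ D) (hq : 1 ≤ q) (hDq : D * q ≤ DD) :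
    (q:ℤ) * Mc h r0 D ∣ Mc h r0 (D * q) ∧ Mc h r0 (D * q) ∣ (q:ℤ) ^ h.natDegree * Mc h r0 D := by
  constructor
  · refine dvd_Mc h r0 _ _ fun j => ?_
    rcases Nat.eq_zero_or_pos j with rfl | hj
    · simp only [pow_zero, one_mul, taylor_coeff_zero]
      refine dvd_trans (mul_dvd_mul_left _ (Mc_dvd_top h r0 D)) ?_
      exact key_dvd h r0 DD hr0 D q hD ((Nat.le_mul_of_pos_right _ hq).trans hDq) hq ((Nat.le_mul_of_pos_left _ hD).trans hDq)
    · push_cast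
      rw [mul_pow, mul_comm ((D:ℤ) ^ j), mul_assoc]
      exact mul_dvd_mul (dvd_pow_self _ hj.ne') (Mc_dvd_coeff h r0 D j)
  · have : (q:ℤ) ^ h.natDegree * Mc h r0 D = (C ((q:ℤ) ^ h.natDegree) * hc h r0 D).content := by
      rw [content_C_mul]; 
      rw [Int.normalize_of_nonneg (by positivity)]; rfl
    rw [this, dvd_content_iff_C_dvd, C_dvd_iff_dvd_coeff]
    intro j
    rw [coeff_C_mul, hc_coeff]
    rcases le_or_gt j h.natDegree with hj | hj
    · refine dvd_trans (Mc_dvd_coeff h r0 (D * q) j) ?_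
      push_cast
      rw [mul_pow, mul_comm ((D:ℤ) ^ j), mul_assoc]
      exact mul_dvd_mul_right (pow_dvd_pow _ hj) _
    · rw [coeff_eq_zero_of_natDegree_lt (by rwa [natDegree_taylor])]; simp

lemma star (h : ℤ[X]) (hk0 : 1 ≤ h.natDegree) (hl : 0 < h.leadingCoeff) (r0 : ℤ) (DD : ℕ) (hr0 : h.leadingCoeff * ((DD.factorial : ℕ) : ℤ) ^ (h.natDegree + 1) ∣ h.eval r0) (hDl : h.leadingCoeff ≤ DD) (D : ℕ) (hD : 1 ≤ D) (hDD : D ≤ DD) (p : ℕ) (hp : p.Prime) :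
    ∃ i, 1 ≤ i ∧ ¬ (p:ℤ) ∣ (hc h r0 D).primPart.coeff i := by
  by_contra hcon
  push Not at hcon
  set g := (hc h r0 D).primPart with hg
  have hM := Mc_pos h hl r0 D hD
  have hcoef : ∀ j, (hc h r0 D).coeff j = Mc h r0 D * g.coeff j := by
    intro j
    conv_lhs => rw [eq_C_content_mul_primPart (hc h r0 D)]
    rw [coeff_C_mul]; rfl
  have hk : (p:ℤ) ∣ g.coeff 0 → False := by
    intro h0
    have h1 : (p:ℤ) ∣ g.content := by
      rw [dvd_content_iff_C_dvd, C_dvd_iff_dvd_coeff]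
      intro j
      rcases Nat.eq_zero_or_pos j with rfl | hj
      · exact h0
      · exact hcon j hj
    rw [(isPrimitive_primPart _).content_eq_one] at h1
    have := Int.le_of_dvd one_pos h1
    have := hp.two_le
    omega
  rcases le_or_gt p DD with hpD | hpD
  · apply hk
    have h1 := key_dvd h r0 DD hr0 D p hD hDD hp.one_lt.le hpD
    rw [← hc_zero h r0 D, hcoef 0] at h1
    have h2 : (p:ℤ) * Mc h r0 D ∣ Mc h r0 D * g.coeff 0 := dvd_trans (mul_dvd_mul_left _ (Mc_dvd_top h r0 D)) h1
    rw [mul_comm (p:ℤ)] at h2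
    exact (mul_dvd_mul_iff_left hM.ne').1 h2
  · have h1 := hcon _ hk0
    have h2 : (p:ℤ) ∣ (D:ℤ) ^ h.natDegree * h.leadingCoeff := by
      rw [← hc_top h r0 D, hcoef]; exact dvd_mul_of_dvd_right h1 _
    have hpp : Prime (p:ℤ) := Nat.prime_iff_prime_int.1 hp
    rcases hpp.dvd_or_dvd h2 with h3 | h3
    · have := Int.le_of_dvd (by omega) (hpp.dvd_of_dvd_pow h3)
      omega
    · have := Int.le_of_dvd hl h3
      omega

end A1
end FS


namespace FS
open Finset Polynomial

section A2

/-- determinant constant -/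
noncomputable def ck (k : ℕ) : ℕ := (Matrix.vandermonde (fun i : Fin k => ((i:ℕ):ℤ))).det.natAbs * k.factorial

lemma ck_pos (k : ℕ) : 0 < ck k := by
  unfold ck
  refine Nat.mul_pos (Int.natAbs_pos.2 ?_) (Nat.factorial_pos k)
  rw [Matrix.det_vandermonde_ne_zero_iff]
  intro i j hij
  exact Fin.ext (Nat.cast_injective (R := ℤ) hij)

lemma vand (k : ℕ) (P : ℤ[X]) (hP : P.natDegree < k) (e : ℤ) (he : ∀ s : ℕ, s < k → e ∣ P.eval (s:ℤ)) (i : ℕ) :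
    e ∣ (Matrix.vandermonde (fun i : Fin k => ((i:ℕ):ℤ))).det * P.coeff i := by
  rcases lt_or_ge i k with hi | hi
  swap
  · rw [coeff_eq_zero_of_natDegree_lt (by omega)]; simp
  set A := Matrix.vandermonde (fun i : Fin k => ((i:ℕ):ℤ)) with hA
  set a : Fin k → ℤ := fun j => P.coeff j with ha
  have h1 : A.mulVec a = fun s : Fin k => P.eval ((s:ℕ):ℤ) := by
    funext s
    rw [eval_eq_sum_range' hP, Finset.sum_range]
    simp only [Matrix.mulVec, dotProduct, hA, Matrix.vandermonde_apply, ha]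
    refine Finset.sum_congr rfl fun j _ => ?_
    ring
  have h2 : A.adjugate.mulVec (A.mulVec a) = A.det • a := by
    rw [Matrix.mulVec_mulVec, Matrix.adjugate_mul, Matrix.smul_mulVec, Matrix.one_mulVec]
  have h3 := congrFun h2 ⟨i, hi⟩
  simp only [Pi.smul_apply, smul_eq_mul, ha] at h3
  rw [← h3, h1]
  simp only [Matrix.mulVec, dotProduct]
  exact Finset.dvd_sum fun s _ => dvd_mul_of_dvd_right (he s s.2) _

lemma lin0 (k : ℕ) (hk : 1 ≤ k) (g : ℤ[X]) (hg : g.natDegree ≤ k) (p : ℕ) (hp : p.Prime)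
    (hstar : ∃ i, 1 ≤ i ∧ ¬ (p:ℤ) ∣ g.coeff i) :
    ∃ s : ℕ, ¬ (p:ℤ) ^ ((ck k).factorization p + 1) ∣ g.derivative.eval (s:ℤ) := by
  by_contra hcon
  push Not at hcon
  obtain ⟨i, hi, hpi⟩ := hstar
  set e := (p:ℤ) ^ ((ck k).factorization p + 1) with he
  have h1 := vand k g.derivative (by have := natDegree_derivative_le g; omega) e (fun s _ => hcon s) (i - 1)
  rw [coeff_derivative, show i - 1 + 1 = i by omega] at h1
  have hik : i ≤ k := by
    by_contra hlt
    exact hpi (by rw [coeff_eq_zero_of_natDegree_lt (by omega)]; simp)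
  have e1 : (((i - 1 : ℕ):ℤ) + 1) = (i:ℤ) := by omega
  rw [e1] at h1
  have h2 : e ∣ ((ck k : ℕ) : ℤ) * g.coeff i := by
    unfold ck
    push_cast
    have h3 : (i:ℤ) ∣ ((k.factorial : ℕ):ℤ) := Int.natCast_dvd_natCast.2 (Nat.dvd_factorial hi hik)
    obtain ⟨w, hw⟩ := h3
    rw [hw]
    have h4 : e ∣ |(Matrix.vandermonde (fun i : Fin k => ((i:ℕ):ℤ))).det| * (g.coeff i * i) := by
      rcases abs_choice (Matrix.vandermonde (fun i : Fin k => ((i:ℕ):ℤ))).det with h5 | h5 <;> rw [h5]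
      · exact h1
      · rw [neg_mul]; exact (dvd_neg).2 h1
    have : |(Matrix.vandermonde (fun i : Fin k => ((i:ℕ):ℤ))).det| * (i * w) * g.coeff i = |(Matrix.vandermonde (fun i : Fin k => ((i:ℕ):ℤ))).det| * (g.coeff i * i) * w := by ring
    rw [this]
    exact h4.mul_right _
  have hpp : Prime (p:ℤ) := Nat.prime_iff_prime_int.1 hp
  have h3 : IsCoprime e (g.coeff i) := by
    refine IsCoprime.pow_left ?_
    exact (Prime.coprime_iff_not_dvd hpp).2 hpi
  have h4 : e ∣ ((ck k : ℕ):ℤ) := h3.dvd_of_dvd_mul_right h2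
  have h5 : p ^ ((ck k).factorization p + 1) ∣ ck k := by
    rw [he] at h4; exact_mod_cast h4
  exact Nat.pow_succ_factorization_not_dvd (ck_pos k).ne' hp h5

lemma lin1 (k : ℕ) (hk : 1 ≤ k) (g : ℤ[X]) (hg : g.natDegree ≤ k)
    (hstar : ∀ p : ℕ, p.Prime → ∃ i, 1 ≤ i ∧ ¬ (p:ℤ) ∣ g.coeff i) (y : ℕ) :
    ∃ s0 : ℤ, ∀ s : ℤ, ((ck k * y.factorial : ℕ) : ℤ) ∣ s - s0 → ∀ p : ℕ, p.Prime → p ≤ y →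
      ¬ (p:ℤ) ^ ((ck k).factorization p + 1) ∣ g.derivative.eval s := by
  have hch : ∀ p : ℕ, ∃ s : ℕ, p.Prime → ¬ (p:ℤ) ^ ((ck k).factorization p + 1) ∣ g.derivative.eval (s:ℤ) := by
    intro p
    by_cases hp : p.Prime
    · obtain ⟨s, hs⟩ := lin0 k hk g hg p hp (hstar p hp)
      exact ⟨s, fun _ => hs⟩
    · exact ⟨0, fun h => absurd h hp⟩
  choose sp hsp using hch
  set t : Finset ℕ := {p ∈ range (y + 1) | p.Prime} with ht
  obtain ⟨s0, hs0⟩ := Nat.chineseRemainderOfFinset sp (fun p => p ^ ((ck k).factorization p + 1)) t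
    (fun p hp => pow_ne_zero _ (Finset.mem_filter.1 hp).2.ne_zero) (by
      intro p hp q hq hpq
      exact Nat.coprime_pow_primes _ _ (Finset.mem_filter.1 hp).2 (Finset.mem_filter.1 hq).2 hpq)
  refine ⟨s0, ?_⟩
  intro s hs p hp hpy hd
  apply hsp p hp
  have h1 := hs0 p (Finset.mem_filter.2 ⟨Finset.mem_range.2 (by omega), hp⟩)
  have h2 : ((p ^ ((ck k).factorization p + 1) : ℕ) : ℤ) ∣ s - s0 := by
    refine dvd_trans (Int.natCast_dvd_natCast.2 ?_) hs
    rw [pow_succ]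
    exact mul_dvd_mul (Nat.ordProj_dvd _ _) (Nat.dvd_factorial hp.pos hpy)
  have h3 : ((p ^ ((ck k).factorization p + 1) : ℕ) : ℤ) ∣ (s0:ℤ) - sp p := Nat.modEq_iff_dvd.1 h1.symm
  have h4 : ((p ^ ((ck k).factorization p + 1) : ℕ) : ℤ) ∣ s - sp p := by
    have := dvd_add h2 h3
    rwa [sub_add_sub_cancel] at this
  push_cast at h4
  have h5 := h4.trans (sub_dvd_eval_sub s (sp p : ℤ) g.derivative)
  exact (dvd_sub_right hd).1 h5

lemma lin2 (k : ℕ) (hk : 1 ≤ k) (g : ℤ[X]) (hg : g.natDegree ≤ k)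
    (hstar : ∀ p : ℕ, p.Prime → ∃ i, 1 ≤ i ∧ ¬ (p:ℤ) ∣ g.coeff i) (y : ℕ) (hy : ck k ≤ y) (s : ℤ)
    (hs : ∀ p : ℕ, p.Prime → p ≤ y → ¬ (p:ℤ) ^ ((ck k).factorization p + 1) ∣ g.derivative.eval s) :
    ∃ (u : ℕ) (G : ℤ[X]), 1 ≤ u ∧ u ≤ ck k ∧ G.natDegree ≤ k ∧ G.coeff 0 = 0 ∧ G.content = 1 ∧
    (∀ p : ℕ, p.Prime → p ≤ y → ¬ (p:ℤ) ∣ G.coeff 1 ∧ ∀ i, 2 ≤ i → (p:ℤ) ∣ G.coeff i) ∧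
    (∀ p : ℕ, p.Prime → y < p → ∃ i, 1 ≤ i ∧ ¬ (p:ℤ) ∣ G.coeff i) ∧
    (∀ j, 1 ≤ j → ((ck k * y.factorial * u : ℕ) : ℤ) * G.coeff j = ((ck k * y.factorial : ℕ) : ℤ) ^ j * (taylor s g).coeff j) ∧
    (∀ x : ℤ, g.eval (s + ((ck k * y.factorial : ℕ) : ℤ) * x) = g.eval s + ((ck k * y.factorial * u : ℕ) : ℤ) * G.eval x) := by
  set c := ck k with hc
  have hc0 : 0 < c := ck_pos k
  set W : ℕ := c * y.factorial with hW
  have hW0 : 0 < W := Nat.mul_pos hc0 (Nat.factorial_pos y)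
  set u : ℕ := Int.gcd (g.derivative.eval s) c with hu
  have huc : u ∣ c := by
    have : (u:ℤ) ∣ (c:ℤ) := Int.gcd_dvd_right _ _
    exact_mod_cast this
  have hug : (u:ℤ) ∣ g.derivative.eval s := Int.gcd_dvd_left _ _
  have hu0 : 0 < u := Nat.pos_of_dvd_of_pos huc hc0
  obtain ⟨c', hc'⟩ := huc
  set Q : ℤ[X] := (taylor s g).comp (C (W:ℤ) * X) - C (g.eval s) with hQ
  have hQ0 : Q.coeff 0 = 0 := by
    rw [hQ, coeff_sub, comp_C_mul_X_coeff]; simp [taylor_coeff_zero]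
  have hQj : ∀ j, 1 ≤ j → Q.coeff j = (W:ℤ) ^ j * (taylor s g).coeff j := by
    intro j hj
    rw [hQ, coeff_sub, comp_C_mul_X_coeff, coeff_C, if_neg (by omega)]; ring
  have hWu : (W:ℤ) = u * (c' * y.factorial) := by rw [hW, hc']; push_cast; ring
  have hdiv : ∀ j, ((W * u : ℕ):ℤ) ∣ Q.coeff j := by
    intro j
    rcases Nat.eq_zero_or_pos j with rfl | hj
    · rw [hQ0]; exact dvd_zero _
    rw [hQj j hj]
    push_cast
    rcases Nat.lt_or_ge j 2 with hj2 | hj2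
    · have : j = 1 := by omega
      subst this
      rw [pow_one, taylor_coeff_one]
      exact mul_dvd_mul_left _ hug
    · obtain ⟨i, rfl⟩ := Nat.exists_eq_add_of_le hj2
      refine Dvd.dvd.mul_right ?_ _
      rw [pow_add, pow_two, mul_assoc]
      refine mul_dvd_mul_left _ (Dvd.dvd.mul_right ?_ _)
      exact ⟨_, hWu⟩
  obtain ⟨G, hG⟩ := (C_dvd_iff_dvd_coeff _ _).2 hdiv
  have hVne : ((W * u : ℕ):ℤ) ≠ 0 := by exact_mod_cast (Nat.mul_pos hW0 hu0).ne'
  have hGQ : ∀ j, Q.coeff j = ((W * u : ℕ):ℤ) * G.coeff j := by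
    intro j; rw [hG, coeff_C_mul]
  have hGj : ∀ j, 1 ≤ j → ((W * u : ℕ):ℤ) * G.coeff j = (W:ℤ) ^ j * (taylor s g).coeff j := by
    intro j hj; rw [← hGQ, hQj j hj]
  have hWz : (W:ℤ) ≠ 0 := by exact_mod_cast hW0.ne'
  have huz : (u:ℤ) ≠ 0 := by exact_mod_cast hu0.ne'
  have hsmall : ∀ p : ℕ, p.Prime → p ≤ y → ¬ (p:ℤ) ∣ G.coeff 1 ∧ ∀ i, 2 ≤ i → (p:ℤ) ∣ G.coeff i := by
    intro p hp hpy
    constructor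
    · intro hd
      have h1 : (u:ℤ) * G.coeff 1 = g.derivative.eval s := by
        have := hGj 1 le_rfl
        rw [taylor_coeff_one, pow_one] at this
        push_cast at this
        rw [mul_assoc] at this
        exact mul_left_cancel₀ hWz this
      have h2 : (u:ℤ) * p ∣ g.derivative.eval s := by rw [← h1]; exact mul_dvd_mul_left _ hd
      have h3 : ∀ f, f ≤ c.factorization p + 1 → (p:ℤ) ^ f ∣ g.derivative.eval s := by
        intro f
        induction f with
        | zero => intro _; simp
        | succ f ih =>
          intro hf
          have h4 := ih (by omega)
          have h5 : (p:ℤ) ^ f ∣ (c:ℤ) := by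
            have : p ^ f ∣ c := (pow_dvd_pow p (by omega)).trans (Nat.ordProj_dvd c p)
            exact_mod_cast this
          have h6 : (p:ℤ) ^ f ∣ (u:ℤ) := Int.dvd_coe_gcd h4 h5
          rw [pow_succ]
          exact (mul_dvd_mul_right h6 _).trans h2
      exact hs p hp hpy (h3 _ le_rfl)
    · intro i hi
      have h1 := hGj i (by omega)
      obtain ⟨j, rfl⟩ := Nat.exists_eq_add_of_le hi
      have h2 : G.coeff (2 + j) = y.factorial * (c' * ((W:ℤ) ^ j * (taylor s g).coeff (2 + j))) := by
        have h3 : ((W:ℤ) * u) * G.coeff (2 + j) = ((W:ℤ) * u) * (y.factorial * (c' * ((W:ℤ) ^ j * (taylor s g).coeff (2 + j)))) := by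
          push_cast at h1
          rw [h1, pow_add, pow_two]
          nth_rewrite 2 [hWu]
          ring
        exact mul_left_cancel₀ (mul_ne_zero hWz huz) h3
      rw [h2]
      exact Dvd.dvd.mul_right (Int.natCast_dvd_natCast.2 (Nat.dvd_factorial hp.pos hpy)) _
  have hlarge : ∀ p : ℕ, p.Prime → y < p → ∃ i, 1 ≤ i ∧ ¬ (p:ℤ) ∣ G.coeff i := by
    intro p hp hpy
    by_contra hcon
    push Not at hcon
    have hpp : Prime (p:ℤ) := Nat.prime_iff_prime_int.1 hp
    have hpW : ¬ (p:ℤ) ∣ (W:ℤ) := by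
      intro hd
      have : p ∣ W := by exact_mod_cast hd
      rcases hp.dvd_mul.1 this with h1 | h1
      · have := Nat.le_of_dvd hc0 h1; omega
      · have := (hp.dvd_factorial).1 h1; omega
    have hT : ∀ i, 1 ≤ i → (p:ℤ) ∣ (taylor s g).coeff i := by
      intro i hi
      have h1 : (p:ℤ) ∣ (W:ℤ) ^ i * (taylor s g).coeff i := by
        rw [← hGj i hi]; exact Dvd.dvd.mul_left (hcon i hi) _
      rcases hpp.dvd_or_dvd h1 with h2 | h2
      · exact absurd (hpp.dvd_of_dvd_pow h2) hpW
      · exact h2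
    obtain ⟨i, hi, hpi⟩ := hstar p hp
    apply hpi
    have := dvd_taylor_coeff (p:ℤ) 1 (-s) (taylor s g) i (fun j hj => by rw [one_mul]; exact hT j (by omega))
    rw [taylor_taylor, one_mul] at this
    simpa using this
  refine ⟨u, G, hu0, Nat.le_of_dvd hc0 ⟨c', hc'⟩, ?_, ?_, ?_, hsmall, hlarge, hGj, ?_⟩
  · refine natDegree_le_iff_coeff_eq_zero.2 fun j hj => ?_
    have h1 := hGj j (by omega)
    rw [coeff_eq_zero_of_natDegree_lt (p := taylor s g) (by rw [natDegree_taylor]; omega), mul_zero] at h1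
    exact (mul_eq_zero.1 h1).resolve_left hVne
  · have := hGQ 0
    rw [hQ0] at this
    exact (mul_eq_zero.1 this.symm).resolve_left hVne
  · by_contra hne
    have h0 : normalize G.content = G.content := normalize_content
    rw [← Int.abs_eq_normalize] at h0
    have h1 : G.content.natAbs ≠ 1 := by
      intro h2
      apply hne
      rw [← h0, Int.abs_eq_natAbs, h2]; rfl
    obtain ⟨p, hp, hpd⟩ := Nat.exists_prime_and_dvd h1
    have hpd' : (p:ℤ) ∣ G.content := Int.natCast_dvd.2 hpd
    rcases le_or_gt p y with hpy | hpy
    · exact (hsmall p hp hpy).1 (hpd'.trans (content_dvd_coeff 1))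
    · obtain ⟨i, _, hi⟩ := hlarge p hp hpy
      exact hi (hpd'.trans (content_dvd_coeff i))
  · intro x
    have h1 : Q.eval x = ((W * u : ℕ):ℤ) * G.eval x := by rw [hG]; simp
    have h2 : Q.eval x = g.eval (s + W * x) - g.eval s := by
      rw [hQ]; simp [eval_comp, taylor_eval, add_comm]
    linarith

end A2
end FS


namespace FS
open Finset Polynomial

section A3

lemma eval_bound (P : ℤ[X]) (K : ℕ) (hP : P.natDegree ≤ K) (n : ℤ) (hn : 1 ≤ n) :
    |P.eval n| ≤ (∑ i ∈ range (K + 1), |P.coeff i|) * n ^ K := by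
  rw [eval_eq_sum_range' (Nat.lt_succ_of_le hP), Finset.sum_mul]
  refine (Finset.abs_sum_le_sum_abs _ _).trans (Finset.sum_le_sum fun i hi => ?_)
  rw [abs_mul, abs_of_nonneg (by positivity : (0:ℤ) ≤ n ^ i)]
  refine mul_le_mul_of_nonneg_left ?_ (abs_nonneg _)
  exact pow_le_pow_right₀ hn (by have := Finset.mem_range.1 hi; omega)

lemma taylor_bound (h : ℤ[X]) : ∃ C1 : ℕ, 1 ≤ C1 ∧ ∀ j, j ≤ h.natDegree → ∀ n : ℤ, 1 ≤ n →
    |(taylor n h).coeff j| ≤ C1 * n ^ (h.natDegree - j) := by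
  set f : ℕ → ℤ := fun j => ∑ i ∈ range (h.natDegree - j + 1), |(hasseDeriv j h).coeff i| with hf
  have hf0 : ∀ j, 0 ≤ f j := fun j => Finset.sum_nonneg fun i _ => abs_nonneg _
  refine ⟨(∑ j ∈ range (h.natDegree + 1), f j).toNat + 1, by omega, ?_⟩
  intro j hj n hn
  rw [taylor_coeff]
  refine (eval_bound _ (h.natDegree - j) (natDegree_hasseDeriv_le h j) n hn).trans ?_
  refine mul_le_mul_of_nonneg_right ?_ (by positivity)
  have h1 : f j ≤ ∑ j ∈ range (h.natDegree + 1), f j := Finset.single_le_sum (fun i _ => hf0 i) (Finset.mem_range.2 (by omega))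
  change f j ≤ _
  push_cast
  have := Int.self_le_toNat (∑ j ∈ range (h.natDegree + 1), f j)
  linarith

lemma eventually_pos (h : ℤ[X]) (hk : 1 ≤ h.natDegree) (hl : 0 < h.leadingCoeff) :
    ∃ nh : ℕ, 1 ≤ nh ∧ ∀ n : ℤ, (nh:ℤ) ≤ n → 0 < h.eval n := by
  have hinj : Function.Injective (Int.castRingHom ℝ) := Int.cast_injective
  have h1 := Polynomial.tendsto_atTop_of_leadingCoeff_nonneg (h.map (Int.castRingHom ℝ))
    (by
      rw [degree_map_eq_of_injective hinj]
      exact natDegree_pos_iff_degree_pos.1 hk)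
    (by
      rw [leadingCoeff_map_of_injective hinj]
      simp only [eq_intCast]; exact_mod_cast hl.le)
  obtain ⟨a, ha⟩ := Filter.eventually_atTop.1 (h1.eventually_gt_atTop 0)
  refine ⟨⌈a⌉₊ + 1, by omega, ?_⟩
  intro n hn
  have h2 : a ≤ (n:ℝ) := by
    have h3 : (((⌈a⌉₊ + 1 : ℕ) : ℤ) : ℝ) ≤ (n:ℝ) := by exact_mod_cast hn
    have := Nat.le_ceil a
    push_cast at h3
    linarith
  have h4 := ha n h2
  rw [show (n:ℝ) = (Int.castRingHom ℝ) n by simp, eval_map_apply] at h4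
  simp only [eq_intCast] at h4
  exact_mod_cast h4

set_option maxHeartbeats 1000000 in
theorem lin (h : ℤ[X]) (hk : 1 ≤ h.natDegree) (hl : 0 < h.leadingCoeff) : ∃ Ch : ℕ, 1 ≤ Ch ∧ ∀ (D : ℕ) (r0 : ℤ), 1 ≤ D →
    (∀ p : ℕ, p.Prime → ∃ i, 1 ≤ i ∧ ¬ (p:ℤ) ∣ (hc h r0 D).primPart.coeff i) → ∀ y : ℕ, ck h.natDegree ≤ y →
    ∃ (V : ℕ) (G : ℤ[X]) (H0 : ℤ), 1 ≤ V ∧ V ≤ ck h.natDegree ^ 2 * y.factorial ∧ G.natDegree ≤ h.natDegree ∧ G.coeff 0 = 0 ∧ G.content = 1 ∧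
    0 < G.coeff h.natDegree ∧ (∀ j, |G.coeff j| ≤ Ch * G.coeff h.natDegree) ∧
    (∀ p : ℕ, p.Prime → p ≤ y → ¬ (p:ℤ) ∣ G.coeff 1 ∧ ∀ i, 2 ≤ i → (p:ℤ) ∣ G.coeff i) ∧
    (∀ p : ℕ, p.Prime → y < p → ∃ i, 1 ≤ i ∧ ¬ (p:ℤ) ∣ G.coeff i) ∧
    G.coeff h.natDegree ≤ Ch * ((D * (ck h.natDegree * y.factorial) : ℕ):ℤ) ^ h.natDegree ∧
    ∀ n : ℕ, 0 < H0 + V * G.eval (n:ℤ) ∧ H0 + V * G.eval (n:ℤ) ≤ Ch * G.coeff h.natDegree * V * ((n:ℤ) + 1) ^ h.natDegree ∧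
      ∃ x : ℤ, h.eval (r0 + D * x) = Mc h r0 D * (H0 + V * G.eval (n:ℤ)) := by
  obtain ⟨C1, hC1, hT⟩ := taylor_bound h
  obtain ⟨nh, hnh1, hnh⟩ := eventually_pos h hk hl
  set k := h.natDegree with hkdef
  refine ⟨C1 * (nh + 1) ^ k + h.leadingCoeff.toNat, ?_, ?_⟩
  · have : 1 ≤ C1 * (nh + 1) ^ k := Nat.mul_pos hC1 (by positivity)
    omega
  intro D r0 hD hstar y hy
  have hM := Mc_pos h hl r0 D hD
  set M := Mc h r0 D with hMdef
  set g := (hc h r0 D).primPart with hg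
  have hgd : g.natDegree ≤ k := by rw [hg, natDegree_primPart]; exact hc_natDegree_le h r0 D
  have hMg : hc h r0 D = C M * g := eq_C_content_mul_primPart _
  obtain ⟨s0, hs0⟩ := lin1 k hk g hgd hstar y
  set W : ℕ := ck k * y.factorial with hW
  have hW0 : 0 < W := Nat.mul_pos (ck_pos k) (Nat.factorial_pos y)
  have hWz : (0:ℤ) < W := by exact_mod_cast hW0
  have hDz : (0:ℤ) < D := by exact_mod_cast hD
  set t : ℤ := -(r0 / D) with ht
  set rem : ℤ := (s0 - nh * W - t) % W with hrem
  set s : ℤ := nh * W + t + rem with hs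
  have hrem0 : 0 ≤ rem := Int.emod_nonneg _ hWz.ne'
  have hremW : rem < W := Int.emod_lt_of_pos _ hWz
  have hsdvd : (W:ℤ) ∣ s - s0 := by
    have : s - s0 = -((s0 - nh * W - t) - rem) := by rw [hs]; ring
    rw [this, dvd_neg]
    exact Int.dvd_self_sub_emod
  obtain ⟨u, G, hu1, huc, hGd, hG0, hG1, hsm, hla, hGj, hGe⟩ := lin2 k hk g hgd hstar y hy s (hs0 s hsdvd)
  rw [← hW] at hGj hGe
  set n0 : ℤ := r0 + D * s with hn0
  have hn0e : n0 = r0 % D + D * (nh * W) + D * rem := by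
    have := Int.emod_add_mul_ediv r0 D
    rw [hn0, hs, ht]; linear_combination -this
  have hr0 := Int.emod_nonneg r0 hDz.ne'
  have hr1 := Int.emod_lt_of_pos r0 hDz
  have hn0l : (nh:ℤ) * (D * W) ≤ n0 := by rw [hn0e]; nlinarith [mul_nonneg hDz.le hrem0]
  have hn0u : n0 ≤ ((nh:ℤ) + 1) * (D * W) := by rw [hn0e]; nlinarith [mul_le_mul_of_nonneg_left (Int.add_one_le_of_lt hremW) hDz.le]
  have hDW1 : (1:ℤ) ≤ D * W := by nlinarith
  have hnhn0 : (nh:ℤ) ≤ n0 := by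
    have : (nh:ℤ) * 1 ≤ nh * (D * W) := mul_le_mul_of_nonneg_left hDW1 (by positivity)
    linarith
  have hnhz : (1:ℤ) ≤ nh := by exact_mod_cast hnh1
  have hn01 : 1 ≤ n0 := by linarith
  have htay : ∀ j, M * (taylor s g).coeff j = (D:ℤ) ^ j * (taylor n0 h).coeff j := by
    intro j
    have e1 : taylor s (hc h r0 D) = hc h n0 D := by
      unfold hc
      rw [taylor_apply, comp_assoc]
      congr 1
      rw [hn0]
      simp only [add_comp, mul_comp, C_comp, X_comp, C_add, C_mul]
      ring
    rw [← hc_coeff, ← e1, hMg, taylor_mul, taylor_C, coeff_C_mul]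
  set V : ℕ := W * u with hV
  have hV0 : 0 < V := Nat.mul_pos hW0 hu1
  have hVz : (0:ℤ) < V := by exact_mod_cast hV0
  have hMVj : ∀ j, 1 ≤ j → M * V * G.coeff j = ((D:ℤ) * W) ^ j * (taylor n0 h).coeff j := by
    intro j hj
    rw [mul_assoc, hGj j hj, mul_left_comm, htay j, mul_pow]; ring
  have htop : (taylor n0 h).coeff k = h.leadingCoeff := by
    rw [hkdef, ← natDegree_taylor h n0, coeff_natDegree, leadingCoeff_taylor]
  have hMVk : M * V * G.coeff k = ((D:ℤ) * W) ^ k * h.leadingCoeff := by rw [hMVj k hk, htop]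
  have hMV : 0 < M * V := mul_pos hM hVz
  have hMV1 : 1 ≤ M * V := hMV
  have hGk : 0 < G.coeff k := by
    have : 0 < M * V * G.coeff k := by rw [hMVk]; positivity
    exact (mul_pos_iff_of_pos_left hMV).1 this
  have hMVk' : ((D:ℤ) * W) ^ k ≤ M * V * G.coeff k := by
    rw [hMVk]
    exact le_mul_of_one_le_right (by positivity) hl
  have hlc : ((h.leadingCoeff.toNat : ℕ):ℤ) = h.leadingCoeff := Int.toNat_of_nonneg hl.le
  have hCh : (C1:ℤ) * ((nh:ℤ) + 1) ^ k ≤ ((C1 * (nh + 1) ^ k + h.leadingCoeff.toNat : ℕ) : ℤ) := by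
    push_cast; rw [← hlc] at hl; omega
  refine ⟨V, G, g.eval s, hV0, ?_, hGd, hG0, hG1, hGk, ?_, hsm, hla, ?_, ?_⟩
  · calc V = ck k * y.factorial * u := rfl
      _ ≤ ck k * y.factorial * ck k := Nat.mul_le_mul_left _ huc
      _ = _ := by ring
  · intro j
    refine le_trans ?_ (mul_le_mul_of_nonneg_right hCh hGk.le)
    rcases Nat.eq_zero_or_pos j with rfl | hj
    · rw [hG0, abs_zero]; positivity
    rcases lt_or_ge k j with hjk | hjk
    · rw [coeff_eq_zero_of_natDegree_lt (by omega), abs_zero]; positivity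
    refine le_of_mul_le_mul_left ?_ hMV
    calc M * V * |G.coeff j| = |M * V * G.coeff j| := by rw [abs_mul, abs_of_pos hMV]
      _ = ((D:ℤ) * W) ^ j * |(taylor n0 h).coeff j| := by rw [hMVj j hj, abs_mul, abs_of_nonneg (by positivity : (0:ℤ) ≤ ((D:ℤ) * W) ^ j)]
      _ ≤ ((D:ℤ) * W) ^ j * (C1 * n0 ^ (k - j)) := mul_le_mul_of_nonneg_left (hT j hjk n0 hn01) (by positivity)
      _ ≤ ((D:ℤ) * W) ^ j * (C1 * (((nh:ℤ) + 1) * (D * W)) ^ (k - j)) := by gcongr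
      _ = C1 * ((nh:ℤ) + 1) ^ (k - j) * ((D * W) ^ j * (D * W) ^ (k - j)) := by
          rw [mul_pow ((nh:ℤ) + 1) ((D:ℤ) * W) (k - j)]; ring
      _ = C1 * ((nh:ℤ) + 1) ^ (k - j) * ((D:ℤ) * W) ^ k := by rw [← pow_add, Nat.add_sub_cancel' hjk]
      _ ≤ C1 * ((nh:ℤ) + 1) ^ k * (M * V * G.coeff k) := by
          have : ((nh:ℤ) + 1) ^ (k - j) ≤ ((nh:ℤ) + 1) ^ k := pow_le_pow_right₀ (by omega) (by omega)
          gcongr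
      _ = M * V * (C1 * ((nh:ℤ) + 1) ^ k * G.coeff k) := by ring
  · calc G.coeff k ≤ M * V * G.coeff k := le_mul_of_one_le_left hGk.le hMV1
      _ = ((D:ℤ) * W) ^ k * h.leadingCoeff := hMVk
      _ ≤ ((D:ℤ) * W) ^ k * ((C1 * (nh + 1) ^ k + h.leadingCoeff.toNat : ℕ) : ℤ) := by
          refine mul_le_mul_of_nonneg_left ?_ (by positivity)
          push_cast; rw [hlc]
          have : (0:ℤ) ≤ C1 * ((nh:ℤ) + 1) ^ k := by positivity
          linarith
      _ = _ := by push_cast; ring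
  · intro n
    have e1 : g.eval s + V * G.eval (n:ℤ) = g.eval (s + W * n) := (hGe n).symm
    rw [e1]
    have e2 : M * g.eval (s + W * n) = h.eval (n0 + D * W * n) := by
      have : (hc h r0 D).eval (s + W * n) = M * g.eval (s + W * n) := by rw [hMg]; simp
      rw [← this, hc_eval]; congr 1; rw [hn0]; ring
    have hbig : n0 ≤ n0 + D * W * n := by
      have : (0:ℤ) ≤ D * W * n := by positivity
      linarith
    have hup : n0 + D * W * n ≤ (((nh:ℤ) + 1) * (D * W)) * ((n:ℤ) + 1) := by
      have : (0:ℤ) ≤ nh * (D * W) * n := by positivity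
      nlinarith
    refine ⟨?_, ?_, ?_⟩
    · have := hnh (n0 + D * W * n) (by linarith)
      rw [← e2] at this
      exact (mul_pos_iff_of_pos_left hM).1 this
    · refine le_of_mul_le_mul_left ?_ hM
      rw [e2]
      have h1 := hT 0 (Nat.zero_le _) (n0 + D * W * n) (by linarith)
      rw [taylor_coeff_zero, Nat.sub_zero] at h1
      calc h.eval (n0 + D * W * n) ≤ C1 * (n0 + D * W * n) ^ k := (le_abs_self _).trans h1
        _ ≤ C1 * ((((nh:ℤ) + 1) * (D * W)) * ((n:ℤ) + 1)) ^ k := by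
            have : 0 ≤ n0 + D * W * n := by linarith
            gcongr
        _ = C1 * ((nh:ℤ) + 1) ^ k * ((n:ℤ) + 1) ^ k * (D * W) ^ k := by
            rw [mul_pow (((nh:ℤ) + 1) * (D * W)) ((n:ℤ) + 1) k, mul_pow ((nh:ℤ) + 1) ((D:ℤ) * W) k]; ring
        _ ≤ ((C1 * (nh + 1) ^ k + h.leadingCoeff.toNat : ℕ) : ℤ) * ((n:ℤ) + 1) ^ k * (M * V * G.coeff k) := by gcongr
        _ = _ := by ring
    · exact ⟨s + W * n, by rw [e2]; congr 1; rw [hn0]; ring⟩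

end A3
end FS


namespace FS
section B1
open Finset

theorem split (A : Finset ℤ) (b : ℤ) (q l μ : ℕ) (hμ : 1 ≤ μ) (hl : 200 * μ ≤ l) (δ : ℝ) (hδ : 0 < δ)
    (hc : δ * l ≤ (({i ∈ range l | b + q * (i:ℕ) ∈ A} : Finset ℕ).card : ℝ)) :
    ∃ r : ℕ, δ / 1.005 * ((l / μ + 1 : ℕ) : ℝ) ≤
      (((Finset.Ico (0:ℤ) ((l / μ + 1 : ℕ) : ℤ)).filter (fun i => b + q * (r + μ * i) ∈ A)).card : ℝ) := by
  by_contra! hcon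
  set S : Finset ℕ := {i ∈ range l | b + q * (i:ℕ) ∈ A} with hS
  set x : ℕ := l / μ + 1 with hx
  have h1 : S.card = ∑ r ∈ range μ, (S.filter (fun i => i % μ = r)).card :=
    card_eq_sum_card_fiberwise (fun i _ => by
      simpa using Nat.mod_lt i hμ)
  have h2 : ∀ r, (S.filter (fun i => i % μ = r)).card ≤
      ((Finset.Ico (0:ℤ) (x : ℤ)).filter (fun i => b + q * (r + μ * i) ∈ A)).card := by
    intro r
    refine card_le_card_of_injOn (fun i => ((i / μ : ℕ) : ℤ)) ?_ ?_
    · intro i hi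
      simp only [hS, coe_filter, mem_filter, mem_range, Set.mem_ofPred_eq] at hi
      obtain ⟨⟨hil, hiA⟩, hir⟩ := hi
      simp only [coe_filter, Set.mem_ofPred_eq, mem_Ico]
      refine ⟨⟨by positivity, ?_⟩, ?_⟩
      · have := Nat.div_le_div_right (c := μ) hil.le
        exact_mod_cast (by omega : i / μ < x)
      · have : ((r:ℤ) + μ * ((i / μ : ℕ):ℤ)) = i := by
          rw [← hir]; exact_mod_cast Nat.mod_add_div i μ
        rw [this]; exact hiA
    · intro i hi j hj hij
      simp only [coe_filter, Set.mem_ofPred_eq] at hi hj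
      have e : i / μ = j / μ := by
        have hij' : ((i / μ : ℕ) : ℤ) = ((j / μ : ℕ) : ℤ) := hij
        exact_mod_cast hij'
      rw [← Nat.mod_add_div i μ, ← Nat.mod_add_div j μ, hi.2, hj.2, e]
  have h3 : (S.card : ℝ) < ∑ _r ∈ range μ, δ / 1.005 * (x : ℝ) := by
    rw [h1, Nat.cast_sum]
    refine sum_lt_sum_of_nonempty ⟨0, mem_range.2 hμ⟩ fun r _ => ?_
    exact lt_of_le_of_lt (by exact_mod_cast h2 r) (hcon r)
  rw [sum_const, card_range, nsmul_eq_mul] at h3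
  have h4 : (μ:ℝ) * x ≤ l + μ := by
    have := Nat.mul_div_le l μ
    have : μ * x ≤ l + μ := by rw [hx, mul_add]; omega
    exact_mod_cast this
  have h5 : (200:ℝ) * μ ≤ l := by exact_mod_cast hl
  have h6 : (μ:ℝ) * (δ / 1.005 * x) = δ / 1.005 * (μ * x) := by ring
  have h7 : δ / 1.005 * (μ * x) ≤ δ / 1.005 * (1.005 * l) := by
    refine mul_le_mul_of_nonneg_left ?_ (by positivity); linarith
  have h8 : δ / 1.005 * (1.005 * l) = δ * l := by field_simp
  linarith

end B1
end FS


namespace FS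
section I1
open Finset Polynomial

lemma qmod_le (Q0 d : ℕ) (hQ : 1 ≤ Q0) (S : Finset ℕ) (hS : S.card ≤ d) : qmod Q0 S ≤ Q0 ^ d := by
  unfold qmod
  calc ∏ p ∈ S, p ^ Nat.log p Q0 ≤ ∏ _p ∈ S, Q0 :=
        Finset.prod_le_prod' fun p _ => Nat.pow_log_le_self p (by omega)
    _ = Q0 ^ S.card := by rw [prod_const]
    _ ≤ Q0 ^ d := Nat.pow_le_pow_right hQ hS

lemma qmod_pos (Q0 : ℕ) (S : Finset ℕ) (hS : ∀ p ∈ S, p.Prime ∧ p ≤ Q0) : 1 ≤ qmod Q0 S := by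
  unfold qmod
  exact Finset.prod_pos fun p hp => pow_pos (hS p hp).1.pos _

/-- The state of the density increment iteration. -/
def Good (h : ℤ[X]) (r0 : ℤ) (D x : ℕ) (A : Finset ℤ) : Prop :=
  A ⊆ Finset.Ico 0 (x:ℤ) ∧ ∀ a ∈ A, ∀ b ∈ A, ∀ n : ℤ, h.eval (r0 + D * n) = Mc h r0 D * (b - a) → b = a

theorem ap_next (h : ℤ[X]) (hk : 1 ≤ h.natDegree) (hl : 0 < h.leadingCoeff) (r0 : ℤ) (DD : ℕ)
    (hr0 : h.leadingCoeff * ((DD.factorial : ℕ) : ℤ) ^ (h.natDegree + 1) ∣ h.eval r0)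
    (D q x : ℕ) (hD : 1 ≤ D) (hq : 1 ≤ q) (hDq : D * q ≤ DD) (A : Finset ℤ) (hG : Good h r0 D x A)
    (b : ℤ) (l : ℕ) (hl2 : 200 * q ^ (h.natDegree - 1) ≤ l) (δ : ℝ) (hδ : 0 < δ)
    (hc : δ * l ≤ (({i ∈ range l | b + q * (i:ℕ) ∈ A} : Finset ℕ).card : ℝ)) :
    ∃ (x' : ℕ) (A' : Finset ℤ), Good h r0 (D * q) x' A' ∧ δ / 1.005 * x' ≤ A'.card ∧ l ≤ x' * q ^ (h.natDegree - 1) := by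
  obtain ⟨⟨μ, hμ⟩, h2⟩ := cont_step h r0 DD hr0 D q hD hq hDq
  have hM := Mc_pos h hl r0 D hD
  have hM' := Mc_pos h hl r0 (D * q) (Nat.mul_pos hD hq)
  have hqz : (0:ℤ) < q := by exact_mod_cast hq
  have hμ0 : 0 < μ := by
    rw [hμ] at hM'
    exact (mul_pos_iff_of_pos_left (mul_pos hqz hM)).1 hM'
  lift μ to ℕ using hμ0.le
  have hμ1 : 1 ≤ μ := by exact_mod_cast hμ0
  have hμq : μ ≤ q ^ (h.natDegree - 1) := by
    have e : (q:ℤ) ^ h.natDegree = q ^ (h.natDegree - 1) * q := by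
      rw [← pow_succ]; congr 1; omega
    rw [hμ, e, show (q:ℤ) * Mc h r0 D * μ = (μ:ℤ) * (q * Mc h r0 D) by ring, mul_assoc] at h2
    have h3 := Int.dvd_of_mul_dvd_mul_right (mul_pos hqz hM).ne' h2
    have h4 : μ ∣ q ^ (h.natDegree - 1) := by exact_mod_cast h3
    exact Nat.le_of_dvd (by positivity) h4
  obtain ⟨r, hr⟩ := split A b q l μ hμ1 (le_trans (Nat.mul_le_mul_left _ hμq) hl2) δ hδ hc
  refine ⟨l / μ + 1, _, ⟨Finset.filter_subset _ _, ?_⟩, hr, ?_⟩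
  · intro i hi j hj n hn
    rw [mem_filter] at hi hj
    have h5 := hG.2 _ hi.2 _ hj.2 (q * n) (by
      rw [show r0 + (D:ℤ) * (q * n) = r0 + ((D * q : ℕ):ℤ) * n by push_cast; ring, hn, hμ]; ring)
    have h6 : (q:ℤ) * μ * (j - i) = 0 := by linear_combination h5
    have h7 : (q:ℤ) * μ ≠ 0 := by positivity
    have := (mul_eq_zero.1 h6).resolve_left h7
    linarith
  · have h8 := Nat.div_add_mod l μ
    have h9 := Nat.mod_lt l hμ1
    calc l ≤ (l / μ + 1) * μ := by nlinarith
      _ ≤ _ := Nat.mul_le_mul_left _ hμq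

lemma chooseN (k c g x : ℕ) (hk : 1 ≤ k) (hc : 1 ≤ c) (hg : c * g ^ k ≤ x) :
    ∃ N : ℕ, g ≤ N ∧ c * N ^ k ≤ x ∧ x < c * (N + 1) ^ k := by
  classical
  have hle : ∀ n, n ≤ c * n ^ k := fun n =>
    (Nat.le_self_pow (by omega) n).trans (Nat.le_mul_of_pos_left _ hc)
  have hgx : g ≤ x := (hle g).trans hg
  refine ⟨Nat.findGreatest (fun n => c * n ^ k ≤ x) x, Nat.le_findGreatest hgx hg, ?_, ?_⟩
  · exact Nat.findGreatest_spec (P := fun n => c * n ^ k ≤ x) hgx hg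
  · by_contra! hcon
    have h1 := (hle _).trans hcon
    exact Nat.findGreatest_is_greatest (P := fun n => c * n ^ k ≤ x) (Nat.lt_succ_self _) h1 hcon

set_option maxHeartbeats 2000000 in
theorem step (h : ℤ[X]) (hk : 1 ≤ h.natDegree) (hl : 0 < h.leadingCoeff) : ∃ Ch C₀ : ℕ, 1 ≤ Ch ∧
    ∀ (r0 : ℤ) (DD : ℕ), h.leadingCoeff * ((DD.factorial : ℕ) : ℤ) ^ (h.natDegree + 1) ∣ h.eval r0 → h.leadingCoeff ≤ DD →
    ∀ (y m d Q0 U : ℕ), 4 ≤ m → 1 ≤ d → 2 ≤ Q0 → Q0 < 2 ^ (d + 1) → (38400 * m * h.natDegree) ^ 2 ≤ y → ck h.natDegree ≤ y →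
    (8 * 4 ^ m) ^ C₀ ≤ Q0 → 8 * 4 ^ m ≤ Q0 → ck h.natDegree ^ 2 * y.factorial * Q0 ^ d ≤ U → Q0 ^ (8 * m * d) ≤ U →
    800 * Ch * 2 ^ h.natDegree * Q0 ^ 2 ≤ U →
    ∀ (D x : ℕ) (A : Finset ℤ), 1 ≤ D → D * U ≤ DD → Good h r0 D x A →
    ∀ α : ℝ, α * x ≤ A.card → 1 ≤ 4 ^ m * α → (U * DD) ^ (h.natDegree ^ 2 + 3 * h.natDegree + 3) ≤ x →
    ∃ (D' x' : ℕ) (A' : Finset ℤ), 1 ≤ D' ∧ D' ≤ D * U ∧ Good h r0 D' x' A' ∧ 1.09 * α * x' ≤ A'.card ∧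
      x ≤ x' * U ^ (h.natDegree + 3) := by
  obtain ⟨Ch, hCh, hlin⟩ := lin h hk hl
  obtain ⟨C₀, hf⟩ := fstep h.natDegree hk Ch (by positivity)
  refine ⟨Ch, C₀, hCh, ?_⟩
  intro r0 DD hr0 hDDl y m d Q0 U hm hd hQ2 hQd hy hyc hQ8 hQ8' hU1 hU2 hU3 D x A hD hDU hG α0 hα0 hα0m hx
  set k := h.natDegree with hkdef
  have hU200 : 200 ≤ U := by
    refine le_trans ?_ hU3
    calc 200 ≤ 800 * 1 * 1 * 1 := by norm_num
      _ ≤ _ := Nat.mul_le_mul (Nat.mul_le_mul (Nat.mul_le_mul_left _ hCh) Nat.one_le_two_pow) (Nat.one_le_pow _ _ (by omega))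
  have hDDp : 1 ≤ DD := le_trans (Nat.mul_pos hD (by omega)) hDU
  have hDDD : D ≤ DD := le_trans (Nat.le_mul_of_pos_right _ (by omega)) hDU
  obtain ⟨V, G, H0, hV1, hVle, hGd, hG0, hG1, hGk, hGj, hsm, hla, hγ, hH⟩ :=
    hlin D r0 hD (fun p hp => star h (by omega) hl r0 DD hr0 hDDl D hD hDDD p hp) y hyc
  obtain ⟨γ, hγe⟩ : ∃ γ : ℕ, G.coeff k = (γ:ℤ) := ⟨(G.coeff k).toNat, (Int.toNat_of_nonneg hGk.le).symm⟩
  rw [hγe] at hγ hGk hGj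
  simp only [hγe] at hH
  have hγ1 : 1 ≤ γ := by exact_mod_cast hGk
  obtain ⟨T, hT⟩ : ∃ T : ℕ, T = 800 * Ch * 2 ^ k * Q0 ^ 2 := ⟨_, rfl⟩
  rw [← hT] at hU3
  have hQ1 : 1 ≤ Q0 := by omega
  have hcky : ck k ^ 2 * y.factorial ≤ U := le_trans (Nat.le_mul_of_pos_right _ (Nat.one_le_pow _ _ hQ1)) hU1
  have hVU : V ≤ U := hVle.trans hcky
  have hT1 : 800 ≤ T := by
    rw [hT]
    calc 800 = 800 * 1 * 1 * 1 := by norm_num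
      _ ≤ _ := Nat.mul_le_mul (Nat.mul_le_mul (Nat.mul_le_mul_left _ hCh) Nat.one_le_two_pow) (Nat.one_le_pow _ _ (by omega))
  have hVT : 0 < V * T := Nat.mul_pos hV1 (by omega)
  have hxU : U ^ (k + 3) ≤ x := by
    refine le_trans ?_ hx
    calc U ^ (k + 3) ≤ U ^ (k ^ 2 + 3 * k + 3) := Nat.pow_le_pow_right (by omega) (by nlinarith)
      _ ≤ _ := Nat.pow_le_pow_left (Nat.le_mul_of_pos_right _ hDDp) _
  obtain ⟨Y, hY⟩ : ∃ Y : ℕ, Y = x / (V * T) := ⟨_, rfl⟩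
  have hYU : U ^ (k + 1) ≤ Y := by
    rw [hY, Nat.le_div_iff_mul_le hVT]
    refine le_trans ?_ hxU
    calc U ^ (k + 1) * (V * T) ≤ U ^ (k + 1) * (U * U) := Nat.mul_le_mul_left _ (Nat.mul_le_mul hVU hU3)
      _ = _ := by ring
  have hY1 : 1 ≤ Y := le_trans (Nat.one_le_pow _ _ (by omega)) hYU
  have hYx : Y * (V * T) ≤ x := by
    rw [hY]; exact Nat.div_mul_le_self _ _
  have hx1 : 1 ≤ x := le_trans (Nat.one_le_pow _ _ (by omega)) hxU
  have hxr : (0:ℝ) < x := by exact_mod_cast hx1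
  obtain ⟨α, hα⟩ : ∃ α : ℝ, α = A.card / x := ⟨_, rfl⟩
  have hαα : α0 ≤ α := by rw [hα, le_div_iff₀ hxr]; exact hα0
  have h4m : (0:ℝ) < 4 ^ m := by positivity
  have hα00 : 0 < α0 := by
    by_contra! hc
    nlinarith
  have hαp : 0 < α := hα00.trans_le hαα
  have hcard : (A.card : ℝ) = α * x := by rw [hα]; field_simp
  have hcx : A.card ≤ x := by
    have := Finset.card_le_card hG.1
    simpa using this
  have hα1 : α ≤ 1 := by rw [hα, div_le_one hxr]; exact_mod_cast hcx
  have hαm : 1 ≤ 4 ^ m * α := hα0m.trans (mul_le_mul_of_nonneg_left hαα h4m.le)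
  have hnext : ∀ (q l : ℕ) (b : ℤ), 1 ≤ q → V * q ≤ U → Y ≤ l * q →
      1.1 * α * l ≤ (({i ∈ range l | b + ((V * q : ℕ) : ℤ) * (i:ℕ) ∈ A} : Finset ℕ).card : ℝ) →
      ∃ (D' x' : ℕ) (A' : Finset ℤ), 1 ≤ D' ∧ D' ≤ D * U ∧ Good h r0 D' x' A' ∧ 1.09 * α0 * x' ≤ A'.card ∧
        x ≤ x' * U ^ (k + 3) := by
    intro q l b hq hVq hYl hc
    have hqV : q ≤ V * q := Nat.le_mul_of_pos_left _ hV1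
    have hpow : (V * q) ^ (k - 1) * q ≤ U ^ k := by
      calc (V * q) ^ (k - 1) * q ≤ U ^ (k - 1) * U := Nat.mul_le_mul (Nat.pow_le_pow_left hVq _) (hqV.trans hVq)
        _ = U ^ k := by rw [← pow_succ]; congr 1; omega
    have hl200 : 200 * (V * q) ^ (k - 1) ≤ l := by
      refine Nat.le_of_mul_le_mul_right ?_ hq
      calc 200 * (V * q) ^ (k - 1) * q = 200 * ((V * q) ^ (k - 1) * q) := by ring
        _ ≤ U * U ^ k := Nat.mul_le_mul hU200 hpow
        _ = U ^ (k + 1) := by ring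
        _ ≤ _ := hYU.trans hYl
    obtain ⟨x', A', hG', hd', hlx⟩ := ap_next h hk hl r0 DD hr0 D (V * q) x hD (Nat.mul_pos hV1 hq)
      ((Nat.mul_le_mul_left _ hVq).trans hDU) A hG b l hl200 (1.1 * α) (by positivity) hc
    refine ⟨D * (V * q), x', A', Nat.mul_pos hD (Nat.mul_pos hV1 hq), Nat.mul_le_mul_left _ hVq, hG', le_trans ?_ hd', ?_⟩
    · refine mul_le_mul_of_nonneg_right ?_ (by positivity)
      rw [le_div_iff₀ (by norm_num)]
      nlinarith
    · have h1 : x < V * T * (Y + 1) := by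
        rw [hY]; exact Nat.lt_mul_div_succ x hVT
      have h2 : Y ≤ x' * U ^ k := by
        calc Y ≤ l * q := hYl
          _ ≤ x' * (V * q) ^ (k - 1) * q := Nat.mul_le_mul_right _ hlx
          _ = x' * ((V * q) ^ (k - 1) * q) := by ring
          _ ≤ _ := Nat.mul_le_mul_left _ hpow
      calc x ≤ V * T * (Y + 1) := h1.le
        _ ≤ (U * U) * (200 * Y) := Nat.mul_le_mul (Nat.mul_le_mul hVU hU3) (by omega)
        _ ≤ (U * U) * (U * (x' * U ^ k)) := Nat.mul_le_mul_left _ (Nat.mul_le_mul hU200 h2)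
        _ = _ := by ring
  by_contra hcon
  have hno := fun q l b h1 h2 h3 => not_le.1 (mt (hnext q l b h1 h2 h3) hcon)
  clear hnext
  -- bound for the leading coefficient
  have hDD0 : D * (ck k * y.factorial) ≤ U * DD := by
    rw [mul_comm U DD]
    refine Nat.mul_le_mul hDDD (le_trans ?_ hcky)
    exact Nat.mul_le_mul_right _ (Nat.le_self_pow (by norm_num) _)
  have hChU : 100 * Ch ≤ U := by
    refine le_trans ?_ hU3
    rw [hT]
    calc 100 * Ch ≤ 800 * Ch * 1 * 1 := by omega
      _ ≤ _ := Nat.mul_le_mul (Nat.mul_le_mul_left _ Nat.one_le_two_pow) (Nat.one_le_pow _ _ (by omega))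
  obtain ⟨Z, hZ⟩ : ∃ Z : ℕ, Z = U * DD := ⟨_, rfl⟩
  rw [← hZ] at hDD0 hx
  have hUZ : U ≤ Z := by
    rw [hZ]; exact Nat.le_mul_of_pos_right _ hDDp
  have hγZ : γ ≤ Z ^ (k + 1) := by
    have : γ ≤ Ch * (D * (ck k * y.factorial)) ^ k := by exact_mod_cast hγ
    calc γ ≤ Ch * (D * (ck k * y.factorial)) ^ k := this
      _ ≤ Z * Z ^ k := Nat.mul_le_mul (by omega) (Nat.pow_le_pow_left hDD0 _)
      _ = _ := by ring
  have hQU : Q0 ≤ Z := by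
    refine le_trans (le_trans ?_ hU3) hUZ
    rw [hT]
    calc Q0 = 1 * Q0 := by ring
      _ ≤ _ := Nat.mul_le_mul (Nat.mul_pos (by omega) (by positivity)) (Nat.le_self_pow (by norm_num) _)
  obtain ⟨c, hc⟩ : ∃ c : ℕ, c = 100 * Ch * γ * V := ⟨_, rfl⟩
  have hc1 : 1 ≤ c := by
    rw [hc]
    have : 0 < 100 * Ch * γ * V := by positivity
    exact this
  have hcg : c * (γ * Q0) ^ k ≤ x := by
    refine le_trans ?_ hx
    calc c * (γ * Q0) ^ k ≤ (Z * Z ^ (k + 1) * Z) * (Z ^ (k + 1) * Z) ^ k := by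
          rw [hc]
          refine Nat.mul_le_mul (Nat.mul_le_mul (Nat.mul_le_mul (hChU.trans hUZ) hγZ) (hVU.trans hUZ)) (Nat.pow_le_pow_left (Nat.mul_le_mul hγZ hQU) _)
      _ = _ := by
          rw [← pow_succ, ← pow_mul, ← pow_succ', ← pow_succ, ← pow_add]; congr 1; ring
  obtain ⟨N, hN1, hN2, hN3⟩ := chooseN k c (γ * Q0) x hk hc1 hcg
  have hNp : 1 ≤ N := le_trans (Nat.mul_pos hγ1 hQ1) hN1
  have h8α : 8 / α ≤ 8 * 4 ^ m := by
    rw [div_le_iff₀ hαp]; nlinarith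
  have hαQ : 8 ≤ α * Q0 := by
    have h1 : (8 * 4 ^ m : ℝ) ≤ Q0 := by exact_mod_cast hQ8'
    nlinarith
  refine hf G hGd hG0 hG1 (by rw [hγe]; exact hGk) ?_ y m d Q0 hm hd hQ2 hQd hy hsm hla x V Y N A hG.1 hx1 α hαp hα1 hcard ?_ ?_ ?_ hNp ?_ ?_ ?_ H0 ?_ ?_ ?_ ?_
  · intro j
    rw [hγe]
    exact_mod_cast hGj j
  · calc (8 / α) ^ C₀ ≤ (8 * 4 ^ m) ^ C₀ := pow_le_pow_left₀ (by positivity) h8α _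
      _ ≤ Q0 := by exact_mod_cast hQ8
  · refine hαm.trans (mul_le_mul_of_nonneg_right ?_ hαp.le)
    exact pow_le_pow_left₀ (by norm_num) (by norm_num) _
  · refine hU2.trans (le_trans (Nat.le_self_pow (by omega) U) hYU)
  · rw [hγe]; exact_mod_cast hN1
  · rw [hγe]
    have hN2k : (N + 1) ^ k ≤ 2 ^ k * N ^ k := by
      rw [← mul_pow]; exact Nat.pow_le_pow_left (by omega) _
    have h1 : Y * (V * T) ≤ c * (2 ^ k * N ^ k) := hYx.trans (hN3.le.trans (Nat.mul_le_mul_left _ hN2k))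
    have h2 : Y * V * (800 * Ch * 2 ^ k * Q0 ^ 2) ≤ 100 * Ch * γ * V * (2 ^ k * N ^ k) := by
      rw [← hT, mul_assoc Y V T, ← hc]; exact h1
    have h3 : (100 * Ch * 2 ^ k * V) * (8 * Y * Q0 ^ 2) ≤ (100 * Ch * 2 ^ k * V) * (γ * N ^ k) := by
      calc _ = Y * V * (800 * Ch * 2 ^ k * Q0 ^ 2) := by ring
        _ ≤ _ := h2
        _ = _ := by ring
    have h4 : 8 * Y * Q0 ^ 2 ≤ γ * N ^ k := Nat.le_of_mul_le_mul_left h3 (by positivity)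
    have h5 : (8:ℝ) * Y * Q0 ^ 2 ≤ γ * N ^ k := by exact_mod_cast h4
    calc (64:ℝ) * Y * Q0 = 8 * (8 * Y * Q0) := by ring
      _ ≤ α * Q0 * (8 * Y * Q0) := mul_le_mul_of_nonneg_right hαQ (by positivity)
      _ = α * (8 * Y * Q0 ^ 2) := by ring
      _ ≤ _ := by
        push_cast
        exact mul_le_mul_of_nonneg_left h5 hαp.le
  · calc 100 * (V * Y) ≤ T * (V * Y) := Nat.mul_le_mul_right _ (by omega)
      _ = Y * (V * T) := by ring
      _ ≤ x := hYx
  · intro n hn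
    obtain ⟨h1, h2, _⟩ := hH n
    refine ⟨h1.le, ?_⟩
    have h3 : 100 * (Ch * γ * V * (n + 1) ^ k) ≤ x := by
      calc 100 * (Ch * γ * V * (n + 1) ^ k) = c * (n + 1) ^ k := by rw [hc]; ring
        _ ≤ c * N ^ k := Nat.mul_le_mul_left _ (Nat.pow_le_pow_left hn _)
        _ ≤ x := hN2
    have h4 : (100:ℤ) * (Ch * γ * V * (n + 1) ^ k) ≤ x := by exact_mod_cast h3
    linarith
  · intro n hn a ha b hb hab
    obtain ⟨h1, _, z, hz⟩ := hH n
    rw [← hab] at hz h1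
    have := hG.2 a ha b hb z hz
    linarith
  · intro z
    have h1 := hno 1 Y z le_rfl (by rw [mul_one]; exact hVU) (by rw [mul_one])
    rw [mul_one] at h1
    exact h1.le
  · intro S hS hSd z r
    obtain ⟨q, hq⟩ : ∃ q : ℕ, q = qmod Q0 S := ⟨_, rfl⟩
    rw [← hq]
    have hq1 : 1 ≤ q := by rw [hq]; exact qmod_pos Q0 S hS
    have hqd : q ≤ Q0 ^ d := by rw [hq]; exact qmod_le Q0 d hQ1 S hSd
    have hVq : V * q ≤ U := le_trans (Nat.mul_le_mul hVle hqd) hU1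
    have hqU : q ≤ U := (Nat.le_mul_of_pos_left _ hV1).trans hVq
    have hmd := Nat.div_add_mod Y q
    have hml := Nat.mod_lt Y hq1
    have hYl : Y ≤ (Y / q + 1) * q := by
      rw [show (Y / q + 1) * q = q * (Y / q) + q by ring]; omega
    have h1 := hno q (Y / q + 1) (z + V * r) hq1 hVq hYl
    have h2 : ({t ∈ range Y | z + V * t ∈ A ∧ t % q = r} : Finset ℕ).card ≤
        ({i ∈ range (Y / q + 1) | z + V * r + ((V * q : ℕ) : ℤ) * (i:ℕ) ∈ A} : Finset ℕ).card := by
      refine card_le_card_of_injOn (fun t => t / q) ?_ ?_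
      · intro t ht
        simp only [coe_filter, mem_range, Set.mem_ofPred_eq] at ht ⊢
        obtain ⟨ht1, ht2, ht3⟩ := ht
        refine ⟨?_, ?_⟩
        · have := Nat.div_le_div_right (c := q) ht1.le
          omega
        · have e : (r:ℤ) + q * ((t / q : ℕ):ℤ) = t := by
            rw [← ht3]; exact_mod_cast Nat.mod_add_div t q
          have e2 : z + V * r + ((V * q : ℕ) : ℤ) * ((t / q : ℕ):ℤ) = z + V * t := by
            rw [← e]; push_cast; ring
          rw [e2]; exact ht2
      · intro t ht s hs hts
        simp only [coe_filter, Set.mem_ofPred_eq] at ht hs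
        have e : t / q = s / q := hts
        rw [← Nat.mod_add_div t q, ← Nat.mod_add_div s q, ht.2.2, hs.2.2, e]
    have h2' : (({t ∈ range Y | z + V * t ∈ A ∧ t % q = r} : Finset ℕ).card : ℝ) ≤ 1.1 * α * ((Y / q + 1 : ℕ) : ℝ) :=
      le_trans (by exact_mod_cast h2) h1.le
    have hexp : (Y / q + 1) * q = q * (Y / q) + q := by ring
    have h3 : (Y / q + 1) * q ≤ Y + q := by rw [hexp]; omega
    have h3' : ((Y / q + 1 : ℕ) : ℝ) * q ≤ Y + q := by exact_mod_cast h3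
    have h4 : 2 * q ≤ Y := by
      calc 2 * q ≤ U * U := Nat.mul_le_mul (by omega) hqU
        _ = U ^ 2 := by ring
        _ ≤ U ^ (k + 1) := Nat.pow_le_pow_right (by omega) (by omega)
        _ ≤ Y := hYU
    have h4' : 2 * (q:ℝ) ≤ Y := by exact_mod_cast h4
    calc _ ≤ 1.1 * α * ((Y / q + 1 : ℕ) : ℝ) * q := mul_le_mul_of_nonneg_right h2' (by positivity)
      _ = α * (1.1 * (((Y / q + 1 : ℕ) : ℝ) * q)) := by ring
      _ ≤ α * (2 * Y) := mul_le_mul_of_nonneg_left (by linarith) hαp.le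
      _ = 2 * α * Y := by ring

end I1
end FS


namespace FS
section I2
open Finset Polynomial

theorem iter (h : ℤ[X]) (hk : 1 ≤ h.natDegree) (hl : 0 < h.leadingCoeff) : ∃ Ch C₀ : ℕ, 1 ≤ Ch ∧
    ∀ (y m d Q0 U : ℕ), 4 ≤ m → 1 ≤ d → 2 ≤ Q0 → Q0 < 2 ^ (d + 1) → (38400 * m * h.natDegree) ^ 2 ≤ y → ck h.natDegree ≤ y →
    (8 * 4 ^ m) ^ C₀ ≤ Q0 → 8 * 4 ^ m ≤ Q0 → ck h.natDegree ^ 2 * y.factorial * Q0 ^ d ≤ U → Q0 ^ (8 * m * d) ≤ U →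
    800 * Ch * 2 ^ h.natDegree * Q0 ^ 2 ≤ U → h.leadingCoeff ≤ ((U ^ (19 * m) : ℕ) : ℤ) →
    ∀ r0 : ℤ, h.leadingCoeff * (((U ^ (19 * m)).factorial : ℕ) : ℤ) ^ (h.natDegree + 1) ∣ h.eval r0 →
    ∀ (x : ℕ) (A : Finset ℤ), Good h r0 1 x A →
    U ^ ((19 * m + 1) * (h.natDegree ^ 2 + 3 * h.natDegree + 3) + 19 * m * (h.natDegree + 3)) ≤ x → 4 ^ m * A.card < x := by
  obtain ⟨Ch, C₀, hCh, hs⟩ := step h hk hl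
  refine ⟨Ch, C₀, hCh, ?_⟩
  intro y m d Q0 U hm hd hQ2 hQd hy hyc hQ8 hQ8' hU1 hU2 hU3 hDDl r0 hr0 x A hG hx
  have hst := hs r0 (U ^ (19 * m)) hr0 hDDl y m d Q0 U hm hd hQ2 hQd hy hyc hQ8 hQ8' hU1 hU2 hU3
  clear hs
  generalize h.natDegree ^ 2 + 3 * h.natDegree + 3 = K at hst hx
  generalize h.natDegree + 3 = K' at hst hx
  have hU0 : 0 < U := lt_of_lt_of_le (by positivity) hU2
  by_contra! hcon
  have hx0 : 0 < x := lt_of_lt_of_le (by positivity) hx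
  have hxr : (0:ℝ) < x := by exact_mod_cast hx0
  set α : ℝ := A.card / x with hα
  have hcard : α * x = A.card := by rw [hα]; field_simp
  have hαm : 1 ≤ 4 ^ m * α := by
    rw [hα, ← mul_div_assoc, le_div_iff₀ hxr, one_mul]; exact_mod_cast hcon
  have h4m : (0:ℝ) < 4 ^ m := by positivity
  have hα0 : 0 < α := by
    by_contra! hc
    nlinarith
  have key : ∀ j : ℕ, j ≤ 19 * m → ∃ (D x' : ℕ) (A' : Finset ℤ), 1 ≤ D ∧ D ≤ U ^ j ∧ Good h r0 D x' A' ∧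
      1.09 ^ j * α * x' ≤ A'.card ∧ x ≤ x' * U ^ (j * K') := by
    intro j
    induction j with
    | zero =>
      intro _
      exact ⟨1, x, A, le_rfl, by simp, hG, by rw [pow_zero, one_mul, hcard], by simp⟩
    | succ j ih =>
      intro hj
      obtain ⟨D, x', A', hD, hDU, hG', hd', hx'⟩ := ih (by omega)
      have hDD : D * U ≤ U ^ (19 * m) := by
        calc D * U ≤ U ^ j * U := Nat.mul_le_mul_right _ hDU
          _ = U ^ (j + 1) := by ring
          _ ≤ _ := Nat.pow_le_pow_right hU0 hj
      have h1 : (1:ℝ) ≤ 1.09 ^ j := one_le_pow₀ (by norm_num)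
      have h2 : (U * U ^ (19 * m)) ^ K ≤ x' := by
        refine Nat.le_of_mul_le_mul_right ?_ (Nat.pow_pos hU0 : 0 < U ^ (j * K'))
        refine le_trans (le_trans ?_ hx) hx'
        rw [← pow_succ', ← pow_mul, ← pow_add]
        refine Nat.pow_le_pow_right hU0 ?_
        have : j * K' ≤ 19 * m * K' := Nat.mul_le_mul_right _ (by omega)
        omega
      obtain ⟨D', x'', A'', hD', hDU', hG'', hd'', hx''⟩ := hst D x' A' hD hDD hG' (1.09 ^ j * α) hd' (by nlinarith) h2
      refine ⟨D', x'', A'', hD', hDU'.trans ?_, hG'', ?_, hx'.trans ?_⟩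
      · calc D * U ≤ U ^ j * U := Nat.mul_le_mul_right _ hDU
          _ = U ^ (j + 1) := by ring
      · calc _ = 1.09 * (1.09 ^ j * α) * (x'':ℝ) := by ring
          _ ≤ _ := hd''
      · calc x' * U ^ (j * K') ≤ x'' * U ^ K' * U ^ (j * K') := Nat.mul_le_mul_right _ hx''
          _ = _ := by rw [mul_assoc, ← pow_add]; congr 2; ring
  obtain ⟨D, x', A', -, -, hG', hd', hx'⟩ := key (19 * m) le_rfl
  have hx'0 : 0 < x' := by
    rcases Nat.eq_zero_or_pos x' with h0 | h0
    · rw [h0, zero_mul] at hx'; omega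
    · exact h0
  have hcx : A'.card ≤ x' := by
    have := Finset.card_le_card hG'.1
    simpa using this
  have hcx' : (A'.card : ℝ) ≤ 1 * x' := by rw [one_mul]; exact_mod_cast hcx
  have h3 : 1.09 ^ (19 * m) * α ≤ 1 := le_of_mul_le_mul_right (hd'.trans hcx') (by exact_mod_cast hx'0)
  have h5 : (4:ℝ) ^ m < 1.09 ^ (19 * m) := by
    rw [pow_mul]
    exact pow_lt_pow_left₀ (by norm_num) (by norm_num) (by omega)
  nlinarith

theorem params (h : ℤ[X]) (hk : 1 ≤ h.natDegree) (hl : 0 < h.leadingCoeff) : ∃ κ : ℕ, ∀ m : ℕ, 4 ≤ m → ∃ DD : ℕ,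
    ∀ r0 : ℤ, h.leadingCoeff * ((DD.factorial : ℕ) : ℤ) ^ (h.natDegree + 1) ∣ h.eval r0 →
    ∀ (x : ℕ) (A : Finset ℤ), Good h r0 1 x A → 2 ^ (κ * m ^ 4) ≤ x → 4 ^ m * A.card < x := by
  obtain ⟨Ch, C₀, hCh, hit⟩ := iter h hk hl
  set k := h.natDegree with hkd
  have hck := ck_pos k
  obtain ⟨C, hC⟩ : ∃ C : ℕ, C = max C₀ 1 := ⟨_, rfl⟩
  have hC1 : 1 ≤ C := by omega
  have hC2 : C₀ ≤ C := by omega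
  obtain ⟨B, hB⟩ : ∃ B : ℕ, B = ck k * (38400 * k) ^ 2 := ⟨_, rfl⟩
  obtain ⟨κ, hκ⟩ : ∃ κ : ℕ, κ = (B + 2) * B + 81 * C ^ 2 + 2 * ck k + 800 * Ch + k + 6 * C + h.leadingCoeff.toNat := ⟨_, rfl⟩
  refine ⟨κ * (20 * (k ^ 2 + 3 * k + 3) + 19 * (k + 3)), fun m hm => ?_⟩
  refine ⟨(2 ^ (κ * m ^ 3)) ^ (19 * m), fun r0 hr0 x A hG hx => ?_⟩
  have hm1 : 1 ≤ m := by omega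
  have hm3 : 1 ≤ m ^ 3 := Nat.one_le_pow _ _ hm1
  have hm23 : m ^ 2 ≤ m ^ 3 := Nat.pow_le_pow_right hm1 (by norm_num)
  have hm13 : m ≤ m ^ 3 := Nat.le_self_pow (by norm_num) m
  have e8 : 8 * 4 ^ m = 2 ^ (2 * m + 3) := by
    rw [pow_add, pow_mul]; norm_num; ring
  have h8 : 2 * m + 3 ≤ 3 * m := by omega
  have hlt : ∀ n : ℕ, n ≤ 2 ^ n := fun n => Nat.lt_two_pow_self.le
  have hy : (B * m ^ 2).factorial ≤ 2 ^ ((B + 2) * B * m ^ 3) := by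
    calc (B * m ^ 2).factorial ≤ (B * m ^ 2) ^ (B * m ^ 2) := Nat.factorial_le_pow _
      _ ≤ (2 ^ ((B + 2) * m)) ^ (B * m ^ 2) := by
          refine Nat.pow_le_pow_left ?_ _
          calc B * m ^ 2 ≤ 2 ^ B * (2 ^ m) ^ 2 := Nat.mul_le_mul (hlt B) (Nat.pow_le_pow_left (hlt m) 2)
            _ = 2 ^ (B + m * 2) := by rw [← pow_mul, ← pow_add]
            _ ≤ _ := Nat.pow_le_pow_right (by norm_num) (by nlinarith)
      _ = _ := by rw [← pow_mul]; congr 1; ring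
  refine hit (B * m ^ 2) m (3 * m * C) (2 ^ (3 * m * C)) (2 ^ (κ * m ^ 3)) hm (Nat.mul_pos (by omega) hC1) ?_ ?_ ?_ ?_ ?_ ?_ ?_ ?_ ?_ ?_ r0 hr0 x A hG (le_trans ?_ hx)
  · exact Nat.le_self_pow (Nat.mul_pos (by omega) hC1).ne' 2
  · exact Nat.pow_lt_pow_right (by norm_num) (by omega)
  · calc (38400 * m * k) ^ 2 = 1 * ((38400 * k) ^ 2 * m ^ 2) := by ring
      _ ≤ ck k * ((38400 * k) ^ 2 * m ^ 2) := Nat.mul_le_mul_right _ hck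
      _ = _ := by rw [hB]; ring
  · rw [hB, mul_assoc]
    exact Nat.le_mul_of_pos_right _ (by positivity)
  · rw [e8, ← pow_mul]
    exact Nat.pow_le_pow_right (by norm_num) (Nat.mul_le_mul h8 hC2)
  · rw [e8]
    exact Nat.pow_le_pow_right (by norm_num) (h8.trans (Nat.le_mul_of_pos_right _ hC1))
  · calc ck k ^ 2 * (B * m ^ 2).factorial * (2 ^ (3 * m * C)) ^ (3 * m * C)
        ≤ (2 ^ ck k) ^ 2 * 2 ^ ((B + 2) * B * m ^ 3) * (2 ^ (3 * m * C)) ^ (3 * m * C) :=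
          Nat.mul_le_mul_right _ (Nat.mul_le_mul (Nat.pow_le_pow_left (hlt _) 2) hy)
      _ = 2 ^ (2 * ck k + (B + 2) * B * m ^ 3 + 9 * C ^ 2 * m ^ 2) := by
          rw [← pow_mul, ← pow_mul, ← pow_add, ← pow_add]; congr 1; ring
      _ ≤ _ := by
          refine Nat.pow_le_pow_right (by norm_num) ?_
          have h1 : 2 * ck k ≤ 2 * ck k * m ^ 3 := Nat.le_mul_of_pos_right _ hm3
          have h2 : 9 * C ^ 2 * m ^ 2 ≤ 81 * C ^ 2 * m ^ 3 := Nat.mul_le_mul (by omega) hm23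
          calc _ ≤ (2 * ck k + (B + 2) * B + 81 * C ^ 2) * m ^ 3 := by
                linarith
            _ ≤ _ := Nat.mul_le_mul_right _ (by rw [hκ]; omega)
  · rw [← pow_mul]
    refine Nat.pow_le_pow_right (by norm_num) ?_
    calc 3 * m * C * (8 * m * (3 * m * C)) = 72 * C ^ 2 * m ^ 3 := by ring
      _ ≤ _ := Nat.mul_le_mul_right _ (by rw [hκ]; omega)
  · calc 800 * Ch * 2 ^ k * (2 ^ (3 * m * C)) ^ 2 ≤ 2 ^ (800 * Ch) * 2 ^ k * (2 ^ (3 * m * C)) ^ 2 :=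
          Nat.mul_le_mul_right _ (Nat.mul_le_mul_right _ (hlt _))
      _ = 2 ^ (800 * Ch + k + 6 * C * m) := by
          rw [← pow_mul, ← pow_add, ← pow_add]; congr 1; ring
      _ ≤ _ := by
          refine Nat.pow_le_pow_right (by norm_num) ?_
          calc 800 * Ch + k + 6 * C * m ≤ (800 * Ch + k + 6 * C) * m ^ 3 := by
                rw [add_mul]
                exact Nat.add_le_add (Nat.le_mul_of_pos_right _ hm3) (Nat.mul_le_mul_left _ hm13)
            _ ≤ _ := Nat.mul_le_mul_right _ (by rw [hκ]; omega)
  · rw [← Int.toNat_of_nonneg hl.le]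
    have : h.leadingCoeff.toNat ≤ (2 ^ (κ * m ^ 3)) ^ (19 * m) := by
      calc h.leadingCoeff.toNat ≤ 2 ^ h.leadingCoeff.toNat := hlt _
        _ ≤ 2 ^ (κ * m ^ 3) := Nat.pow_le_pow_right (by norm_num) (le_trans (by rw [hκ]; omega) (Nat.le_mul_of_pos_right _ hm3))
        _ ≤ _ := Nat.le_self_pow (by omega) _
    exact_mod_cast this
  · rw [← pow_mul]
    refine Nat.pow_le_pow_right (by norm_num) ?_
    have h1 : (19 * m + 1) * (k ^ 2 + 3 * k + 3) + 19 * m * (k + 3) ≤ m * (20 * (k ^ 2 + 3 * k + 3) + 19 * (k + 3)) := by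
      have : (19 * m + 1) * (k ^ 2 + 3 * k + 3) ≤ (20 * m) * (k ^ 2 + 3 * k + 3) := Nat.mul_le_mul_right _ (by omega)
      linarith
    calc _ ≤ κ * m ^ 3 * (m * (20 * (k ^ 2 + 3 * k + 3) + 19 * (k + 3))) := Nat.mul_le_mul_left _ h1
      _ = _ := by ring

end I2
end FS


namespace FS
section I3
open Finset Polynomial Filter

theorem analytic (d : ℝ) (hd0 : 0 < d) (hd1 : d < 1 / 4) (κ W : ℝ) (hκ : 0 ≤ κ) :
    ∃ Xmin : ℝ, 1 ≤ Xmin ∧ ∀ X : ℝ, Xmin < X → W ≤ X ∧ κ * (Real.log X ^ d + 5) ^ 4 + W ≤ Real.log X := by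
  have h1 : Tendsto (fun t : ℝ => t ^ (1 - 4 * d)) atTop atTop := tendsto_rpow_atTop (by linarith)
  have h2 : ∀ᶠ t : ℝ in atTop, κ * (t ^ d + 5) ^ 4 + W ≤ t := by
    filter_upwards [h1.eventually_ge_atTop (2592 * κ), eventually_ge_atTop (1:ℝ), eventually_ge_atTop (2 * W)] with t ht ht1 htW
    have ht0 : 0 < t := by linarith
    have h3 : 1 ≤ t ^ d := Real.one_le_rpow ht1 hd0.le
    have h4 : (t ^ d + 5) ^ 4 ≤ (6 * t ^ d) ^ 4 := pow_le_pow_left₀ (by positivity) (by linarith) 4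
    have h5 : (t ^ d) ^ 4 = t ^ (4 * d) := by
      rw [← Real.rpow_natCast, ← Real.rpow_mul ht0.le]; congr 1; push_cast; ring
    have h6 : t ^ (4 * d) * t ^ (1 - 4 * d) = t := by
      rw [← Real.rpow_add ht0]; simp
    have h7 : 0 < t ^ (4 * d) := Real.rpow_pos_of_pos ht0 _
    have h8 : t ^ (4 * d) * (2592 * κ) ≤ t := by
      conv_rhs => rw [← h6]
      exact mul_le_mul_of_nonneg_left ht h7.le
    have h9 : κ * (t ^ d + 5) ^ 4 ≤ κ * (1296 * t ^ (4 * d)) := by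
      refine mul_le_mul_of_nonneg_left (h4.trans (le_of_eq ?_)) hκ
      rw [mul_pow, h5]; norm_num
    nlinarith
  have h3 := (Real.tendsto_log_atTop.eventually h2).and (eventually_ge_atTop W)
  obtain ⟨X0, hX0⟩ := eventually_atTop.1 h3
  refine ⟨max X0 1, le_max_right _ _, fun X hX => ?_⟩
  have := hX0 X ((le_max_left _ _).trans hX.le)
  exact ⟨this.2, this.1⟩

theorem final (d : ℝ) (hd0 : 0 < d) (hd1 : d < 1 / 4) (h : Polynomial ℤ) (hdeg : 2 ≤ h.natDegree)
    (hlead : 0 < h.leadingCoeff) (hint : ∀ q : ℕ, 0 < q → ∃ n : ℤ, (q : ℤ) ∣ h.eval n) :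
    ∃ Xmin : ℝ, 0 < Xmin ∧ ∀ X : ℝ, Xmin < X → ∀ A : Finset ℤ, A ⊆ Finset.Icc 1 ⌊X⌋ →
      (∀ a ∈ A, ∀ b ∈ A, (∃ n : ℤ, h.eval n = a - b) → a - b = 0) →
      (A.card : ℝ) ≤ X * Real.exp (-1 * Real.log X ^ d) := by
  obtain ⟨κ, hκ⟩ := params h (by omega) hlead
  obtain ⟨ℓ, hℓ⟩ : ∃ ℓ : ℕ, h.leadingCoeff = (ℓ:ℤ) := ⟨h.leadingCoeff.toNat, (Int.toNat_of_nonneg hlead.le).symm⟩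
  have hℓ1 : 1 ≤ ℓ := by rw [hℓ] at hlead; exact_mod_cast hlead
  have hℓr : (1:ℝ) ≤ ℓ := by exact_mod_cast hℓ1
  obtain ⟨Xmin, hX1, hXm⟩ := analytic d hd0 hd1 κ (400 * ℓ) (by positivity)
  refine ⟨Xmin, by linarith, fun X hX A hA hdiff => ?_⟩
  obtain ⟨hXW, hXlog⟩ := hXm X hX
  have hXp : 0 < X := by linarith
  have hlogp : 0 ≤ Real.log X := Real.log_nonneg (by linarith)
  set L : ℝ := Real.log X ^ d with hL
  have hL0 : 0 ≤ L := Real.rpow_nonneg hlogp d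
  obtain ⟨m, hm⟩ : ∃ m : ℕ, m = ⌈L⌉₊ + 4 := ⟨_, rfl⟩
  have hmL : L + 4 ≤ m := by
    rw [hm]; push_cast; have := Nat.le_ceil L; linarith
  have hmU : (m:ℝ) ≤ L + 5 := by
    rw [hm]; push_cast; have := (Nat.ceil_lt_add_one hL0).le; linarith
  obtain ⟨DD, hDD⟩ := hκ m (by omega)
  have hqpos : 0 < ℓ * DD.factorial ^ (h.natDegree + 1) := Nat.mul_pos hℓ1 (Nat.pow_pos (Nat.factorial_pos _))
  obtain ⟨r0, hr0⟩ := hint _ hqpos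
  have hr0' : h.leadingCoeff * ((DD.factorial : ℕ) : ℤ) ^ (h.natDegree + 1) ∣ h.eval r0 := by
    rw [hℓ]; exact_mod_cast hr0
  have hD := hDD r0 hr0'
  by_contra! hcon
  -- the first content
  have hM := Mc_pos h hlead r0 1 le_rfl
  have hMd := Mc_dvd_top h r0 1
  obtain ⟨μ, hμ⟩ : ∃ μ : ℕ, Mc h r0 1 = (μ:ℤ) := ⟨(Mc h r0 1).toNat, (Int.toNat_of_nonneg hM.le).symm⟩
  have hμ1 : 1 ≤ μ := by rw [hμ] at hM; exact_mod_cast hM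
  have hμℓ : μ ≤ ℓ := by
    rw [hμ, hℓ] at hMd
    have : μ ∣ ℓ := by
      have h' : (μ:ℤ) ∣ (ℓ:ℤ) := by simpa using hMd
      exact_mod_cast h'
    exact Nat.le_of_dvd hℓ1 this
  have hμr : (μ:ℝ) ≤ ℓ := by exact_mod_cast hμℓ
  set l : ℕ := ⌊X⌋₊ with hl
  have hlX : (l:ℝ) ≤ X := Nat.floor_le hXp.le
  have hXl : X < l + 1 := Nat.lt_floor_add_one X
  have hlz : ((l:ℕ):ℤ) = ⌊X⌋ := Int.natCast_floor_eq_floor hXp.le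
  have h200 : 200 * μ ≤ l := by
    have : (200:ℝ) * μ ≤ l := by nlinarith
    exact_mod_cast this
  have hcount : (A.card : ℝ) ≤ (({i ∈ range l | (1:ℤ) + ((1:ℕ):ℤ) * (i:ℕ) ∈ A} : Finset ℕ).card : ℝ) := by
    have : A.card ≤ ({i ∈ range l | (1:ℤ) + ((1:ℕ):ℤ) * (i:ℕ) ∈ A} : Finset ℕ).card := by
      refine card_le_card_of_injOn (fun a => (a - 1).toNat) ?_ ?_
      · intro a ha
        have ha' := mem_Icc.1 (hA ha)
        simp only [coe_filter, mem_range, Set.mem_ofPred_eq]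
        refine ⟨by omega, ?_⟩
        have : (1:ℤ) + ((1:ℕ):ℤ) * (((a - 1).toNat : ℕ) : ℤ) = a := by
          rw [Int.toNat_of_nonneg (by omega)]; push_cast; ring
        rw [this]; exact ha
      · intro a ha b hb hab
        have ha' := mem_Icc.1 (hA ha)
        have hb' := mem_Icc.1 (hA hb)
        have hab' : (a - 1).toNat = (b - 1).toNat := hab
        omega
    exact_mod_cast this
  set δ : ℝ := Real.exp (-1 * L) with hδ
  have hδ0 : 0 < δ := Real.exp_pos _
  obtain ⟨r, hr⟩ := split A 1 1 l μ hμ1 h200 δ hδ0 (by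
    refine le_trans ?_ hcount
    nlinarith)
  set x : ℕ := l / μ + 1 with hx
  set A' := (Finset.Ico (0:ℤ) (x : ℤ)).filter (fun i => (1:ℤ) + ((1:ℕ):ℤ) * (r + μ * i) ∈ A) with hA'
  have hG : Good h r0 1 x A' := by
    refine ⟨Finset.filter_subset _ _, ?_⟩
    intro i hi j hj n hn
    rw [hA', mem_filter] at hi hj
    have h1 := hdiff _ hj.2 _ hi.2 ⟨r0 + (1:ℕ) * n, by rw [hn, hμ]; push_cast; ring⟩
    have h2 : (μ:ℤ) * (j - i) = 0 := by push_cast at h1; linear_combination h1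
    have h3 : (μ:ℤ) ≠ 0 := by positivity
    have := (mul_eq_zero.1 h2).resolve_left h3
    linarith
  have hxX : X ≤ 2 * ℓ * x := by
    have h1 : l ≤ x * μ := by
      have h8 := Nat.div_add_mod l μ
      have h9 := Nat.mod_lt l hμ1
      rw [hx, show (l / μ + 1) * μ = μ * (l / μ) + μ by ring]; omega
    have h2 : l ≤ x * ℓ := h1.trans (Nat.mul_le_mul_left _ hμℓ)
    have h3 : (l:ℝ) ≤ x * ℓ := by exact_mod_cast h2
    nlinarith
  have hxr : (0:ℝ) < x := by rw [hx]; positivity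
  have hbig : 2 ^ (κ * m ^ 4) ≤ x := by
    have h1 : (κ:ℝ) * m ^ 4 + 400 * ℓ ≤ Real.log X := by
      refine le_trans ?_ hXlog
      have : (m:ℝ) ^ 4 ≤ (L + 5) ^ 4 := pow_le_pow_left₀ (by positivity) hmU 4
      have := mul_le_mul_of_nonneg_left this (by positivity : (0:ℝ) ≤ κ)
      linarith
    have h2 : Real.exp ((κ:ℝ) * m ^ 4) * Real.exp (400 * ℓ) ≤ X := by
      rw [← Real.exp_add]
      calc _ ≤ Real.exp (Real.log X) := Real.exp_le_exp.2 h1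
        _ = X := Real.exp_log hXp
    have h3 : (2:ℝ) * ℓ ≤ Real.exp (400 * ℓ) := by
      have := Real.add_one_le_exp (400 * (ℓ:ℝ)); linarith
    have h4 : (2:ℝ) ^ (κ * m ^ 4) ≤ Real.exp ((κ:ℝ) * m ^ 4) := by
      have : Real.exp ((κ:ℝ) * m ^ 4) = Real.exp 1 ^ (κ * m ^ 4) := by
        rw [← Real.exp_nat_mul]; push_cast; ring_nf
      rw [this]
      refine pow_le_pow_left₀ (by norm_num) ?_ _
      have := Real.add_one_le_exp (1:ℝ); linarith
    have h5 : (2:ℝ) ^ (κ * m ^ 4) * (2 * ℓ) ≤ x * (2 * ℓ) := by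
      calc _ ≤ Real.exp ((κ:ℝ) * m ^ 4) * Real.exp (400 * ℓ) := mul_le_mul h4 h3 (by positivity) (by positivity)
        _ ≤ X := h2
        _ ≤ _ := by linarith
    have h6 := le_of_mul_le_mul_right h5 (by positivity)
    exact_mod_cast h6
  have hlt := hD x A' hG hbig
  have hlt' : (4:ℝ) ^ m * A'.card < x := by exact_mod_cast hlt
  have h4 : Real.exp L * 2 ≤ 4 ^ m := by
    have h1 : Real.exp (m:ℝ) ≤ 4 ^ m := by
      rw [← mul_one (m:ℝ), Real.exp_nat_mul]
      exact pow_le_pow_left₀ (Real.exp_pos _).le (by have := Real.exp_one_lt_d9; linarith) _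
    refine le_trans ?_ h1
    calc Real.exp L * 2 ≤ Real.exp L * Real.exp 1 := by
          have := Real.add_one_le_exp (1:ℝ)
          exact mul_le_mul_of_nonneg_left (by linarith) (Real.exp_pos _).le
      _ = Real.exp (L + 1) := by rw [Real.exp_add]
      _ ≤ _ := Real.exp_le_exp.2 (by linarith)
  have h5 : Real.exp L * δ = 1 := by rw [hδ, ← Real.exp_add]; simp
  have h6 : (x:ℝ) ≤ 4 ^ m * A'.card := by
    calc (x:ℝ) ≤ (Real.exp L * δ) * (2 / 1.005 * x) := by rw [h5]; norm_num; linarith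
      _ = Real.exp L * 2 * (δ / 1.005 * x) := by ring
      _ ≤ 4 ^ m * A'.card := mul_le_mul h4 hr (by positivity) (by positivity)
  linarith

end I3
end FS


theorem stmt0 (d : ℝ) (hd0 : 0 < d) (hd1 : d < 1 / 4)
    (h : Polynomial ℤ) (hdeg : 2 ≤ h.natDegree) (hlead : 0 < h.leadingCoeff)
    (hint : ∀ q : ℕ, 0 < q → ∃ n : ℤ, (q : ℤ) ∣ h.eval n) :
    ∃ c₀ Xmin : ℝ, 0 < c₀ ∧ 0 < Xmin ∧
      ∀ X : ℝ, Xmin < X →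
        ∀ A : Finset ℤ, A ⊆ Finset.Icc 1 ⌊X⌋ →
          (∀ a ∈ A, ∀ b ∈ A, (∃ n : ℤ, h.eval n = a - b) → a - b = 0) →
          (A.card : ℝ) ≤ X * Real.exp (-c₀ * Real.log X ^ d) := by
  obtain ⟨Xmin, h1, h2⟩ := FS.final d hd0 hd1 h hdeg hlead hint
  exact ⟨1, Xmin, one_pos, h1, h2⟩
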